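/- Let g be a simple Lie algebra. Then codim_C C^irr = 5 − l, where l is the lacing number ('lacety') of g: l = 1 if g is of type A_r, D_r, E_6, E_7 or E_8; l = 2 if g is of type B_r, C_r or F_4; l = 3 if g is of type G_2. (Equivalently, for rk g ≥ 2, l is the maximum of the absolute values of the Cartan integers ⟨α, β∨⟩ over pairs of non-proportional roots α, β, and l = 1 when rk g = 1.) -/

import Mathlib

noncomputable section

namespace CV

variable (k : Type*) [Field k] (V : Type*) [AddCommGroup V] [Module k V] [FiniteDimensional k V]

/-- Coordinates with respect to a chosen basis of `V`. -/
def coordFn (z : V) (i : Module.Free.ChooseBasisIndex k V) : k :=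
  (Module.Free.chooseBasis k V).repr z i

/-- Evaluation of a polynomial (in the chosen coordinates) at a point of `V`. -/
def evalP (F : MvPolynomial (Module.Free.ChooseBasisIndex k V) k) (z : V) : k :=
  MvPolynomial.aeval (coordFn k V z) F

/-- The Zariski topology on `V`: generated by complements of zero sets of polynomial
functions. -/
def zar : TopologicalSpace V :=
  TopologicalSpace.generateFrom
    {U | ∃ F : MvPolynomial (Module.Free.ChooseBasisIndex k V) k, U = {z | evalP k V F z ≠ 0}}

/-- The dimension of a subset of `V`:  the Krull dimension for the topology induced by the
Zariski topology of `V`. -/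
def dimSet (S : Set V) : WithBot ℕ∞ :=
  @topologicalKrullDim S (TopologicalSpace.induced Subtype.val (zar k V))

/-- The differential at `z ∈ V` of a polynomial `F`, as a linear functional on `V`. -/
def diffAt (F : MvPolynomial (Module.Free.ChooseBasisIndex k V) k) (z : V) : V →ₗ[k] k :=
  (Module.Free.chooseBasis k V).constr k fun i => evalP k V (MvPolynomial.pderiv i F) z

/-- The Zariski tangent space at `z` of a subset `S ⊆ V`:  the common kernel of the
differentials at `z` of all polynomial functions vanishing identically on `S`. -/
def tangent (S : Set V) (z : V) : Submodule k V :=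
  ⨅ F ∈ {F | ∀ w ∈ S, evalP k V F w = 0}, LinearMap.ker (diffAt k V F z)

end CV

/-- The commuting variety `C = {(x,y) ∈ g × g | [x,y] = 0}`. -/
def commSet (k : Type*) (g : Type*) [Field k] [LieRing g] [LieAlgebra k g] : Set (g × g) :=
  {p | ⁅p.1, p.2⁆ = 0}

/-- The centralizer `g_x = {y ∈ g | [x,y] = 0}` of an element `x` of a Lie algebra,
as a submodule. -/
def cent (k : Type*) {g : Type*} [Field k] [LieRing g] [LieAlgebra k g] (x : g) :
    Submodule k g := LinearMap.ker (LieAlgebra.ad k g x)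

variable (k : Type*) [Field k] [IsAlgClosed k] [CharZero k]
variable (g : Type*) [LieRing g] [LieAlgebra k g] [FiniteDimensional k g]

/-- The lacing number ("lacety") of a Lie algebra with nondegenerate Killing form, relative
to a Cartan subalgebra `t`:  it is `1` if `rk g = 1`, and otherwise the maximum of the
absolute values of the Cartan integers `⟨α, β∨⟩ = α (coroot β)` over pairs of
non-proportional roots `α`, `β`.  (For a simple Lie algebra this equals `1` in types
`A`, `D`, `E`, `2` in types `B`, `C`, `F₄`, and `3` in type `G₂`.) -/
def lacety [LieAlgebra.IsKilling k g] (t : LieSubalgebra k g) [t.IsCartanSubalgebra] : ℕ :=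
  if Module.finrank k ↥t = 1 then 1
  else sSup {n : ℕ | ∃ α β : LieModule.Weight k ↥t g, α.IsNonZero ∧ β.IsNonZero ∧
    (∀ c : k, (α : ↥t → k) ≠ c • (β : ↥t → k)) ∧
    (α (LieAlgebra.IsKilling.coroot β) = (n : k) ∨ α (LieAlgebra.IsKilling.coroot β) = -(n : k))}

/-- The irregular locus of the commuting variety:  points `(x,y) ∈ C` with
`dim (g_x ∩ g_y) > rk g`. -/
def Cirr (t : LieSubalgebra k g) : Set (g × g) :=
  {z ∈ commSet k g | Module.finrank k ↥t < Module.finrank k ↥(cent k z.1 ⊓ cent k z.2)}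

section
set_option linter.all false
namespace CVA
open MvPolynomial

/-- chain rule for a derivation applied to a polynomial expression -/
lemma deriv_aeval {K A M σ : Type*} [CommRing K] [CommRing A] [Algebra K A] [Fintype σ]
    [AddCommGroup M] [Module K M] [Module A M] 
    (D : Derivation K A M) (a : σ → A) (F : MvPolynomial σ K) :
    D (aeval a F) = ∑ j, aeval a (pderiv j F) • D (a j) := by
  classical
  induction F using MvPolynomial.induction_on with
  | C c => simp [← MvPolynomial.algebraMap_eq]
  | add p q hp hq => simp [hp, hq, add_smul, Finset.sum_add_distrib]
  | mul_X p i hp =>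
    simp only [map_mul, aeval_X, Derivation.leibniz, hp, pderiv_X, smul_eq_mul, map_add,
      add_smul, Finset.sum_add_distrib]
    congr 1
    · simp [Pi.single_apply, apply_ite, ite_smul]
    · rw [Finset.smul_sum]
      refine Finset.sum_congr rfl fun j _ => ?_
      rw [smul_smul]

lemma totalDegree_pderiv_lt {K σ : Type*} [Field K] (F : MvPolynomial σ K) (i : σ)
    (h : pderiv i F ≠ 0) : (pderiv i F).totalDegree < F.totalDegree := by
  have key : ∀ m ∈ (pderiv i F).support, (m.sum fun _ e => e) + 1 ≤ F.totalDegree := by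
    intro m hm
    rw [mem_support_iff, coeff_pderiv] at hm
    have h2 : m + Finsupp.single i 1 ∈ F.support := by
      rw [mem_support_iff]; intro h0; exact hm (by rw [h0]; simp)
    have := le_totalDegree h2
    rwa [Finsupp.sum_add_index' (by simp) (by intros; rfl), Finsupp.sum_single_index rfl] at this
  obtain ⟨m0, hm0⟩ := MvPolynomial.support_nonempty.mpr h
  have h1 := key m0 hm0
  rw [Nat.lt_iff_add_one_le]
  have : (pderiv i F).totalDegree ≤ F.totalDegree - 1 := by
    rw [MvPolynomial.totalDegree]
    apply Finset.sup_le
    intro m hm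
    have := key m hm
    omega
  omega

lemma eq_C_of_pderiv_eq_zero {K σ : Type*} [Field K] [CharZero K] (F : MvPolynomial σ K)
    (h : ∀ i, pderiv i F = 0) : F = C (coeff 0 F) := by
  classical
  ext m
  rw [coeff_C]
  split_ifs with h0
  · rw [h0]
  · obtain ⟨i, hi⟩ : ∃ i, m i ≠ 0 := by
      by_contra hcon; push Not at hcon; exact h0 (by ext j; simp [hcon j])
    have := congrArg (coeff (m - Finsupp.single i 1)) (h i)
    rw [coeff_pderiv] at this
    have hm : m - Finsupp.single i 1 + Finsupp.single i 1 = m := by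
      ext j
      by_cases hj : i = j
      · subst hj; simp; omega
      · simp [hj]
    rw [hm] at this
    simp only [coeff_zero, mul_eq_zero] at this
    rcases this with h | h
    · exact h
    · exfalso; norm_cast at h

/-- Jacobian criterion -/
lemma jac {K σ : Type*} [Field K] [CharZero K] [Fintype σ] [DecidableEq σ]
    (f : σ → MvPolynomial σ K) (h : (Matrix.of fun i j => pderiv i (f j)).det ≠ 0) :
    AlgebraicIndependent K f := by
  rw [algebraicIndependent_iff]
  have key : ∀ n : ℕ, ∀ F : MvPolynomial σ K, F.totalDegree < n → aeval f F = 0 → F = 0 := by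
    intro n
    induction n with
    | zero => intro F h; omega
    | succ n ih =>
      intro F hF h0
      have h1 : ∀ i, ∑ j, pderiv i (f j) * aeval f (pderiv j F) = 0 := by
        intro i
        have := deriv_aeval (pderiv i) f F
        rw [h0, map_zero] at this
        rw [this]
        exact Finset.sum_congr rfl fun j _ => by rw [smul_eq_mul, mul_comm]
      have h2 : (fun j => aeval f (pderiv j F)) = 0 := by
        apply Matrix.eq_zero_of_mulVec_eq_zero h
        ext1 i
        simpa [Matrix.mulVec, dotProduct] using h1 i
      have h3 : ∀ j, pderiv j F = 0 := by
        intro j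
        by_contra hne
        exact hne (ih _ (by have := totalDegree_pderiv_lt F j hne; omega) (congrFun h2 j))
      rw [eq_C_of_pderiv_eq_zero F h3] at h0 ⊢
      rw [aeval_C] at h0
      have : coeff 0 F = 0 := by simpa [MvPolynomial.algebraMap_eq] using h0
      rw [this, C_0]
  intro F hF
  exact key _ F (Nat.lt_succ_self _) hF

/-- `f : (σ → K) → V` is polynomial, with partial derivatives `f' j` at `a0`. -/
def HasPD {K σ V : Type*} [Field K] [AddCommGroup V] [Module K V]
    (f : (σ → K) → V) (a0 : σ → K) (f' : σ → V) : Prop :=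
  ∀ l : V →ₗ[K] K, ∃ P : MvPolynomial σ K, (∀ a, eval a P = l (f a)) ∧
    ∀ j, eval a0 (pderiv j P) = l (f' j)

namespace HasPD
variable {K σ V W : Type*} [Field K] [AddCommGroup V] [Module K V] [AddCommGroup W] [Module K W]
  {f g : (σ → K) → V} {a0 : σ → K} {f' g' : σ → V}

lemma const (v : V) : HasPD (fun _ : σ → K => v) a0 (fun _ => 0) := fun l =>
  ⟨C (l v), by simp, by simp⟩

lemma coord [DecidableEq σ] (i : σ) (v : V) :
    HasPD (fun a : σ → K => a i • v) a0 (fun j => if j = i then v else 0) := fun l =>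
  ⟨C (l v) * X i, by simp [mul_comm], by
    intro j
    by_cases h : j = i
    · subst h; simp
    · simp [h, Pi.single_apply]⟩

lemma add (hf : HasPD f a0 f') (hg : HasPD g a0 g') :
    HasPD (fun a => f a + g a) a0 (fun j => f' j + g' j) := fun l => by
  obtain ⟨P, h1, h2⟩ := hf l
  obtain ⟨Q, h3, h4⟩ := hg l
  exact ⟨P + Q, by simp [h1, h3], by simp [h2, h4]⟩

lemma sum {ι : Type*} (s : Finset ι) {f : ι → (σ → K) → V} {f' : ι → σ → V}
    (hf : ∀ i ∈ s, HasPD (f i) a0 (f' i)) :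
    HasPD (fun a => ∑ i ∈ s, f i a) a0 (fun j => ∑ i ∈ s, f' i j) := by
  classical
  induction s using Finset.induction_on with
  | empty => simpa using const (0 : V)
  | insert i s hi ih =>
    simp only [Finset.sum_insert hi]
    exact add (hf i (by simp)) (ih fun j hj => hf j (by simp [hj]))

lemma map (hf : HasPD f a0 f') (T : V →ₗ[K] W) :
    HasPD (fun a => T (f a)) a0 (fun j => T (f' j)) := fun l => hf (l ∘ₗ T)

lemma smul (hf : HasPD f a0 f') (Q : MvPolynomial σ K) :
    HasPD (fun a => eval a Q • f a) a0
      (fun j => eval a0 (pderiv j Q) • f a0 + eval a0 Q • f' j) := fun l => by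
  obtain ⟨P, h1, h2⟩ := hf l
  exact ⟨Q * P, by simp [h1], by intro j; simp [h1, h2, pderiv_mul]; ring⟩

lemma congr {f₂ : (σ → K) → V} {f₂' : σ → V} (hf : HasPD f a0 f') (h : ∀ a, f a = f₂ a)
    (h' : ∀ j, f' j = f₂' j) : HasPD f₂ a0 f₂' := by
  have e1 : f = f₂ := funext h
  have e2 : f' = f₂' := funext h'
  rw [← e1, ← e2]; exact hf

/-- moving by the exponential of a nilpotent map -/
lemma exp [DecidableEq σ] [Algebra ℚ K] [Module ℚ V] [IsScalarTower ℚ K V] (hf : HasPD f a0 f')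
    (i : σ) (h0 : a0 i = 0) (N : Module.End K V) (hN : IsNilpotent N) :
    HasPD (fun a => IsNilpotent.exp (a i • N) (f a)) a0
      (fun j => f' j + if j = i then N (f a0) else 0) := by
  obtain ⟨m, hm⟩ := hN
  have hpow : ∀ (c : K), (c • N) ^ (m + 2) = 0 := fun c => by
    rw [smul_pow, pow_add N, hm]; simp
  have hs : HasPD (fun a => ∑ n ∈ Finset.range (m + 2),
      eval a (X i ^ n) • (((n.factorial : ℚ)⁻¹ • N ^ n : Module.End K V) (f a))) a0
      (fun j => ∑ n ∈ Finset.range (m + 2),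
        (eval a0 (pderiv j (X i ^ n)) • (((n.factorial : ℚ)⁻¹ • N ^ n : Module.End K V) (f a0))
        + eval a0 (X i ^ n) • (((n.factorial : ℚ)⁻¹ • N ^ n : Module.End K V) (f' j)))) :=
    sum _ fun n _ => (hf.map _).smul _
  refine hs.congr (fun a => ?_) (fun j => ?_)
  · rw [IsNilpotent.exp_eq_sum (hpow (a i))]
    rw [LinearMap.sum_apply]
    refine Finset.sum_congr rfl fun n _ => ?_
    simp only [smul_pow, LinearMap.smul_apply, eval_X, map_pow]
    rw [smul_comm]
  · rw [Finset.sum_add_distrib, add_comm]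
    congr 1
    · rw [Finset.sum_eq_single 0]
      · simp
      · intro n _ hn; simp [h0, hn]
      · simp
    · rw [Finset.sum_eq_single 1]
      · by_cases h : j = i
        · subst h; simp
        · simp [h, pderiv_X, Pi.single_apply]
      · intro n _ hn
        rcases n with _ | _ | n
        · simp
        · exact absurd rfl hn
        · simp [pderiv_pow, h0]
      · simp

end HasPD
end CVA
end

section
set_option linter.all false
namespace CVA
open MvPolynomial Topology

section top
variable {K V : Type*} [Field K] [AddCommGroup V] [Module K V] [FiniteDimensional K V]

lemma evalP_mul (F G : MvPolynomial (Module.Free.ChooseBasisIndex K V) K) (z : V) :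
    CV.evalP K V (F * G) z = CV.evalP K V F z * CV.evalP K V G z := by
  simp [CV.evalP]

lemma zar_basis {U : Set V} (hU : IsOpen[CV.zar K V] U) {z : V} (hz : z ∈ U) :
    ∃ F, CV.evalP K V F z ≠ 0 ∧ ∀ w, CV.evalP K V F w ≠ 0 → w ∈ U := by
  have h : TopologicalSpace.GenerateOpen
    {U | ∃ F : MvPolynomial (Module.Free.ChooseBasisIndex K V) K,
      U = {z | CV.evalP K V F z ≠ 0}} U := hU
  clear hU
  induction h with
  | basic s hs =>
    obtain ⟨F, rfl⟩ := hs
    exact ⟨F, hz, fun w hw => hw⟩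
  | univ => exact ⟨1, by simp [CV.evalP], fun _ _ => trivial⟩
  | inter s t _ _ h1 h2 =>
    obtain ⟨F, hF, hF'⟩ := h1 hz.1
    obtain ⟨G, hG, hG'⟩ := h2 hz.2
    refine ⟨F * G, by rw [evalP_mul]; exact mul_ne_zero hF hG, fun w hw => ?_⟩
    rw [evalP_mul] at hw
    exact ⟨hF' w (left_ne_zero_of_mul hw), hG' w (right_ne_zero_of_mul hw)⟩
  | sUnion S _ ih =>
    obtain ⟨t, ht, hzt⟩ := hz
    obtain ⟨F, hF, hF'⟩ := ih t ht hzt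
    exact ⟨F, hF, fun w hw => ⟨t, ht, hF' w hw⟩⟩

lemma zar_open (F : MvPolynomial (Module.Free.ChooseBasisIndex K V) K) :
    IsOpen[CV.zar K V] {z | CV.evalP K V F z ≠ 0} :=
  TopologicalSpace.GenerateOpen.basic _ ⟨F, rfl⟩

/-- polynomial expressions in linear functionals are polynomial functions -/
lemma exists_evalP {τ : Type*} (l : τ → V →ₗ[K] K) (G : MvPolynomial τ K) :
    ∃ F, ∀ z, CV.evalP K V F z = aeval (fun t => l t z) G := by
  refine ⟨aeval (fun t => ∑ j, C (l t (Module.Free.chooseBasis K V j)) * X j) G, fun z => ?_⟩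
  have h : (fun t => l t z) = fun t => aeval (CV.coordFn K V z)
      (∑ j, C (l t (Module.Free.chooseBasis K V j)) * X j) := by
    funext t
    conv_lhs => rw [← (Module.Free.chooseBasis K V).sum_repr z]
    rw [map_sum, map_sum]
    refine Finset.sum_congr rfl fun j _ => ?_
    simp [CV.coordFn, mul_comm]
  rw [CV.evalP, h]
  have := comp_aeval_apply (f := fun t => ∑ j, C (l t (Module.Free.chooseBasis K V j)) * X j)
    (aeval (CV.coordFn K V z) : _ →ₐ[K] K) G
  exact this

/-- polynomial functions pulled back along a polynomial map are polynomial -/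
lemma HasPD.exists_poly {σ : Type*} {f : (σ → K) → V} {a0 f'} (hf : HasPD f a0 f')
    (F : MvPolynomial (Module.Free.ChooseBasisIndex K V) K) :
    ∃ P : MvPolynomial σ K, ∀ a, eval a P = CV.evalP K V F (f a) := by
  choose P hP _ using fun i => hf ((Module.Free.chooseBasis K V).coord i)
  refine ⟨aeval P F, fun a => ?_⟩
  rw [CV.evalP]
  have : CV.coordFn K V (f a) = fun i => eval a (P i) := by
    funext i; rw [hP]; rfl
  rw [this]
  have := comp_aeval_apply (f := P) (aeval a : MvPolynomial σ K →ₐ[K] K) F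
  simpa [aeval_eq_eval] using this
end top

section dep
variable {K V : Type*} [Field K] [CharZero K] [AddCommGroup V] [Module K V]

lemma HasPD.exists_dep {i : ℕ} {f : (Fin i → K) → V} {a0 f'} (hf : HasPD f a0 f')
    (l : Fin (i + 1) → V →ₗ[K] K) :
    ∃ G : MvPolynomial (Fin (i + 1)) K, G ≠ 0 ∧ ∀ a, aeval (fun t => l t (f a)) G = 0 := by
  choose P hP _ using fun t => hf (l t)
  by_contra hcon
  push Not at hcon
  have hind : AlgebraicIndependent K P := by
    rw [algebraicIndependent_iff]
    intro G hG
    by_contra hne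
    obtain ⟨a, ha⟩ := hcon G hne
    apply ha
    have := comp_aeval_apply (f := P) (aeval a : MvPolynomial (Fin i) K →ₐ[K] K) G
    rw [hG, map_zero] at this
    rw [this]
    congr 2
    funext t
    rw [← hP]; simp [aeval_eq_eval]
  have h1 := hind.lift_cardinalMk_le_trdeg
  rw [MvPolynomial.trdeg_of_isDomain] at h1
  simp at h1

lemma HasPD.indep {σ : Type*} [Fintype σ] [DecidableEq σ] {f : (σ → K) → V} {a0 f'}
    (hf : HasPD f a0 f')
    (l : σ → V →ₗ[K] K) (hl : ∀ s t, l s (f' t) = if s = t then 1 else 0)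
    (G : MvPolynomial σ K) (hG : ∀ a, aeval (fun t => l t (f a)) G = 0) : G = 0 := by
  choose P hP hP' using fun t => hf (l t)
  have hind : AlgebraicIndependent K P := by
    apply jac
    intro h0
    have h1 := congrArg (eval a0) h0
    rw [RingHom.map_det, map_zero] at h1
    have : (eval a0).mapMatrix (Matrix.of fun i j => (pderiv i) (P j)) = 1 := by
      ext s t
      simp [hP', hl, Matrix.one_apply, eq_comm]
    rw [this] at h1
    simp at h1
  rw [algebraicIndependent_iff] at hind
  apply hind
  apply MvPolynomial.funext
  intro a
  rw [map_zero, ← hG a]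
  have := comp_aeval_apply (f := P) (aeval a : MvPolynomial σ K →ₐ[K] K) G
  rw [show eval a (aeval P G) = aeval a (aeval P G) by simp [aeval_eq_eval], this]
  congr 2
  funext t
  rw [← hP]; simp [aeval_eq_eval]

/-- restriction of a polynomial map to an affine coordinate subspace -/
lemma HasPD.restrict {d i : ℕ} {f : (Fin d → K) → V} {a0 f'} (hf : HasPD f a0 f') (hi : i ≤ d) :
    HasPD (fun a : Fin i → K => f fun j : Fin d => if h : j.1 < i then a ⟨j, h⟩ else a0 j)
      (fun j => a0 (Fin.castLE hi j)) (fun j => f' (Fin.castLE hi j)) := by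
  intro l
  obtain ⟨P, h1, h2⟩ := hf l
  set s : Fin d → MvPolynomial (Fin i) K := fun j : Fin d => if h : j.1 < i then X ⟨j.1, h⟩ else C (a0 j)
    with hs
  have hev : ∀ (a : Fin i → K) (Q : MvPolynomial (Fin d) K), eval a (aeval s Q) =
      eval (fun j : Fin d => if h : j.1 < i then a ⟨j, h⟩ else a0 j) Q := by
    intro a Q
    have := comp_aeval_apply (f := s) (aeval a : MvPolynomial (Fin i) K →ₐ[K] K) Q
    rw [show eval a (aeval s Q) = aeval a (aeval s Q) by simp [aeval_eq_eval], this,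
      show (fun j => aeval a (s j)) = (fun j : Fin d => if h : j.1 < i then a ⟨j, h⟩ else a0 j) from ?_]
    · simp [aeval_eq_eval]
    · funext j
      simp only [hs]
      split_ifs <;> simp
  have h0 : (fun j : Fin d => if h : j.1 < i then a0 (Fin.castLE hi ⟨j, h⟩) else a0 j) = a0 := by
    funext j; split_ifs <;> rfl
  refine ⟨aeval s P, fun a => by rw [hev, h1], fun t => ?_⟩
  rw [deriv_aeval, map_sum, ← h2]
  rw [Finset.sum_eq_single (Fin.castLE hi t)]
  · have : s (Fin.castLE hi t) = X t := by simp [hs]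
    rw [this]
    simp only [pderiv_X_self, smul_eq_mul, mul_one]
    rw [hev, h0]
  · intro j _ hj
    have : pderiv t (s j) = 0 := by
      simp only [hs]
      split_ifs with h
      · apply pderiv_X_of_ne
        intro e
        apply hj
        rw [← e]; rfl
      · simp
    rw [this]; simp
  · simp
end dep

/-- lower bound for the dimension -/
theorem le_dimSet_fin {K V : Type*} [Field K] [CharZero K] [AddCommGroup V] [Module K V]
    [FiniteDimensional K V] (S : Set V) {d : ℕ} {f : (Fin d → K) → V} {a0 f'}
    (hf : HasPD f a0 f') (hS : ∀ a, f a ∈ S) (hli : LinearIndependent K f') :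
    (d : WithBot ℕ∞) ≤ CV.dimSet K V S := by
  letI tS : TopologicalSpace S := TopologicalSpace.induced Subtype.val (CV.zar K V)
  -- dual functionals
  obtain ⟨l, hl⟩ : ∃ l : Fin d → V →ₗ[K] K, ∀ s t, l s (f' t) = if s = t then 1 else 0 := by
    choose l hl using fun s : Fin d => LinearMap.exists_extend
      ((Finsupp.lapply s : (Fin d →₀ K) →ₗ[K] K) ∘ₗ hli.repr)
    refine ⟨l, fun s t => ?_⟩
    have := LinearMap.congr_fun (hl s) ⟨f' t, Submodule.subset_span ⟨t, rfl⟩⟩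
    simp only [LinearMap.comp_apply, Submodule.subtype_apply] at this
    rw [this, hli.repr_eq_single t _ rfl]
    simp [Finsupp.single_apply, eq_comm]
  let A : ℕ → Set (Fin d → K) := fun i => {a | ∀ j : Fin d, i ≤ j.1 → a j = a0 j}
  let Y : ℕ → Set S := fun i => (fun a => (⟨f a, hS a⟩ : S)) '' A i
  have hAmono : ∀ i, A i ⊆ A (i + 1) := fun i a ha j hj => ha j (by omega)
  -- parametrization of A i
  have hpar : ∀ i (hi : i ≤ d) (a : Fin i → K),
      (fun j : Fin d => if h : j.1 < i then a ⟨j, h⟩ else a0 j) ∈ A i := by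
    intro i hi a j hj
    simp only [dif_neg (not_lt.mpr hj)]
  have hpar' : ∀ i (hi : i ≤ d) b, b ∈ A i → ∃ a : Fin i → K,
      (fun j : Fin d => if h : j.1 < i then a ⟨j, h⟩ else a0 j) = b := by
    intro i hi b hb
    refine ⟨fun j => b (Fin.castLE hi j), ?_⟩
    funext j
    split_ifs with h
    · rfl
    · exact (hb j (by omega)).symm
  have hirr : ∀ i ≤ d, IsIrreducible (Y i) := by
    intro i hi
    refine ⟨⟨_, ⟨a0, fun _ _ => rfl, rfl⟩⟩, ?_⟩
    rintro U W ⟨U', hU', rfl⟩ ⟨W', hW', rfl⟩ ⟨_, ⟨a, ha, rfl⟩, haU⟩ ⟨_, ⟨b, hb, rfl⟩, hbW⟩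
    obtain ⟨F, hF, hF'⟩ := zar_basis (z := f a) hU' haU
    obtain ⟨G, hG, hG'⟩ := zar_basis (z := f b) hW' hbW
    obtain ⟨P, hP⟩ := (hf.restrict hi).exists_poly F
    obtain ⟨Q, hQ⟩ := (hf.restrict hi).exists_poly G
    obtain ⟨a', rfl⟩ := hpar' i hi a ha
    obtain ⟨b', rfl⟩ := hpar' i hi b hb
    have hP0 : P ≠ 0 := by rintro rfl; exact hF (by rw [← hP a', map_zero])
    have hQ0 : Q ≠ 0 := by rintro rfl; exact hG (by rw [← hQ b', map_zero])
    obtain ⟨c, hc⟩ : ∃ c, eval c (P * Q) ≠ 0 := by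
      by_contra hcon
      push Not at hcon
      exact mul_ne_zero hP0 hQ0 (MvPolynomial.funext fun x => by rw [hcon x, map_zero])
    rw [map_mul, hP, hQ] at hc
    exact ⟨_, ⟨_, hpar i hi c, rfl⟩, hF' _ (left_ne_zero_of_mul hc),
      hG' _ (right_ne_zero_of_mul hc)⟩
  let Z : ∀ i : Fin (d + 1), TopologicalSpace.IrreducibleCloseds S := fun i =>
    ⟨closure (Y i), (hirr i (by omega)).closure, isClosed_closure⟩
  have hlt : ∀ i : Fin d, Z i.castSucc < Z i.succ := by
    intro i
    refine lt_of_le_of_ne ?_ ?_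
    · change closure (Y i) ⊆ closure (Y (i + 1))
      exact closure_mono (Set.image_mono (hAmono i))
    · intro heq
      have heq' : closure (Y i) = closure (Y (i + 1)) := congrArg (fun z => (z.carrier : Set S)) heq
      obtain ⟨G, hG, hG0⟩ := (hf.restrict (i := i) (by omega)).exists_dep
        (fun t : Fin (i + 1) => l ⟨t, by omega⟩)
      obtain ⟨F, hF⟩ := exists_evalP (fun t : Fin (i + 1) => l ⟨t, by omega⟩) G
      have hcl : IsClosed {z : S | CV.evalP K V F z = 0} := by
        rw [← isOpen_compl_iff]
        exact ⟨_, zar_open F, rfl⟩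
      have hsub : closure (Y i) ⊆ {z : S | CV.evalP K V F z = 0} := by
        apply closure_minimal _ hcl
        rintro _ ⟨b, hb, rfl⟩
        obtain ⟨a, rfl⟩ := hpar' i (by omega) b hb
        change CV.evalP K V F _ = 0
        rw [hF]; exact hG0 a
      apply hG
      refine (hf.restrict (i := i + 1) (by omega)).indep
        (fun t : Fin (i + 1) => l ⟨t, by omega⟩) ?_ G ?_
      · intro s t
        rw [hl]
        simp [Fin.ext_iff]
      · intro a
        rw [← hF]
        have : (⟨_, hS (fun j : Fin d => if h : j.1 < i + 1 then a ⟨j, h⟩ else a0 j)⟩ : S) ∈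
            Y (i + 1) := ⟨_, hpar (i + 1) (by omega) a, rfl⟩
        have h2 := subset_closure this
        rw [← heq'] at h2
        have h3 := hsub h2
        simp only [Set.mem_setOf_eq] at h3
        exact h3
  let ser : LTSeries (TopologicalSpace.IrreducibleCloseds S) :=
    { length := d, toFun := Z, step := hlt }
  have := Order.LTSeries.length_le_krullDim ser
  exact this

theorem le_dimSet {K V σ : Type*} [Field K] [CharZero K] [AddCommGroup V] [Module K V]
    [FiniteDimensional K V] [Fintype σ] (S : Set V) {f : (σ → K) → V} {a0 f'}
    (hf : HasPD f a0 f') (hS : ∀ a, f a ∈ S) (hli : LinearIndependent K f') :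
    (Fintype.card σ : WithBot ℕ∞) ≤ CV.dimSet K V S := by
  classical
  let e := Fintype.equivFin σ
  refine le_dimSet_fin S (f := fun a => f (a ∘ e)) (a0 := a0 ∘ e.symm) (f' := f' ∘ e.symm) ?_
    (fun a => hS _) (hli.comp _ e.symm.injective)
  intro l
  obtain ⟨P, h1, h2⟩ := hf l
  refine ⟨rename e P, fun a => by rw [eval_rename, h1], fun j => ?_⟩
  obtain ⟨t, rfl⟩ := e.surjective j
  rw [pderiv_rename e.injective, eval_rename, Function.comp_assoc]
  simp [h2]

end CVA
end

section
set_option linter.all false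
namespace CVA
open MvPolynomial Topology

lemma prime_step {K R : Type*} [Field K] [CommRing R] [Algebra K R] {I J : Ideal R} (hI : I.IsPrime)
    (hlt : I < J) {i : ℕ} (a : Fin i → R) (ha : ∀ F : MvPolynomial (Fin i) K, aeval a F ∈ J → F = 0) :
    ∃ a' : Fin (i + 1) → R, ∀ F : MvPolynomial (Fin (i + 1)) K, aeval a' F ∈ I → F = 0 := by
  obtain ⟨f, hfJ, hfI⟩ := Set.exists_of_ssubset hlt
  have key : ∀ (n : ℕ) (P : Polynomial (MvPolynomial (Fin i) K)), P.natDegree ≤ n →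
      P.eval₂ (aeval a : MvPolynomial (Fin i) K →ₐ[K] R).toRingHom f ∈ I → P = 0 := by
    intro n
    induction n with
    | zero =>
      intro P hP h
      rw [Polynomial.eq_C_of_natDegree_le_zero hP] at h ⊢
      rw [Polynomial.eval₂_C] at h
      rw [ha _ (hlt.le h), map_zero]
    | succ n ih =>
      intro P hP h
      rw [← Polynomial.divX_mul_X_add P, Polynomial.eval₂_add, Polynomial.eval₂_mul,
        Polynomial.eval₂_X, Polynomial.eval₂_C] at h
      have h0 : P.coeff 0 = 0 := by
        apply ha
        have := J.sub_mem (hlt.le h) (J.mul_mem_left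
          (P.divX.eval₂ (aeval a : MvPolynomial (Fin i) K →ₐ[K] R).toRingHom f) hfJ)
        simpa using this
      rw [h0, map_zero, add_zero] at h
      have h1 := (hI.mem_or_mem h).resolve_right hfI
      have h2 := ih P.divX (by rw [Polynomial.natDegree_divX_eq_natDegree_tsub_one]; omega) h1
      rw [← Polynomial.divX_mul_X_add P, h0, h2]; simp
  refine ⟨Fin.cons f a, fun F hF => ?_⟩
  have h := key _ (finSuccEquiv K i F) le_rfl
  apply (finSuccEquiv K i).injective
  rw [map_zero]
  apply h
  convert hF using 1
  have : (((Polynomial.eval₂RingHom (aeval a : MvPolynomial (Fin i) K →ₐ[K] R).toRingHom f).comp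
      (finSuccEquiv K i : _ →+* _))) = (aeval (Fin.cons f a : Fin (i+1) → R) : _ →ₐ[K] R).toRingHom := by
    apply MvPolynomial.ringHom_ext
    · intro c
      simp [finSuccEquiv_apply]
    · intro j
      refine Fin.cases ?_ (fun j => ?_) j
      · simp [finSuccEquiv_apply]
      · simp [finSuccEquiv_apply]
  exact congrArg (fun φ : MvPolynomial (Fin (i+1)) K →+* R => φ F) this

section
variable {K V : Type*} [Field K] [AddCommGroup V] [Module K V] [FiniteDimensional K V]

def vanI (Z : Set V) : Ideal (MvPolynomial (Module.Free.ChooseBasisIndex K V) K) where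
  carrier := {F | ∀ z ∈ Z, CV.evalP K V F z = 0}
  add_mem' := by
    intro F G hF hG z hz
    have := hF z hz; have := hG z hz
    simp_all [CV.evalP]
  zero_mem' := by intro z hz; simp [CV.evalP]
  smul_mem' := by
    intro c F hF z hz
    have := hF z hz
    simp_all [CV.evalP]

theorem exists_prime_of_dim (S : Set V) (N : ℕ) (h : ¬ CV.dimSet K V S ≤ (N : WithBot ℕ∞)) :
    ∃ I : Ideal (MvPolynomial (Module.Free.ChooseBasisIndex K V) K), I.IsPrime ∧
      (∀ F, (∀ z ∈ S, CV.evalP K V F z = 0) → F ∈ I) ∧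
      ∃ a : Fin (N + 1) → MvPolynomial (Module.Free.ChooseBasisIndex K V) K,
        ∀ F : MvPolynomial (Fin (N + 1)) K, aeval a F ∈ I → F = 0 := by
  letI tS : TopologicalSpace S := TopologicalSpace.induced Subtype.val (CV.zar K V)
  obtain ⟨p, hp⟩ : ∃ p : LTSeries (TopologicalSpace.IrreducibleCloseds S), N < p.length := by
    by_contra hcon
    push Not at hcon
    apply h
    refine iSup_le fun p => ?_
    exact_mod_cast hcon p
  let I : Fin (p.length + 1) → Ideal (MvPolynomial (Module.Free.ChooseBasisIndex K V) K) :=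
    fun j => vanI (K := K) (Subtype.val '' ((p j).carrier : Set S))
  have hprime : ∀ j, (I j).IsPrime := by
    intro j
    constructor
    · intro htop
      have h1 : (1 : MvPolynomial (Module.Free.ChooseBasisIndex K V) K) ∈ I j := by
        rw [htop]; trivial
      obtain ⟨z, hz⟩ := (p j).isIrreducible'.nonempty
      have := h1 z ⟨z, hz, rfl⟩
      simp [CV.evalP] at this
    · intro F G hFG
      by_contra hcon
      push Not at hcon
      obtain ⟨hF, hG⟩ := hcon
      have hF' : ∃ z ∈ (p j).carrier, CV.evalP K V F z ≠ 0 := by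
        by_contra hc; push Not at hc
        exact hF (by rintro _ ⟨z, hz, rfl⟩; exact hc z hz)
      have hG' : ∃ z ∈ (p j).carrier, CV.evalP K V G z ≠ 0 := by
        by_contra hc; push Not at hc
        exact hG (by rintro _ ⟨z, hz, rfl⟩; exact hc z hz)
      obtain ⟨z, hz, hzF⟩ := hF'
      obtain ⟨w, hw, hwG⟩ := hG'
      obtain ⟨u, hu, hu1, hu2⟩ := (p j).isIrreducible'.2 {z : S | CV.evalP K V F z ≠ 0}
        {z : S | CV.evalP K V G z ≠ 0} ⟨_, zar_open F, rfl⟩ ⟨_, zar_open G, rfl⟩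
        ⟨z, hz, hzF⟩ ⟨w, hw, hwG⟩
      have := hFG u ⟨u, hu, rfl⟩
      rw [evalP_mul] at this
      exact mul_ne_zero hu1 hu2 this
  have hlt : ∀ j : Fin p.length, I j.succ < I j.castSucc := by
    intro j
    have hj : p j.castSucc < p j.succ := p.step j
    have hsub : ((p j.castSucc).carrier : Set S) ⊆ (p j.succ).carrier := hj.le
    refine lt_of_le_of_ne (fun F hF => ?_) (fun heq => ?_)
    · rintro _ ⟨z, hz, rfl⟩
      exact hF z ⟨z, hsub hz, rfl⟩
    · apply hj.not_ge
      intro z hz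
      by_contra hzn
      obtain ⟨U, hU, hU'⟩ := (p j.castSucc).isClosed'.isOpen_compl
      have hzU : z.1 ∈ U := by
        have : z ∈ Subtype.val ⁻¹' U := by rw [hU']; exact hzn
        exact this
      obtain ⟨F, hF, hF'⟩ := zar_basis hU hzU
      have hFI : F ∈ I j.castSucc := by
        rintro _ ⟨w, hw, rfl⟩
        by_contra hne
        have : w ∈ Subtype.val ⁻¹' U := hF' _ hne
        rw [hU'] at this
        exact this hw
      rw [← heq] at hFI
      exact hF (hFI z ⟨z, hz, rfl⟩)
  have key : ∀ i (hi : i ≤ p.length), ∃ a : Fin i → MvPolynomial (Module.Free.ChooseBasisIndex K V) K,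
      ∀ F : MvPolynomial (Fin i) K, aeval a F ∈ I ⟨i, by omega⟩ → F = 0 := by
    intro i
    induction i with
    | zero =>
      intro hi
      refine ⟨Fin.elim0, fun F hF => ?_⟩
      obtain ⟨c, rfl⟩ := C_surjective (Fin 0) F
      by_contra hne
      have hc : c ≠ 0 := by rintro rfl; simp at hne
      apply (hprime ⟨0, by omega⟩).ne_top
      apply Ideal.eq_top_of_isUnit_mem _ hF
      rw [aeval_C]
      exact (isUnit_iff_ne_zero.mpr hc).map _
    | succ i ih =>
      intro hi
      obtain ⟨a, ha⟩ := ih (by omega)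
      exact prime_step (hprime _) (hlt ⟨i, by omega⟩) a ha
  obtain ⟨a, ha⟩ := key p.length le_rfl
  refine ⟨I ⟨p.length, by omega⟩, hprime _, ?_, fun j => a ⟨j, by omega⟩, fun F hF => ?_⟩
  · rintro F hF _ ⟨z, hz, rfl⟩
    exact hF z z.2
  · have hinj : Function.Injective (fun j : Fin (N+1) => (⟨j, by omega⟩ : Fin p.length)) := by
      intro x y hxy; simpa [Fin.ext_iff] using hxy
    apply rename_injective _ hinj
    rw [map_zero]
    apply ha
    rw [aeval_rename]
    exact hF
end

theorem exists_der_aux {K Ω : Type*} [Field K] [Field Ω] [CharZero Ω] [Algebra K Ω] {m : ℕ} (b : Fin m → Ω)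
    (hb : AlgebraicIndependent K b) :
    ∃ D : Fin m → Derivation K Ω Ω, ∀ t u, D t (b u) = if u = t then 1 else 0 := by
  classical
  obtain ⟨s, hs1, hs⟩ := exists_isTranscendenceBasis_superset
    (show AlgebraicIndepOn K id (Set.range b) from hb.coe_range)
  let A := MvPolynomial s K
  have hs' : IsTranscendenceBasis K ((↑) : s → Ω) := hs
  letI algA : Algebra A Ω := (aeval ((↑) : s → Ω) : MvPolynomial s K →ₐ[K] Ω).toAlgebra
  have hAdef : ∀ P : A, algebraMap A Ω P = aeval ((↑) : s → Ω) P := fun P => rfl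
  haveI tow : IsScalarTower K A Ω := IsScalarTower.of_algebraMap_eq fun c => by
    rw [hAdef]; simp [A]
  have hinj : Function.Injective (algebraMap A Ω) := hs'.1
  haveI : FaithfulSMul A Ω := (faithfulSMul_iff_algebraMap_injective A Ω).mpr hinj
  letI : Algebra (FractionRing A) Ω := FractionRing.liftAlgebra A Ω
  haveI : IsScalarTower A (FractionRing A) Ω := FractionRing.isScalarTower_liftAlgebra A Ω
  haveI : Algebra.IsAlgebraic A Ω := by
    haveI := hs'.isAlgebraic
    let e := hs'.1.aevalEquiv
    refine ⟨fun x => IsAlgebraic.of_ringHom_of_comp_eq (e : A →+* _) (RingHom.id Ω) (a := x)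
      (Algebra.IsAlgebraic.isAlgebraic (R := Algebra.adjoin K (Set.range ((↑) : s → Ω))) x)
      e.surjective Function.injective_id ?_⟩
    ext P
    · simp [hAdef, e]
    · simp [hAdef, e]
  haveI : Algebra.IsAlgebraic (FractionRing A) Ω :=
    (IsFractionRing.comap_isAlgebraic_iff (A := A)).mp inferInstance
  haveI : CharZero (FractionRing A) := (algebraMap (FractionRing A) Ω).charZero_iff
    (algebraMap (FractionRing A) Ω).injective |>.mpr inferInstance
  haveI : Algebra.IsSeparable (FractionRing A) Ω := inferInstance
  haveI : Algebra.FormallyEtale A (FractionRing A) := Algebra.FormallyEtale.of_isLocalization (nonZeroDivisors A)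
  haveI : Algebra.FormallyEtale (FractionRing A) Ω := Algebra.FormallyEtale.of_isSeparable _ _
  haveI : Algebra.FormallyEtale A Ω := Algebra.FormallyEtale.comp A (FractionRing A) Ω
  have hder : ∀ u : s → Ω, ∃ D : Derivation K Ω Ω, ∀ j : s, D (j : Ω) = u j := by
    intro u
    let d0 : Derivation K A Ω := MvPolynomial.mkDerivation K u
    let e := KaehlerDifferential.tensorKaehlerEquivOfFormallyEtale K A Ω
    let L : Ω[Ω⁄K] →ₗ[Ω] Ω := (LinearMap.liftBaseChange Ω d0.liftKaehlerDifferential) ∘ₗ e.symm.toLinearMap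
    refine ⟨L.compDer (KaehlerDifferential.D K Ω), fun j => ?_⟩
    have h1 : (j : Ω) = algebraMap A Ω (X j) := by rw [hAdef]; simp
    have h2 : L (KaehlerDifferential.D K Ω (j : Ω)) = u j := by
      rw [h1]
      simp only [L, e, LinearMap.comp_apply, LinearEquiv.coe_coe]
      rw [KaehlerDifferential.tensorKaehlerEquivOfFormallyEtale_symm_D_algebraMap]
      rw [LinearMap.liftBaseChange_tmul, one_smul, Derivation.liftKaehlerDifferential_comp_D]
      exact mkDerivation_X K u j
    exact h2
  have hbinj : Function.Injective b := hb.injective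
  choose D hD using fun t : Fin m => hder (fun j => if (j : Ω) = b t then 1 else 0)
  have hDb : ∀ t u, D t (b u) = if u = t then 1 else 0 := by
    intro t u
    have := hD t ⟨b u, hs1 ⟨u, rfl⟩⟩
    simp only at this
    rw [this]
    simp [hbinj.eq_iff]
  exact ⟨D, hDb⟩

theorem linInd_aux {K Ω ι : Type*} [Field K] [Field Ω] [Algebra K Ω] [Fintype ι] {m : ℕ} (ζ : ι → Ω)
    (a : Fin m → MvPolynomial ι K) (D : Fin m → Derivation K Ω Ω)
    (hDb : ∀ t u, D t (aeval ζ (a u)) = if u = t then 1 else 0) :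
    LinearIndependent Ω (fun s i => D s (ζ i)) := by
  rw [Fintype.linearIndependent_iff]
  intro c hc u
  have h1 : ∀ P : MvPolynomial ι K, ∑ t, c t * D t (aeval ζ P) = 0 := by
    intro P
    simp only [deriv_aeval, Finset.mul_sum]
    rw [Finset.sum_comm]
    refine Finset.sum_eq_zero fun j _ => ?_
    have := congrFun hc j
    simp only [Finset.sum_apply, Pi.smul_apply, smul_eq_mul, Pi.zero_apply] at this
    calc _ = aeval ζ (pderiv j P) * ∑ t, c t * D t (ζ j) := by
          rw [Finset.mul_sum]; refine Finset.sum_congr rfl fun t _ => ?_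
          simp only [smul_eq_mul]; ring
      _ = 0 := by rw [this, mul_zero]
  have h2 := h1 (a u)
  simpa [hDb] using h2

universe uu vv
theorem exists_derivations {K : Type uu} {ι : Type vv} [Finite ι] [Field K] [CharZero K]
    (I : Ideal (MvPolynomial ι K)) (hI : I.IsPrime) {m : ℕ} (a : Fin m → MvPolynomial ι K)
    (ha : ∀ F : MvPolynomial (Fin m) K, aeval a F ∈ I → F = 0) :
    ∃ (Ω : Type (max uu vv)) (_ : Field Ω) (_ : IsAlgClosed Ω) (_ : Algebra K Ω) (ζ : ι → Ω),
      (∀ F ∈ I, aeval ζ F = 0) ∧ ∃ D : Fin m → Derivation K Ω Ω,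
        LinearIndependent Ω (fun s i => D s (ζ i)) := by
  classical
  haveI := Fintype.ofFinite ι
  haveI := hI
  let Q := MvPolynomial ι K ⧸ I
  let F0 := FractionRing Q
  let Ω := AlgebraicClosure F0
  letI : CharZero Ω := 
    (algebraMap K Ω).charZero_iff (algebraMap K Ω).injective |>.mp inferInstance
  let φ : MvPolynomial ι K →ₐ[K] Ω := (IsScalarTower.toAlgHom K Q Ω).comp (Ideal.Quotient.mkₐ K I)
  have hφ : ∀ F, φ F = 0 ↔ F ∈ I := by
    intro F
    have : φ F = algebraMap F0 Ω (algebraMap Q F0 (Ideal.Quotient.mk I F)) := by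
      simp only [φ, AlgHom.comp_apply, IsScalarTower.toAlgHom_apply]
      rw [IsScalarTower.algebraMap_apply Q F0 Ω]; rfl
    rw [this, map_eq_zero_iff _ (algebraMap F0 Ω).injective,
      map_eq_zero_iff _ (IsFractionRing.injective Q F0), Ideal.Quotient.eq_zero_iff_mem]
  let ζ : ι → Ω := fun i => φ (X i)
  have hζ : ∀ F, aeval ζ F = φ F := fun F => by
    rw [← comp_aeval_apply (f := X) φ F]; simp
  let b : Fin m → Ω := fun t => φ (a t)
  have hb : AlgebraicIndependent K b := by
    rw [algebraicIndependent_iff]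
    intro F hF
    apply ha
    rw [← hφ, comp_aeval_apply]
    exact hF
  obtain ⟨D, hDb⟩ := exists_der_aux b hb
  refine ⟨Ω, inferInstance, inferInstance, inferInstance, ζ, fun F hF => by rw [hζ, hφ]; exact hF,
    D, ?_⟩
  exact linInd_aux ζ a D (fun t u => by rw [hζ]; exact hDb t u)

end CVA
end

section
set_option linter.all false
namespace CVA
open MvPolynomial Topology TensorProduct

lemma exists_cols {F p q : Type*} [Field F] [Fintype p] [Fintype q] 
    (A : Matrix p q F) {m : ℕ} (hm : m ≤ A.rank) :
    ∃ c : Fin m → q, LinearIndependent F (A.submatrix id c).col := by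
  rw [Matrix.rank_eq_finrank_span_cols] at hm
  obtain ⟨f, hf1, hf2, hf3⟩ := Submodule.exists_fun_fin_finrank_span_eq F (Set.range A.col)
  choose c hc using hf1
  refine ⟨fun i => c (Fin.castLE hm i), ?_⟩
  have : (A.submatrix id fun i => c (Fin.castLE hm i)).col = f ∘ Fin.castLE hm := by
    funext i; rw [Function.comp_apply, ← hc]; rfl
  rw [this]
  exact hf3.comp _ (Fin.castLE_injective hm)

lemma exists_minor {F p q : Type*} [Field F] [Fintype p] [Fintype q] [DecidableEq p] [DecidableEq q]
    (A : Matrix p q F) {m : ℕ} (hm : m ≤ A.rank) :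
    ∃ (r : Fin m → p) (c : Fin m → q), (A.submatrix r c).det ≠ 0 := by
  obtain ⟨c, hc⟩ := exists_cols A hm
  have h1 : (A.submatrix id c).rank = m := by
    rw [Matrix.rank_eq_finrank_span_cols, finrank_span_eq_card hc]; simp
  obtain ⟨r, hr⟩ := exists_cols (A.submatrix id c).transpose (by rw [Matrix.rank_transpose, h1])
  refine ⟨r, c, ?_⟩
  have h2 : LinearIndependent F (A.submatrix r c).row := hr
  have := Matrix.linearIndependent_rows_iff_isUnit.mp h2
  rw [Matrix.isUnit_iff_isUnit_det] at this
  exact this.ne_zero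

lemma rank_cent {F L ι : Type*} [Field F] [LieRing L] [LieAlgebra F L] [Fintype ι] [DecidableEq ι]
    (b : Module.Basis ι F L) (x y : L) :
    (LinearMap.toMatrix b (b.prod b) ((LieAlgebra.ad F L x).prod (LieAlgebra.ad F L y))).rank
      + Module.finrank F ↥(cent F x ⊓ cent F y) = Fintype.card ι := by
  haveI : FiniteDimensional F L := Module.Finite.of_basis b
  rw [Matrix.rank_eq_finrank_range_toLin _ (b.prod b) b, Matrix.toLin_toMatrix, cent, cent,
    ← LinearMap.ker_prod, LinearMap.finrank_range_add_finrank_ker, Module.finrank_eq_card_basis b]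

universe uu vv
theorem exists_generic {K : Type uu} {G : Type vv} [Field K] [CharZero K] [LieRing G] [LieAlgebra K G]
    [FiniteDimensional K G] (S : Set (G × G)) (r : ℕ)
    (hS : ∀ z ∈ S, ⁅z.1, z.2⁆ = 0 ∧ r < Module.finrank K ↥(cent K z.1 ⊓ cent K z.2)) (N : ℕ)
    (h : ¬ CV.dimSet K (G × G) S ≤ (N : WithBot ℕ∞)) :
    ∃ (Ω : Type (max uu vv)) (_ : Field Ω) (_ : IsAlgClosed Ω) (_ : Algebra K Ω) (x y : Ω ⊗[K] G),
      ⁅x, y⁆ = 0 ∧ r < Module.finrank Ω ↥(cent Ω x ⊓ cent Ω y) ∧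
      ∃ T : Submodule Ω ((Ω ⊗[K] G) × (Ω ⊗[K] G)), N < Module.finrank Ω T ∧
        ∀ p ∈ T, ∃ δ : (Ω ⊗[K] G) →+ (Ω ⊗[K] G), (∀ a b, δ ⁅a, b⁆ = ⁅δ a, b⁆ + ⁅a, δ b⁆) ∧
          δ x = p.1 ∧ δ y = p.2 := by
  classical
  obtain ⟨I, hI, hIS, a, ha⟩ := exists_prime_of_dim S N h
  obtain ⟨Ω, _, _, _, ζ, hζ, D, hD⟩ := exists_derivations I hI a ha
  have hev : ∀ F, (∀ z ∈ S, CV.evalP K (G × G) F z = 0) → aeval ζ F = 0 := fun F hF => hζ F (hIS F hF)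
  clear hζ hIS ha a hI I h
  set B := Module.Free.chooseBasis K (G × G) with hB
  let b := Module.Free.chooseBasis K G
  let b' := Algebra.TensorProduct.basis Ω b
  let x : Ω ⊗[K] G := ∑ i, ζ i ⊗ₜ (B i).1
  let y : Ω ⊗[K] G := ∑ i, ζ i ⊗ₜ (B i).2
  have hz1 : ∀ z : G × G, z.1 = ∑ i, CV.coordFn K (G × G) z i • (B i).1 := by
    intro z
    conv_lhs => rw [← B.sum_repr z]
    rw [Prod.fst_sum]; rfl
  have hz2 : ∀ z : G × G, z.2 = ∑ i, CV.coordFn K (G × G) z i • (B i).2 := by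
    intro z
    conv_lhs => rw [← B.sum_repr z]
    rw [Prod.snd_sum]; rfl
  have hb' : ∀ (c : Ω) (u : G) j, b'.repr (c ⊗ₜ u) j = c * algebraMap K Ω (b.repr u j) := by
    intro c u j
    simp [b']
  refine ⟨Ω, inferInstance, inferInstance, inferInstance, x, y, ?_, ?_, ?_⟩
  · apply b'.repr.injective
    ext j
    rw [map_zero, Finsupp.zero_apply]
    have := hev (∑ i, ∑ i', C (b.repr ⁅(B i).1, (B i').2⁆ j) * X i * X i') (by
      intro z hz
      have h0 := (hS z hz).1
      rw [hz1 z, hz2 z] at h0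
      have h1 := congrArg (fun w => b.repr w j) h0
      simp only [LieRing.of_associative_ring_bracket, sum_lie, lie_sum, map_sum, smul_lie, lie_smul, map_smul, Finsupp.smul_apply, smul_eq_mul, Finsupp.coe_finset_sum, Finset.sum_apply, map_zero, Finsupp.zero_apply] at h1
      rw [← h1, CV.evalP]
      simp only [map_sum, map_mul, aeval_C, aeval_X]
      rw [Finset.sum_comm]
      refine Finset.sum_congr rfl fun i _ => ?_
      rw [Finset.mul_sum]
      refine Finset.sum_congr rfl fun i' _ => ?_
      simp only [Algebra.algebraMap_self, RingHom.id_apply, smul_eq_mul]; ring)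
    rw [← this]
    simp only [x, y, sum_lie, lie_sum, LieAlgebra.ExtendScalars.bracket_tmul, map_sum,
      Finsupp.coe_finset_sum, Finset.sum_apply, hb', map_mul, aeval_C, aeval_X]
    rw [Finset.sum_comm]
    refine Finset.sum_congr rfl fun i _ => Finset.sum_congr rfl fun i' _ => ?_
    ring
  · by_contra hle
    push Not at hle
    have hr := rank_cent b' x y
    obtain ⟨ro, co, hdet⟩ := exists_minor (m := Fintype.card (Module.Free.ChooseBasisIndex K G) - r)
      (LinearMap.toMatrix b' (b'.prod b') ((LieAlgebra.ad Ω _ x).prod (LieAlgebra.ad Ω _ y)))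
      (by omega)
    let P : Matrix (Module.Free.ChooseBasisIndex K G ⊕ Module.Free.ChooseBasisIndex K G)
        (Module.Free.ChooseBasisIndex K G) (MvPolynomial (Module.Free.ChooseBasisIndex K (G × G)) K) :=
      Matrix.of fun s d => Sum.elim (fun c => ∑ i, C (b.repr ⁅(B i).1, b d⁆ c) * X i)
        (fun c => ∑ i, C (b.repr ⁅(B i).2, b d⁆ c) * X i) s
    have hP1 : P.map (aeval ζ) =
        LinearMap.toMatrix b' (b'.prod b') ((LieAlgebra.ad Ω _ x).prod (LieAlgebra.ad Ω _ y)) := by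
      ext s d
      rw [LinearMap.toMatrix_apply]
      have hbd : b' d = 1 ⊗ₜ b d := by simp [b']
      rcases s with c | c
      · rw [Module.Basis.prod_repr_inl]; change _ = b'.repr ⁅x, b' d⁆ c
        simp only [P, Matrix.map_apply, Matrix.of_apply, Sum.elim_inl, map_sum, map_mul, aeval_C,
          aeval_X, LinearMap.prod_apply, Pi.prod, Module.Basis.prod_repr_inl, LieAlgebra.ad_apply,
          x, sum_lie, hbd, LieAlgebra.ExtendScalars.bracket_tmul, Finsupp.coe_finset_sum,
          Finset.sum_apply, hb', mul_one]
        exact Finset.sum_congr rfl fun i _ => mul_comm _ _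
      · rw [Module.Basis.prod_repr_inr]; change _ = b'.repr ⁅y, b' d⁆ c
        simp only [P, Matrix.map_apply, Matrix.of_apply, Sum.elim_inr, map_sum, map_mul, aeval_C,
          aeval_X, LinearMap.prod_apply, Pi.prod, Module.Basis.prod_repr_inr, LieAlgebra.ad_apply,
          y, sum_lie, hbd, LieAlgebra.ExtendScalars.bracket_tmul, Finsupp.coe_finset_sum,
          Finset.sum_apply, hb', mul_one]
        exact Finset.sum_congr rfl fun i _ => mul_comm _ _
    have hP2 : ∀ z : G × G, P.map (aeval (CV.coordFn K (G × G) z)) =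
        LinearMap.toMatrix b (b.prod b) ((LieAlgebra.ad K _ z.1).prod (LieAlgebra.ad K _ z.2)) := by
      intro z
      ext s d
      rw [LinearMap.toMatrix_apply]
      rcases s with c | c
      · rw [Module.Basis.prod_repr_inl]; change _ = b.repr ⁅z.1, b d⁆ c
        rw [hz1 z]
        simp only [P, Matrix.map_apply, Matrix.of_apply, Sum.elim_inl, map_sum, map_mul, aeval_C,
          aeval_X, LinearMap.prod_apply, Pi.prod, Module.Basis.prod_repr_inl, LieAlgebra.ad_apply,
          sum_lie, smul_lie, map_smul, Finsupp.smul_apply, Finsupp.coe_finset_sum,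
          Finset.sum_apply, smul_eq_mul, Algebra.algebraMap_self, RingHom.id_apply]
        exact Finset.sum_congr rfl fun i _ => mul_comm _ _
      · rw [Module.Basis.prod_repr_inr]; change _ = b.repr ⁅z.2, b d⁆ c
        rw [hz2 z]
        simp only [P, Matrix.map_apply, Matrix.of_apply, Sum.elim_inr, map_sum, map_mul, aeval_C,
          aeval_X, LinearMap.prod_apply, Pi.prod, Module.Basis.prod_repr_inr, LieAlgebra.ad_apply,
          sum_lie, smul_lie, map_smul, Finsupp.smul_apply, Finsupp.coe_finset_sum,
          Finset.sum_apply, smul_eq_mul, Algebra.algebraMap_self, RingHom.id_apply]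
        exact Finset.sum_congr rfl fun i _ => mul_comm _ _
    apply hdet
    have h2 := hev (P.submatrix ro co).det (by
      intro z hz
      rw [CV.evalP, AlgHom.map_det]
      by_contra hne
      have h3 := rank_cent b z.1 z.2
      have h4 := (hS z hz).2
      have h5 := Matrix.rank_submatrix_le
        (LinearMap.toMatrix b (b.prod b) ((LieAlgebra.ad K _ z.1).prod (LieAlgebra.ad K _ z.2))) ro co
      rw [← hP2 z] at h5
      have h6 := Matrix.rank_of_isUnit ((P.map (aeval (CV.coordFn K (G × G) z))).submatrix ro co)
        ((Matrix.isUnit_iff_isUnit_det _).mpr (isUnit_iff_ne_zero.mpr hne))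
      rw [h6, hP2 z] at h5
      simp only [Fintype.card_fin] at h5
      omega)
    rw [AlgHom.map_det] at h2
    rw [← hP1]
    exact h2
  · let v : Fin (N + 1) → (Ω ⊗[K] G) × (Ω ⊗[K] G) := fun s =>
      (Lie.Derivation.ofDerivation G (D s) x, Lie.Derivation.ofDerivation G (D s) y)
    have hDx : ∀ d : Derivation K Ω Ω, Lie.Derivation.ofDerivation G d x = ∑ i, d (ζ i) ⊗ₜ (B i).1 := by
      intro d
      simp [Lie.Derivation.ofDerivation_apply, x]
    have hDy : ∀ d : Derivation K Ω Ω, Lie.Derivation.ofDerivation G d y = ∑ i, d (ζ i) ⊗ₜ (B i).2 := by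
      intro d
      simp [Lie.Derivation.ofDerivation_apply, y]
    have hlin : LinearIndependent Ω v := by
      have e1 : v = fun s => (TensorProduct.prodRight K Ω Ω G G) ((Algebra.TensorProduct.basis Ω B).equivFun.symm
          (fun i => D s (ζ i))) := by
        funext s
        simp only [v, Module.Basis.equivFun_symm_apply, map_sum, map_smul,
          Algebra.TensorProduct.basis_apply, TensorProduct.prodRight_tmul]
        rw [hDx, hDy]
        ext
        · rw [Prod.fst_sum]; simp [TensorProduct.smul_tmul']
        · rw [Prod.snd_sum]; simp [TensorProduct.smul_tmul']
      rw [e1]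
      exact (hD.map' (Algebra.TensorProduct.basis Ω B).equivFun.symm.toLinearMap
        (LinearEquiv.ker _)).map' (TensorProduct.prodRight K Ω Ω G G).toLinearMap (LinearEquiv.ker _)
    refine ⟨Submodule.span Ω (Set.range v), ?_, ?_⟩
    · rw [finrank_span_eq_card hlin]; simp
    · intro p hp
      obtain ⟨c, rfl⟩ := (Submodule.mem_span_range_iff_exists_fun Ω).mp hp
      let d : Derivation K Ω Ω := ∑ s, c s • D s
      have hd : ∀ u, d u = ∑ s, c s * D s u := by
        intro u
        have : d u = ∑ s, (c s • D s) u := by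
          simp only [d]
          induction (Finset.univ : Finset (Fin (N+1))) using Finset.induction_on with
          | empty => simp
          | insert a s ha ih => rw [Finset.sum_insert ha, Finset.sum_insert ha, Derivation.add_apply, ih]
        rw [this]; rfl
      refine ⟨((Lie.Derivation.ofDerivation G d : LieDerivation K _ _) : (Ω ⊗[K] G) →ₗ[K] (Ω ⊗[K] G)).toAddMonoidHom, ?_, ?_, ?_⟩
      · intro u w
        have := (Lie.Derivation.ofDerivation G d).apply_lie_eq_add u w
        change Lie.Derivation.ofDerivation G d ⁅u, w⁆ = _
        rw [this, add_comm]; rfl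
      · change Lie.Derivation.ofDerivation G d x = _
        rw [hDx, Prod.fst_sum]
        simp only [v, Prod.smul_fst, hDx, Finset.smul_sum, hd, TensorProduct.sum_tmul]
        rw [Finset.sum_comm]
        rfl
      · change Lie.Derivation.ofDerivation G d y = _
        rw [hDy, Prod.snd_sum]
        simp only [v, Prod.smul_snd, hDy, Finset.smul_sum, hd, TensorProduct.sum_tmul]
        rw [Finset.sum_comm]
        rfl
end CVA
end

section
set_option linter.all false
namespace CVA
open LieAlgebra Module

lemma isNilpotent_of_trace {F V : Type*} [Field F] [CharZero F] [AddCommGroup V] [Module F V]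
    [FiniteDimensional F V] (A : Module.End F V)
    (h : ∀ q : Polynomial F, LinearMap.trace F V (Polynomial.aeval A q * A) = 0) : IsNilpotent A := by
  obtain ⟨u, hu, hnd⟩ := Polynomial.exists_eq_pow_rootMultiplicity_mul_and_not_dvd (minpoly F A)
    (minpoly.ne_zero_of_finite F A) 0
  set n := Polynomial.rootMultiplicity 0 (minpoly F A)
  rw [map_zero, sub_zero] at hu hnd
  have hcop : IsCoprime (Polynomial.X ^ (n + 1)) u :=
    ((Polynomial.irreducible_X.coprime_iff_not_dvd).mpr hnd).pow_left
  obtain ⟨a, b, hab⟩ := hcop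
  have h0 : Polynomial.aeval A (Polynomial.X ^ (n + 1) * u) = 0 := by
    rw [pow_succ', mul_assoc, ← hu, map_mul, minpoly.aeval, mul_zero]
  have hid : IsIdempotentElem (Polynomial.aeval A (a * Polynomial.X ^ (n + 1))) := by
    unfold IsIdempotentElem
    rw [← map_mul, ← sub_eq_zero, ← map_sub]
    have : a * Polynomial.X ^ (n + 1) * (a * Polynomial.X ^ (n + 1)) - a * Polynomial.X ^ (n + 1)
        = (Polynomial.X ^ (n + 1) * u) * (-(a * b)) := by
      linear_combination (a * Polynomial.X ^ (n + 1)) * hab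
    rw [this, map_mul, h0, zero_mul]
  have htr : LinearMap.trace F V (Polynomial.aeval A (a * Polynomial.X ^ (n + 1))) = 0 := by
    rw [pow_succ, ← mul_assoc, map_mul, Polynomial.aeval_X]
    exact h _
  have hz := LinearMap.IsIdempotentElem.eq_zero_of_trace_eq_zero hid htr
  refine ⟨n + 1, ?_⟩
  have : (Polynomial.X ^ (n + 1) : Polynomial F) = (a * Polynomial.X ^ (n + 1)) * Polynomial.X ^ (n + 1)
      + (Polynomial.X ^ (n + 1) * u) * b := by
    linear_combination (-Polynomial.X ^ (n + 1)) * hab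
  have h2 := congrArg (Polynomial.aeval A) this
  rw [map_add, map_mul, hz, zero_mul, map_mul (Polynomial.aeval A) (Polynomial.X ^ (n + 1) * u), h0, zero_mul, map_pow, Polynomial.aeval_X] at h2
  simpa using h2

lemma commute_aeval {F A : Type*} [Field F] [Ring A] [Algebra F A] {a b : A} (h : Commute a b) (q : Polynomial F) :
    Commute (Polynomial.aeval a q) b := by
  induction q using Polynomial.induction_on' with
  | add p q hp hq => rw [map_add]; exact hp.add_left hq
  | monomial n c => rw [Polynomial.aeval_monomial]; exact Commute.mul_left (Algebra.commutes c b) (h.pow_left n)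

section
variable {F L : Type*} [Field F] [LieRing L] [LieAlgebra F L]

lemma kf_inv (x y z : L) : killingForm F L ⁅x, y⁆ z = killingForm F L x ⁅y, z⁆ :=
  LieModule.traceForm_apply_lie_apply F L L x y z

lemma kf_comm (x y : L) : killingForm F L x y = killingForm F L y x :=
  LieModule.traceForm_comm F L L x y

/-- `[x,[·]]` skew -/
lemma kf_inv' (x y z : L) : killingForm F L ⁅x, y⁆ z = - killingForm F L y ⁅x, z⁆ := by
  rw [← lie_skew, map_neg, LinearMap.neg_apply, kf_inv]

variable (F) in
def IsSS (x : L) : Prop := (ad F L x).IsSemisimple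
variable (F) in
def IsNil (x : L) : Prop := IsNilpotent (ad F L x)

lemma mem_cent {x w : L} : w ∈ cent F x ↔ ⁅x, w⁆ = 0 := by
  rw [cent, LinearMap.mem_ker, ad_apply]

lemma comm_symm {x y : L} (h : ⁅x, y⁆ = 0) : ⁅y, x⁆ = 0 := by
  rw [← lie_skew, h, neg_zero]

lemma ad_commute {x y : L} (h : ⁅x, y⁆ = 0) : Commute (ad F L x) (ad F L y) := by
  ext w
  have := leibniz_lie x y w
  rw [h, zero_lie, zero_add] at this
  simpa using this

lemma lie_comm_of {s a b : L} (ha : ⁅s, a⁆ = 0) (hb : ⁅s, b⁆ = 0) : ⁅s, ⁅a, b⁆⁆ = 0 := by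
  rw [leibniz_lie, ha, hb]; simp

variable [FiniteDimensional F L] 

lemma kf_eq_zero_of_nil {e w : L} (he : IsNil F e) (hw : ⁅e, w⁆ = 0) : killingForm F L e w = 0 := by
  rw [killingForm_apply_apply]
  have : IsNilpotent (ad F L e ∘ₗ ad F L w) := (ad_commute hw).isNilpotent_mul_right he
  exact (LinearMap.isNilpotent_trace_of_isNilpotent this).eq_zero

lemma perp_perp [IsKilling F L] (U : Submodule F L) (w : L)
    (h : ∀ v, (∀ u ∈ U, killingForm F L u v = 0) → killingForm F L w v = 0) : w ∈ U := by
  by_contra hw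
  obtain ⟨f, hf1, hf2⟩ := Submodule.exists_le_ker_of_notMem hw
  have hnd := IsKilling.killingForm_nondegenerate F L
  obtain ⟨v, rfl⟩ := (LinearMap.BilinForm.toDual (killingForm F L) hnd).surjective f
  have := h v (fun u hu => by
    have := hf2 hu
    rw [LinearMap.mem_ker, LinearMap.BilinForm.toDual_def] at this
    rw [kf_comm]; exact this)
  rw [kf_comm] at this
  exact hf1 this

lemma kf_nondeg [IsKilling F L] {w : L} (h : ∀ v, killingForm F L w v = 0) : w = 0 := by
  have := perp_perp (⊥ : Submodule F L) w (fun v _ => h v)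
  simpa using this

lemma ad_inj [IsKilling F L] {x : L} (h : ad F L x = 0) : x = 0 := by
  apply kf_nondeg (F := F)
  intro v
  rw [killingForm_apply_apply, h]; simp

lemma nil_crit [CharZero F] {e w w2 : L} (h1 : w = ⁅e, w2⁆) (h2 : ⁅e, w⁆ = 0) : IsNil F w := by
  apply isNilpotent_of_trace
  intro q
  have hc : Commute (Polynomial.aeval (ad F L w) q) (ad F L e) :=
    commute_aeval ((ad_commute (F := F) h2).symm) q
  have hb : ad F L ⁅e, w2⁆ = ad F L e * ad F L w2 - ad F L w2 * ad F L e := by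
    ext v; simp [lie_lie]
  nth_rewrite 2 [h1]
  rw [hb, mul_sub, map_sub, ← mul_assoc, hc.eq, mul_assoc,
    LinearMap.trace_mul_comm, mul_assoc, sub_self]

variable [IsAlgClosed F] [CharZero F]

lemma IsSS.pow_zero {s : L} (hs : IsSS F s) {w : L} {n : ℕ} (h : (ad F L s ^ n) w = 0) : ⁅s, w⁆ = 0 := by
  have h1 := hs.isFinitelySemisimple.maxGenEigenspace_eq_eigenspace 0
  have : w ∈ (ad F L s).maxGenEigenspace 0 := by
    rw [Module.End.mem_maxGenEigenspace]
    exact ⟨n, by simpa using h⟩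
  rw [h1, Module.End.mem_eigenspace_iff] at this
  simpa using this

lemma IsSS.sq_zero {s : L} (hs : IsSS F s) {w : L} (h : ⁅s, ⁅s, w⁆⁆ = 0) : ⁅s, w⁆ = 0 :=
  hs.pow_zero (n := 2) (by simpa [pow_two] using h)

/-- a semisimple operator on a stable subspace: kernel plus image -/
lemma IsSS.decomp {s : L} (hs : IsSS F s) (W : Submodule F L) (hW : ∀ w ∈ W, ⁅s, w⁆ ∈ W) {w : L} (hw : w ∈ W) :
    ∃ u ∈ W, ∃ v ∈ W, w = u + ⁅s, v⁆ ∧ ⁅s, u⁆ = 0 := by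
  let f : Module.End F W := (ad F L s).restrict hW
  have hdis : Disjoint (LinearMap.ker f) (LinearMap.range f) := by
    rw [Submodule.disjoint_def]
    rintro x hx ⟨y, rfl⟩
    rw [LinearMap.mem_ker] at hx
    have h2 : ⁅s, ⁅s, (y : L)⁆⁆ = 0 := congrArg Subtype.val hx
    apply Subtype.ext
    exact hs.sq_zero h2
  have htop : LinearMap.ker f ⊔ LinearMap.range f = ⊤ := by
    apply Submodule.eq_top_of_disjoint _ _ _ hdis
    rw [add_comm, LinearMap.finrank_range_add_finrank_ker]
  have : (⟨w, hw⟩ : W) ∈ LinearMap.ker f ⊔ LinearMap.range f := by rw [htop]; trivial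
  obtain ⟨u, hu, _, ⟨v, rfl⟩, huv⟩ := Submodule.mem_sup.mp this
  refine ⟨u, u.2, v, v.2, ?_, ?_⟩
  · exact (congrArg Subtype.val huv).symm
  · exact congrArg Subtype.val (LinearMap.mem_ker.mp hu)

theorem jordan [IsKilling F L] (p : L) : ∃ s e : L, p = s + e ∧ IsSS F s ∧ IsNil F e ∧ ⁅s, e⁆ = 0 ∧
    (∀ w : L, ⁅p, w⁆ = 0 → ⁅s, w⁆ = 0) ∧ (∀ μ : F, ∀ w : L, ⁅p, w⁆ = μ • w → ⁅s, w⁆ = μ • w) ∧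
    (∀ w : L, ⁅s, w⁆ = 0 ↔ ∃ n : ℕ, (ad F L p ^ n) w = 0) ∧
    (∃ q : Polynomial F, ad F L s = Polynomial.aeval (ad F L p) q) ∧
    (∀ (μ : F) (w : L), w ∈ (ad F L p).maxGenEigenspace μ → ⁅s, w⁆ = μ • w) := by
  obtain ⟨n, hn, s, hs, hnil, hss, hp⟩ := Module.End.exists_isNilpotent_isSemisimple (K := F) (f := ad F L p)
  have cps : Commute (ad F L p) s := by
    obtain ⟨q, rfl⟩ := (Algebra.adjoin_singleton_eq_range_aeval F (ad F L p)) ▸ hs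
    exact (Polynomial.commute_X q).map (Polynomial.aeval (ad F L p)) |> fun h => by simpa using h
  have cns : Commute n s := by
    have : n = ad F L p - s := by rw [hp]; simp
    rw [this]; exact cps.sub_left (Commute.refl s)
  have hgen : ∀ μ : F, ∀ w, w ∈ (ad F L p).maxGenEigenspace μ → s w = μ • w := by
    intro μ w hw
    have h1 : w ∈ s.maxGenEigenspace μ := by
      rw [Module.End.mem_maxGenEigenspace] at hw ⊢
      obtain ⟨a, ha⟩ := hw
      obtain ⟨b, hb⟩ := hnil
      have hc : Commute (ad F L p - μ • 1) (-n) := by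
        apply Commute.neg_right
        apply Commute.sub_left _ ((Commute.one_left n).smul_left μ)
        rw [hp]; exact (Commute.refl n).add_left cns.symm
      have e1 : s - μ • 1 = (ad F L p - μ • 1) + (-n) := by rw [hp]; abel
      refine ⟨a + b, ?_⟩
      rw [e1, hc.add_pow, LinearMap.sum_apply]
      refine Finset.sum_eq_zero fun i hi => ?_
      by_cases hia : a ≤ i
      · rw [(hc.pow_pow i _).eq, mul_assoc, Module.End.mul_apply]
        have : ((ad F L p - μ • 1) ^ i * (((a + b).choose i : ℕ) : Module.End F L)) w = 0 := by
          rw [← (Nat.cast_commute _ _).eq, Module.End.mul_apply,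
            ← Nat.sub_add_cancel hia, pow_add, Module.End.mul_apply, ha]; simp
        rw [this, map_zero]
      · have : (-n) ^ (a + b - i) = 0 := by
          rw [neg_pow, ← Nat.sub_add_cancel (show b ≤ a + b - i by omega), pow_add n, hb]; simp
        rw [this]; simp
    rw [hss.isFinitelySemisimple.maxGenEigenspace_eq_eigenspace, Module.End.mem_eigenspace_iff] at h1
    exact h1
  have htop : ⨆ μ : F, (ad F L p).maxGenEigenspace μ = ⊤ := Module.End.iSup_maxGenEigenspace_eq_top _
  have hder : ∀ a b : L, s ⁅a, b⁆ = ⁅a, s b⁆ - ⁅b, s a⁆ := by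
    intro a b
    have ha : a ∈ ⨆ μ : F, (ad F L p).maxGenEigenspace μ := by rw [htop]; trivial
    have hb : b ∈ ⨆ μ : F, (ad F L p).maxGenEigenspace μ := by rw [htop]; trivial
    induction ha using Submodule.iSup_induction' with
    | mem μ a ha =>
      induction hb using Submodule.iSup_induction' with
      | mem ν b hb =>
        rw [hgen _ _ ha, hgen _ _ hb, hgen (μ + ν) _ (LieModule.lie_mem_maxGenEigenspace_toEnd ha hb)]
        rw [lie_smul, lie_smul, ← lie_skew a b, smul_neg, smul_neg, add_smul]
        abel
      | zero => simp
      | add b c _ _ h1 h2 => simp only [lie_add, map_add, add_lie, h1, h2]; abel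
    | zero => simp
    | add b c _ _ h1 h2 => simp only [lie_add, map_add, add_lie, h1, h2]; abel
  obtain ⟨s', hs'⟩ := LieDerivation.IsKilling.exists_eq_ad (R := F) (L := L) ⟨s, hder⟩
  have hs'' : ∀ w : L, ⁅s', w⁆ = s w := by
    intro w
    have := congrArg (fun D : LieDerivation F L L => D w) hs'
    simpa using this
  have hads : ad F L s' = s := by ext w; simp [hs'']
  have h0 : ∀ (μ : F) (w : L), ⁅p, w⁆ = μ • w → ⁅s', w⁆ = μ • w := by
    intro μ w hw
    rw [hs'']
    apply hgen
    rw [Module.End.mem_maxGenEigenspace]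
    exact ⟨1, by simp [hw]⟩
  have h00 : ∀ w : L, ⁅p, w⁆ = 0 → ⁅s', w⁆ = 0 := fun w hw => by
    have := h0 0 w (by simpa using hw)
    simpa using this
  have hsp : ⁅s', p⁆ = 0 := h00 p (lie_self p)
  have hade : ad F L (p - s') = n := by rw [map_sub, hads, hp]; abel
  refine ⟨s', p - s', by abel, by rw [IsSS, hads]; exact hss, by rw [IsNil, hade]; exact hnil,
    by simp [hsp], h00, h0, ?_, ?_, fun μ w hw => by rw [hs'']; exact hgen μ w hw⟩
  swap
  · obtain ⟨q, hq⟩ := (Algebra.adjoin_singleton_eq_range_aeval F (ad F L p)) ▸ hs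
    exact ⟨q, by rw [hads, ← hq]; rfl⟩
  intro w
  constructor
  · intro hw
    obtain ⟨b, hb⟩ := hnil
    refine ⟨b, ?_⟩
    have hsw : s w = 0 := by rw [← hs'', hw]
    have : ∀ j, (ad F L p ^ j) w = (n ^ j) w := by
      intro j
      induction j with
      | zero => rfl
      | succ j ih =>
        rw [pow_succ', Module.End.mul_apply, ih, pow_succ' n, Module.End.mul_apply, hp, LinearMap.add_apply]
        have : s ((n ^ j) w) = (n ^ j) (s w) := by
          rw [← Module.End.mul_apply, ← Module.End.mul_apply, ((cns.pow_left j).eq)]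
        rw [this, hsw, map_zero, add_zero]
    rw [this, hb]; rfl
  · rintro ⟨j, hj⟩
    rw [hs'', hgen 0 w, zero_smul]
    rw [Module.End.mem_maxGenEigenspace]
    exact ⟨j, by simpa using hj⟩
end
end CVA
end

section
set_option linter.all false
namespace CVA
open LieAlgebra Module

section
variable {F L : Type*} [Field F] [LieRing L] [LieAlgebra F L]

variable (F) in
/-- reductive subalgebra: closed under bracket and Killing form nondegenerate on it -/
structure IsRed (l : Submodule F L) : Prop where
  lie : ∀ a ∈ l, ∀ b ∈ l, ⁅a, b⁆ ∈ l
  nd : ∀ w ∈ l, (∀ v ∈ l, killingForm F L w v = 0) → w = 0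

def der (l : Submodule F L) : Submodule F L := Submodule.span F {c | ∃ a ∈ l, ∃ b ∈ l, c = ⁅a, b⁆}

def zen (l : Submodule F L) : Submodule F L where
  carrier := {w | w ∈ l ∧ ∀ a ∈ l, ⁅a, w⁆ = 0}
  zero_mem' := ⟨l.zero_mem, by simp⟩
  add_mem' := fun {a b} ha hb => ⟨l.add_mem ha.1 hb.1, fun c hc => by rw [lie_add, ha.2 c hc, hb.2 c hc, add_zero]⟩
  smul_mem' := fun c a ha => ⟨l.smul_mem c ha.1, fun b hb => by rw [lie_smul, ha.2 b hb, smul_zero]⟩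

lemma mem_zen {l : Submodule F L} {w : L} : w ∈ zen l ↔ w ∈ l ∧ ∀ a ∈ l, ⁅a, w⁆ = 0 := Iff.rfl

lemma lie_mem_der {l : Submodule F L} {a b : L} (ha : a ∈ l) (hb : b ∈ l) : ⁅a, b⁆ ∈ der l :=
  Submodule.subset_span ⟨a, ha, b, hb, rfl⟩

lemma IsRed.der_le {l : Submodule F L} (hl : IsRed F l) : der l ≤ l := by
  rw [der, Submodule.span_le]
  rintro _ ⟨a, ha, b, hb, rfl⟩
  exact hl.lie a ha b hb

lemma zen_le {l : Submodule F L} : zen l ≤ l := fun _ h => h.1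

variable [FiniteDimensional F L]

lemma trace_lie {Q : Module.End F L} {a b : L} (h : Commute Q (ad F L a)) :
    LinearMap.trace F L (Q * ad F L ⁅a, b⁆) = 0 := by
  have hb : ad F L ⁅a, b⁆ = ad F L a * ad F L b - ad F L b * ad F L a := by
    ext v; simp [lie_lie]
  rw [hb, mul_sub, map_sub, ← mul_assoc, h.eq, mul_assoc,
    LinearMap.trace_mul_comm, mul_assoc, sub_self]

lemma IsRed.perp {l : Submodule F L} (hl : IsRed F l) {U : Submodule F L} (hU : U ≤ l) {w : L} (hw : w ∈ l)
    (h : ∀ v ∈ l, (∀ u ∈ U, killingForm F L u v = 0) → killingForm F L w v = 0) : w ∈ U := by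
  by_contra hwU
  obtain ⟨f, hf1, hf2⟩ := Submodule.exists_le_ker_of_notMem hwU
  let φ : l →ₗ[F] Module.Dual F l := ((killingForm F L).domRestrict l).compr₂ (LinearMap.id) |>.flip.domRestrict l |>.flip
  have hφ : ∀ a b : l, φ a b = killingForm F L a b := fun a b => rfl
  have hinj : Function.Injective φ := by
    rw [← LinearMap.ker_eq_bot, LinearMap.ker_eq_bot']
    intro a ha
    apply Subtype.ext
    apply hl.nd a a.2
    intro v hv
    have := LinearMap.congr_fun ha ⟨v, hv⟩
    rwa [hφ] at this
  have hsurj : Function.Surjective φ :=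
    (LinearMap.injective_iff_surjective_of_finrank_eq_finrank (Subspace.dual_finrank_eq).symm).mp hinj
  obtain ⟨v, hv⟩ := hsurj (f.domRestrict l)
  have hv' : ∀ u ∈ l, killingForm F L v u = f u := fun u hu => by
    have := LinearMap.congr_fun hv ⟨u, hu⟩
    rwa [hφ] at this
  apply hf1
  rw [← hv' w hw, kf_comm]
  apply h v v.2
  intro u hu
  rw [kf_comm, hv' u (hU hu)]
  exact hf2 hu

lemma IsRed.perp_der_iff {l : Submodule F L} (hl : IsRed F l) {w : L} (hw : w ∈ l) :
    (∀ d ∈ der l, killingForm F L d w = 0) ↔ w ∈ zen l := by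
  constructor
  · intro h
    refine ⟨hw, fun a ha => ?_⟩
    apply hl.nd _ (hl.lie a ha w hw)
    intro v hv
    rw [kf_comm, ← kf_inv]
    exact h _ (lie_mem_der hv ha)
  · intro h d hd
    induction hd using Submodule.span_induction with
    | mem x hx => obtain ⟨a, ha, b, hb, rfl⟩ := hx; rw [kf_inv, h.2 b hb, map_zero]
    | zero => simp
    | add x y _ _ hx hy => rw [map_add, LinearMap.add_apply, hx, hy, add_zero]
    | smul c x _ hx => rw [map_smul, LinearMap.smul_apply, hx, smul_zero]

lemma IsRed.der_perp {l : Submodule F L} (hl : IsRed F l) {w : L} (hw : w ∈ l)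
    (h : ∀ z ∈ zen l, killingForm F L w z = 0) : w ∈ der l :=
  hl.perp hl.der_le hw fun v hv hvd => h v ((hl.perp_der_iff hv).mp hvd)

lemma IsRed.nil_mem_der {l : Submodule F L} (hl : IsRed F l) {e : L} (he : IsNil F e) (hel : e ∈ l) : e ∈ der l :=
  hl.der_perp hel fun z hz => kf_eq_zero_of_nil he (hz.2 e hel)

variable [CharZero F]

lemma IsRed.zen_disj {l : Submodule F L} (hl : IsRed F l) {w : L} (h1 : w ∈ zen l) (h2 : w ∈ der l) : w = 0 := by
  have hnil : IsNil F w := by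
    apply isNilpotent_of_trace
    intro q
    have : ∀ d ∈ der l, LinearMap.trace F L (Polynomial.aeval (ad F L w) q * ad F L d) = 0 := by
      intro d hd
      induction hd using Submodule.span_induction with
      | mem x hx => 
        obtain ⟨a, ha, b, hb, rfl⟩ := hx
        exact trace_lie (commute_aeval (ad_commute (comm_symm (h1.2 a ha))) q)
      | zero => simp
      | add x y _ _ hx hy => rw [map_add, mul_add, map_add, hx, hy, add_zero]
      | smul c x _ hx => rw [map_smul, mul_smul_comm, map_smul, hx, smul_zero]
    exact this w h2
  exact hl.nd w h1.1 fun v hv => kf_eq_zero_of_nil hnil (comm_symm (h1.2 v hv))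

lemma IsRed.sup_eq {l : Submodule F L} (hl : IsRed F l) : zen l ⊔ der l = l := by
  apply le_antisymm (sup_le zen_le hl.der_le)
  intro w hw
  refine hl.perp (sup_le zen_le hl.der_le) hw fun v hv h => ?_
  have h1 : v ∈ zen l := (hl.perp_der_iff hv).mp fun d hd => h d (Submodule.mem_sup_right hd)
  have h2 : v ∈ der l := hl.der_perp hv fun z hz => by rw [kf_comm]; exact h z (Submodule.mem_sup_left hz)
  rw [hl.zen_disj h1 h2, map_zero]

lemma IsRed.inf_eq {l : Submodule F L} (hl : IsRed F l) : zen l ⊓ der l = ⊥ := by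
  rw [eq_bot_iff]
  rintro w ⟨h1, h2⟩
  exact hl.zen_disj h1 h2

lemma IsRed.exists_add {l : Submodule F L} (hl : IsRed F l) {w : L} (hw : w ∈ l) :
    ∃ z ∈ zen l, ∃ d ∈ der l, z + d = w := by
  rw [← hl.sup_eq] at hw
  exact Submodule.mem_sup.mp hw

lemma IsRed.finrank_add {l : Submodule F L} (hl : IsRed F l) :
    finrank F (zen l) + finrank F (der l) = finrank F l := by
  have := Submodule.finrank_sup_add_finrank_inf_eq (zen l) (der l)
  rw [hl.sup_eq, hl.inf_eq, finrank_bot] at this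
  omega

lemma isRed_top [IsKilling F L] : IsRed F (⊤ : Submodule F L) :=
  ⟨fun _ _ _ _ => trivial, fun w _ h => kf_nondeg (F := F) fun v => h v trivial⟩

variable [IsAlgClosed F]

lemma IsRed.inf_cent {l : Submodule F L} (hl : IsRed F l) {s : L} (hs : IsSS F s) (hsl : ∀ w ∈ l, ⁅s, w⁆ ∈ l) :
    IsRed F (l ⊓ cent F s) := by
  constructor
  · rintro a ⟨ha, ha'⟩ b ⟨hb, hb'⟩
    refine ⟨hl.lie a ha b hb, ?_⟩
    exact mem_cent.mpr (lie_comm_of (mem_cent.mp ha') (mem_cent.mp hb'))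
  · rintro w ⟨hw, hw'⟩ h
    apply hl.nd w hw
    intro v hv
    obtain ⟨u, hu, v', hv', rfl, hsu⟩ := hs.decomp l hsl hv
    rw [map_add, h u ⟨hu, mem_cent.mpr hsu⟩, zero_add, ← kf_inv, comm_symm (mem_cent.mp hw')]
    simp

lemma isRed_cent [IsKilling F L] {s : L} (hs : IsSS F s) : IsRed F (cent F s) := by
  have := (isRed_top (F := F) (L := L)).inf_cent hs (fun _ _ => trivial)
  rwa [top_inf_eq] at this

lemma self_mem_cent (s : L) : s ∈ cent F s := mem_cent.mpr (lie_self s)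

lemma self_mem_zen (s : L) : s ∈ zen (cent F s) :=
  ⟨self_mem_cent s, fun a ha => comm_symm (mem_cent.mp ha)⟩

end
end CVA
end

section
set_option linter.all false
namespace CVA
open LieAlgebra Module

section
variable {F L : Type*} [Field F] [LieRing L] [LieAlgebra F L]

/-- eigenvectors of `h2=[e,f]` on `ker e` -/
lemma sl2_eig_aux [CharZero F] {e f h2 : L} (hh : h2 = ⁅e, f⁆) (he : ⁅h2, e⁆ = (2 : F) • e) (j : ℕ) :
    ∀ u : L, (ad F L e ^ (j + 1)) ⁅f, u⁆ - ⁅f, (ad F L e ^ (j + 1)) u⁆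
      = ((j : F) + 1) • (⁅h2, (ad F L e ^ j) u⁆ - (j : F) • (ad F L e ^ j) u) := by
  have hE : ∀ (m : ℕ) (u : L), ⁅h2, (ad F L e ^ m) u⁆ = (ad F L e ^ m) ⁅h2, u⁆ + (2 * m : F) • (ad F L e ^ m) u := by
    intro m
    induction m with
    | zero => intro u; simp
    | succ m ih =>
      intro u
      rw [pow_succ', Module.End.mul_apply, ad_apply, leibniz_lie, he, ih, lie_add, smul_lie, Module.End.mul_apply, ad_apply,
        lie_smul, add_comm, add_assoc, ← add_smul]
      push_cast; ring_nf
  induction j with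
  | zero =>
    intro u
    simp only [zero_add, pow_one, ad_apply, Nat.cast_zero, pow_zero, Module.End.one_apply, zero_smul, sub_zero, one_smul]
    rw [hh, lie_lie]
  | succ j ih =>
    intro u
    have h1 := ih ⁅e, u⁆
    have h2' : (ad F L e ^ (j + 1)) ⁅e, u⁆ = (ad F L e ^ (j + 1 + 1)) u := by
      rw [pow_succ _ (j+1), Module.End.mul_apply, ad_apply]
    have h3 : (ad F L e ^ j) ⁅e, u⁆ = (ad F L e ^ (j + 1)) u := by
      rw [pow_succ _ j, Module.End.mul_apply, ad_apply]
    have h4 : (ad F L e ^ (j + 1 + 1)) ⁅f, u⁆ = (ad F L e ^ (j + 1)) ⁅h2, u⁆ + (ad F L e ^ (j + 1)) ⁅f, ⁅e, u⁆⁆ := by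
      rw [pow_succ _ (j+1), Module.End.mul_apply, ad_apply, leibniz_lie, ← hh, map_add]
    rw [h2', h3] at h1
    have h5 := hE (j + 1) u
    rw [h4, add_sub_assoc, h1, eq_sub_of_add_eq h5.symm]
    push_cast
    module

lemma sl2_eig [CharZero F] {e f h2 w : L} (hh : h2 = ⁅e, f⁆) (he : ⁅h2, e⁆ = (2 : F) • e) (hn : IsNil F e)
    (hw : w ≠ 0) (hew : ⁅e, w⁆ = 0) {c : F} (hc : ⁅h2, w⁆ = c • w) :
    ∃ j : ℕ, c = j ∧ ((∃ w2, w = ⁅e, w2⁆) → 1 ≤ j) := by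
  classical
  obtain ⟨n, hn⟩ := hn
  have hex : ∃ j, ¬ ∃ u, w = (ad F L e ^ j) u := ⟨n, by
    rintro ⟨u, hu⟩; rw [hn] at hu; exact hw hu⟩
  have hspec := Nat.find_spec hex
  have hmin := fun m hm => Nat.find_min hex (m := m) hm
  rcases hj : Nat.find hex with _ | j
  · rw [hj] at hspec
    exact absurd ⟨w, by simp⟩ hspec
  · rw [hj] at hspec hmin
    obtain ⟨u, hu⟩ := not_not.mp (hmin j (Nat.lt_succ_self j))
    have h1 := sl2_eig_aux hh he j u
    rw [← hu, hc, pow_succ' _ j, Module.End.mul_apply, Module.End.mul_apply, ← hu, ad_apply F L e w, hew, lie_zero, sub_zero, ← sub_smul] at h1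
    refine ⟨j, ?_, ?_⟩
    · by_contra hcj
      apply hspec
      refine ⟨(((j : F) + 1) * (c - j))⁻¹ • ⁅f, u⁆, ?_⟩
      have hne : ((j : F) + 1) * (c - j) ≠ 0 := mul_ne_zero (by exact_mod_cast Nat.succ_ne_zero j) (sub_ne_zero.mpr hcj)
      rw [map_smul, pow_succ' _ j, Module.End.mul_apply, h1, smul_smul, smul_smul, mul_assoc, inv_mul_cancel₀ hne, one_smul]
    · rintro ⟨w2, hw2⟩
      by_contra h0
      have : j = 0 := by omega
      subst this
      exact hspec ⟨w2, by simpa using hw2⟩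

variable [FiniteDimensional F L] [CharZero F] [IsAlgClosed F] [IsKilling F L]

/-- closed under Jordan components -/
def IsJ (l : Submodule F L) : Prop := ∀ p ∈ l, ∀ s : L, (∀ w : L, ⁅p, w⁆ = 0 → ⁅s, w⁆ = 0) → s ∈ l

lemma isJ_cent (s : L) : IsJ (cent F s) := fun p hp s' h => by
  rw [mem_cent] at hp ⊢
  exact comm_symm (h s (comm_symm hp))

lemma IsJ.inf {l m : Submodule F L} (h1 : IsJ l) (h2 : IsJ m) : IsJ (l ⊓ m) := fun p hp s h =>
  ⟨h1 p hp.1 s h, h2 p hp.2 s h⟩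

/-- existence of an eigenvector of `p` within eigenspace of its semisimple part -/
lemma exists_eig {p s : L} (W : Submodule F L) (hW : ∀ w ∈ W, ⁅p, w⁆ ∈ W) (hps : ⁅p, s⁆ = 0)
    (hμ : ∀ μ : F, ∀ w : L, ⁅p, w⁆ = μ • w → ⁅s, w⁆ = μ • w) {w : L} {c : F} (hw : w ∈ W) (hw0 : w ≠ 0)
    (hc : ⁅s, w⁆ = c • w) : ∃ w' ∈ W, w' ≠ 0 ∧ ⁅p, w'⁆ = c • w' := by
  let V : Submodule F L := W ⊓ (ad F L s).eigenspace c
  have hV : ∀ v ∈ V, ad F L p v ∈ V := by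
    rintro v ⟨hv, hv'⟩
    refine ⟨hW v hv, ?_⟩
    have hv'' := Module.End.mem_eigenspace_iff.mp hv'
    apply Module.End.mem_eigenspace_iff.mpr
    rw [ad_apply] at hv'' ⊢
    rw [ad_apply, leibniz_lie, comm_symm hps, hv'', zero_lie, zero_add, lie_smul]
  have hne : Nontrivial V := ⟨⟨⟨w, hw, Module.End.mem_eigenspace_iff.mpr hc⟩, 0, fun h => hw0 (congrArg Subtype.val h)⟩⟩
  obtain ⟨μ, hμ'⟩ := Module.End.exists_eigenvalue ((ad F L p).restrict hV)
  obtain ⟨v, hv⟩ := hμ'.exists_hasEigenvector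
  have h1 : ⁅p, (v : L)⁆ = μ • (v : L) := congrArg Subtype.val hv.apply_eq_smul
  have hv0 : (v : L) ≠ 0 := fun h => hv.2 (Subtype.ext h)
  have h2 := hμ μ _ h1
  have h3 : ⁅s, (v : L)⁆ = c • (v : L) := Module.End.mem_eigenspace_iff.mp v.2.2
  have : μ = c := by
    rw [h2] at h3
    exact smul_left_injective F hv0 h3
  exact ⟨v, v.2.1, hv0, by rw [h1, this]⟩

theorem jacobson_morozov {l : Submodule F L} (hl : IsRed F l) (hJ : IsJ l) {e : L} (hel : e ∈ l) (he : IsNil F e) :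
    ∃ h ∈ der l, IsSS F h ∧ ⁅h, e⁆ = (2 : F) • e ∧
      (∀ w : L, w ≠ 0 → ⁅e, w⁆ = 0 → ∀ c : F, ⁅h, w⁆ = c • w → ∃ j : ℕ, c = j ∧ ((∃ w2, w = ⁅e, w2⁆) → 1 ≤ j)) ∧
      (∀ w : L, w ≠ 0 → ∀ c : F, ⁅h, w⁆ = c • w → ∃ j : ℤ, c = j) := by
  -- step 1
  have hmap : ∀ v ∈ l, (∀ u ∈ l.map (ad F L e), killingForm F L u v = 0) → ⁅e, v⁆ = 0 := by
    intro v hv h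
    apply hl.nd _ (hl.lie e hel v hv)
    intro u hu
    have := h ⁅e, u⁆ ⟨u, hu, rfl⟩
    rw [kf_inv', neg_eq_zero, kf_comm] at this
    exact this
  have hle : l.map (ad F L e) ≤ l := by
    rintro _ ⟨u, hu, rfl⟩; exact hl.lie e hel u hu
  have h1 : e ∈ l.map (ad F L e) := hl.perp hle hel fun v hv h => kf_eq_zero_of_nil he (hmap v hv h)
  obtain ⟨u, hu, hue⟩ := h1
  rw [ad_apply] at hue
  have hp2 : ⁅-(2 : F) • u, e⁆ = (2 : F) • e := by
    rw [smul_lie, ← lie_skew, hue]; module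
  obtain ⟨h1, n1, hp, hss1, -, -, hz1, hμ1, -, -, -⟩ := jordan (F := F) (-(2 : F) • u)
  have hh1l : h1 ∈ l := hJ _ (l.smul_mem _ hu) h1 hz1
  have hh1e : ⁅h1, e⁆ = (2 : F) • e := hμ1 2 e hp2
  -- step 2
  have hmem : h1 ∈ (l ⊓ cent F e) ⊔ l.map (ad F L e) := by
    refine hl.perp (sup_le inf_le_left hle) hh1l fun v hv h => ?_
    have hv1 : ⁅e, v⁆ = 0 := hmap v hv fun u hu => h u (Submodule.mem_sup_right hu)
    have hv2 : v ∈ l.map (ad F L e) := hl.perp hle hv fun x hx hx' => by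
      rw [kf_comm]
      exact h x (Submodule.mem_sup_left ⟨hx, mem_cent.mpr (hmap x hx hx')⟩)
    let W : Submodule F L := (l ⊓ cent F e) ⊓ l.map (ad F L e)
    have hW : ∀ w ∈ W, ⁅h1, w⁆ ∈ W := by
      rintro w ⟨⟨hw1, hw2⟩, ⟨w', hw', hw''⟩⟩
      have hw2 := mem_cent.mp hw2
      rw [ad_apply] at hw''
      refine ⟨⟨hl.lie _ hh1l _ hw1, mem_cent.mpr ?_⟩, ?_⟩
      · rw [leibniz_lie, hw2, lie_zero, add_zero, ← lie_skew e h1, hh1e, neg_lie, smul_lie, hw2, smul_zero, neg_zero]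
      · refine ⟨(2 : F) • w' + ⁅h1, w'⁆, l.add_mem (l.smul_mem _ hw') (hl.lie _ hh1l _ hw'), ?_⟩
        rw [← hw'', leibniz_lie, hh1e, ad_apply, lie_add, smul_lie, lie_smul]
    obtain ⟨u, ⟨⟨hu1, hu2⟩, ⟨u', -, hu'⟩⟩, v', -, rfl, hu3⟩ := hss1.decomp W hW ⟨⟨hv, mem_cent.mpr hv1⟩, hv2⟩
    have hnu : IsNil F u := nil_crit (e := e) (w2 := u') hu'.symm (mem_cent.mp hu2)
    rw [map_add, kf_comm h1 u, kf_eq_zero_of_nil hnu (comm_symm hu3), ← kf_inv, lie_self]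
    simp
  obtain ⟨c, ⟨hcl, hce⟩, h2, ⟨f, hf, hef⟩, hsum⟩ := Submodule.mem_sup.mp hmem
  have hce := mem_cent.mp hce
  rw [ad_apply] at hef
  have hh2 : h2 = ⁅e, f⁆ := hef.symm
  have hh2l : h2 ∈ l := by rw [hh2]; exact hl.lie _ hel _ hf
  have hh2e : ⁅h2, e⁆ = (2 : F) • e := by
    rw [← hh1e, ← hsum, add_lie, comm_symm hce, zero_add]
  obtain ⟨h, n, hp', hss, hn, hhn, hz, hμ, -, -, -⟩ := jordan (F := F) h2
  have hhl : h ∈ l := hJ _ hh2l h hz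
  have hnl : n ∈ l := by
    have : n = h2 - h := by rw [hp']; abel
    rw [this]; exact l.sub_mem hh2l hhl
  have hhD : h ∈ der l := by
    have : h = h2 - n := by rw [hp']; abel
    rw [this]
    exact (der l).sub_mem (by rw [hh2]; exact lie_mem_der hel hf) (hl.nil_mem_der hn hnl)
  have hhe := hμ 2 e hh2e
  have hph : ⁅h2, h⁆ = 0 := by rw [hp', add_lie, lie_self, comm_symm hhn, add_zero]
  have hE1 : (∀ w : L, w ≠ 0 → ⁅e, w⁆ = 0 → ∀ c : F, ⁅h, w⁆ = c • w → ∃ j : ℕ, c = j ∧ ((∃ w2, w = ⁅e, w2⁆) → 1 ≤ j)) := by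
    intro w hw hew c hc
    have hst : ∀ w ∈ cent F e, ⁅h2, w⁆ ∈ cent F e := by
      intro w hw2
      rw [mem_cent] at hw2 ⊢
      rw [leibniz_lie, hw2, lie_zero, add_zero, ← lie_skew e h2, hh2e, neg_lie, smul_lie, hw2, smul_zero, neg_zero]
    by_cases hex : ∃ w2, w = ⁅e, w2⁆
    · obtain ⟨w2, hw2⟩ := hex
      obtain ⟨w', hw', hw'0, hw'c⟩ := exists_eig (cent F e ⊓ LinearMap.range (ad F L e)) (by
        rintro v ⟨hv1, ⟨v', hv'⟩⟩
        refine ⟨hst v hv1, ⟨(2 : F) • v' + ⁅h2, v'⁆, ?_⟩⟩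
        rw [ad_apply] at hv'
        rw [← hv', leibniz_lie, hh2e, ad_apply, lie_add, smul_lie, lie_smul]) hph hμ (w := w) ⟨mem_cent.mpr hew, ⟨w2, hw2.symm⟩⟩ hw hc
      obtain ⟨j, hj1, hj2⟩ := sl2_eig hh2 hh2e he hw'0 (mem_cent.mp hw'.1) hw'c
      obtain ⟨w3, hw3⟩ := hw'.2
      exact ⟨j, hj1, fun _ => hj2 ⟨w3, hw3.symm⟩⟩
    · obtain ⟨w', hw', hw'0, hw'c⟩ := exists_eig (cent F e) hst hph hμ (mem_cent.mpr hew) hw hc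
      obtain ⟨j, hj1, hj2⟩ := sl2_eig hh2 hh2e he hw'0 (mem_cent.mp hw') hw'c
      exact ⟨j, hj1, fun h => absurd h hex⟩
  refine ⟨h, hhD, hss, hhe, hE1, ?_⟩
  intro w hw c hc
  classical
  obtain ⟨N, hN⟩ := he
  have hex : ∃ m, (ad F L e ^ m) w = 0 := ⟨N, by rw [hN]; rfl⟩
  have hspec := Nat.find_spec hex
  have hmin := fun m hm => Nat.find_min hex (m := m) hm
  have hEm : ∀ m : ℕ, ⁅h, (ad F L e ^ m) w⁆ = (c + 2 * m) • (ad F L e ^ m) w := by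
    intro m
    induction m with
    | zero => simpa using hc
    | succ m ih =>
      rw [pow_succ', Module.End.mul_apply, ad_apply, leibniz_lie, hhe, ih, smul_lie, lie_smul, ← add_smul]
      push_cast; ring_nf
  rcases hm : Nat.find hex with _ | m
  · rw [hm] at hspec
    exact absurd (by simpa using hspec) hw
  · rw [hm] at hspec hmin
    obtain ⟨j, hj, -⟩ := hE1 _ (hmin m (Nat.lt_succ_self m)) (by
      rw [pow_succ', Module.End.mul_apply] at hspec; exact hspec) _ (hEm m)
    exact ⟨j - 2 * m, by push_cast; rw [← hj]; ring⟩

end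
end CVA
end

section
set_option linter.all false
namespace CVA
open Module

/-- rational root data -/
structure RD {ι E : Type*} [AddCommGroup E] [Module ℚ E] (B : LinearMap.BilinForm ℚ E) (φ : ι → E)
    (p : ι → ι → ℤ) : Prop where
  pos : ∀ x, x ≠ 0 → 0 < B x x
  symm : ∀ x y, B x y = B y x
  inj : Function.Injective φ
  ne0 : ∀ i, φ i ≠ 0
  pair : ∀ i j, 2 * B (φ i) (φ j) = p i j * B (φ j) (φ j)
  neg : ∀ i, ∃ j, φ j = - φ i
  sub : ∀ i j, i ≠ j → 0 < p i j → ∃ m, φ m = φ i - φ j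
  red : ∀ i j, φ i ≠ (2 : ℚ) • φ j

namespace RD
variable {ι E : Type*} [Fintype ι] [DecidableEq ι] [AddCommGroup E] [Module ℚ E] [FiniteDimensional ℚ E]
  {B : LinearMap.BilinForm ℚ E} {φ : ι → E} {p : ι → ι → ℤ}

lemma bpos (h : RD B φ p) (i : ι) : 0 < B (φ i) (φ i) := h.pos _ (h.ne0 i)

lemma p_pos_iff (h : RD B φ p) (i j : ι) : 0 < p i j ↔ 0 < B (φ i) (φ j) := by
  have h1 := h.pair i j
  have h2 := h.bpos j
  constructor
  · intro hp
    have : (0 : ℚ) < p i j := by exact_mod_cast hp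
    nlinarith [mul_pos this h2]
  · intro hp
    have : (0 : ℚ) < p i j := by
      by_contra hc
      nlinarith [mul_nonneg (neg_nonneg.mpr (not_lt.mp hc)) h2.le]
    exact_mod_cast this

lemma p_eq (h : RD B φ p) (i j : ι) : (p i j : ℚ) = 2 * B (φ i) (φ j) / B (φ j) (φ j) := by
  rw [h.pair, mul_div_cancel_right₀ _ (h.bpos j).ne']

lemma obtuse (h : RD B φ p) (s : Finset ι) (f : E →ₗ[ℚ] ℚ) (hf : ∀ i ∈ s, 0 < f (φ i))
    (hs : ∀ i ∈ s, ∀ j ∈ s, i ≠ j → p i j ≤ 0) : s.card ≤ finrank ℚ E := by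
  have : LinearIndependent ℚ (fun i : s => φ i) := by
    refine LinearMap.BilinForm.linearIndependent_of_pairwise_le_zero B ?_ f _ (fun i => hf i i.2) ?_
    · intro x hx
      exact h.pos x hx
    · rintro ⟨i, hi⟩ ⟨j, hj⟩ hij
      have hij' : i ≠ j := fun e => hij (by subst e; rfl)
      have := mt (h.p_pos_iff i j).mpr (by have := hs i hi j hj hij'; omega)
      exact not_lt.mp this
  simpa using this.fintype_card_le_finrank

theorem dist (h : RD B φ p) {d l : ℕ} (hd : finrank ℚ E ≤ d) (hdl : d = 2 ∧ l ≤ 2 ∨ d = 3 ∧ l ≤ 1)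
    (hl : ∀ i j, φ i ≠ φ j → φ i ≠ - φ j → |p i j| ≤ l) (v : E →ₗ[ℚ] ℚ)
    (hA : (Finset.univ.filter fun i => v (φ i) = 2).card = d + (Finset.univ.filter fun i => v (φ i) = 0).card)
    (hB : Even (Finset.univ.filter fun i => v (φ i) = 1).card) :
    (Finset.univ.filter fun i => v (φ i) = 0) = ∅ ∧ (Finset.univ.filter fun i => v (φ i) = 1) = ∅ := by
  classical
  set A := Finset.univ.filter fun i => v (φ i) = 2 with hAd
  set Z := Finset.univ.filter fun i => v (φ i) = 0 with hZd
  set N := Finset.univ.filter fun i => v (φ i) = 1 with hNd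
  have mA : ∀ i, i ∈ A ↔ v (φ i) = 2 := fun i => by simp [hAd]
  have mZ : ∀ i, i ∈ Z ↔ v (φ i) = 0 := fun i => by simp [hZd]
  have mN : ∀ i, i ∈ N ↔ v (φ i) = 1 := fun i => by simp [hNd]
  by_cases hZ : Z = ∅
  · refine ⟨hZ, ?_⟩
    have hZ' : ∀ i, v (φ i) ≠ 0 := fun i hi => by
      have := (mZ i).mpr hi; rw [hZ] at this; simp at this
    have oA : ∀ c : ℚ, ∀ i j, v (φ i) = c → v (φ j) = c → i ≠ j → p i j ≤ 0 := by
      intro c i j hi hj hij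
      by_contra hc
      obtain ⟨m, hm⟩ := h.sub i j hij (not_le.mp hc)
      apply hZ' m
      rw [hm, map_sub, hi, hj, sub_self]
    have cN : N.card ≤ d := by
      refine le_trans (h.obtuse N v (fun i hi => ?_) fun i hi j hj => oA 1 i j ((mN i).mp hi) ((mN j).mp hj)) hd
      rw [(mN i).mp hi]; norm_num
    have hcA : A.card = d := by rw [hA, hZ]; simp
    by_contra hN
    have hN2 : N.card = 2 := by
      have : N.card ≠ 0 := by rwa [Ne, Finset.card_eq_zero]
      obtain ⟨q, hq⟩ := hB
      omega
    obtain ⟨b, b', hbb, hNe⟩ := Finset.card_eq_two.mp hN2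
    have hb : v (φ b) = 1 := (mN b).mp (by rw [hNe]; simp)
    have hb' : v (φ b') = 1 := (mN b').mp (by rw [hNe]; simp)
    set A' := A.filter fun i => φ i ≠ φ b + φ b' with hA'
    have cA' : d ≤ A'.card + 1 := by
      have h1 : (A.filter fun i => ¬ (φ i ≠ φ b + φ b')).card ≤ 1 := by
        rw [Finset.card_le_one]
        intro i hi j hj
        simp only [Finset.mem_filter, not_not] at hi hj
        exact h.inj (hi.2.trans hj.2.symm)
      have h2 : A ⊆ A' ∪ (A.filter fun i => ¬ (φ i ≠ φ b + φ b')) := by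
        intro i hi
        rw [Finset.mem_union]
        rcases em (φ i ≠ φ b + φ b') with h3 | h3
        · exact Or.inl (Finset.mem_filter.mpr ⟨hi, h3⟩)
        · exact Or.inr (Finset.mem_filter.mpr ⟨hi, h3⟩)
      have h3 := (Finset.card_le_card h2).trans (Finset.card_union_le _ _)
      omega
    have hdis : Disjoint A' N := by
      rw [Finset.disjoint_left]
      intro i hi hi'
      have h1 := (mA i).mp (Finset.mem_filter.mp hi).1
      have h2 := (mN i).mp hi'
      rw [h1] at h2; norm_num at h2
    have key : ∀ i ∈ A', ∀ j ∈ N, p i j ≤ 0 := by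
      intro i hi j hj
      by_contra hc
      have h1 := (mA i).mp (Finset.mem_filter.mp hi).1
      have hj1 := (mN j).mp hj
      obtain ⟨m, hm⟩ := h.sub i j (fun e => by subst e; rw [h1] at hj1; norm_num at hj1) (not_le.mp hc)
      have hmN : m ∈ N := (mN m).mpr (by rw [hm, map_sub, h1, hj1]; norm_num)
      have hsum : φ i = φ m + φ j := by rw [hm]; abel
      have hne : m ≠ j := by
        rintro rfl
        exact h.red i m (by rw [hsum]; module)
      rw [hNe, Finset.mem_insert, Finset.mem_singleton] at hmN hj
      have h3 := (Finset.mem_filter.mp hi).2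
      rcases hmN with rfl | rfl <;> rcases hj with rfl | rfl
      · exact hne rfl
      · exact h3 hsum
      · exact h3 (by rw [hsum, add_comm])
      · exact hne rfl
    have key' : ∀ i ∈ N, ∀ j ∈ A', p i j ≤ 0 := by
      intro i hi j hj
      have := key j hj i hi
      by_contra hc
      have h1 := (h.p_pos_iff i j).mp (not_le.mp hc)
      rw [h.symm] at h1
      have := (h.p_pos_iff j i).mpr h1
      omega
    have := h.obtuse (A' ∪ N) v (by
      intro i hi
      rcases Finset.mem_union.mp hi with hi | hi
      · rw [(mA i).mp (Finset.mem_filter.mp hi).1]; norm_num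
      · rw [(mN i).mp hi]; norm_num) (by
      intro i hi j hj hij
      rcases Finset.mem_union.mp hi with hi | hi <;> rcases Finset.mem_union.mp hj with hj | hj
      · exact oA 2 i j ((mA i).mp (Finset.mem_filter.mp hi).1) ((mA j).mp (Finset.mem_filter.mp hj).1) hij
      · exact key i hi j hj
      · exact key' i hi j hj
      · exact oA 1 i j ((mN i).mp hi) ((mN j).mp hj) hij)
    rw [Finset.card_union_of_disjoint hdis] at this
    omega
  · exfalso
    obtain ⟨a, ha⟩ := Finset.nonempty_iff_ne_empty.mpr hZ
    have ha0 := (mZ a).mp ha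
    obtain ⟨a', ha'⟩ := h.neg a
    have haa' : a ≠ a' := fun e => h.ne0 a (by
      rw [← e] at ha'
      have : (2 : ℚ) • φ a = 0 := by rw [two_smul]; nth_rewrite 1 [ha']; abel
      simpa using this)
    have ha'Z : a' ∈ Z := (mZ a').mpr (by rw [ha', map_neg, ha0, neg_zero])
    have hγa : ∀ i ∈ A, ∀ b ∈ Z, φ i ≠ φ b ∧ φ i ≠ - φ b := by
      intro i hi b hb
      have h1 := (mA i).mp hi
      have h2 := (mZ b).mp hb
      constructor
      · intro e; rw [e, h2] at h1; norm_num at h1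
      · intro e; rw [e, map_neg, h2] at h1; norm_num at h1
    by_cases hb : ∃ b ∈ Z, φ b ≠ φ a ∧ φ b ≠ - φ a
    · have hb : ∃ b ∈ Z, φ b ≠ φ a ∧ φ b ≠ - φ a ∧ p a b ≤ 0 := by
        obtain ⟨b, hbZ, hb1, hb2⟩ := hb
        obtain ⟨b', hb'⟩ := h.neg b
        by_cases hpab : p a b ≤ 0
        · exact ⟨b, hbZ, hb1, hb2, hpab⟩
        · refine ⟨b', (mZ b').mpr (by rw [hb', map_neg, (mZ b).mp hbZ, neg_zero]), ?_, ?_, ?_⟩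
          · rw [hb']; intro e; exact hb2 (by rw [← e, neg_neg])
          · rw [hb']; intro e; exact hb1 (neg_injective e)
          · by_contra hc
            have h1 := (h.p_pos_iff a b').mp (not_le.mp hc)
            have h2 := (h.p_pos_iff a b).mp (not_le.mp hpab)
            rw [hb', map_neg] at h1
            linarith
      obtain ⟨b, hbZ, hb1, hb2, hpab⟩ := hb
      have hb0 := (mZ b).mp hbZ
      obtain ⟨b', hb'⟩ := h.neg b
      have hb'Z : b' ∈ Z := (mZ b').mpr (by rw [hb', map_neg, hb0, neg_zero])
      have hcA0 : A.Nonempty := by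
        rw [← Finset.card_pos]; omega
      have hab1 : φ a ≠ φ b := fun e => hb1 e.symm
      have hab2 : φ a ≠ - φ b := fun e => hb2 (by rw [e, neg_neg])
      have lab := hl a b hab1 hab2
      have lba := hl b a hb1 hb2
      have hBa := h.bpos a
      have hBb := h.bpos b
      have pab := h.pair a b
      have pba := h.pair b a
      have hsym := h.symm (φ a) (φ b)
      -- linear independence of a, b
      have hab : ∀ x y : ℚ, x • φ a + y • φ b = 0 → x = 0 ∧ y = 0 := by
        intro x y hxy
        by_cases hy : y = 0
        · subst hy
          simp only [zero_smul, add_zero, smul_eq_zero] at hxy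
          exact ⟨hxy.resolve_right (h.ne0 a), rfl⟩
        · exfalso
          have hbc : φ b = (-x / y) • φ a := by
            have : y • φ b = (-x) • φ a := by rw [neg_smul]; exact eq_neg_of_add_eq_zero_right hxy
            rw [div_eq_inv_mul, mul_smul, ← this, smul_smul, inv_mul_cancel₀ hy, one_smul]
          set c := -x / y
          have h1 : (p b a : ℚ) = 2 * c := by
            rw [h.p_eq, hbc, map_smul, LinearMap.smul_apply, smul_eq_mul]
            field_simp
          have hc0 : c ≠ 0 := fun e => h.ne0 b (by rw [hbc, e, zero_smul])
          have h2 : (p a b : ℚ) * c = 2 := by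
            rw [h.p_eq, hbc]
            simp only [map_smul, LinearMap.smul_apply, smul_eq_mul]
            field_simp
          have h3 : p a b * p b a = 4 := by
            have : (p a b : ℚ) * p b a = 4 := by rw [h1]; linarith
            exact_mod_cast this
          have l2 : l ≤ 2 := by omega
          have lab' := abs_le.mp lab
          have lba' := abs_le.mp lba
          have k1 : -2 ≤ p a b ∧ p a b ≤ 2 := by omega
          have k2 : -2 ≤ p b a ∧ p b a ≤ 2 := by omega
          have : p b a = 2 ∨ p b a = -2 := by
            obtain ⟨k11, k12⟩ := k1
            interval_cases (p a b) <;> omega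
          rcases this with e | e
          · rw [e] at h1
            apply hb1; rw [hbc, show c = 1 by push_cast at h1; linarith, one_smul]
          · rw [e] at h1
            apply hb2; rw [hbc, show c = -1 by push_cast at h1; linarith, neg_one_smul]
      obtain ⟨γ, hγ⟩ := hcA0
      have hγ2 := (mA γ).mp hγ
      have hli : LinearIndependent ℚ ![φ a, φ b, φ γ] := by
        rw [Fintype.linearIndependent_iff]
        intro c hc
        rw [Fin.sum_univ_three] at hc
        simp only [Matrix.cons_val_zero, Matrix.cons_val_one, Matrix.cons_val_two, Matrix.head_cons, Matrix.tail_cons, Matrix.cons_val] at hc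
        have h4 := congrArg v hc
        simp only [map_add, map_smul, ha0, hb0, hγ2, smul_eq_mul, map_zero] at h4
        have h5 : c 2 = 0 := by linarith
        rw [h5, zero_smul, add_zero] at hc
        have := hab _ _ hc
        intro i
        fin_cases i
        · exact this.1
        · exact this.2
        · exact h5
      have h3 := hli.fintype_card_le_finrank
      simp only [Fintype.card_fin] at h3
      have hd3 : d = 3 ∧ l ≤ 1 := by omega
      obtain ⟨rfl, hl1⟩ := hd3
      have hsp : ∀ δ : E, v δ = 0 → ∃ x y : ℚ, δ = x • φ a + y • φ b := by
        intro δ hδ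
        have htop := hli.span_eq_top_of_card_eq_finrank (by simp; omega)
        have : δ ∈ Submodule.span ℚ (Set.range ![φ a, φ b, φ γ]) := by rw [htop]; trivial
        rw [Submodule.mem_span_range_iff_exists_fun] at this
        obtain ⟨c, hc⟩ := this
        rw [Fin.sum_univ_three] at hc
        simp only [Matrix.cons_val_zero, Matrix.cons_val_one, Matrix.cons_val_two, Matrix.head_cons, Matrix.tail_cons, Matrix.cons_val] at hc
        have h4 := congrArg v hc
        simp only [map_add, map_smul, ha0, hb0, hγ2, hδ, smul_eq_mul] at h4
        have h5 : c 2 = 0 := by linarith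
        exact ⟨c 0, c 1, by rw [← hc, h5]; module⟩
      have hdiff : ∀ i ∈ A, ∀ j ∈ A, ∃ x y : ℚ, φ i = φ j + (x • φ a + y • φ b) := by
        intro i hi j hj
        obtain ⟨x, y, hxy⟩ := hsp (φ i - φ j) (by rw [map_sub, (mA i).mp hi, (mA j).mp hj, sub_self])
        exact ⟨x, y, by rw [← hxy]; abel⟩
      have hdet : ∀ i ∈ A, ∀ j ∈ A, p i a = p j a → p i b = p j b → i = j := by
        intro i hi j hj e1 e2
        obtain ⟨x, y, hxy⟩ := hdiff i hi j hj
        apply h.inj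
        set δ := x • φ a + y • φ b with hδ
        have k1 : B δ (φ a) = 0 := by
          have q1 := h.pair i a
          have q2 := h.pair j a
          rw [hxy, map_add, LinearMap.add_apply, e1] at q1
          linarith
        have k2 : B δ (φ b) = 0 := by
          have q1 := h.pair i b
          have q2 := h.pair j b
          rw [hxy, map_add, LinearMap.add_apply, e2] at q1
          linarith
        have k3 : B δ δ = 0 := by
          conv_lhs => arg 2; rw [hδ]
          rw [map_add, map_smul, map_smul, k1, k2]; simp
        have k4 : δ = 0 := by
          by_contra hne
          exact (h.pos δ hne).ne' k3
        rw [hxy, k4, add_zero]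
      have hlA : ∀ i ∈ A, ∀ z ∈ Z, -1 ≤ p i z ∧ p i z ≤ 1 := by
        intro i hi z hz
        have := abs_le.mp (hl i z (hγa i hi z hz).1 (hγa i hi z hz).2)
        omega
      have hcard : ∀ T : Finset (ℤ × ℤ), (∀ t ∈ T, ∃ i, φ i = (t.1 : ℚ) • φ a + (t.2 : ℚ) • φ b) → T.card ≤ Z.card := by
        intro T hT
        haveI : Nonempty ι := ⟨a⟩
        choose! g hg using hT
        apply Finset.card_le_card_of_injOn g
        · intro t ht
          exact (mZ _).mpr (by rw [hg t ht, map_add, map_smul, map_smul, ha0, hb0]; simp)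
        · intro t ht t' ht' e
          have h1 := hg t ht
          rw [e, hg t' ht'] at h1
          obtain ⟨e1, e2⟩ := hab ((t'.1 : ℚ) - t.1) (t'.2 - t.2) (by
            rw [sub_smul, sub_smul, sub_add_sub_comm, h1, sub_self])
          ext
          · exact_mod_cast (sub_eq_zero.mp e1).symm
          · exact_mod_cast (sub_eq_zero.mp e2).symm
      have lab' := abs_le.mp lab
      have lba' := abs_le.mp lba
      rcases hpab.lt_or_eq with hlt | heq
      · have e1 : p a b = -1 := by omega
        have e2 : p b a = -1 := by
          have : B (φ a) (φ b) < 0 := by rw [e1] at pab; push_cast at pab; linarith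
          have : (p b a : ℚ) < 0 := by
            rw [h.p_eq]
            apply div_neg_of_neg_of_pos _ hBa
            linarith
          have : p b a < 0 := by exact_mod_cast this
          omega
        rw [e1] at pab; rw [e2] at pba
        push_cast at pab pba
        have hpab' : 0 < p a b' := by
          rw [h.p_pos_iff, hb', map_neg]; linarith
        obtain ⟨c, hc⟩ := h.sub a b' (fun e => hab2 (by rw [e, hb'])) hpab'
        rw [hb', sub_neg_eq_add] at hc
        obtain ⟨c', hc'⟩ := h.neg c
        have hcZ : c ∈ Z := (mZ c).mpr (by rw [hc, map_add, ha0, hb0, add_zero])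
        have h6 := hcard {(1, 0), (-1, 0), (0, 1), (0, -1), (1, 1), (-1, -1)} (by
          intro t ht
          simp only [Finset.mem_insert, Finset.mem_singleton] at ht
          rcases ht with rfl | rfl | rfl | rfl | rfl | rfl
          · exact ⟨a, by simp⟩
          · exact ⟨a', by simp [ha']⟩
          · exact ⟨b, by simp⟩
          · exact ⟨b', by simp [hb']⟩
          · exact ⟨c, by simp [hc]⟩
          · exact ⟨c', by simp [hc', hc]; abel⟩)
        have h6' : ({(1, 0), (-1, 0), (0, 1), (0, -1), (1, 1), (-1, -1)} : Finset (ℤ × ℤ)).card = 6 := by decide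
        have hBc : B (φ c) (φ c) = B (φ a) (φ a) := by
          rw [hc]; simp only [map_add, LinearMap.add_apply]; linarith
        have h7 : A.card ≤ ((Finset.Icc (-1 : ℤ) 1 ×ˢ Finset.Icc (-1 : ℤ) 1).filter fun t => |t.1 + t.2| ≤ 1).card := by
          apply Finset.card_le_card_of_injOn (fun i => (p i a, p i b))
          · intro i hi
            have g1 := hlA i hi a ha
            have g2 := hlA i hi b hbZ
            have g3 := hlA i hi c hcZ
            have g4 : p i c = p i a + p i b := by
              have : (p i c : ℚ) = p i a + p i b := by
                rw [h.p_eq, h.p_eq, h.p_eq, hBc, hc, map_add, show B (φ b) (φ b) = B (φ a) (φ a) by linarith]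
                ring
              exact_mod_cast this
            simp only [Finset.coe_filter, Finset.mem_product, Finset.mem_Icc, Set.mem_setOf_eq]
            refine ⟨⟨g1, g2⟩, abs_le.mpr ?_⟩
            rw [g4] at g3; exact g3
          · intro i hi j hj e
            simp only [Prod.mk.injEq] at e
            exact hdet i hi j hj e.1 e.2
        have h7' : ((Finset.Icc (-1 : ℤ) 1 ×ˢ Finset.Icc (-1 : ℤ) 1).filter fun t => |t.1 + t.2| ≤ 1).card = 7 := by decide
        omega
      · have h4 := hcard {(1, 0), (-1, 0), (0, 1), (0, -1)} (by
          intro t ht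
          simp only [Finset.mem_insert, Finset.mem_singleton] at ht
          rcases ht with rfl | rfl | rfl | rfl
          · exact ⟨a, by simp⟩
          · exact ⟨a', by simp [ha']⟩
          · exact ⟨b, by simp⟩
          · exact ⟨b', by simp [hb']⟩)
        have h4' : ({(1, 0), (-1, 0), (0, 1), (0, -1)} : Finset (ℤ × ℤ)).card = 4 := by decide
        have hBab : B (φ a) (φ b) = 0 := by rw [heq] at pab; push_cast at pab; linarith
        have hadj : ∀ i ∈ A, ∀ j ∈ A, p i b = p j b → p i a = -1 → p j a = 0 → False := by
          intro i hi j hj e1 e2 e3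
          obtain ⟨x, y, hxy⟩ := hdiff j hj i hi
          have q1 := h.pair i b
          have q2 := h.pair j b
          have q3 := h.pair i a
          have q4 := h.pair j a
          rw [hxy] at q2 q4
          simp only [map_add, map_smul, LinearMap.add_apply, LinearMap.smul_apply, smul_eq_mul, hBab, ← hsym] at q2 q4
          rw [e1] at q1
          rw [e2] at q3
          rw [e3] at q4
          push_cast at q3 q4
          have hy : y = 0 := by
            have : y * B (φ b) (φ b) = 0 := by linarith
            exact (mul_eq_zero.mp this).resolve_right hBb.ne'
          have hx : x = 1 / 2 := by
            have : (x - 1 / 2) * B (φ a) (φ a) = 0 := by linarith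
            linarith [(mul_eq_zero.mp this).resolve_right hBa.ne']
          subst hy hx
          have hφ : φ i = φ j - (1 / 2 : ℚ) • φ a := by rw [hxy]; module
          have hja : B (φ j) (φ a) = 0 := by have := h.pair j a; rw [e3] at this; push_cast at this; linarith
          have hia : B (φ i) (φ a) = - B (φ a) (φ a) / 2 := by linarith
          have pai : p a i = -1 := by
            have l1 := abs_le.mp (hl a i (fun e => (hγa i hi a ha).1 e.symm) (fun e => (hγa i hi a ha).2 (by rw [e, neg_neg])))
            have : (p a i : ℚ) < 0 := by
              rw [h.p_eq, h.symm, hia]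
              apply div_neg_of_neg_of_pos _ (h.bpos i)
              linarith
            have : p a i < 0 := by exact_mod_cast this
            omega
          have hii : B (φ i) (φ i) = B (φ a) (φ a) := by
            have := h.pair a i
            rw [pai, h.symm, hia] at this
            push_cast at this; linarith
          have hij : B (φ i) (φ j) = B (φ j) (φ j) := by
            rw [hφ]; simp only [map_sub, map_smul, LinearMap.sub_apply, LinearMap.smul_apply, smul_eq_mul]
            rw [h.symm (φ a) (φ j), hja]; ring
          have pij : p i j = 2 := by
            have : (p i j : ℚ) = 2 := by
              rw [h.p_eq, hij]; have := (h.bpos j).ne'; field_simp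
            exact_mod_cast this
          have n1 : φ i ≠ φ j := by
            intro e; have := h.inj e; subst this; omega
          have n2 : φ i ≠ - φ j := by
            intro e
            have : v (φ i) = - v (φ j) := by rw [e, map_neg]
            rw [(mA i).mp hi, (mA j).mp hj] at this; norm_num at this
          have := abs_le.mp (hl i j n1 n2)
          omega
        have h7 : A.card ≤ (Finset.Icc (-1 : ℤ) 1 ×ˢ (Finset.univ : Finset Bool)).card := by
          apply Finset.card_le_card_of_injOn (fun i => (p i b, decide (p i a = 1)))
          · intro i hi
            have g2 := hlA i hi b hbZ
            simp [g2]
            exact em _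
          · intro i hi j hj e
            simp only [Prod.mk.injEq, decide_eq_decide] at e
            have g1 := hlA i hi a ha
            have g2 := hlA j hj a ha
            by_cases hs : p i a = p j a
            · exact hdet i hi j hj hs e.1
            · exfalso
              have n1 : p i a ≠ 1 := fun k => hs (by rw [k, e.2.mp k])
              have n2 : p j a ≠ 1 := fun k => hs (by rw [k, e.2.mpr k])
              have : (p i a = -1 ∧ p j a = 0) ∨ (p j a = -1 ∧ p i a = 0) := by omega
              rcases this with ⟨k1, k2⟩ | ⟨k1, k2⟩
              · exact hadj i hi j hj e.1 k1 k2
              · exact hadj j hj i hi e.1.symm k1 k2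
        have h7' : (Finset.Icc (-1 : ℤ) 1 ×ˢ (Finset.univ : Finset Bool)).card = 6 := by decide
        omega
    · push Not at hb
      have hZ2 : Z = {a, a'} := by
        ext i
        rw [Finset.mem_insert, Finset.mem_singleton]
        constructor
        · intro hi
          by_cases e : φ i = φ a
          · exact Or.inl (h.inj e)
          · exact Or.inr (h.inj ((hb i hi e).trans ha'.symm))
        · rintro (rfl | rfl) <;> assumption
      have hcZ : Z.card = 2 := by rw [hZ2]; exact Finset.card_pair haa'
      set A0 := A.filter fun i => ¬ ∃ m, φ m = φ i - φ a with hA0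
      have haA0 : a ∉ A0 := fun hh => by
        have := (mA a).mp (Finset.mem_filter.mp hh).1
        rw [ha0] at this; norm_num at this
      have hpa : ∀ i ∈ A0, p i a ≤ 0 := by
        intro i hi
        by_contra hc
        exact (Finset.mem_filter.mp hi).2 (h.sub i a (fun e => haA0 (e ▸ hi)) (not_le.mp hc))
      have hpa' : ∀ i ∈ A0, p a i ≤ 0 := by
        intro i hi
        have := hpa i hi
        by_contra hc
        have h1 := (h.p_pos_iff a i).mp (not_le.mp hc)
        rw [h.symm] at h1
        have := (h.p_pos_iff i a).mpr h1
        omega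
      have hc0 : A0.card + 1 ≤ d := by
        rw [← Finset.card_insert_of_notMem haA0]
        set M : ℚ := ∑ i, |B (φ i) (φ a)| with hM
        have hM0 : ∀ i, |B (φ i) (φ a)| ≤ M := fun i => Finset.single_le_sum (f := fun i => |B (φ i) (φ a)|) (fun i _ => abs_nonneg _) (Finset.mem_univ i)
        refine le_trans (h.obtuse (insert a A0) ((M + 1) • v + LinearMap.flip B (φ a)) ?_ ?_) hd
        · intro i hi
          rw [LinearMap.add_apply, LinearMap.smul_apply, LinearMap.flip_apply, smul_eq_mul]
          rcases Finset.mem_insert.mp hi with rfl | hi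
          · rw [ha0, mul_zero, zero_add]; exact h.bpos _
          · rw [(mA i).mp (Finset.mem_filter.mp hi).1]
            have := hM0 i
            have := neg_abs_le (B (φ i) (φ a))
            have : 0 ≤ M := le_trans (abs_nonneg _) (hM0 i)
            linarith
        · intro i hi j hj hij
          rcases Finset.mem_insert.mp hi with rfl | hi <;> rcases Finset.mem_insert.mp hj with rfl | hj
          · exact absurd rfl hij
          · exact hpa' j hj
          · exact hpa i hi
          · by_contra hc
            obtain ⟨m, hm⟩ := h.sub i j hij (not_le.mp hc)
            have hmZ : m ∈ Z := (mZ m).mpr (by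
              rw [hm, map_sub, (mA i).mp (Finset.mem_filter.mp hi).1, (mA j).mp (Finset.mem_filter.mp hj).1, sub_self])
            rw [hZ2, Finset.mem_insert, Finset.mem_singleton] at hmZ
            rcases hmZ with rfl | rfl
            · exact (Finset.mem_filter.mp hi).2 ⟨j, by rw [hm]; abel⟩
            · exact (Finset.mem_filter.mp hj).2 ⟨i, by rw [← neg_eq_iff_eq_neg.mpr ha', hm]; abel⟩
      have hex : ∀ i ∈ A, ∃ j ∈ A0, ∃ q : ℕ, q < l + 1 ∧ φ i = φ j + (q : ℚ) • φ a := by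
        intro i hi
        let S : Set ℕ := {q | ∃ m, φ m = φ i - (q : ℚ) • φ a}
        have hfin : S.Finite := by
          have hex' : ∀ q ∈ S, ∃ m, φ m = φ i - (q : ℚ) • φ a := fun q hq => hq
          haveI : Nonempty ι := ⟨a⟩
          choose! g hg using hex'
          refine Set.Finite.of_finite_image (f := g) (Set.toFinite _) ?_
          intro q hq q' hq' e
          have h1 := hg q hq
          have h2 := hg q' hq'
          rw [e, h2] at h1
          have h3 : (q : ℚ) • φ a = (q' : ℚ) • φ a := (sub_right_injective h1).symm
          have := smul_left_injective ℚ (h.ne0 a) h3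
          exact_mod_cast this
        have hne : S.Nonempty := ⟨0, i, by simp⟩
        obtain ⟨q, hq, hmax⟩ := hfin.exists_maximal hne
        obtain ⟨j, hj⟩ := hq
        have hjA : j ∈ A := (mA j).mpr (by rw [hj, map_sub, map_smul, ha0, (mA i).mp hi]; simp)
        have hjA0 : j ∈ A0 := Finset.mem_filter.mpr ⟨hjA, by
          rintro ⟨m, hm⟩
          have : q + 1 ∈ S := ⟨m, by rw [hm, hj]; push_cast; module⟩
          have := hmax this (Nat.le_succ q)
          omega⟩
        refine ⟨j, hjA0, q, ?_, by rw [hj]; abel⟩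
        have e1 := hl i a (hγa i hi a ha).1 (hγa i hi a ha).2
        have e2 := hl j a (hγa j hjA a ha).1 (hγa j hjA a ha).2
        have e3 : p i a = p j a + 2 * q := by
          have : (p i a : ℚ) = p j a + 2 * q := by
            rw [h.p_eq, h.p_eq, hj, map_sub, LinearMap.sub_apply, map_smul, LinearMap.smul_apply, smul_eq_mul]
            have := (h.bpos a).ne'
            field_simp
            ring
          exact_mod_cast this
        rw [abs_le] at e1 e2
        omega
      choose! f hf1 g hg hfg using hex
      have : A.card ≤ (A0 ×ˢ Finset.range (l + 1)).card := by
        apply Finset.card_le_card_of_injOn (fun i => (f i, g i))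
        · intro i hi
          simp only [Finset.coe_product, Set.mem_prod, Finset.mem_coe, Finset.mem_range]
          exact ⟨hf1 i hi, hg i hi⟩
        · intro i hi j hj hij
          simp only [Prod.mk.injEq] at hij
          apply h.inj
          rw [hfg i hi, hfg j hj, hij.1, hij.2]
      rw [Finset.card_product, Finset.card_range] at this
      rcases hdl with ⟨rfl, hl2⟩ | ⟨rfl, hl2⟩
      · have h1 : A0.card ≤ 1 := by omega
        have : A0.card * (l + 1) ≤ 1 * 3 := Nat.mul_le_mul h1 (by omega)
        omega
      · have h1 : A0.card ≤ 2 := by omega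
        have : A0.card * (l + 1) ≤ 2 * 2 := Nat.mul_le_mul h1 (by omega)
        omega
end RD
end CVA
end

section
set_option linter.all false
namespace CVA
open LieAlgebra Module LieAlgebra.IsKilling LieModule

section
variable {F L : Type*} [Field F] [CharZero F] [IsAlgClosed F] [LieRing L] [LieAlgebra F L] [FiniteDimensional F L]
  [IsKilling F L]

lemma exists_cartan (S : Set L) (hS : ∀ s ∈ S, IsSS F s) (hc : ∀ s ∈ S, ∀ s' ∈ S, ⁅s, s'⁆ = 0) :
    ∃ H : LieSubalgebra F L, H.IsCartanSubalgebra ∧ ∀ s ∈ S, s ∈ H := by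
  let M : LieSubalgebra F L :=
    { carrier := {w | ∀ s ∈ S, ⁅s, w⁆ = 0}
      add_mem' := fun {a b} ha hb s hs => by rw [lie_add, ha s hs, hb s hs, add_zero]
      zero_mem' := fun s hs => lie_zero s
      smul_mem' := fun c a ha s hs => by rw [lie_smul, ha s hs, smul_zero]
      lie_mem' := fun {a b} ha hb s hs => lie_comm_of (ha s hs) (hb s hs) }
  have hM : ∀ w, w ∈ M ↔ ∀ s ∈ S, ⁅s, w⁆ = 0 := fun w => Iff.rfl
  obtain ⟨x, hx⟩ := LieAlgebra.exists_isCartanSubalgebra_engel F M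
  set H' := LieSubalgebra.engel F x
  have hsn := hx.self_normalizing
  have hSH : ∀ s (hs : s ∈ S), (⟨s, fun s' hs' => hc s' hs' s hs⟩ : M) ∈ H' := by
    intro s hs
    rw [← hsn, LieSubalgebra.mem_normalizer_iff]
    intro y hy
    have : ⁅(⟨s, fun s' hs' => hc s' hs' s hs⟩ : M), y⁆ = 0 := by
      ext; exact y.2 s hs
    rw [this]; exact H'.zero_mem
  have hSH' : ∀ s ∈ S, s ∈ H'.map M.incl := fun s hs =>
    (LieSubalgebra.mem_map _ _ _).mpr ⟨_, hSH s hs, rfl⟩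
  refine ⟨H'.map M.incl, ⟨?_, ?_⟩, hSH'⟩
  · have e := H'.equivMapOfInjective M.incl Subtype.val_injective
    have := hx.nilpotent
    exact e.nilpotent_iff_equiv_nilpotent.mp this
  · apply le_antisymm _ (LieSubalgebra.le_normalizer _)
    intro n hn
    rw [LieSubalgebra.mem_normalizer_iff'] at hn
    have hnM : n ∈ M := by
      intro s hs
      apply (hS s hs).sq_zero
      obtain ⟨m, hm, e⟩ := (LieSubalgebra.mem_map _ _ _).mp (hn s (hSH' s hs))
      rw [← e]; exact m.2 s hs
    rw [LieSubalgebra.mem_map]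
    refine ⟨⟨n, hnM⟩, ?_, rfl⟩
    rw [← hsn, LieSubalgebra.mem_normalizer_iff']
    intro y hy
    obtain ⟨m, hm, e⟩ := (LieSubalgebra.mem_map _ _ _).mp (hn y ((LieSubalgebra.mem_map _ _ _).mpr ⟨y, hy, rfl⟩))
    have : m = ⁅y, (⟨n, hnM⟩ : M)⁆ := Subtype.ext e
    rw [← this]; exact hm

variable (H : LieSubalgebra F L) [H.IsCartanSubalgebra]

lemma cartan_comm {a b : L} (ha : a ∈ H) (hb : b ∈ H) : ⁅a, b⁆ = 0 := by
  have : ⁅(⟨a, ha⟩ : H), (⟨b, hb⟩ : H)⁆ = 0 := trivial_lie_zero _ _ _ _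
  exact congrArg Subtype.val this

lemma cartan_ss {a : L} (ha : a ∈ H) : IsSS F a :=
  isSemisimple_ad_of_mem_isCartanSubalgebra ha

lemma root_nz (α : H.root) : α.1.IsNonZero := by
  exact (Finset.mem_filter.mp α.2).2

lemma exists_basis : ∃ b : Basis (Fin (finrank F H) ⊕ H.root) F L,
    (∀ i, b (Sum.inl i) ∈ H) ∧ (∀ α : H.root, b (Sum.inr α) ∈ rootSpace H α.1) := by
  have h1 : ∀ α : H.root, ∃ w ∈ rootSpace H α.1, w ≠ 0 := by
    intro α
    by_contra hc
    push Not at hc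
    exact α.1.genWeightSpace_ne_bot' ((LieSubmodule.eq_bot_iff _).mpr hc)
  choose w hw hw0 using h1
  let bH := finBasis F H
  let f : Fin (finrank F H) ⊕ H.root → L := Sum.elim (fun i => (bH i : L)) w
  have hind := LieModule.iSupIndep_genWeightSpace F H L
  rw [← LieSubmodule.iSupIndep_toSubmodule] at hind
  have h0 : (rootSpace H (0 : H → F)) = H.toLieSubmodule := rootSpace_zero_eq F L H
  have hHle : ∀ i, (bH i : L) ∈ (rootSpace H (0 : H → F)) := by
    intro i; rw [h0]; exact (bH i).2
  have hli : LinearIndependent F f := by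
    refine LinearIndependent.sum_type ?_ ?_ ?_
    · exact bH.linearIndependent.map' H.toSubmodule.subtype (Submodule.ker_subtype _)
    · have h2 : iSupIndep fun α : H.root => (rootSpace H α.1).toSubmodule :=
        hind.comp (f := fun α : H.root => (α.1 : H → F)) (fun a b e => Subtype.ext (DFunLike.coe_injective e))
      exact h2.linearIndependent _ hw hw0
    · refine Disjoint.mono ?_ ?_ (hind (0 : H → F))
      · rw [Submodule.span_le]; rintro _ ⟨i, rfl⟩; exact hHle i
      · rw [Submodule.span_le]; rintro _ ⟨α, rfl⟩
        have h3 : ((α.1 : H → F)) ≠ 0 := root_nz H α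
        exact Submodule.mem_iSup_of_mem (α.1 : H → F) (Submodule.mem_iSup_of_mem h3 (hw α))
  have hsp : ⊤ ≤ Submodule.span F (Set.range f) := by
    have h4 := LieModule.iSup_genWeightSpace_eq_top' F H L
    rw [← LieSubmodule.toSubmodule_inj, LieSubmodule.iSup_toSubmodule, LieSubmodule.top_toSubmodule] at h4
    rw [← h4]
    apply iSup_le
    intro χ
    by_cases hχ : χ.IsNonZero
    · intro z hz
      have h5 := finrank_rootSpace_eq_one χ hχ
      let α : H.root := ⟨χ, by simpa using hχ⟩
      obtain ⟨c, hc⟩ := (finrank_eq_one_iff_of_nonzero' (⟨w α, hw α⟩ : rootSpace H χ)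
        (fun e => hw0 α (congrArg Subtype.val e))).mp h5 ⟨z, hz⟩
      have : z = c • f (Sum.inr α) := (congrArg Subtype.val hc).symm
      rw [this]
      exact Submodule.smul_mem _ _ (Submodule.subset_span ⟨_, rfl⟩)
    · have : (χ : H → F) = 0 := not_not.mp hχ
      rw [this]
      intro z hz
      have hz' : z ∈ H.toLieSubmodule := by rw [← h0]; exact hz
      replace hz' : z ∈ H := hz'
      have h6 := bH.sum_repr ⟨z, hz'⟩
      have h7 := congrArg (H.toSubmodule.subtype) h6
      rw [map_sum] at h7
      have : z = ∑ i, bH.repr ⟨z, hz'⟩ i • f (Sum.inl i) := h7.symm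
      rw [this]
      exact Submodule.sum_mem _ fun i _ => Submodule.smul_mem _ _ (Submodule.subset_span ⟨_, rfl⟩)
  refine ⟨Basis.mk hli hsp, ?_, ?_⟩
  · intro i; rw [Basis.mk_apply]; exact (bH i).2
  · intro α; rw [Basis.mk_apply]; exact hw α

/-- adapted basis -/
def cb : Basis (Fin (finrank F H) ⊕ H.root) F L := (exists_basis H).choose
lemma cb_inl (i) : cb H (Sum.inl i) ∈ H := (exists_basis H).choose_spec.1 i
lemma cb_inr (α : H.root) : cb H (Sum.inr α) ∈ rootSpace H α.1 := (exists_basis H).choose_spec.2 α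

/-- weights of the adapted basis -/
def wt : Fin (finrank F H) ⊕ H.root → H → F
  | Sum.inl _, _ => 0
  | Sum.inr α, h => α.1 h

lemma lie_root {α : Weight F H L} {w : L} (hw : w ∈ rootSpace H α) {h : L} (hh : h ∈ H) :
    ⁅h, w⁆ = α ⟨h, hh⟩ • w := lie_eq_smul_of_mem_rootSpace hw ⟨h, hh⟩

lemma lie_cb (i) {h : L} (hh : h ∈ H) : ⁅h, cb H i⁆ = wt H i ⟨h, hh⟩ • cb H i := by
  rcases i with i | α
  · simp only [wt, zero_smul]; exact cartan_comm H hh (cb_inl H i)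
  · exact lie_root H (cb_inr H α) hh

lemma mem_eig_iff {J : Type*} (h : J → H) (c : J → F) (w : L) :
    (∀ j, ⁅(h j : L), w⁆ = c j • w) ↔ ∀ i, (cb H).repr w i ≠ 0 → ∀ j, wt H i (h j) = c j := by
  have key : ∀ j i, (cb H).repr ⁅(h j : L), w⁆ i = wt H i (h j) * (cb H).repr w i := by
    intro j i
    conv_lhs => rw [← (cb H).sum_repr w, lie_sum]
    simp only [lie_smul, lie_cb H _ (h j).2, map_sum, map_smul, Basis.repr_self, Finsupp.coe_finset_sum, Finset.sum_apply,
      Finsupp.smul_apply, smul_eq_mul, Finsupp.single_apply]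
    rw [Finset.sum_eq_single i]
    · simp [mul_comm]
    · intro b _ hb; simp [hb]
    · simp
  constructor
  · intro hw i hi j
    have := key j i
    rw [hw j, map_smul, Finsupp.smul_apply, smul_eq_mul] at this
    exact (mul_right_cancel₀ hi this).symm
  · intro hw j
    apply (cb H).repr.injective
    ext i
    rw [key, map_smul, Finsupp.smul_apply, smul_eq_mul]
    by_cases hi : (cb H).repr w i = 0
    · rw [hi, mul_zero, mul_zero]
    · rw [hw i hi j]

open Classical in
lemma finrank_eig {J : Type*} (h : J → H) (c : J → F) (U : Submodule F L)
    (hU : ∀ w, w ∈ U ↔ ∀ j, ⁅(h j : L), w⁆ = c j • w) :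
    finrank F U = (Finset.univ.filter fun α : H.root => ∀ j, α.1 (h j) = c j).card +
      (if ∀ j, c j = 0 then finrank F H else 0) := by
  have hUs : U = Submodule.span F (cb H '' {i | ∀ j, wt H i (h j) = c j}) := by
    ext w
    rw [hU, mem_eig_iff, Basis.mem_span_image]
    constructor
    · intro hw i hi
      exact hw i (by simpa using hi)
    · intro hw i hi
      exact hw (by simpa using hi)
  have hfs := finrank_span_eq_card ((cb H).linearIndependent.comp (Subtype.val : {i | ∀ j, wt H i (h j) = c j} → _) Subtype.val_injective)
  rw [Set.range_comp, Subtype.range_coe] at hfs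
  rw [hUs, hfs]
  change Fintype.card {i // ∀ j, wt H i (h j) = c j} = _
  rw [Fintype.card_subtype, Finset.card_filter, Fintype.sum_sum_type, add_comm, Finset.card_filter]
  congr 1
  split_ifs with hc
  · have : ∀ i : Fin (finrank F H), (∀ j, wt H (Sum.inl i) (h j) = c j) := fun i j => (hc j).symm
    simp [this]
  · have : ∀ i : Fin (finrank F H), ¬ (∀ j, wt H (Sum.inl i) (h j) = c j) := fun i hj => hc fun j => (hj j).symm
    simp only [this, if_false, Finset.sum_const_zero]

end
end CVA
end

section
set_option linter.all false
namespace CVA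
open LieAlgebra Module LieAlgebra.IsKilling LieModule

section
variable {F L : Type*} [Field F] [CharZero F] [IsAlgClosed F] [LieRing L] [LieAlgebra F L] [FiniteDimensional F L]
  [IsKilling F L]
variable (H : LieSubalgebra F L) [H.IsCartanSubalgebra]

/-- bound for Cartan integers -/
def LacLE (l : ℕ) : Prop := ∀ α β : H.root, α ≠ β → (α.1 : H → F) ≠ -(β.1 : H → F) →
  ∀ n : ℤ, α.1 (coroot β.1) = (n : F) → |n| ≤ l

/-- integer pairing -/
def pz (α β : H.root) : ℤ := (rootSystem H).pairingIn ℤ α β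

lemma pz_cast (α β : H.root) : (pz H α β : F) = α.1 (coroot β.1) := by
  have := (rootSystem H).algebraMap_pairingIn ℤ α β
  rw [rootSystem_pairing_apply] at this
  rw [← this]; simp [pz]

/-- root as a linear form -/
def rl (α : H.root) : Dual F H := (rootSystem H).root α

lemma rl_apply (α : H.root) (h : H) : rl H α h = α.1 h := by
  simp [rl]

lemma rl_inj : Function.Injective (rl H) := (rootSystem H).root.injective

lemma dual_ext_coroot {x : Dual F H} (h : ∀ γ : H.root, x (coroot γ.1) = 0) : x = 0 := by
  have h1 : Submodule.span F (Set.range (rootSystem H).coroot) = ⊤ :=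
    RootPairing.IsRootSystem.span_coroot_eq_top (P := rootSystem H)
  apply LinearMap.ext
  intro y
  have hy : y ∈ Submodule.span F (Set.range (rootSystem H).coroot) := by rw [h1]; trivial
  induction hy using Submodule.span_induction with
  | mem y hy => obtain ⟨γ, rfl⟩ := hy; simpa using h γ
  | zero => simp
  | add a b _ _ ha hb => rw [map_add, ha, hb]; simp
  | smul c a _ ha => rw [map_smul, ha]; simp

lemma exists_retract : ∃ ρ : F →ₗ[ℚ] ℚ, ∀ q : ℚ, ρ (q : F) = q := by
  obtain ⟨ρ, hρ⟩ := LinearMap.exists_leftInverse_of_injective (Algebra.linearMap ℚ F)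
    (LinearMap.ker_eq_bot.mpr (algebraMap ℚ F).injective)
  refine ⟨ρ, fun q => ?_⟩
  have := LinearMap.congr_fun hρ q
  simpa using this

/-- `ℚ`-span of a set of roots -/
def qsp (Q : Set H.root) : Submodule ℚ (Dual F H) := Submodule.span ℚ (rl H '' Q)

lemma qsp_rat {Q : Set H.root} {x : Dual F H} (hx : x ∈ qsp H Q) (γ : H.root) : ∃ q : ℚ, x (coroot γ.1) = q := by
  induction hx using Submodule.span_induction with
  | mem y hy => obtain ⟨α, _, rfl⟩ := hy; exact ⟨pz H α γ, by rw [rl_apply, ← pz_cast]; simp⟩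
  | zero => exact ⟨0, by simp⟩
  | add a b _ _ ha hb =>
    obtain ⟨p, hp⟩ := ha; obtain ⟨q, hq⟩ := hb
    exact ⟨p + q, by rw [LinearMap.add_apply, hp, hq]; simp⟩
  | smul c a _ ha =>
    obtain ⟨p, hp⟩ := ha
    exact ⟨c * p, by rw [LinearMap.smul_apply, hp, Algebra.smul_def]; simp⟩

lemma qsp_finrank (Q : Set H.root) :
    finrank ℚ (qsp H Q) ≤ finrank F (Submodule.span F (rl H '' Q)) := by
  obtain ⟨b, hb, hsp, hli⟩ := exists_linearIndependent ℚ (rl H '' Q)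
  have hbf : b.Finite := (Set.toFinite (rl H '' Q)).subset hb
  haveI : Fintype b := hbf.fintype
  have h1 : finrank ℚ (qsp H Q) = Fintype.card b := by
    rw [qsp, ← hsp]
    have := finrank_span_eq_card hli
    rwa [Subtype.range_coe] at this
  have hF : LinearIndependent F (Subtype.val : b → Dual F H) := by
    rw [Fintype.linearIndependent_iff]
    intro c hc i
    rw [← Module.forall_dual_apply_eq_zero_iff ℚ]
    intro lam
    have h2 : ∑ i : b, lam (c i) • (i : Dual F H) = 0 := by
      apply dual_ext_coroot
      intro γ
      have h3 : ∀ i : b, ∃ n : ℤ, (i : Dual F H) (coroot γ.1) = n := by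
        intro i
        obtain ⟨α, _, e⟩ := hb i.2
        exact ⟨pz H α γ, by rw [← e, rl_apply, ← pz_cast]⟩
      choose n hn using h3
      have h4 := congrArg lam (LinearMap.congr_fun hc (coroot γ.1))
      rw [LinearMap.sum_apply] at h4 ⊢
      simp only [LinearMap.smul_apply, hn] at h4 ⊢
      rw [map_sum] at h4
      have h5 : ∀ i, lam (c i • (n i : F)) = lam (c i) * n i := by
        intro i
        have : c i • (n i : F) = (n i) • c i := by rw [smul_eq_mul, zsmul_eq_mul, mul_comm]
        rw [this, map_zsmul, zsmul_eq_mul, mul_comm]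
      simp only [h5] at h4
      have h6 : ∀ i, lam (c i) • (n i : F) = ((lam (c i) * n i : ℚ) : F) := by
        intro i; rw [Algebra.smul_def]; simp
      simp only [h6]
      rw [← Rat.cast_sum, h4]; simp
    exact (Fintype.linearIndependent_iff.mp hli) _ h2 i
  rw [h1]
  have h7 := finrank_span_eq_card hF
  rw [Subtype.range_coe] at h7
  rw [← h7]
  exact Submodule.finrank_mono (Submodule.span_mono hb)

lemma rf_pair (α β : H.root) : 2 * (rootSystem H).RootForm (rl H α) (rl H β) =
    (pz H α β : F) * (rootSystem H).RootForm (rl H β) (rl H β) := by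
  have := ((rootSystem H).posRootForm ℚ).two_mul_apply_root_root α β
  rw [pz_cast]
  exact this

/-- root in the rational span -/
def qr (s : H) (α : {α : H.root // α.1 s = 0}) : qsp H {α | α.1 s = 0} :=
  ⟨rl H α, Submodule.subset_span ⟨_, α.2, rfl⟩⟩

lemma exists_rd (s : H) (ρ : F →ₗ[ℚ] ℚ) (hρ : ∀ q : ℚ, ρ (q : F) = q) :
    ∃ B : LinearMap.BilinForm ℚ (qsp H {α | α.1 s = 0}),
      RD (E := ↥(qsp H {α | α.1 s = 0})) B (qr H s)
        (fun α β => pz H α β) := by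
  set Q := {α : H.root | α.1 s = 0}
  let B : LinearMap.BilinForm ℚ (qsp H Q) := LinearMap.mk₂ ℚ
    (fun x y => ρ ((rootSystem H).RootForm x.1 y.1))
    (by intro a b c; simp) (by intro r a b; simp [LinearMap.map_smul_of_tower])
    (by intro a b c; simp) (by intro r a b; simp [LinearMap.map_smul_of_tower])
  have hB : ∀ x y, B x y = ρ ((rootSystem H).RootForm x.1 y.1) := fun x y => rfl
  have hmem : ∀ x : Dual F H, x s = 0 → x ∈ Set.range (rl H) → ∃ m : {α : H.root // α.1 s = 0}, rl H m = x := by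
    rintro x hx ⟨m, rfl⟩
    exact ⟨⟨m, by rwa [rl_apply] at hx⟩, rfl⟩
  refine ⟨B, ?_, ?_, ?_, ?_, ?_, ?_, ?_, ?_⟩
  · intro x hx
    have h1 : ∀ γ : H.root, ∃ q : ℚ, x.1 (coroot γ.1) = q := fun γ => qsp_rat H x.2 γ
    choose q hq using h1
    have h2 : B x x = ∑ γ, q γ * q γ := by
      rw [hB, RootPairing.rootForm_apply_apply, ← hρ (∑ γ, q γ * q γ)]
      congr 1
      push_cast
      apply Finset.sum_congr rfl
      intro γ _
      rw [← hq γ]; rfl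
    rw [h2]
    have h3 : ∃ γ, q γ ≠ 0 := by
      by_contra hc
      push Not at hc
      apply hx
      apply Subtype.ext
      apply dual_ext_coroot
      intro γ; rw [hq, hc]; simp
    obtain ⟨γ, hγ⟩ := h3
    exact Finset.sum_pos' (fun i _ => mul_self_nonneg _) ⟨γ, Finset.mem_univ _, mul_self_pos.mpr hγ⟩
  · intro x y
    rw [hB, hB]
    congr 1
    simp only [RootPairing.rootForm_apply_apply]
    exact Finset.sum_congr rfl fun _ _ => mul_comm _ _
  · intro a b e
    exact Subtype.ext (rl_inj H (congrArg Subtype.val e))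
  · intro a e
    have := congrArg Subtype.val e
    exact (rootSystem H).ne_zero a.1 this
  · intro a b
    rw [hB, hB]
    have h1 := congrArg ρ (rf_pair H a b)
    rw [← zsmul_eq_mul, map_zsmul, two_mul, map_add, ← two_mul, zsmul_eq_mul] at h1
    exact h1
  · intro a
    obtain ⟨m, hm⟩ := hmem (- rl H a) (by rw [LinearMap.neg_apply, rl_apply, a.2, neg_zero])
      ⟨(rootSystem H).reflectionPerm a.1 a.1, by rw [rl, RootPairing.root_reflectionPerm, RootPairing.reflection_apply_self]; rfl⟩
    exact ⟨m, Subtype.ext hm⟩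
  · intro a b hab hp
    obtain ⟨m, hm⟩ := hmem (rl H a - rl H b) (by rw [LinearMap.sub_apply, rl_apply, rl_apply, a.2, b.2, sub_zero])
      ((rootSystem H).root_sub_root_mem_of_pairingIn_pos hp (fun e => hab (Subtype.ext e)))
    exact ⟨m, Subtype.ext hm⟩
  · intro a b e
    have h1 : rl H a = (2 : ℚ) • rl H b := congrArg Subtype.val e
    have h2 : (a.1.1 : H → F) = (2 : F) • (b.1.1 : H → F) := by
      funext x
      have := LinearMap.congr_fun h1 x
      rw [LinearMap.smul_apply, rl_apply, rl_apply, Algebra.smul_def] at this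
      simpa using this
    rcases eq_neg_or_eq_of_eq_smul b.1.1 a.1.1 (root_nz H a.1) 2 h2 with h3 | h3
    all_goals
      apply root_nz H b.1
      funext x
      have h4 := congrFun h2 x
      rw [h3] at h4
      simp at h4
      first
        | (have : (3 : F) * b.1.1 x = 0 := by linear_combination -h4
           simpa using this)
        | (have : b.1.1 x = 0 := by linear_combination -h4
           simpa using this)

open Classical in
theorem bridge {d l : ℕ} (hdl : d = 2 ∧ l ≤ 2 ∨ d = 3 ∧ l ≤ 1) (hlac : LacLE H l) (s h : H)
    (hintg : ∀ α : H.root, α.1 s = 0 → ∃ n : ℤ, α.1 h = n)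
    (hd : finrank F (Submodule.span F (rl H '' {α | α.1 s = 0})) ≤ d)
    (hA : (Finset.univ.filter fun α : H.root => α.1 s = 0 ∧ α.1 h = 2).card =
      d + (Finset.univ.filter fun α : H.root => α.1 s = 0 ∧ α.1 h = 0).card)
    (hB : Even (Finset.univ.filter fun α : H.root => α.1 s = 0 ∧ α.1 h = 1).card) :
    ∀ α : H.root, α.1 s = 0 → α.1 h ≠ 0 ∧ α.1 h ≠ 1 := by
  obtain ⟨ρ, hρ⟩ := exists_retract (F := F)
  obtain ⟨B, hB'⟩ := exists_rd H s ρ hρ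
  set Q := {α : H.root | α.1 s = 0}
  haveI : FiniteDimensional ℚ (qsp H Q) := FiniteDimensional.span_of_finite ℚ (Set.toFinite _)
  let v : qsp H Q →ₗ[ℚ] ℚ :=
    { toFun := fun x => ρ (x.1 h)
      map_add' := by intro a b; simp
      map_smul' := by intro c a; simp [LinearMap.map_smul_of_tower] }
  have hv : ∀ (α : {α : H.root // α.1 s = 0}) (n : ℤ), v (qr H s α) = (n : ℚ) ↔ α.1.1 h = (n : F) := by
    intro α n
    obtain ⟨m, hm⟩ := hintg α.1 α.2
    have h1 : v (qr H s α) = (m : ℚ) := by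
      change ρ (rl H α h) = _
      rw [rl_apply, hm]
      have := hρ m
      simpa using this
    rw [h1, hm]
    norm_cast
  have hcard : ∀ n : ℤ, (Finset.univ.filter fun α : {α : H.root // α.1 s = 0} => v (qr H s α) = (n : ℚ)).card
      = (Finset.univ.filter fun α : H.root => α.1 s = 0 ∧ α.1 h = (n : F)).card := by
    intro n
    refine Finset.card_bij (fun a _ => a.1) ?_ ?_ ?_
    · intro a ha
      rw [Finset.mem_filter] at ha ⊢
      exact ⟨Finset.mem_univ _, a.2, (hv a n).mp ha.2⟩
    · intro a _ b _ e; exact Subtype.ext e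
    · intro b hb
      rw [Finset.mem_filter] at hb
      exact ⟨⟨b, hb.2.1⟩, Finset.mem_filter.mpr ⟨Finset.mem_univ _, (hv ⟨b, hb.2.1⟩ n).mpr hb.2.2⟩, rfl⟩
  have c2 := hcard 2
  have c1 := hcard 1
  have c0 := hcard 0
  push_cast at c2 c1 c0
  have key := hB'.dist ((qsp_finrank H Q).trans hd) hdl (by
    intro i j h1 h2
    apply hlac i.1 j.1
    · intro e; apply h1; have := Subtype.ext e; rw [this]
    · intro e
      apply h2
      apply Subtype.ext
      apply LinearMap.ext
      intro x
      change rl H i.1 x = - rl H j.1 x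
      rw [rl_apply, rl_apply]; exact congrFun e x
    · exact (pz_cast H _ _).symm) v (by rw [c2, c0]; convert hA) (by rw [c1]; convert hB)
  obtain ⟨k0, k1⟩ := key
  intro α hα
  constructor
  · intro e
    have : (⟨α, hα⟩ : {α : H.root // α.1 s = 0}) ∈ (∅ : Finset _) := by
      rw [← k0, Finset.mem_filter]
      exact ⟨Finset.mem_univ _, by simpa using (hv ⟨α, hα⟩ 0).mpr (by simpa using e)⟩
    simp at this
  · intro e
    have : (⟨α, hα⟩ : {α : H.root // α.1 s = 0}) ∈ (∅ : Finset _) := by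
      rw [← k1, Finset.mem_filter]
      exact ⟨Finset.mem_univ _, by simpa using (hv ⟨α, hα⟩ 1).mpr (by simpa using e)⟩
    simp at this

end
end CVA
end

section
set_option linter.all false
namespace CVA
open LieAlgebra Module LieAlgebra.IsKilling LieModule

lemma even_of_alt {F V : Type*} [Field F] [CharZero F] [AddCommGroup V] [Module F V] [FiniteDimensional F V]
    (ω : V →ₗ[F] V →ₗ[F] F) (ha : ∀ v, ω v v = 0) (hn : ∀ v, (∀ w, ω v w = 0) → v = 0) : Even (finrank F V) := by
  let b := finBasis F V
  let A : Matrix (Fin (finrank F V)) (Fin (finrank F V)) F := Matrix.of fun i j => ω (b i) (b j)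
  have hskew : ∀ v w, ω v w = - ω w v := by
    intro v w
    have := ha (v + w)
    simp only [map_add, LinearMap.add_apply, ha] at this
    linear_combination this
  have hA : A.transpose = - A := by
    ext i j
    simp only [A, Matrix.transpose_apply, Matrix.of_apply, Matrix.neg_apply]
    exact hskew _ _
  have hdet : A.det ≠ 0 := by
    intro h0
    obtain ⟨c, hc, hc'⟩ := Matrix.exists_vecMul_eq_zero_iff.mpr h0
    apply hc
    have h1 : ∑ i, c i • b i = 0 := by
      apply hn
      intro w
      rw [← b.sum_repr w, map_sum]
      apply Finset.sum_eq_zero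
      intro j _
      rw [map_smul, map_sum, LinearMap.sum_apply]
      have := congrFun hc' j
      simp only [Matrix.vecMul, dotProduct, A, Matrix.of_apply, Pi.zero_apply] at this
      simp only [map_smul, LinearMap.smul_apply, smul_eq_mul]
      rw [this, mul_zero]
    funext i
    exact Fintype.linearIndependent_iff.mp b.linearIndependent c h1 i
  by_contra hodd
  rw [Nat.not_even_iff_odd] at hodd
  have h2 := congrArg Matrix.det hA
  rw [Matrix.det_transpose, Matrix.det_neg, Fintype.card_fin, hodd.neg_one_pow] at h2
  apply hdet
  have : (2 : F) * A.det = 0 := by linear_combination h2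
  simpa using this

lemma finrank_map_add {F V : Type*} [Field F] [AddCommGroup V] [Module F V] [FiniteDimensional F V]
    (f : V →ₗ[F] V) (U : Submodule F V) :
    finrank F (U.map f) + finrank F (U ⊓ LinearMap.ker f : Submodule F V) = finrank F U := by
  have h1 := LinearMap.finrank_range_add_finrank_ker (f.domRestrict U)
  rw [LinearMap.range_domRestrict] at h1
  have h2 : (U ⊓ LinearMap.ker f : Submodule F V) = (LinearMap.ker (f.domRestrict U)).map U.subtype := by
    ext w
    simp only [Submodule.mem_inf, LinearMap.mem_ker, Submodule.mem_map]
    constructor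
    · rintro ⟨h, h'⟩; exact ⟨⟨w, h⟩, h', rfl⟩
    · rintro ⟨y, hy, rfl⟩; exact ⟨y.2, hy⟩
  rw [h2, ← (Submodule.equivMapOfInjective U.subtype Subtype.val_injective (LinearMap.ker (f.domRestrict U))).finrank_eq]
  exact h1

section
variable {F L : Type*} [Field F] [CharZero F] [IsAlgClosed F] [LieRing L] [LieAlgebra F L] [FiniteDimensional F L]
  [IsKilling F L]

lemma IsSS.le_of_eig {h : L} (hh : IsSS F h) (V W : Submodule F L) (hV : ∀ w ∈ V, ⁅h, w⁆ ∈ V)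
    (hW : ∀ μ : F, ∀ w ∈ V, ⁅h, w⁆ = μ • w → w ∈ W) : V ≤ W := by
  have h1 := Submodule.inf_iSup_genEigenspace (f := ad F L h) (p := V) hV ⊤
  have h2 : ⨆ μ, (ad F L h).genEigenspace μ ⊤ = ⊤ := Module.End.iSup_maxGenEigenspace_eq_top _
  rw [h2, inf_top_eq] at h1
  rw [h1]
  apply iSup_le
  rintro μ w ⟨hw, hw'⟩
  apply hW μ w hw
  have h3 := (Module.End.IsSemisimple.isFinitelySemisimple hh).maxGenEigenspace_eq_eigenspace μ
  have : w ∈ (ad F L h).maxGenEigenspace μ := hw'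
  rw [h3, Module.End.mem_eigenspace_iff] at this
  exact this

section
variable (H : LieSubalgebra F L) [H.IsCartanSubalgebra]

open Classical in
lemma proj {J : Type*} (h : J → H) (c : J → F) (v : L) : ∃ v0 : L, (∀ j, ⁅(h j : L), v0⁆ = c j • v0) ∧
    ∀ z, (∀ j, ⁅(h j : L), z⁆ = (- c j) • z) → killingForm F L z v = killingForm F L z v0 := by
  refine ⟨∑ i, if ∀ j, wt H i (h j) = c j then (cb H).repr v i • cb H i else 0, ?_, ?_⟩
  · intro j
    rw [lie_sum, Finset.smul_sum]
    apply Finset.sum_congr rfl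
    intro i _
    split_ifs with hi
    · rw [lie_smul, lie_cb H i (h j).2, smul_comm, ← hi j]
    · simp
  · intro z hz
    conv_lhs => rw [← (cb H).sum_repr v]
    rw [map_sum, map_sum]
    apply Finset.sum_congr rfl
    intro i _
    split_ifs with hi
    · rfl
    · push Not at hi
      obtain ⟨j, hj⟩ := hi
      rw [map_zero, map_smul]
      have h1 := kf_inv' (F := F) (h j : L) z (cb H i)
      rw [hz j, lie_cb H i (h j).2, map_smul, map_smul, LinearMap.smul_apply, smul_eq_mul, smul_eq_mul] at h1
      have h2 : (wt H i (h j) - c j) * killingForm F L z (cb H i) = 0 := by linear_combination h1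
      rcases mul_eq_zero.mp h2 with h3 | h3
      · exact absurd (sub_eq_zero.mp h3) hj
      · rw [h3, smul_zero]

lemma le_cent {s : L} (hs : s ∈ H) {w : L} (hw : w ∈ H) : w ∈ cent F s := mem_cent.mpr (cartan_comm H hs hw)

lemma mem_cartan {w : L} (h : ∀ a ∈ H, ⁅a, w⁆ = 0) : w ∈ H := by
  have h1 := LieSubalgebra.IsCartanSubalgebra.self_normalizing (H := H)
  rw [← h1, LieSubalgebra.mem_normalizer_iff']
  intro a ha
  rw [h a ha]; exact H.zero_mem

lemma zen_iff (s : H) (w : L) : w ∈ zen (cent F (s : L)) ↔ ∃ hw : w ∈ H, ∀ α : H.root, α.1 s = 0 → α.1 ⟨w, hw⟩ = 0 := by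
  constructor
  · intro hw
    have hwH : w ∈ H := mem_cartan H fun a ha => (mem_zen.mp hw).2 a (le_cent H s.2 ha)
    refine ⟨hwH, fun α hα => ?_⟩
    have h1 : cb H (Sum.inr α) ∈ cent F (s : L) := by
      rw [mem_cent, lie_cb H _ s.2]
      simp [wt, hα]
    have h2 := comm_symm ((mem_zen.mp hw).2 _ h1)
    rw [lie_cb H _ hwH] at h2
    exact (smul_eq_zero.mp h2).resolve_right ((cb H).ne_zero _)
  · rintro ⟨hwH, hw⟩
    refine mem_zen.mpr ⟨le_cent H s.2 hwH, fun a ha => comm_symm ?_⟩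
    have h1 := (mem_eig_iff H (fun _ : Unit => s) (fun _ => 0) a).mp (fun _ => by rw [mem_cent.mp ha, zero_smul])
    have h2 := (mem_eig_iff H (fun _ : Unit => (⟨w, hwH⟩ : H)) (fun _ => 0) a).mpr (by
      intro i hi j
      have h3 := h1 i hi ()
      rcases i with i | α
      · rfl
      · exact hw α h3) ()
    rw [zero_smul] at h2
    exact h2

lemma finrank_zen (s : H) : finrank F (Submodule.span F (rl H '' {α | α.1 s = 0})) + finrank F (zen (cent F (s : L))) =
    finrank F H := by
  set W := Submodule.span F (rl H '' {α | α.1 s = 0})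
  have h1 := Subspace.finrank_add_finrank_dualCoannihilator_eq W
  have h2 : zen (cent F (s : L)) = W.dualCoannihilator.map H.toSubmodule.subtype := by
    ext w
    rw [zen_iff, Submodule.mem_map]
    constructor
    · rintro ⟨hw, h⟩
      refine ⟨⟨w, hw⟩, ?_, rfl⟩
      rw [Submodule.mem_dualCoannihilator]
      intro φ hφ
      induction hφ using Submodule.span_induction with
      | mem y hy => obtain ⟨α, hα, rfl⟩ := hy; rw [rl_apply]; exact h α hα
      | zero => simp
      | add a b _ _ ha hb => rw [LinearMap.add_apply, ha, hb, add_zero]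
      | smul c a _ ha => rw [LinearMap.smul_apply, ha, smul_zero]
    · rintro ⟨y, hy, rfl⟩
      rw [Submodule.mem_dualCoannihilator] at hy
      exact ⟨y.2, fun α hα => by rw [← hy (rl H α) (Submodule.subset_span ⟨α, hα, rfl⟩), rl_apply]; rfl⟩
  rw [h2, ← (Submodule.equivMapOfInjective _ Subtype.val_injective _).finrank_eq]
  exact h1
end

end
end CVA
end

section
set_option linter.all false
namespace CVA
open LieAlgebra Module LieAlgebra.IsKilling LieModule

section
variable {F L : Type*} [Field F] [CharZero F] [IsAlgClosed F] [LieRing L] [LieAlgebra F L] [FiniteDimensional F L]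
  [IsKilling F L]

/-- joint eigenspace -/
def ei (s h : L) (c : F) : Submodule F L := cent F s ⊓ (ad F L h).eigenspace c

lemma mem_ei {s h : L} {c : F} {w : L} : w ∈ ei s h c ↔ ⁅s, w⁆ = 0 ∧ ⁅h, w⁆ = c • w := by
  rw [ei, Submodule.mem_inf, mem_cent, Module.End.mem_eigenspace_iff]; rfl

lemma lie_ei {s h e : L} (hse : ⁅s, e⁆ = 0) (hhe : ⁅h, e⁆ = (2 : F) • e) {c : F} {w : L} (hw : w ∈ ei s h c) :
    ⁅e, w⁆ ∈ ei s h (c + 2) := by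
  obtain ⟨h1, h2⟩ := mem_ei.mp hw
  refine mem_ei.mpr ⟨lie_comm_of hse h1, ?_⟩
  rw [leibniz_lie, hhe, h2, smul_lie, lie_smul, add_smul, add_comm]

variable (H : LieSubalgebra F L) [H.IsCartanSubalgebra]

lemma ei_proj (s h : H) (c : F) (v : L) : ∃ v0 ∈ ei (s : L) (h : L) c,
    ∀ z ∈ ei (s : L) (h : L) (-c), killingForm F L z v = killingForm F L z v0 := by
  obtain ⟨v0, h1, h2⟩ := proj H (fun j : Bool => if j then h else s) (fun j => if j then c else 0) v
  refine ⟨v0, mem_ei.mpr ⟨by simpa using h1 false, by simpa using h1 true⟩, fun z hz => h2 z ?_⟩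
  obtain ⟨h3, h4⟩ := mem_ei.mp hz
  intro j
  cases j
  · simpa using h3
  · simpa using h4

open Classical in
lemma ei_finrank (s h : H) (c : F) : finrank F (ei (s : L) (h : L) c) =
    (Finset.univ.filter fun α : H.root => α.1 s = 0 ∧ α.1 h = c).card + (if c = 0 then finrank F H else 0) := by
  have := finrank_eig H (fun j : Bool => if j then h else s) (fun j => if j then c else 0) (ei (s : L) (h : L) c) (by
    intro w
    rw [mem_ei, Bool.forall_bool]
    simp)
  rw [this]
  simp [Bool.forall_bool]

lemma ei_nd (s h : H) (c : F) {w : L} (hw : w ∈ ei (s : L) (h : L) c)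
    (h0 : ∀ v ∈ ei (s : L) (h : L) (-c), killingForm F L w v = 0) : w = 0 := by
  apply kf_nondeg (F := F)
  intro v
  obtain ⟨v0, h1, h2⟩ := ei_proj H s h (-c) v
  rw [h2 w (by rwa [neg_neg]), h0 v0 h1]

/-- surjectivity of `ad e` -/
lemma ei_surj (s h : H) {e : L} (hse : ⁅(s : L), e⁆ = 0) (hhe : ⁅(h : L), e⁆ = (2 : F) • e) {c : F}
    (hinj : ∀ w ∈ ei (s : L) (h : L) (-(c + 2)), ⁅e, w⁆ = 0 → w = 0) {z : L} (hz : z ∈ ei (s : L) (h : L) (c + 2)) :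
    ∃ u ∈ ei (s : L) (h : L) c, z = ⁅e, u⁆ := by
  have h1 : z ∈ (ei (s : L) (h : L) c).map (ad F L e) := by
    apply perp_perp
    intro v hv
    obtain ⟨v0, hv0, h2⟩ := ei_proj H s h (-(c + 2)) v
    rw [h2 z (by rwa [neg_neg])]
    have h3 : ⁅e, v0⁆ = 0 := by
      apply ei_nd H s h (-c)
      · have := lie_ei hse hhe hv0
        rwa [show -(c + 2) + 2 = -c by ring] at this
      · intro u hu
        rw [neg_neg] at hu
        have h4 := hv ⁅e, u⁆ ⟨u, hu, rfl⟩
        rw [h2 _ (by rw [neg_neg]; exact lie_ei hse hhe hu), kf_inv', neg_eq_zero, kf_comm] at h4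
        exact h4
    rw [hinj v0 hv0 h3, map_zero]
  obtain ⟨u, hu, e1⟩ := h1
  exact ⟨u, hu, e1.symm⟩

lemma ei_map (s h : H) {e : L} (hse : ⁅(s : L), e⁆ = 0) (hhe : ⁅(h : L), e⁆ = (2 : F) • e) {c : F}
    (hinj : ∀ w ∈ ei (s : L) (h : L) (-(c + 2)), ⁅e, w⁆ = 0 → w = 0) :
    finrank F (ei (s : L) (h : L) (c + 2)) + finrank F (ei (s : L) (h : L) c ⊓ cent F e : Submodule F L) =
      finrank F (ei (s : L) (h : L) c) := by
  have heq : ei (s : L) (h : L) (c + 2) = (ei (s : L) (h : L) c).map (ad F L e) := by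
    apply le_antisymm
    · intro z hz
      obtain ⟨u, hu, rfl⟩ := ei_surj H s h hse hhe hinj hz
      exact ⟨u, hu, rfl⟩
    · rintro _ ⟨u, hu, rfl⟩
      exact lie_ei hse hhe hu
  rw [← finrank_map_add (ad F L e) (ei (s : L) (h : L) c), heq]
  rfl

lemma ei_even (s h : H) {e : L} (hse : ⁅(s : L), e⁆ = 0) (hhe : ⁅(h : L), e⁆ = (2 : F) • e)
    (hinj : ∀ w ∈ ei (s : L) (h : L) (-1 : F), ⁅e, w⁆ = 0 → w = 0) : Even (finrank F (ei (s : L) (h : L) (-1 : F))) := by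
  refine even_of_alt ((killingForm F L).compl₁₂ ((ad F L e).domRestrict (ei (s : L) (h : L) (-1 : F))) (Submodule.subtype _)) ?_ ?_
  · intro v
    change killingForm F L ⁅e, (v : L)⁆ (v : L) = 0
    rw [kf_inv, lie_self, map_zero]
  · intro v hv
    apply Subtype.ext
    apply hinj v.1 v.2
    apply ei_nd H s h 1
    · have := lie_ei hse hhe v.2
      convert this using 1; norm_num
    · intro w hw
      exact hv ⟨w, hw⟩

lemma cent_le_pos (s h : H) {e : L} (hse : ⁅(s : L), e⁆ = 0) (hhe : ⁅(h : L), e⁆ = (2 : F) • e)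
    (hnn : ∀ w : L, w ≠ 0 → ⁅e, w⁆ = 0 → ∀ c : F, ⁅(h : L), w⁆ = c • w → ∃ j : ℕ, c = j) :
    finrank F (cent F (s : L) ⊓ cent F e : Submodule F L) ≤
      finrank F (ei (s : L) (h : L) (0 : F)) + finrank F (ei (s : L) (h : L) (1 : F)) := by
  classical
  have hsh : ⁅(s : L), (h : L)⁆ = 0 := cartan_comm H s.2 h.2
  let I : ℕ → Set (Fin (finrank F H) ⊕ H.root) := fun m => {i | wt H i s = 0 ∧ ∃ n : ℕ, wt H i h = (n : F) + m}
  let P : ℕ → Submodule F L := fun m => Submodule.span F (cb H '' I m)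
  have hei : ∀ i, cb H i ∈ ei (s : L) (h : L) (wt H i h) ↔ wt H i s = 0 := by
    intro i
    rw [mem_ei, lie_cb H i s.2, lie_cb H i h.2]
    constructor
    · rintro ⟨h1, _⟩; exact (smul_eq_zero.mp h1).resolve_right ((cb H).ne_zero _)
    · intro h1; rw [h1, zero_smul]; exact ⟨rfl, rfl⟩
  have heiP : ∀ (m n : ℕ), ei (s : L) (h : L) ((n : F) + m) ≤ P m := by
    intro m n w hw
    obtain ⟨h1, h2⟩ := mem_ei.mp hw
    rw [Basis.mem_span_image]
    intro i hi
    have := (mem_eig_iff H (fun j : Bool => if j then h else s) (fun j => if j then (n : F) + m else 0) w).mp (by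
      intro j; cases j
      · simpa using h1
      · simpa using h2) i (by simpa using hi)
    exact ⟨by simpa using this false, n, by simpa using this true⟩
  have hP0 : (cent F (s : L) ⊓ cent F e : Submodule F L) ≤ P 0 := by
    apply (cartan_ss H h.2).le_of_eig
    · rintro w ⟨h1, h2⟩
      refine ⟨mem_cent.mpr (lie_comm_of hsh (mem_cent.mp h1)), mem_cent.mpr ?_⟩
      have h3 := mem_cent.mp h2
      have h4 : ⁅e, (h : L)⁆ = -((2 : F) • e) := by rw [← lie_skew, hhe]
      rw [leibniz_lie, h3, lie_zero, add_zero, h4, neg_lie, smul_lie, h3, smul_zero, neg_zero]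
    · rintro μ w ⟨h1, h2⟩ h3
      by_cases hw : w = 0
      · rw [hw]; exact zero_mem _
      obtain ⟨j, hj⟩ := hnn w hw (mem_cent.mp h2) μ h3
      apply heiP 0 j
      rw [mem_ei]
      exact ⟨mem_cent.mp h1, by rw [h3, hj]; simp⟩
  have hP2 : P 2 ≤ (P 0).map (ad F L e) := by
    refine Submodule.span_le.mpr ?_
    rintro _ ⟨i, ⟨hi1, n, hi2⟩, rfl⟩
    have h1 := (hei i).mpr hi1
    rw [hi2] at h1
    obtain ⟨u, hu, e1⟩ := ei_surj H s h hse hhe (c := (n : F)) (by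
      intro w hw hw0
      by_contra hne
      obtain ⟨j, hj⟩ := hnn w hne hw0 _ (mem_ei.mp hw).2
      have : ((j + (n + 2) : ℕ) : F) = 0 := by push_cast; rw [← hj]; ring
      have := Nat.cast_eq_zero.mp this
      omega) (by simpa using h1)
    exact ⟨u, heiP 0 n (by simpa using hu), e1.symm⟩
  have h1 := finrank_map_add (ad F L e) (P 0)
  have h2 : finrank F (cent F (s : L) ⊓ cent F e : Submodule F L) ≤ finrank F (P 0 ⊓ LinearMap.ker (ad F L e) : Submodule F L) :=
    Submodule.finrank_mono (le_inf hP0 inf_le_right)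
  have h3 := Submodule.finrank_mono hP2
  have hle : P 0 ≤ P 2 ⊔ (ei (s : L) (h : L) (0 : F) ⊔ ei (s : L) (h : L) (1 : F)) := by
    refine Submodule.span_le.mpr ?_
    rintro _ ⟨i, ⟨hi1, n, hi2⟩, rfl⟩
    have h4 := (hei i).mpr hi1
    rw [hi2] at h4
    rcases n with _ | _ | n
    · exact Submodule.mem_sup_right (Submodule.mem_sup_left (by simpa using h4))
    · exact Submodule.mem_sup_right (Submodule.mem_sup_right (by simpa using h4))
    · exact Submodule.mem_sup_left (Submodule.subset_span ⟨i, ⟨hi1, n, by rw [hi2]; push_cast; ring⟩, rfl⟩)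
  have h5 := Submodule.finrank_mono hle
  have h6 := Submodule.finrank_add_le_finrank_add_finrank (P 2) (ei (s : L) (h : L) (0 : F) ⊔ ei (s : L) (h : L) (1 : F))
  have h7 := Submodule.finrank_add_le_finrank_add_finrank (ei (s : L) (h : L) (0 : F)) (ei (s : L) (h : L) (1 : F))
  omega

end
end CVA
end

section
set_option linter.all false
namespace CVA
open LieAlgebra Module LieAlgebra.IsKilling LieModule

section
variable {F L : Type*} [Field F] [CharZero F] [IsAlgClosed F] [LieRing L] [LieAlgebra F L] [FiniteDimensional F L]
  [IsKilling F L]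

theorem dist_lemma {s e : L} (hs : IsSS F s) (he : IsNil F e) (hse : ⁅s, e⁆ = 0) {r l d : ℕ}
    (hlac : ∀ (H : LieSubalgebra F L) [H.IsCartanSubalgebra], LacLE H l)
    (hr : ∀ (H : LieSubalgebra F L) [H.IsCartanSubalgebra], finrank F H = r)
    (hdl : d = 2 ∧ l ≤ 2 ∨ d = 3 ∧ l ≤ 1) (hd : d + finrank F (zen (cent F s)) = r)
    (hM : ∀ a ∈ der (cent F s), ⁅e, a⁆ = 0 → ∀ b ∈ der (cent F s), ⁅e, b⁆ = 0 → killingForm F L a b = 0) :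
    finrank F (cent F s ⊓ cent F e : Submodule F L) ≤ r := by
  classical
  have hl := isRed_cent (F := F) hs
  have hel : e ∈ cent F s := mem_cent.mpr hse
  obtain ⟨h, hhd, hhss, hhe, hJ, hZ⟩ := jacobson_morozov hl (isJ_cent s) hel he
  have hsh : ⁅s, h⁆ = 0 := mem_cent.mp (hl.der_le hhd)
  obtain ⟨H, hH, hHS⟩ := exists_cartan (F := F) ({s, h} : Set L) (by
    rintro a (rfl | rfl)
    · exact hs
    · exact hhss) (by
    rintro a (rfl | rfl) b (rfl | rfl)
    · exact lie_self _
    · exact hsh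
    · exact comm_symm hsh
    · exact lie_self _)
  obtain ⟨s, rfl⟩ : ∃ s' : H, (s' : L) = s := ⟨⟨s, hHS s (by simp)⟩, rfl⟩
  obtain ⟨h, rfl⟩ : ∃ s' : H, (s' : L) = h := ⟨⟨h, hHS h (by simp)⟩, rfl⟩
  have hnn : ∀ w : L, w ≠ 0 → ⁅e, w⁆ = 0 → ∀ c : F, ⁅(h : L), w⁆ = c • w → ∃ j : ℕ, c = j := by
    intro w h1 h2 c h3
    obtain ⟨j, hj, _⟩ := hJ w h1 h2 c h3
    exact ⟨j, hj⟩
  have hneg : ∀ n : ℕ, 0 < n → ∀ w ∈ ei (s : L) (h : L) (-(n : F)), ⁅e, w⁆ = 0 → w = 0 := by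
    intro n hn w hw hw0
    by_contra hne
    obtain ⟨j, hj⟩ := hnn w hne hw0 _ (mem_ei.mp hw).2
    have : ((j + n : ℕ) : F) = 0 := by push_cast; rw [← hj]; ring
    have := Nat.cast_eq_zero.mp this
    omega
  have hK0 : (ei (s : L) (h : L) (0 : F) ⊓ cent F e : Submodule F L) = zen (cent F (s : L)) := by
    apply le_antisymm
    · rintro w ⟨hw1, hw2⟩
      obtain ⟨hw3, hw4⟩ := mem_ei.mp hw1
      obtain ⟨z, hz, m, hm, rfl⟩ := hl.exists_add (mem_cent.mpr hw3)
      have hzc := (mem_zen.mp hz).2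
      have hem : ⁅e, m⁆ = 0 := by
        have := mem_cent.mp hw2
        rwa [lie_add, hzc e hel, zero_add] at this
      have hhm : ⁅(h : L), m⁆ = (0 : F) • m := by
        rw [zero_smul] at hw4 ⊢
        rwa [lie_add, hzc h (hl.der_le hhd), zero_add] at hw4
      have hme : m ∈ (cent F (s : L)).map (ad F L e) := by
        apply hl.perp
        · rintro _ ⟨u, hu, rfl⟩
          exact hl.lie e hel u hu
        · exact hl.der_le hm
        · intro v hv hvp
          have hev : ⁅e, v⁆ = 0 := by
            apply hl.nd _ (hl.lie e hel v hv)
            intro u hu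
            have := hvp ⁅e, u⁆ ⟨u, hu, rfl⟩
            rw [kf_inv', neg_eq_zero, kf_comm] at this
            exact this
          obtain ⟨z', hz', d', hd', rfl⟩ := hl.exists_add hv
          rw [lie_add, (mem_zen.mp hz').2 e hel, zero_add] at hev
          rw [map_add, (hl.perp_der_iff (zen_le hz')).mpr hz' m hm, hM m hm hem d' hd' hev, add_zero]
      obtain ⟨w2, _, hw2'⟩ := hme
      have hm0 : m = 0 := by
        by_contra hne
        obtain ⟨j, hj, hj'⟩ := hJ m hne hem 0 hhm
        have := hj' ⟨w2, hw2'.symm⟩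
        have := Nat.cast_eq_zero.mp hj.symm
        omega
      rw [hm0, add_zero]; exact hz
    · intro z hz
      obtain ⟨h1, h2⟩ := mem_zen.mp hz
      exact ⟨mem_ei.mpr ⟨mem_cent.mp h1, by rw [zero_smul]; exact h2 h (hl.der_le hhd)⟩, mem_cent.mpr (h2 e hel)⟩
  have e0 := ei_map H s h hse hhe (c := 0) (by simpa using hneg 2 (by norm_num))
  have e1 := ei_map H s h hse hhe (c := -1) (by
    rw [show (-(-1 + 2) : F) = -((1 : ℕ) : F) by norm_num]; exact hneg 1 (by norm_num))
  have hK1 : (ei (s : L) (h : L) (-1 : F) ⊓ cent F e : Submodule F L) = ⊥ := by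
    rw [eq_bot_iff]
    rintro w ⟨h1, h2⟩
    exact hneg 1 one_pos w (by simpa using h1) (mem_cent.mp h2)
  have hev := ei_even H s h hse hhe (by simpa using hneg 1 one_pos)
  rw [hK1, finrank_bot, add_zero, show (-1 + 2 : F) = 1 by norm_num] at e1
  rw [hK0, zero_add] at e0
  rw [← e1] at hev
  have f0 := ei_finrank H s h 0
  have f1 := ei_finrank H s h 1
  have f2 := ei_finrank H s h 2
  rw [if_pos rfl] at f0
  rw [if_neg one_ne_zero, add_zero] at f1
  rw [if_neg two_ne_zero, add_zero] at f2
  have hrH := hr H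
  have hfz := finrank_zen H s
  have hb := bridge H hdl (hlac H) s h (by
    intro α hα
    have := lie_cb H (Sum.inr α) h.2
    exact hZ (cb H (Sum.inr α)) ((cb H).ne_zero _) _ this) (by omega) (by omega) (by rw [← f1]; exact hev)
  have g0 : (Finset.univ.filter fun α : H.root => α.1 s = 0 ∧ α.1 h = 0).card = 0 := by
    rw [Finset.card_eq_zero, Finset.filter_eq_empty_iff]
    rintro α _ ⟨h1, h2⟩
    exact (hb α h1).1 h2
  have g1 : (Finset.univ.filter fun α : H.root => α.1 s = 0 ∧ α.1 h = 1).card = 0 := by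
    rw [Finset.card_eq_zero, Finset.filter_eq_empty_iff]
    rintro α _ ⟨h1, h2⟩
    exact (hb α h1).2 h2
  have := cent_le_pos H s h hse hhe hnn
  omega

end
end CVA
end

section
set_option linter.all false
namespace CVA
open LieAlgebra Module LieAlgebra.IsKilling LieModule

/-- openness of linear independence along lines -/
lemma linInd_line {F V : Type*} [Field F] [CharZero F] [AddCommGroup V] [Module F V] [FiniteDimensional F V]
    {ι : Type*} [Fintype ι] (u w : ι → V) (hu : LinearIndependent F u) (B : Set ℕ) (hB : B.Infinite) :
    ∃ b ∈ B, LinearIndependent F (fun i => u i + (b : F) • w i) := by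
  classical
  obtain ⟨π, hπ⟩ := LinearMap.exists_leftInverse_of_injective (Fintype.linearCombination F u) (by
    rw [LinearMap.ker_eq_bot]; exact hu.fintypeLinearCombination_injective)
  have hπu : ∀ i, π (u i) = Pi.single i 1 := by
    intro i
    have := congrArg (fun f => f (Pi.single i 1)) hπ
    simpa [Fintype.linearCombination_apply_single] using this
  let N : Matrix ι ι F := Matrix.of fun i j => π (w i) j
  let P : Polynomial F := Matrix.det ((1 : Matrix ι ι (Polynomial F)) + (Polynomial.X : Polynomial F) • N.map Polynomial.C)
  have hP : ∀ b : F, P.eval b = Matrix.det (1 + b • N) := by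
    intro b
    have := RingHom.map_det (Polynomial.evalRingHom b) ((1 : Matrix ι ι (Polynomial F)) + (Polynomial.X : Polynomial F) • N.map Polynomial.C)
    rw [Polynomial.coe_evalRingHom] at this
    rw [this]
    congr 1
    ext i j
    simp [Matrix.one_apply, apply_ite]
    exact mul_comm _ _
  have hP0 : P ≠ 0 := by
    intro h
    have := hP 0
    rw [h] at this
    simp at this
  have hfin : {b : ℕ | P.eval (b : F) = 0}.Finite := by
    have h1 : {b : F | P.IsRoot b}.Finite := Polynomial.finite_setOf_isRoot hP0
    exact h1.preimage (f := fun n : ℕ => (n : F)) (Nat.cast_injective.injOn)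
  obtain ⟨b, hb, hb'⟩ := hB.exists_notMem_finite hfin
  refine ⟨b, hb, ?_⟩
  have hdet : Matrix.det (1 + (b : F) • N) ≠ 0 := by rw [← hP]; exact hb'
  apply LinearIndependent.of_comp π
  have : (⇑π ∘ fun i => u i + (b : F) • w i) = (1 + (b : F) • N).row := by
    funext i j
    simp [hπu, N, Matrix.one_apply, Pi.single_apply, eq_comm]
  rw [this]
  exact Matrix.linearIndependent_rows_iff_isUnit.mpr ((Matrix.isUnit_iff_isUnit_det _).mpr (isUnit_iff_ne_zero.mpr hdet))

lemma limit_lemma {F V : Type*} [Field F] [CharZero F] [AddCommGroup V] [Module F V] [FiniteDimensional F V]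
    (A C : V →ₗ[F] V) (φ : V →ₗ[F] F) (B : Set ℕ) (hB : B.Infinite)
    (hdim : ∀ b ∈ B, finrank F (LinearMap.ker A) ≤ finrank F (LinearMap.ker (A + (b : F) • C)))
    (hφ : ∀ b ∈ B, ∀ w, (A + (b : F) • C) w = 0 → φ w = 0) : ∀ w, A w = 0 → φ w = 0 := by
  by_contra hcon
  push Not at hcon
  obtain ⟨w, hw, hw'⟩ := hcon
  let A' : V →ₗ[F] V × F := A.prod φ
  let C' : V →ₗ[F] V × F := C.prod 0
  have hlt : finrank F (LinearMap.ker A') < finrank F (LinearMap.ker A) := by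
    apply Submodule.finrank_lt_finrank_of_lt
    refine lt_of_le_of_ne ?_ ?_
    · intro v hv
      exact (Prod.ext_iff.mp hv).1
    · intro h
      have : w ∈ LinearMap.ker A' := by rw [h]; exact hw
      exact hw' (Prod.ext_iff.mp this).2
  have h1 := LinearMap.finrank_range_add_finrank_ker A'
  obtain ⟨b0⟩ : Nonempty (Basis (Fin (finrank F (LinearMap.range A'))) F (LinearMap.range A')) := ⟨finBasis _ _⟩
  choose v hv using fun i => (b0 i).2
  have hli : LinearIndependent F (fun i => A' (v i)) := by
    have := b0.linearIndependent.map' (LinearMap.range A').subtype (Submodule.ker_subtype _)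
    rw [show (fun i => A' (v i)) = ⇑(LinearMap.range A').subtype ∘ ⇑b0 from funext hv]
    exact this
  obtain ⟨b, hb, hbli⟩ := linInd_line _ (fun i => C' (v i)) hli B hB
  have h2 : (LinearMap.ker (A + (b : F) • C)) ≤ LinearMap.ker (A' + (b : F) • C') := by
    intro u hu
    have hu' : A u + (b : F) • C u = 0 := hu
    have h3 := hφ b hb u hu
    show (A u, φ u) + (b : F) • (C u, (0 : F)) = 0
    ext
    · simpa using hu'
    · simpa using h3
  have h3 := Submodule.finrank_mono h2
  have h4 := LinearMap.finrank_range_add_finrank_ker (A' + (b : F) • C')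
  have h5 : finrank F (LinearMap.range A') ≤ finrank F (LinearMap.range (A' + (b : F) • C')) := by
    have h6 : LinearIndependent F (fun i => (⟨(A' + (b : F) • C') (v i), ⟨_, rfl⟩⟩ : LinearMap.range (A' + (b : F) • C'))) :=
      LinearIndependent.of_comp (LinearMap.range (A' + (b : F) • C')).subtype hbli
    have := h6.fintype_card_le_finrank
    simpa using this
  have h7 := hdim b hb
  omega

section
variable {F L : Type*} [Field F] [CharZero F] [IsAlgClosed F] [LieRing L] [LieAlgebra F L] [FiniteDimensional F L]
  [IsKilling F L]

lemma cent_add {s e : L} (hs : IsSS F s) (he : IsNil F e) (hse : ⁅s, e⁆ = 0) :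
    cent F (s + e) = cent F s ⊓ cent F e := by
  apply le_antisymm
  · intro w hw
    have h1 := mem_cent.mp hw
    rw [add_lie] at h1
    have hc : Commute (ad F L s) (ad F L e) := ad_commute hse
    have h2 : ∀ n : ℕ, (ad F L s ^ n) w = ((-1 : F) ^ n) • (ad F L e ^ n) w := by
      intro n
      induction n with
      | zero => simp
      | succ n ih =>
        rw [pow_succ', Module.End.mul_apply, ih, map_smul]
        have h3 : (ad F L s) w = - (ad F L e) w := by
          rw [ad_apply, ad_apply]; exact eq_neg_of_add_eq_zero_left h1
        rw [← Module.End.mul_apply, (hc.pow_right n).eq, Module.End.mul_apply, h3, map_neg, ← Module.End.mul_apply, ← pow_succ,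
          pow_succ (-1 : F), mul_neg_one, neg_smul, smul_neg]
    obtain ⟨n, hn⟩ := he
    have h4 := h2 n
    rw [hn, LinearMap.zero_apply, smul_zero] at h4
    have h5 : ⁅s, w⁆ = 0 := hs.pow_zero h4
    rw [h5, zero_add] at h1
    exact ⟨mem_cent.mpr h5, mem_cent.mpr h1⟩
  · rintro w ⟨h1, h2⟩
    rw [mem_cent, add_lie, mem_cent.mp h1, mem_cent.mp h2, add_zero]

lemma P1 {s e : L} (hs : IsSS F s) (he : IsNil F e) (hse : ⁅s, e⁆ = 0) (δ : L →+ L)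
    (hδ : ∀ a b, δ ⁅a, b⁆ = ⁅δ a, b⁆ + ⁅a, δ b⁆) {w : L} (hw : w ∈ der (cent F s)) (hew : ⁅e, w⁆ = 0) :
    killingForm F L (δ (s + e)) w = 0 := by
  have hl := isRed_cent (F := F) hs
  have hel : e ∈ cent F s := mem_cent.mpr hse
  obtain ⟨h, hhd, hhss, hhe, hJ, hZ⟩ := jacobson_morozov hl (isJ_cent s) hel he
  have h1 : ∀ w ∈ der (cent F s), killingForm F L (δ s) w = 0 := by
    intro w hw
    refine Submodule.span_induction ?_ ?_ ?_ ?_ hw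
    · rintro _ ⟨a, ha, b, hb, rfl⟩
      have h2 := hδ s a
      rw [mem_cent.mp ha, map_zero] at h2
      rw [← kf_inv, eq_neg_of_add_eq_zero_left h2.symm, map_neg, LinearMap.neg_apply, kf_inv', mem_cent.mp hb, map_zero]
      simp
    · simp
    · intro a b _ _ ha hb; rw [map_add, ha, hb, add_zero]
    · intro c a _ ha; rw [map_smul, ha, smul_zero]
  rw [map_add, map_add, LinearMap.add_apply, h1 w hw, zero_add]
  let M : Submodule F L := der (cent F s) ⊓ cent F e
  have hst : ∀ v ∈ M, ⁅h, v⁆ ∈ M := by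
    rintro v ⟨hv1, hv2⟩
    have h3 := mem_cent.mp hv2
    refine ⟨lie_mem_der (hl.der_le hhd) (hl.der_le hv1), mem_cent.mpr ?_⟩
    have h4 : ⁅e, (h : L)⁆ = -((2 : F) • e) := by rw [← lie_skew, hhe]
    rw [leibniz_lie, h3, lie_zero, add_zero, h4, neg_lie, smul_lie, h3, smul_zero, neg_zero]
  let f : M →ₗ[F] M := (2 : F) • LinearMap.id + (ad F L h).restrict hst
  have hf : ∀ v : M, ((f v : M) : L) = (2 : F) • (v : L) + ⁅h, (v : L)⁆ := fun v => rfl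
  have hinj : Function.Injective f := by
    rw [injective_iff_map_eq_zero]
    intro v hv
    have h3 : (2 : F) • (v : L) + ⁅h, (v : L)⁆ = 0 := by rw [← hf, hv]; rfl
    by_contra hne
    have hne' : (v : L) ≠ 0 := fun h => hne (Subtype.ext h)
    obtain ⟨j, hj, _⟩ := hJ v hne' (mem_cent.mp v.2.2) (-2) (by
      rw [neg_smul]; exact eq_neg_of_add_eq_zero_right h3)
    have : ((j + 2 : ℕ) : F) = 0 := by push_cast; rw [← hj]; ring
    have := Nat.cast_eq_zero.mp this
    omega
  obtain ⟨v, hv⟩ := LinearMap.surjective_of_injective hinj ⟨w, hw, mem_cent.mpr hew⟩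
  have hv' : w = (2 : F) • (v : L) + ⁅h, (v : L)⁆ := by rw [← hf, hv]
  have hde := hδ h e
  rw [hhe, two_smul, map_add] at hde
  rw [hv', map_add, map_smul]
  have h5 : killingForm F L (δ e + δ e) (v : L) = killingForm F L (⁅δ h, e⁆ + ⁅h, δ e⁆) v := by rw [hde]
  rw [map_add, map_add, LinearMap.add_apply, LinearMap.add_apply, kf_inv, mem_cent.mp v.2.2, map_zero, zero_add, kf_inv'] at h5
  rw [smul_eq_mul]
  linear_combination h5

lemma finrank_M {s e : L} (hs : IsSS F s) (hse : ⁅s, e⁆ = 0) :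
    finrank F (zen (cent F s)) + finrank F (der (cent F s) ⊓ cent F e : Submodule F L) =
      finrank F (cent F s ⊓ cent F e : Submodule F L) := by
  have hl := isRed_cent (F := F) hs
  have hel : e ∈ cent F s := mem_cent.mpr hse
  have := Submodule.finrank_sup_add_finrank_inf_eq (zen (cent F s)) (der (cent F s) ⊓ cent F e)
  rw [← inf_assoc, hl.inf_eq, bot_inf_eq, finrank_bot, add_zero] at this
  rw [← this]
  have heq : zen (cent F s) ⊔ der (cent F s) ⊓ cent F e = cent F s ⊓ cent F e := by
    apply le_antisymm
    · refine sup_le (fun z hz => ⟨zen_le hz, mem_cent.mpr ((mem_zen.mp hz).2 e hel)⟩) (inf_le_inf_right _ hl.der_le)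
    · rintro w ⟨h1, h2⟩
      obtain ⟨z, hz, d, hd, rfl⟩ := hl.exists_add h1
      refine Submodule.add_mem_sup hz ⟨hd, mem_cent.mpr ?_⟩
      have := mem_cent.mp h2
      rwa [lie_add, (mem_zen.mp hz).2 e hel, zero_add] at this
  rw [heq]

lemma count {T : Submodule F (L × L)} {M : Submodule F L} (hT : ∀ p ∈ T, ∀ w ∈ M, killingForm F L p.1 w = 0) :
    finrank F T + finrank F M ≤ finrank F L + finrank F (T.comap (LinearMap.inr F L L)) := by
  have h1 := LinearMap.finrank_range_add_finrank_ker ((LinearMap.fst F L L).domRestrict T)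
  have h2 : finrank F (LinearMap.ker ((LinearMap.fst F L L).domRestrict T)) ≤ finrank F (T.comap (LinearMap.inr F L L)) := by
    have : ∀ p : LinearMap.ker ((LinearMap.fst F L L).domRestrict T), (p.1.1 : L × L) = (0, p.1.1.2) := by
      intro p
      ext
      · exact p.2
      · rfl
    let f : LinearMap.ker ((LinearMap.fst F L L).domRestrict T) →ₗ[F] (T.comap (LinearMap.inr F L L)) :=
      LinearMap.codRestrict _ ((LinearMap.snd F L L) ∘ₗ T.subtype ∘ₗ Submodule.subtype _) (by
        intro p
        show ((0 : L), p.1.1.2) ∈ T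
        rw [← this p]; exact p.1.2)
    refine LinearMap.finrank_le_finrank_of_injective (f := f) ?_
    intro p q hpq
    have h3 : p.1.1.2 = q.1.1.2 := congrArg Subtype.val hpq
    apply Subtype.ext; apply Subtype.ext
    rw [this p, this q, h3]
  have h3 : finrank F (LinearMap.range ((LinearMap.fst F L L).domRestrict T)) + finrank F M ≤ finrank F L := by
    let g : L →ₗ[F] Dual F M := (Submodule.subtype M).dualMap ∘ₗ (killingForm F L)
    have hker : LinearMap.range ((LinearMap.fst F L L).domRestrict T) ≤ LinearMap.ker g := by
      rintro _ ⟨p, rfl⟩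
      rw [LinearMap.mem_ker]
      ext w
      exact hT p.1 p.2 w.1 w.2
    have hsurj : Function.Surjective g := by
      have hnd : Function.Injective (killingForm F L) := by
        rw [injective_iff_map_eq_zero]
        intro w hw
        exact kf_nondeg (F := F) fun v => by rw [hw]; rfl
      have h5 : Function.Surjective (killingForm F L) := by
        refine (LinearMap.injective_iff_surjective_of_finrank_eq_finrank ?_).mp hnd
        exact (Subspace.dual_finrank_eq).symm
      exact (LinearMap.dualMap_surjective_of_injective (Submodule.subtype_injective M)).comp h5
    have h6 := LinearMap.finrank_range_add_finrank_ker g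
    rw [LinearMap.range_eq_top.mpr hsurj, finrank_top, Subspace.dual_finrank_eq] at h6
    have := Submodule.finrank_mono hker
    omega
  omega

end
end CVA
end

section
set_option linter.all false
namespace CVA
open LieAlgebra Module LieAlgebra.IsKilling LieModule

section
variable {F L : Type*} [Field F] [CharZero F] [IsAlgClosed F] [LieRing L] [LieAlgebra F L] [FiniteDimensional F L]
  [IsKilling F L]

/-- reduced setup -/
structure Rdc (s e s' e' : L) (B : Set ℕ) (r : ℕ) (T : Submodule F (L × L)) : Prop where
  hs : IsSS F s
  he : IsNil F e
  he' : IsNil F e'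
  hse : ⁅s, e⁆ = 0
  hse' : ⁅s, e'⁆ = 0
  hee' : ⁅e, e'⁆ = 0
  hz : s' ∈ zen (cent F s)
  hB : B.Infinite
  hB0 : 0 ∉ B
  hBs : ∀ b ∈ B, IsSS F (s + (b : F) • s')
  hBc : ∀ b ∈ B, cent F (s + (b : F) • s') = cent F s
  hBd : ∀ b ∈ B, finrank F (cent F (s + e)) ≤ finrank F (cent F (s + e + (b : F) • (s' + e')))
  hr : ∀ (H : LieSubalgebra F L) [H.IsCartanSubalgebra], finrank F H = r
  hT : ∀ p ∈ T, ∃ δ : L →+ L, (∀ a b, δ ⁅a, b⁆ = ⁅δ a, b⁆ + ⁅a, δ b⁆) ∧ δ (s + e) = p.1 ∧ δ (s' + e') = p.2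
  hirr : r < finrank F (cent F (s + e) ⊓ cent F (s' + e') : Submodule F L)

variable {s e s' e' : L} {B : Set ℕ} {r : ℕ} {T : Submodule F (L × L)}

namespace Rdc

lemma cx (R : Rdc s e s' e' B r T) : cent F (s + e) = cent F s ⊓ cent F e := cent_add R.hs R.he R.hse

lemma lxy (R : Rdc s e s' e' B r T) : ⁅s + e, s' + e'⁆ = 0 := by
  have h1 : ⁅s, s'⁆ = 0 := mem_cent.mp R.hz.1
  have h2 : ⁅e, s'⁆ = 0 := R.hz.2 e (mem_cent.mpr R.hse)
  rw [add_lie, lie_add, lie_add, h1, h2, R.hse', R.hee']; simp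

lemma r1 (R : Rdc s e s' e' B r T) {v : L} (hv : v ∈ T.comap (LinearMap.inr F L L)) : v ∈ cent F (s + e) := by
  obtain ⟨δ, h1, h2, h3⟩ := R.hT _ hv
  have h4 := h1 (s + e) (s' + e')
  rw [R.lxy, map_zero, h2, h3] at h4
  simpa [mem_cent] using h4.symm

lemma r2 (R : Rdc s e s' e' B r T) {v : L} (hv : v ∈ T.comap (LinearMap.inr F L L)) {w : L}
    (hw : ⁅s + e, w⁆ = 0) (hw' : ⁅s' + e', w⁆ = 0) : ∃ u ∈ cent F (s + e), ⁅v, w⁆ = ⁅s' + e', u⁆ := by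
  obtain ⟨δ, h1, h2, h3⟩ := R.hT _ hv
  have h4 := h1 (s + e) w
  have h5 := h1 (s' + e') w
  rw [hw, map_zero, h2] at h4
  rw [hw', map_zero, h3] at h5
  refine ⟨-δ w, ?_, ?_⟩
  · rw [mem_cent, lie_neg, neg_eq_zero]
    simpa using h4.symm
  · rw [lie_neg]; exact eq_neg_of_add_eq_zero_left h5.symm

lemma nilb (R : Rdc s e s' e' B r T) (b : F) : IsNil F (e + b • e') := by
  have h1 : IsNilpotent (b • ad F L e') := R.he'.smul b
  have h2 : Commute (ad F L e) (b • ad F L e') := (ad_commute R.hee').smul_right b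
  have := h2.isNilpotent_add R.he h1
  rwa [← map_smul, ← map_add] at this

lemma cxb (R : Rdc s e s' e' B r T) {b : ℕ} (hb : b ∈ B) :
    cent F (s + e + (b : F) • (s' + e')) = cent F s ⊓ cent F (e + (b : F) • e') := by
  have h1 : ⁅s', e⁆ = 0 := comm_symm (R.hz.2 e (mem_cent.mpr R.hse))
  have h2 : ⁅s', e'⁆ = 0 := comm_symm (R.hz.2 e' (mem_cent.mpr R.hse'))
  rw [← R.hBc b hb, ← cent_add (R.hBs b hb) (R.nilb b)]
  · congr 1; rw [smul_add]; abel
  · simp [add_lie, lie_add, R.hse, R.hse', h1, h2]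

lemma r3 (R : Rdc s e s' e' B r T) {v : L} (hv : v ∈ T.comap (LinearMap.inr F L L)) {w : L}
    (hw : w ∈ der (cent F s)) (hw' : ⁅e, w⁆ = 0) : killingForm F L v w = 0 := by
  have hl := isRed_cent (F := F) R.hs
  have hv1 := R.r1 hv
  rw [R.cx] at hv1
  obtain ⟨z, hz, d, hd, rfl⟩ := hl.exists_add hv1.1
  have hzd : ∀ m ∈ der (cent F s), killingForm F L z m = 0 := fun m hm => by
    rw [kf_comm]; exact (hl.perp_der_iff (zen_le hz)).mpr hz m hm
  have hdz : ∀ m ∈ zen (cent F s), killingForm F L d m = 0 := fun m hm =>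
    (hl.perp_der_iff (zen_le hm)).mpr hm d hd
  rw [map_add, LinearMap.add_apply, hzd w hw, zero_add]
  refine limit_lemma (ad F L (s + e)) (ad F L (s' + e')) (killingForm F L d) B R.hB ?_ ?_ w ?_
  · intro b hb
    have h1 := R.hBd b hb
    have h2 : ad F L (s + e) + (b : F) • ad F L (s' + e') = ad F L (s + e + (b : F) • (s' + e')) := by
      rw [map_add _ (s + e), map_smul]
    rw [h2]
    exact h1
  · intro b hb m hm
    have hm1 : m ∈ cent F (s + e + (b : F) • (s' + e')) := by
      rw [mem_cent, add_lie, smul_lie]; exact hm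
    rw [R.cxb hb] at hm1
    obtain ⟨z2, hz2, m2, hm2, rfl⟩ := hl.exists_add hm1.1
    have h3 : ⁅e + (b : F) • e', m2⁆ = 0 := by
      have := mem_cent.mp hm1.2
      rwa [lie_add, hz2.2 _ (Submodule.add_mem _ (mem_cent.mpr R.hse) (Submodule.smul_mem _ _ (mem_cent.mpr R.hse'))), zero_add] at this
    rw [map_add, hdz z2 hz2, zero_add]
    obtain ⟨δ, d1, d2, d3⟩ := R.hT _ hv
    have h1 : ⁅s', e⁆ = 0 := comm_symm (R.hz.2 e (mem_cent.mpr R.hse))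
    have h2 : ⁅s', e'⁆ = 0 := comm_symm (R.hz.2 e' (mem_cent.mpr R.hse'))
    have h4 := P1 (R.hBs b hb) (R.nilb b) (by simp [add_lie, lie_add, R.hse, R.hse', h1, h2]) δ d1 (w := m2)
      (by rw [R.hBc b hb]; exact hm2) h3
    have h5 : s + (b : F) • s' + (e + (b : F) • e') = (s + e) + b • (s' + e') := by
      rw [← Nat.cast_smul_eq_nsmul F, smul_add]; abel
    rw [h5, map_add, map_nsmul, d2, d3] at h4
    have h7 : killingForm F L (0 + b • (z + d)) m2 = 0 := h4
    simp only [zero_add, map_nsmul, LinearMap.smul_apply, map_add, LinearMap.add_apply, hzd m2 hm2] at h7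
    rcases smul_eq_zero.mp h7 with h6 | h6
    · exact absurd hb (by rw [h6]; exact R.hB0)
    · exact h6
  · have := hl.der_le hw
    rw [ad_apply, add_lie, mem_cent.mp this, hw', add_zero]

lemma r4 (R : Rdc s e s' e' B r T) : finrank F T + finrank F (cent F (s + e)) ≤
    finrank F L + finrank F (zen (cent F s)) + finrank F (T.comap (LinearMap.inr F L L)) := by
  have h1 := count (T := T) (M := der (cent F s) ⊓ cent F e) (by
    rintro p hp w ⟨hw, hw'⟩
    obtain ⟨δ, d1, d2, d3⟩ := R.hT _ hp
    rw [← d2]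
    exact P1 R.hs R.he R.hse δ d1 hw (mem_cent.mp hw'))
  have h2 := finrank_M (F := F) R.hs R.hse
  rw [← R.cx] at h2
  omega

lemma codim (R : Rdc s e s' e' B r T) (U : Submodule F L) (hU : U ≤ cent F (s + e))
    (h : ∀ u ∈ U, u ∈ T.comap (LinearMap.inr F L L) → u = 0) :
    finrank F T + finrank F U ≤ finrank F L + finrank F (zen (cent F s)) := by
  have h1 := R.r4
  have h2 := Submodule.finrank_sup_add_finrank_inf_eq U (T.comap (LinearMap.inr F L L))
  have h3 : U ⊓ (T.comap (LinearMap.inr F L L)) = ⊥ := by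
    rw [eq_bot_iff]; rintro u ⟨hu, hu'⟩; exact h u hu hu'
  rw [h3, finrank_bot, add_zero] at h2
  have h4 : U ⊔ (T.comap (LinearMap.inr F L L)) ≤ cent F (s + e) := sup_le hU fun v hv => R.r1 hv
  have := Submodule.finrank_mono h4
  omega

lemma exists_H (hs : IsSS F s) : ∃ H : LieSubalgebra F L, ∃ _ : H.IsCartanSubalgebra, ∃ s0 : H, (s0 : L) = s := by
  obtain ⟨H, h1, h2⟩ := exists_cartan (F := F) ({s} : Set L) (by rintro a rfl; exact hs) (by
    rintro a rfl b rfl; exact lie_self _)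
  exact ⟨H, h1, ⟨s, h2 s rfl⟩, rfl⟩

open Classical in
lemma finrank_cent_ss (H : LieSubalgebra F L) [H.IsCartanSubalgebra] (s : H) : finrank F (cent F (s : L)) =
    (Finset.univ.filter fun α : H.root => α.1 s = 0).card + finrank F H := by
  have := finrank_eig H (fun _ : Unit => s) (fun _ => 0) (cent F (s : L)) (by
    intro w; rw [mem_cent]; simp)
  rw [this]
  simp

lemma exists_neg (H : LieSubalgebra F L) [H.IsCartanSubalgebra] (α : H.root) :
    ∃ β : H.root, (β.1 : H → F) = -(α.1 : H → F) ∧ β ≠ α := by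
  refine ⟨⟨-α.1, ?_⟩, ?_, ?_⟩
  · have := root_nz H α
    simpa [LieSubalgebra.root] using this
  · funext h; simp
  · intro h
    have h1 := congrArg Subtype.val h
    have h2 := root_nz H α
    apply h2
    have h3 : (α.1 : H → F) = - (α.1 : H → F) := by
      conv_lhs => rw [← h1]
      funext h; simp
    funext h
    have := congrFun h3 h
    simp only [Pi.neg_apply] at this
    have h4 : (2 : F) * α.1 h = 0 := by linear_combination this
    simpa using h4

/-- the case of rank zero -/
lemma zen_lt (R : Rdc s e s' e' B r T) : finrank F (zen (cent F s)) < r ∧ finrank F (zen (cent F s)) + 3 ≤ finrank F (cent F s) := by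
  classical
  obtain ⟨H, hH, s, rfl⟩ := exists_H R.hs
  have h1 := finrank_cent_ss H s
  have h2 := finrank_zen H s
  have h3 := R.hr H
  have h4 : r < finrank F (cent F (s : L)) := lt_of_lt_of_le R.hirr (Submodule.finrank_mono (by
    rw [R.cx]; exact inf_le_left.trans inf_le_left))
  have h5 : 0 < (Finset.univ.filter fun α : H.root => α.1 s = 0).card := by omega
  obtain ⟨α, hα⟩ := Finset.card_pos.mp h5
  have hα' := (Finset.mem_filter.mp hα).2
  have h6 : finrank F (Submodule.span F (rl H '' {α | α.1 s = 0})) ≠ 0 := by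
    intro h0
    rw [Submodule.finrank_eq_zero, Submodule.span_eq_bot] at h0
    have := h0 (rl H α) ⟨α, hα', rfl⟩
    apply root_nz H α
    funext h
    rw [← rl_apply, this]; rfl
  have h7 : 1 < (Finset.univ.filter fun α : H.root => α.1 s = 0).card := by
    rw [Finset.one_lt_card]
    obtain ⟨β, hβ, hne⟩ := exists_neg H α
    refine ⟨α, hα, β, ?_, hne.symm⟩
    simp [hβ, hα']
  omega

lemma case_zero (R : Rdc s e s' e' B r T) (he0 : e = 0) : finrank F T + 4 ≤ finrank F L + r := by
  have hl := isRed_cent (F := F) R.hs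
  obtain ⟨h1, h2⟩ := R.zen_lt
  have hx : cent F (s + e) = cent F s := by rw [he0, add_zero]
  obtain ⟨b, hb⟩ := R.hB.nonempty
  have h3 := R.hBd b hb
  rw [R.cxb hb, hx] at h3
  have h4 : cent F s ⊓ cent F (e + (b : F) • e') = cent F s :=
    Submodule.eq_of_le_of_finrank_le inf_le_left h3
  have hb0 : (b : F) ≠ 0 := by
    intro h; rw [Nat.cast_eq_zero] at h; exact R.hB0 (h ▸ hb)
  have h5 : ∀ w ∈ cent F s, ⁅s' + e', w⁆ = 0 := by
    intro w hw
    rw [← h4] at hw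
    have := mem_cent.mp hw.2
    rw [he0, zero_add, smul_lie] at this
    rw [add_lie, comm_symm (R.hz.2 w hw.1), (smul_eq_zero.mp this).resolve_left hb0, add_zero]
  have h6 := R.codim (der (cent F s)) (by rw [hx]; exact hl.der_le) (by
    intro u hu hu'
    apply hl.zen_disj _ hu
    refine ⟨hl.der_le hu, fun w hw => ?_⟩
    obtain ⟨u2, hu2, h7⟩ := R.r2 hu' (w := w) (by rw [he0, add_zero]; exact mem_cent.mp hw) (h5 w hw)
    rw [h5 u2 (by rwa [hx] at hu2)] at h7
    exact comm_symm h7)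
  have h8 := hl.finrank_add
  omega

end Rdc
end
end CVA
end

section
set_option linter.all false
namespace CVA
open LieAlgebra Module LieAlgebra.IsKilling LieModule

section
variable {F L : Type*} [Field F] [CharZero F] [IsAlgClosed F] [LieRing L] [LieAlgebra F L] [FiniteDimensional F L]
  [IsKilling F L]
variable (H : LieSubalgebra F L) [H.IsCartanSubalgebra]

lemma root_one (α : H.root) {e w : L} (he : e ∈ rootSpace H α.1) (he0 : e ≠ 0) (hw : w ∈ rootSpace H α.1) :
    ∃ c : F, w = c • e := by
  obtain ⟨c, hc⟩ := (finrank_eq_one_iff_of_nonzero' (⟨e, he⟩ : rootSpace H α.1) (by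
    intro h; exact he0 (congrArg Subtype.val h))).mp (finrank_rootSpace_eq_one α.1 (root_nz H α)) ⟨w, hw⟩
  exact ⟨c, (congrArg Subtype.val hc).symm⟩

lemma nn_root (α : H.root) {e w : L} (he : e ∈ rootSpace H α.1) (hw0 : w ≠ 0) (he0 : e ≠ 0) (hew : ⁅e, w⁆ = 0)
    {c : F} (hw : ⁅((coroot α.1 : H) : L), w⁆ = c • w) : ∃ n : ℕ, c = n := by
  obtain ⟨h, e1, f, t, h1, h2⟩ := exists_isSl2Triple_of_weight_isNonZero (root_nz H α)
  have h3 := IsSl2Triple.h_eq_coroot (root_nz H α) t h1 h2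
  obtain ⟨c1, hc1⟩ := root_one H α he he0 h1
  have P : t.HasPrimitiveVectorWith w c := ⟨hw0, by rw [h3]; exact hw, by rw [hc1, smul_lie, hew, smul_zero]⟩
  exact P.exists_nat

lemma root_ext {α β : H.root} (h : ∀ x, α.1 x = β.1 x) : α = β := by
  apply rl_inj H
  ext x
  rw [rl_apply, rl_apply, h]

lemma exists_gen : ∃ h : H, (∀ α : H.root, α.1 h ≠ 0) ∧ ∀ α β : H.root, α ≠ β → α.1 h ≠ β.1 h := by
  obtain ⟨h, hh⟩ := Module.Dual.exists_forall_ne_zero_of_forall_exists (K := F) (M := H)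
    (ι := H.root ⊕ {p : H.root × H.root // p.1 ≠ p.2})
    (Sum.elim (fun α => rl H α) (fun p => rl H p.1.1 - rl H p.1.2)) (by
      rintro (α | ⟨⟨α, β⟩, hne⟩)
      · by_contra hcon
        push Not at hcon
        apply root_nz H α
        funext x
        have := hcon x
        rwa [Sum.elim_inl, rl_apply] at this
      · by_contra hcon
        push Not at hcon
        apply hne
        apply root_ext H
        intro x
        have := hcon x
        rw [Sum.elim_inr, LinearMap.sub_apply, rl_apply, rl_apply, sub_eq_zero] at this
        exact this)
  refine ⟨h, fun α => ?_, fun α β hne he => ?_⟩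
  · have := hh (Sum.inl α)
    rwa [Sum.elim_inl, rl_apply] at this
  · have := hh (Sum.inr ⟨(α, β), hne⟩)
    rw [Sum.elim_inr, LinearMap.sub_apply, rl_apply, rl_apply, sub_ne_zero] at this
    exact this he

lemma prop_pm (α β : H.root) (c : F) (h : rl H β = c • rl H α) : (∀ x, β.1 x = - α.1 x) ∨ β = α := by
  rcases eq_neg_or_eq_of_eq_smul α.1 β.1 (root_nz H β) c (by
    funext x
    have := LinearMap.congr_fun h x
    rw [LinearMap.smul_apply, rl_apply, rl_apply] at this
    exact this) with h1 | h1
  · left; intro x; rw [h1]; simp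
  · right; exact Subtype.ext h1

lemma prop_of_finrank {V : Type*} [AddCommGroup V] [Module F V] [FiniteDimensional F V] {W : Submodule F V}
    (hW : finrank F W ≤ 1) {p q : V} (hp : p ∈ W) (hq : q ∈ W) : ∃ a b : F, (a ≠ 0 ∨ b ≠ 0) ∧ a • p + b • q = 0 := by
  obtain ⟨v, hv⟩ := finrank_le_one_iff.mp hW
  obtain ⟨a, ha⟩ := hv ⟨p, hp⟩
  obtain ⟨b, hb⟩ := hv ⟨q, hq⟩
  have ha' : a • (v : V) = p := congrArg Subtype.val ha
  have hb' : b • (v : V) = q := congrArg Subtype.val hb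
  by_cases h0 : a = 0
  · exact ⟨1, 0, Or.inl one_ne_zero, by rw [← ha', h0]; simp⟩
  · exact ⟨b, -a, Or.inr (neg_ne_zero.mpr h0), by rw [← ha', ← hb', smul_smul, smul_smul, ← add_smul]; ring_nf; simp⟩

lemma prop_span {S : Set H.root} (hS : finrank F (Submodule.span F (rl H '' S)) ≤ 1) {α β : H.root} (hα : α ∈ S) (hβ : β ∈ S) :
    (∀ x, β.1 x = - α.1 x) ∨ β = α := by
  obtain ⟨a, b, hab, h⟩ := prop_of_finrank hS (Submodule.subset_span ⟨α, hα, rfl⟩) (Submodule.subset_span ⟨β, hβ, rfl⟩)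
  have hα0 : rl H α ≠ 0 := by
    intro h0; apply root_nz H α; funext x; rw [← rl_apply, h0]; rfl
  have hb : b ≠ 0 := by
    rintro rfl
    rw [zero_smul, add_zero, smul_eq_zero] at h
    rcases hab with h1 | h1
    · exact h.elim h1 hα0
    · exact h1 rfl
  apply prop_pm H α β (-(b⁻¹ * a))
  ext x
  have h2 := LinearMap.congr_fun h x
  simp only [LinearMap.add_apply, LinearMap.smul_apply, LinearMap.zero_apply, smul_eq_mul] at h2
  rw [LinearMap.smul_apply, smul_eq_mul]
  have h3 : b⁻¹ * b = 1 := inv_mul_cancel₀ hb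
  linear_combination b⁻¹ * h2 - (rl H β) x * h3

/-- structure of centralizers of root vectors -/
lemma cent_e_le (s : H) (α : H.root) {e : L} (he : e ∈ rootSpace H α.1) (he0 : e ≠ 0) :
    (cent F (s : L) ⊓ cent F e : Submodule F L) ≤
      ((LinearMap.ker (rl H α)).map H.toSubmodule.subtype) ⊔
      Submodule.span F ((fun β : H.root => cb H (Sum.inr β)) '' {β | β.1 s = 0 ∧ 0 ≤ pz H β α}) := by
  classical
  obtain ⟨h, hh1, hh2⟩ := exists_gen H
  apply (cartan_ss H h.2).le_of_eig
  · rintro w ⟨h1, h2⟩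
    refine ⟨mem_cent.mpr (lie_comm_of (cartan_comm H s.2 h.2) (mem_cent.mp h1)), mem_cent.mpr ?_⟩
    have h3 := mem_cent.mp h2
    have h4 : ⁅e, (h : L)⁆ = -(α.1 h • e) := by rw [← lie_skew, lie_root H he h.2]
    rw [leibniz_lie, h3, lie_zero, add_zero, h4, neg_lie, smul_lie, h3, smul_zero, neg_zero]
  · rintro μ w ⟨h1, h2⟩ h3
    have h4 := (mem_eig_iff H (fun j : Bool => if j then h else s) (fun j => if j then μ else 0) w).mp (by
      intro j; cases j
      · simpa using mem_cent.mp h1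
      · simpa using h3)
    simp only [Bool.forall_bool, if_true, Bool.false_eq_true, if_false] at h4
    by_cases hμ : μ = 0
    · apply Submodule.mem_sup_left
      have hwH : w ∈ H := by
        have : w ∈ Submodule.span F (cb H '' (Set.range Sum.inl)) := by
          rw [Basis.mem_span_image]
          intro i hi
          rcases i with i | β
          · exact ⟨i, rfl⟩
          · have := (h4 (Sum.inr β) (by simpa using hi)).2
            rw [hμ] at this
            exact absurd this (hh1 β)
        refine Submodule.span_le.mpr ?_ this
        rintro _ ⟨_, ⟨i, rfl⟩, rfl⟩
        exact cb_inl H i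
      refine ⟨⟨w, hwH⟩, ?_, rfl⟩
      have h5 := lie_root H he hwH
      have h6 := comm_symm (mem_cent.mp h2)
      rw [h6] at h5
      show rl H α ⟨w, hwH⟩ = 0
      rw [rl_apply]
      exact (smul_eq_zero.mp h5.symm).resolve_right he0
    · by_cases hw0 : w = 0
      · rw [hw0]; exact zero_mem _
      apply Submodule.mem_sup_right
      obtain ⟨β, hβ⟩ : ∃ β : H.root, (cb H).repr w (Sum.inr β) ≠ 0 := by
        by_contra hcon
        push Not at hcon
        apply hw0
        apply (cb H).repr.injective
        ext i
        rcases i with i | β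
        · by_contra hi
          exact hμ (h4 (Sum.inl i) (by simpa using hi)).2.symm
        · simpa using hcon β
      have hβ' := h4 _ hβ
      have hw : w = (cb H).repr w (Sum.inr β) • cb H (Sum.inr β) := by
        apply (cb H).repr.injective
        ext i
        rw [map_smul, Basis.repr_self, Finsupp.smul_single, smul_eq_mul, mul_one, Finsupp.single_apply]
        split_ifs with hi
        · rw [hi]
        · by_contra hne
          have h7 := h4 i hne
          rcases i with i | γ
          · exact hμ h7.2.symm
          · apply hh2 β γ (by rintro rfl; exact hi rfl)
            exact hβ'.2.trans h7.2.symm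
      rw [hw]
      apply Submodule.smul_mem
      apply Submodule.subset_span
      refine ⟨β, ⟨hβ'.1, ?_⟩, rfl⟩
      have h8 : ⁅e, cb H (Sum.inr β)⁆ = 0 := by
        have := mem_cent.mp h2
        rw [hw, lie_smul] at this
        exact (smul_eq_zero.mp this).resolve_left hβ
      obtain ⟨n, hn⟩ := nn_root H α he ((cb H).ne_zero (Sum.inr β)) he0 h8 (lie_cb H (Sum.inr β) (coroot α.1).2)
      have h9 : (pz H β α : F) = n := by rw [pz_cast]; exact hn
      have : pz H β α = n := by exact_mod_cast h9
      omega

lemma root_add {α β : H.root} (h : pz H α β < 0) (h' : rl H α ≠ - rl H β) : ∃ γ : H.root, rl H γ = rl H α + rl H β :=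
  (rootSystem H).root_add_root_mem_of_pairingIn_neg h h'

lemma root_sub {α β : H.root} (h : 0 < pz H α β) (h' : α ≠ β) : ∃ γ : H.root, rl H γ = rl H α - rl H β :=
  (rootSystem H).root_sub_root_mem_of_pairingIn_pos h h'

lemma pz_eq {γ δ : H.root} {z : ℤ} (h : rl H γ (coroot δ.1) = z) : pz H γ δ = z := by
  have : (pz H γ δ : F) = z := by rw [pz_cast, ← rl_apply, h]
  exact_mod_cast this

lemma rl_coroot (α β : H.root) : rl H α (coroot β.1) = (pz H α β : F) := by rw [rl_apply, pz_cast]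

lemma pz_self (α : H.root) : pz H α α = 2 := by
  apply pz_eq; rw [rl_apply, root_apply_coroot (root_nz H α)]; simp

lemma pz_pos (α β : H.root) : 0 < pz H α β ↔ 0 < pz H β α := (rootSystem H).zero_lt_pairingIn_iff' ℤ

lemma lie_rootSpace {α β : H.root} {a b : L} (ha : a ∈ rootSpace H α.1) (hb : b ∈ rootSpace H β.1) :
    ⁅a, b⁆ ∈ rootSpace H ((α.1 : H → F) + (β.1 : H → F)) :=
  lie_mem_genWeightSpace_of_mem_genWeightSpace ha hb

lemma lie_eq_zero_of {α β : H.root} {a b : L} (ha : a ∈ rootSpace H α.1) (hb : b ∈ rootSpace H β.1)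
    (h0 : rl H α + rl H β ≠ 0) (h1 : ∀ γ : H.root, rl H γ ≠ rl H α + rl H β) : ⁅a, b⁆ = 0 := by
  have h2 := lie_rootSpace H ha hb
  by_contra hne
  have h3 : rootSpace H ((α.1 : H → F) + (β.1 : H → F)) ≠ ⊥ := by
    intro h; rw [h] at h2; exact hne h2
  let γ : Weight F H L := ⟨(α.1 : H → F) + (β.1 : H → F), h3⟩
  have hγ : γ.IsNonZero := by
    intro hz
    apply h0
    ext x
    have := congrFun hz x
    rw [LinearMap.add_apply, rl_apply, rl_apply]
    exact this
  refine h1 ⟨γ, by simpa [LieSubalgebra.root] using hγ⟩ ?_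
  ext x
  rw [LinearMap.add_apply, rl_apply, rl_apply, rl_apply]
  rfl

lemma lie_mem_of {α β γ : H.root} {a b : L} (ha : a ∈ rootSpace H α.1) (hb : b ∈ rootSpace H β.1)
    (h : rl H γ = rl H α + rl H β) : ⁅a, b⁆ ∈ rootSpace H γ.1 := by
  have h2 := lie_rootSpace H ha hb
  have : (γ.1 : H → F) = (α.1 : H → F) + (β.1 : H → F) := by
    funext x
    rw [Pi.add_apply, ← rl_apply, ← rl_apply, ← rl_apply, h, LinearMap.add_apply]
  rwa [← this] at h2

lemma lie_ne_zero_of {α β : H.root} {a b : L} (ha : a ∈ rootSpace H α.1) (hb : b ∈ rootSpace H β.1) (ha0 : a ≠ 0) (hb0 : b ≠ 0)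
    (h : pz H β α < 0) : ⁅a, b⁆ ≠ 0 := by
  intro h0
  obtain ⟨n, hn⟩ := nn_root H α ha hb0 ha0 h0 (lie_root H hb (coroot α.1).2)
  have h9 : (pz H β α : F) = n := by rw [pz_cast]; exact hn
  have : pz H β α = n := by exact_mod_cast h9
  omega

end

namespace Rdc
section
variable {F L : Type*} [Field F] [CharZero F] [IsAlgClosed F] [LieRing L] [LieAlgebra F L] [FiniteDimensional F L]
  [IsKilling F L]
variable {s e s' e' : L} {B : Set ℕ} {r : ℕ} {T : Submodule F (L × L)}

lemma case_one (R : Rdc s e s' e' B r T) (he0 : e ≠ 0) : finrank F (zen (cent F s)) + 2 ≤ r := by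
  classical
  by_contra hcon
  have hzl := R.zen_lt.1
  have hl := isRed_cent (F := F) R.hs
  have hs := R.hs
  have hse := R.hse
  have hirr : r < finrank F (cent F s ⊓ cent F e : Submodule F L) := by
    refine lt_of_lt_of_le R.hirr (Submodule.finrank_mono ?_)
    rw [← R.cx]; exact inf_le_left
  have hr := fun H => @R.hr H
  have he := R.he
  clear R
  have hel : e ∈ cent F s := mem_cent.mpr hse
  obtain ⟨h, hhd, hhss, hhe, hJ, hZ⟩ := jacobson_morozov hl (isJ_cent s) hel he
  have hsh : ⁅s, h⁆ = 0 := mem_cent.mp (hl.der_le hhd)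
  obtain ⟨H, hH, hHS⟩ := exists_cartan (F := F) ({s, h} : Set L) (by
    rintro a (rfl | rfl)
    · exact hs
    · exact hhss) (by
    rintro a (rfl | rfl) b (rfl | rfl)
    · exact lie_self _
    · exact hsh
    · exact comm_symm hsh
    · exact lie_self _)
  obtain ⟨s, rfl⟩ : ∃ s' : H, (s' : L) = s := ⟨⟨s, hHS s (by simp)⟩, rfl⟩
  obtain ⟨h, rfl⟩ : ∃ s' : H, (s' : L) = h := ⟨⟨h, hHS h (by simp)⟩, rfl⟩
  have hfz := finrank_zen H s
  have hrH := hr H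
  have hei : e ∈ ei (s : L) (h : L) (2 : F) := mem_ei.mpr ⟨hse, hhe⟩
  have f0 := ei_finrank H s h 0
  have f1 := ei_finrank H s h 1
  have f2 := ei_finrank H s h 2
  rw [if_pos rfl] at f0
  rw [if_neg one_ne_zero, add_zero] at f1
  rw [if_neg two_ne_zero, add_zero] at f2
  have hpos : finrank F (ei (s : L) (h : L) (2 : F)) ≠ 0 := by
    intro h0
    rw [Submodule.finrank_eq_zero] at h0
    rw [h0] at hei
    exact he0 hei
  rw [f2] at hpos
  obtain ⟨α, hα⟩ := Finset.card_pos.mp (Nat.pos_of_ne_zero hpos)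
  obtain ⟨_, hα1, hα2⟩ := Finset.mem_filter.mp hα
  have key : ∀ β : H.root, β.1 s = 0 → β.1 h = 2 ∨ β.1 h = -2 := by
    intro β hβ
    rcases prop_span H (S := {α | α.1 s = 0}) (by omega) hα1 hβ with h1 | rfl
    · right; rw [h1, hα2]
    · left; exact hα2
  have g0 : (Finset.univ.filter fun α : H.root => α.1 s = 0 ∧ α.1 h = 0).card = 0 := by
    rw [Finset.card_eq_zero, Finset.filter_eq_empty_iff]
    rintro β _ ⟨h1, h2⟩
    have := key β h1
    rw [h2] at this
    norm_num at this
  have g1 : (Finset.univ.filter fun α : H.root => α.1 s = 0 ∧ α.1 h = 1).card = 0 := by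
    rw [Finset.card_eq_zero, Finset.filter_eq_empty_iff]
    rintro β _ ⟨h1, h2⟩
    have := key β h1
    rw [h2] at this
    rcases this with h3 | h3
    · norm_num at h3
    · have : (3 : F) = 0 := by linear_combination h3
      norm_num at this
  have := cent_le_pos H s h hse hhe (fun w h1 h2 c h3 => by
    obtain ⟨j, hj, _⟩ := hJ w h1 h2 c h3
    exact ⟨j, hj⟩)
  omega

end
end Rdc
end CVA
end

section
set_option linter.all false
namespace CVA
open LieAlgebra Module LieAlgebra.IsKilling LieModule

section
variable {F L : Type*} [Field F] [CharZero F] [IsAlgClosed F] [LieRing L] [LieAlgebra F L] [FiniteDimensional F L]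
  [IsKilling F L]
variable (H : LieSubalgebra F L) [H.IsCartanSubalgebra]

lemma lac_pz {l : ℕ} (hlac : LacLE H l) {α β : H.root} (h1 : α ≠ β) (h2 : rl H α ≠ - rl H β) : |pz H α β| ≤ l := by
  refine hlac α β h1 (fun h => h2 ?_) _ (pz_cast H α β).symm
  ext x
  rw [LinearMap.neg_apply, rl_apply, rl_apply, h]; rfl

lemma pz_neg {α β γ : H.root} (h : rl H α = - rl H β) : pz H α γ = - pz H β γ := by
  apply pz_eq
  rw [h, LinearMap.neg_apply, rl_coroot]; simp

lemma pz_add {α β γ δ : H.root} (h : rl H α = rl H β + rl H δ) : pz H α γ = pz H β γ + pz H δ γ := by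
  apply pz_eq
  rw [h, LinearMap.add_apply, rl_coroot, rl_coroot]; simp

lemma pz_sub {α β γ δ : H.root} (h : rl H α = rl H β - rl H δ) : pz H α γ = pz H β γ - pz H δ γ := by
  apply pz_eq
  rw [h, LinearMap.sub_apply, rl_coroot, rl_coroot]; simp

lemma exists_neg' (α : H.root) : ∃ β : H.root, rl H β = - rl H α := by
  obtain ⟨β, h, _⟩ := Rdc.exists_neg H α
  refine ⟨β, ?_⟩
  ext x
  rw [LinearMap.neg_apply, rl_apply, rl_apply, h]; rfl

lemma rl_ne_zero (α : H.root) : rl H α ≠ 0 := by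
  intro h0; apply root_nz H α; funext x; rw [← rl_apply, h0]; rfl

lemma cb_mem_der (s : H) {β : H.root} (hβ : β.1 s = 0) : cb H (Sum.inr β) ∈ der (cent F (s : L)) := by
  have h1 : cb H (Sum.inr β) ∈ cent F (s : L) := by
    rw [mem_cent, lie_cb H _ s.2]; simp only [wt]
    show β.1 s • _ = _
    rw [hβ, zero_smul]
  have h2 : ((coroot β.1 : H) : L) ∈ cent F (s : L) := mem_cent.mpr (cartan_comm H s.2 (coroot β.1).2)
  have h3 := lie_mem_der h2 h1
  have h4 : ⁅((coroot β.1 : H) : L), cb H (Sum.inr β)⁆ = (2 : F) • cb H (Sum.inr β) := by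
    rw [lie_root H (cb_inr H β) (coroot β.1).2]
    congr 1
    exact root_apply_coroot (root_nz H β)
  rw [h4] at h3
  have := Submodule.smul_mem _ (2 : F)⁻¹ h3
  rwa [smul_smul, inv_mul_cancel₀ two_ne_zero, one_smul] at this

lemma kf_cb_ne {α β : H.root} (h : rl H β = - rl H α) : killingForm F L (cb H (Sum.inr α)) (cb H (Sum.inr β)) ≠ 0 := by
  intro h0
  have hn : (β.1 : H → F) = -(α.1 : H → F) := by
    funext x
    rw [← rl_apply, h, LinearMap.neg_apply, rl_apply]; rfl
  have := mem_ker_killingForm_of_mem_rootSpace_of_forall_rootSpace_neg F L H (cb_inr H α) (by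
    intro y hy
    rw [← hn] at hy
    obtain ⟨c, rfl⟩ := root_one H β (cb_inr H β) ((cb H).ne_zero _) hy
    rw [map_smul, h0, smul_zero])
  rw [ker_killingForm_eq_bot] at this
  exact (cb H).ne_zero (Sum.inr α) this

lemma kf_cb_self (α : H.root) : killingForm F L (cb H (Sum.inr α)) (cb H (Sum.inr α)) = 0 := by
  refine killingForm_apply_eq_zero_of_mem_rootSpace_of_add_ne_zero F L H (cb_inr H α) (cb_inr H α) ?_
  intro h
  apply root_nz H α
  funext x
  have := congrFun h x
  simp only [Pi.add_apply, Pi.zero_apply] at this ⊢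
  exact self_eq_neg.mp (eq_neg_of_add_eq_zero_left this)

end

section
variable {F L : Type*} [Field F] [CharZero F] [IsAlgClosed F] [LieRing L] [LieAlgebra F L] [FiniteDimensional F L]
  [IsKilling F L]

/-- when the reductive part is of rank two and the centralizer has a semisimple part, `e` is a root vector. -/
lemma single_root {s e : L} (hs : IsSS F s) (he : IsNil F e) (hse : ⁅s, e⁆ = 0) {r : ℕ} (he0 : e ≠ 0)
    (hr : ∀ (H : LieSubalgebra F L) [H.IsCartanSubalgebra], finrank F H = r)
    (hd : finrank F (zen (cent F s)) + 2 = r)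
    {a b : L} (ha : a ∈ der (cent F s)) (ha' : ⁅e, a⁆ = 0) (hb : b ∈ der (cent F s)) (hb' : ⁅e, b⁆ = 0)
    (hab : killingForm F L a b ≠ 0) :
    ∃ (H : LieSubalgebra F L) (_ : H.IsCartanSubalgebra) (s0 : H) (α : H.root), (s0 : L) = s ∧ α.1 s0 = 0 ∧ e ∈ rootSpace H α.1 := by
  classical
  have hl := isRed_cent (F := F) hs
  have hel : e ∈ cent F s := mem_cent.mpr hse
  obtain ⟨a, ha, ha', haa⟩ : ∃ a ∈ der (cent F s), ⁅e, a⁆ = 0 ∧ killingForm F L a a ≠ 0 := by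
    by_contra hcon
    push Not at hcon
    have h1 := hcon (a + b) (Submodule.add_mem _ ha hb) (by rw [lie_add, ha', hb', add_zero])
    have h2 := hcon a ha ha'
    have h3 := hcon b hb hb'
    rw [map_add, map_add, LinearMap.add_apply, LinearMap.add_apply, h2, h3, kf_comm b a] at h1
    apply hab
    have : 2 * killingForm F L a b = 0 := by linear_combination h1
    simpa using this
  have hasl := hl.der_le ha
  obtain ⟨h0, n0, rfl, hss, hn, hc, hj, -⟩ := jordan (F := F) a
  have c1 : ⁅h0, s⁆ = 0 := hj s (comm_symm (mem_cent.mp hasl))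
  have c2 : ⁅h0, e⁆ = 0 := hj e (comm_symm ha')
  have h0l : h0 ∈ cent F s := mem_cent.mpr (comm_symm c1)
  have n0l : n0 ∈ cent F s := by
    have := Submodule.sub_mem _ hasl h0l
    rwa [add_sub_cancel_left] at this
  have n0d := hl.nil_mem_der hn n0l
  have h0d : h0 ∈ der (cent F s) := by
    have := Submodule.sub_mem _ ha n0d
    rwa [add_sub_cancel_right] at this
  have h0z : h0 ∉ zen (cent F s) := by
    intro hz
    have := hl.zen_disj hz h0d
    rw [this, zero_add] at haa
    exact haa (kf_eq_zero_of_nil hn (lie_self _))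
  have hl1 : IsRed F (cent F s ⊓ cent F h0) := hl.inf_cent hss (fun w hw => hl.lie _ h0l _ hw)
  obtain ⟨h', hh'd, hh'ss, hh'e, -, -⟩ := jacobson_morozov hl1 ((isJ_cent s).inf (isJ_cent h0)) ⟨hel, mem_cent.mpr c2⟩ he
  have hh'l := hl1.der_le hh'd
  have c3 : ⁅s, h'⁆ = 0 := mem_cent.mp hh'l.1
  have c4 : ⁅h0, h'⁆ = 0 := mem_cent.mp hh'l.2
  obtain ⟨H, hH, hHS⟩ := exists_cartan (F := F) ({s, h0, h'} : Set L) (by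
    rintro a (rfl | rfl | rfl)
    · exact hs
    · exact hss
    · exact hh'ss) (by
    rintro a (rfl | rfl | rfl) b (rfl | rfl | rfl)
    · exact lie_self _
    · exact comm_symm c1
    · exact c3
    · exact c1
    · exact lie_self _
    · exact c4
    · exact comm_symm c3
    · exact comm_symm c4
    · exact lie_self _)
  obtain ⟨s, rfl⟩ : ∃ s' : H, (s' : L) = s := ⟨⟨s, hHS s (by simp)⟩, rfl⟩
  obtain ⟨h0, rfl⟩ : ∃ s' : H, (s' : L) = h0 := ⟨⟨h0, hHS h0 (by simp)⟩, rfl⟩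
  obtain ⟨h', rfl⟩ : ∃ s' : H, (s' : L) = h' := ⟨⟨h', hHS h' (by simp)⟩, rfl⟩
  have hfz := finrank_zen H s
  have hrH := hr H
  have hW : finrank F (Submodule.span F (rl H '' {α | α.1 s = 0})) = 2 := by omega
  obtain ⟨γ, hγ1, hγ2⟩ : ∃ γ : H.root, γ.1 s = 0 ∧ γ.1 h0 ≠ 0 := by
    by_contra hcon
    push Not at hcon
    exact h0z ((zen_iff H s h0).mpr ⟨h0.2, hcon⟩)
  have hW' : finrank F (Submodule.span F (rl H '' {α | α.1 s = 0 ∧ α.1 h0 = 0})) ≤ 1 := by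
    have : Submodule.span F (rl H '' {α | α.1 s = 0 ∧ α.1 h0 = 0}) < Submodule.span F (rl H '' {α | α.1 s = 0}) := by
      refine lt_of_le_of_ne (Submodule.span_mono (Set.image_mono fun α h => h.1)) ?_
      intro heq
      have h1 : rl H γ ∈ Submodule.span F (rl H '' {α | α.1 s = 0}) := Submodule.subset_span ⟨γ, hγ1, rfl⟩
      rw [← heq] at h1
      have h2 : Submodule.span F (rl H '' {α | α.1 s = 0 ∧ α.1 h0 = 0}) ≤ LinearMap.ker (Dual.eval F H h0) := by
        rw [Submodule.span_le]
        rintro _ ⟨β, hβ, rfl⟩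
        show rl H β h0 = 0
        rw [rl_apply]; exact hβ.2
      have h3 : rl H γ h0 = 0 := h2 h1
      rw [rl_apply] at h3
      exact hγ2 h3
    have := Submodule.finrank_lt_finrank_of_lt this
    omega
  have h4 := (mem_eig_iff H (fun j : Fin 3 => ![s, h0, h'] j) (fun j => ![0, 0, (2:F)] j) e).mp (by
      intro j; fin_cases j
      · simpa using hse
      · simpa using c2
      · simpa using hh'e)
  simp only [Fin.forall_fin_succ, Fin.isValue, Matrix.cons_val_zero, Matrix.cons_val_succ, IsEmpty.forall_iff, and_true] at h4
  obtain ⟨i, hi⟩ : ∃ i, (cb H).repr e i ≠ 0 := by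
    by_contra hcon
    push Not at hcon
    exact he0 ((cb H).repr.injective (by ext i; simpa using hcon i))
  rcases i with i | α
  · have := (h4 _ hi).2.2
    exact absurd this.symm two_ne_zero
  · obtain ⟨q1, q2, q3⟩ := h4 _ hi
    refine ⟨H, hH, s, α, rfl, q1, ?_⟩
    have hw : e = (cb H).repr e (Sum.inr α) • cb H (Sum.inr α) := by
      apply (cb H).repr.injective
      ext i
      rw [map_smul, Basis.repr_self, Finsupp.smul_single, smul_eq_mul, mul_one, Finsupp.single_apply]
      split_ifs with hi
      · rw [hi]
      · by_contra hne
        obtain ⟨p1, p2, p3⟩ := h4 i hne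
        rcases i with i | γ
        · exact absurd p3.symm two_ne_zero
        · rcases prop_span H hW' (⟨q1, q2⟩ : α ∈ {α : H.root | α.1 s = 0 ∧ α.1 h0 = 0}) ⟨p1, p2⟩ with h5 | rfl
          · have : γ.1 h' = 2 := p3
            rw [h5] at this
            have h6 : α.1 h' = 2 := q3
            rw [h6] at this
            have : (4 : F) = 0 := by linear_combination -this
            norm_num at this
          · exact hi rfl
    rw [hw]
    exact Submodule.smul_mem _ _ (cb_inr H α)

end

namespace Rdc
section
variable {F L : Type*} [Field F] [CharZero F] [IsAlgClosed F] [LieRing L] [LieAlgebra F L] [FiniteDimensional F L]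
  [IsKilling F L]
variable {s e s' e' : L} {B : Set ℕ} {r : ℕ} {T : Submodule F (L × L)}

lemma exists_kf (R : Rdc s e s' e' B r T) {d l : ℕ} (hlac : ∀ (H : LieSubalgebra F L) [H.IsCartanSubalgebra], LacLE H l)
    (hdl : d = 2 ∧ l ≤ 2 ∨ d = 3 ∧ l ≤ 1) (hd : d + finrank F (zen (cent F s)) = r) :
    ∃ a ∈ der (cent F s), ⁅e, a⁆ = 0 ∧ ∃ b ∈ der (cent F s), ⁅e, b⁆ = 0 ∧ killingForm F L a b ≠ 0 := by
  by_contra hcon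
  push Not at hcon
  have := dist_lemma R.hs R.he R.hse hlac R.hr hdl hd hcon
  have h2 := R.hirr
  have h3 : finrank F (cent F (s + e) ⊓ cent F (s' + e') : Submodule F L) ≤ finrank F (cent F s ⊓ cent F e : Submodule F L) := by
    refine Submodule.finrank_mono ?_
    rw [← R.cx]; exact inf_le_left
  omega

lemma case_a (R : Rdc s e s' e' B r T) {a b : L} (ha : a ∈ der (cent F s)) (ha' : ⁅e, a⁆ = 0)
    (hb : b ∈ der (cent F s)) (hb' : ⁅e, b⁆ = 0) (hab : killingForm F L a b ≠ 0) :
    finrank F T + 1 ≤ finrank F L + finrank F (zen (cent F s)) := by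
  have ha0 : a ≠ 0 := by rintro rfl; simp at hab
  have := R.codim (Submodule.span F {a}) (by
    rw [Submodule.span_singleton_le_iff_mem, R.cx]
    exact ⟨(isRed_cent R.hs).der_le ha, mem_cent.mpr ha'⟩) (by
    intro u hu hu'
    obtain ⟨c, rfl⟩ := Submodule.mem_span_singleton.mp hu
    have := R.r3 hu' hb hb'
    rw [map_smul, LinearMap.smul_apply, smul_eq_mul] at this
    rw [(mul_eq_zero.mp this).resolve_right hab, zero_smul])
  rwa [finrank_span_singleton ha0] at this

lemma codim_two (R : Rdc s e s' e' B r T) {a b : L} (ha : a ∈ cent F s) (ha' : ⁅e, a⁆ = 0)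
    (hb : b ∈ cent F s) (hb' : ⁅e, b⁆ = 0) (h : ∀ p q : F, p • a + q • b ∈ T.comap (LinearMap.inr F L L) → p = 0 ∧ q = 0) :
    finrank F T + 2 ≤ finrank F L + finrank F (zen (cent F s)) := by
  have hli : LinearIndependent F ![a, b] := by
    rw [LinearIndependent.pair_iff]
    intro p q hpq
    exact h p q (by rw [hpq]; exact zero_mem _)
  have h1 : finrank F (Submodule.span F (Set.range ![a, b])) = 2 := by
    rw [finrank_span_eq_card hli]; simp
  have := R.codim (Submodule.span F (Set.range ![a, b])) (by
    rw [Submodule.span_le, R.cx]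
    rintro _ ⟨i, rfl⟩
    fin_cases i
    · exact ⟨ha, mem_cent.mpr ha'⟩
    · exact ⟨hb, mem_cent.mpr hb'⟩) (by
    intro u hu hu'
    rw [Matrix.range_cons, Matrix.range_cons, Matrix.range_empty, Set.union_empty, Set.singleton_union, Submodule.mem_span_pair] at hu
    obtain ⟨p, q, rfl⟩ := hu
    obtain ⟨rfl, rfl⟩ := h p q hu'
    simp)
  rwa [h1] at this

end
end Rdc
end CVA
end

section
set_option linter.all false
namespace CVA
open LieAlgebra Module LieAlgebra.IsKilling LieModule

section
variable {F L : Type*} [Field F] [CharZero F] [IsAlgClosed F] [LieRing L] [LieAlgebra F L] [FiniteDimensional F L]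
  [IsKilling F L]
variable (H : LieSubalgebra F L) [H.IsCartanSubalgebra]

lemma comm_nonneg (hlac : LacLE H 1) {α β : H.root} {e : L} (he : e ∈ rootSpace H α.1) (hβ : 0 ≤ pz H β α) :
    ⁅e, cb H (Sum.inr β)⁆ = 0 := by
  apply lie_eq_zero_of H he (cb_inr H β)
  · intro h
    have h1 := LinearMap.congr_fun h (coroot α.1)
    rw [LinearMap.add_apply, rl_coroot, rl_coroot, pz_self, LinearMap.zero_apply] at h1
    have h2 : 2 + pz H β α = 0 := by exact_mod_cast h1
    omega
  · intro γ hγ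
    have h1 := pz_add H (γ := α) hγ
    rw [pz_self] at h1
    have h2 := lac_pz H hlac (α := γ) (β := α) (by
      rintro rfl
      exact rl_ne_zero H β (by simpa using hγ)) (by
      intro h
      have := pz_neg H (γ := α) h
      rw [pz_self] at this
      omega)
    rw [abs_le] at h2
    push_cast at h2
    omega

lemma cb_three {α β γ : H.root} (h1 : α ≠ β) (h2 : α ≠ γ) (h3 : β ≠ γ) {x p q : F}
    (h : x • cb H (Sum.inr α) + p • cb H (Sum.inr β) + q • cb H (Sum.inr γ) = 0) : x = 0 ∧ p = 0 ∧ q = 0 := by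
  classical
  have h4 := congrArg (fun v => (cb H).repr v (Sum.inr α)) h
  have h5 := congrArg (fun v => (cb H).repr v (Sum.inr β)) h
  have h6 := congrArg (fun v => (cb H).repr v (Sum.inr γ)) h
  simp [Finsupp.single_apply, h1, h2, h3, h1.symm, h2.symm, h3.symm] at h4 h5 h6
  exact ⟨h4, h5, h6⟩

end

namespace Rdc
section
variable {F L : Type*} [Field F] [CharZero F] [IsAlgClosed F] [LieRing L] [LieAlgebra F L] [FiniteDimensional F L]
  [IsKilling F L]
variable {s e s' e' : L} {B : Set ℕ} {r : ℕ} {T : Submodule F (L × L)}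

lemma case_b1 (H : LieSubalgebra F L) [H.IsCartanSubalgebra] (hlac : LacLE H 1) {s : H} (R : Rdc (s : L) e s' e' B r T) {α : H.root} (he : e ∈ rootSpace H α.1)
    {β : H.root} (h1 : β.1 s = 0) (h2 : pz H β α = 0) :
    finrank F T + 2 ≤ finrank F L + finrank F (zen (cent F (s : L))) := by
  obtain ⟨β', hβ'⟩ := exists_neg' H β
  have hs' : β'.1 s = 0 := by rw [← rl_apply, hβ', LinearMap.neg_apply, rl_apply, h1, neg_zero]
  have h2' : pz H β' α = 0 := by rw [pz_neg H hβ', h2, neg_zero]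
  have d1 := cb_mem_der H s h1
  have d2 := cb_mem_der H s hs'
  have e1 := comm_nonneg H hlac he h2.ge
  have e2 := comm_nonneg H hlac he h2'.ge
  have hl := isRed_cent R.hs
  refine R.codim_two (hl.der_le d1) e1 (hl.der_le d2) e2 ?_
  intro p q hpq
  have k1 := R.r3 hpq d1 e1
  have k2 := R.r3 hpq d2 e2
  rw [map_add, LinearMap.add_apply, map_smul, map_smul, LinearMap.smul_apply, LinearMap.smul_apply, smul_eq_mul, smul_eq_mul,
    kf_cb_self] at k1 k2
  rw [mul_zero, zero_add, kf_comm] at k1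
  rw [mul_zero, add_zero] at k2
  have := kf_cb_ne H hβ'
  exact ⟨(mul_eq_zero.mp k2).resolve_right this, (mul_eq_zero.mp k1).resolve_right this⟩

lemma case_b2 (H : LieSubalgebra F L) [H.IsCartanSubalgebra] (hlac : LacLE H 1) {s : H} (R : Rdc (s : L) e s' e' B r T) {α : H.root} (he : e ∈ rootSpace H α.1)
    (he0 : e ≠ 0) (hα : α.1 s = 0)
    (hd : finrank F (zen (cent F (s : L))) + 2 = r)
    (hP : ∀ β : H.root, β.1 s = 0 → pz H β α ≠ 0) :
    finrank F T + 2 ≤ finrank F L + finrank F (zen (cent F (s : L))) := by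
  classical
  have hfz := finrank_zen H s
  have hrH := R.hr H
  have lac : ∀ {α β : H.root}, α ≠ β → rl H α ≠ - rl H β → -1 ≤ pz H α β ∧ pz H α β ≤ 1 := fun h1 h2 => by
    have := lac_pz H hlac h1 h2
    rw [abs_le] at this
    exact_mod_cast this
  have hs_add : ∀ {γ β δ : H.root}, rl H γ = rl H β + rl H δ → β.1 s = 0 → δ.1 s = 0 → γ.1 s = 0 := fun h h1 h2 => by
    rw [← rl_apply, h, LinearMap.add_apply, rl_apply, rl_apply, h1, h2, add_zero]
  have hs_sub : ∀ {γ β δ : H.root}, rl H γ = rl H β - rl H δ → β.1 s = 0 → δ.1 s = 0 → γ.1 s = 0 := fun h h1 h2 => by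
    rw [← rl_apply, h, LinearMap.sub_apply, rl_apply, rl_apply, h1, h2, sub_zero]
  obtain ⟨β0, hβ0s, hβ0, hβ0'⟩ : ∃ β : H.root, β.1 s = 0 ∧ β ≠ α ∧ rl H β ≠ - rl H α := by
    by_contra hcon
    push Not at hcon
    have h1 : Submodule.span F (rl H '' {α | α.1 s = 0}) ≤ Submodule.span F {rl H α} := by
      rw [Submodule.span_le]
      rintro _ ⟨β, hβ, rfl⟩
      by_cases hb : β = α
      · rw [hb]; exact Submodule.mem_span_singleton_self _
      · rw [hcon β hβ hb]; exact Submodule.neg_mem _ (Submodule.mem_span_singleton_self _)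
    have h2 := Submodule.finrank_mono h1
    rw [finrank_span_singleton (rl_ne_zero H α)] at h2
    omega
  obtain ⟨β1, hb1s, hb1⟩ : ∃ β : H.root, β.1 s = 0 ∧ pz H β α = 1 := by
    have h1 := lac hβ0 hβ0'
    have h2 := hP β0 hβ0s
    by_cases h3 : pz H β0 α = 1
    · exact ⟨β0, hβ0s, h3⟩
    · obtain ⟨β', hβ'⟩ := exists_neg' H β0
      refine ⟨β', by rw [← rl_apply, hβ', LinearMap.neg_apply, rl_apply, hβ0s, neg_zero], ?_⟩
      rw [pz_neg H hβ']; omega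
  have one_ne : ∀ {β : H.root}, pz H β α = 1 → α ≠ β ∧ rl H α ≠ - rl H β := fun {β} h => by
    constructor
    · rintro rfl; rw [pz_self] at h; omega
    · intro h'
      have := pz_neg H (γ := α) h'
      rw [pz_self] at this; omega
  have one_symm : ∀ {β : H.root}, pz H β α = 1 → pz H α β = 1 := fun {β} h => by
    have h1 := (pz_pos H β α).mp (by omega)
    have h2 := lac (one_ne h).1 (one_ne h).2
    omega
  have hb1' := one_symm hb1
  obtain ⟨β2, hb2r⟩ := root_sub H (α := α) (β := β1) (by omega) (one_ne hb1).1
  have hb2 : pz H β2 α = 1 := by rw [pz_sub H hb2r, pz_self, hb1]; norm_num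
  have hb2s : β2.1 s = 0 := hs_sub hb2r hα hb1s
  have hb21 : pz H β2 β1 = -1 := by rw [pz_sub H hb2r, pz_self, hb1']; norm_num
  have hne12 : β1 ≠ β2 := by rintro h; rw [← h, pz_self] at hb21; omega
  have hclass : ∀ β : H.root, β.1 s = 0 → pz H β α = 1 → β = β1 ∨ β = β2 := by
    intro β hβs hβ
    by_contra hcon
    push Not at hcon
    obtain ⟨hn1, hn2⟩ := hcon
    have hlb := lac hn1 (by
      intro h
      have := pz_neg H (γ := α) h
      omega)
    have h3 : pz H β β1 = -1 ∨ pz H β β1 = 0 ∨ pz H β β1 = 1 := by omega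
    rcases h3 with h3 | h3 | h3
    · obtain ⟨γ, hγ⟩ := root_add H (α := β) (β := β1) (by omega) (by
        intro h
        have := pz_neg H (γ := α) h
        omega)
      have h4 := pz_add H (γ := α) hγ
      by_cases hγα : γ = α
      · apply hn2
        apply rl_inj H
        rw [hb2r, ← hγα, hγ, add_sub_cancel_right]
      · have := lac hγα (by
          intro h
          have := pz_neg H (γ := α) h
          rw [pz_self] at this
          omega)
        omega
    · obtain ⟨γ, hγ⟩ := root_sub H (α := α) (β := β) (by have := one_symm hβ; omega) (one_ne hβ).1
      have h4 := pz_sub H (γ := α) hγ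
      have h5 := pz_sub H (γ := β1) hγ
      rw [pz_self] at h4
      obtain ⟨δ, hδ⟩ := root_sub H (α := γ) (β := β1) (by omega) (by
        rintro rfl
        apply hn2
        apply rl_inj H
        rw [hb2r, hγ, sub_sub_cancel])
      have h6 := pz_sub H (γ := α) hδ
      exact hP δ (hs_sub hδ (hs_sub hγ hα hβs) hb1s) (by omega)
    · obtain ⟨δ, hδ⟩ := root_sub H (α := β) (β := β1) (by omega) hn1
      have h6 := pz_sub H (γ := α) hδ
      exact hP δ (hs_sub hδ hβs hb1s) (by omega)
  have hclass' : ∀ β : H.root, β.1 s = 0 → 0 ≤ pz H β α → β = α ∨ β = β1 ∨ β = β2 := by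
    intro β hβs hβ
    by_cases h1 : β = α
    · exact Or.inl h1
    · right
      apply hclass β hβs
      have := hP β hβs
      have := lac h1 (by
        intro h
        have := pz_neg H (γ := α) h
        rw [pz_self] at this
        omega)
      omega
  set E := cb H (Sum.inr α) with hE
  set f1 := cb H (Sum.inr β1) with hf1
  set f2 := cb H (Sum.inr β2) with hf2
  have Ef1 : ⁅E, f1⁆ = 0 := comm_nonneg H hlac (cb_inr H α) (by omega)
  have Ef2 : ⁅E, f2⁆ = 0 := comm_nonneg H hlac (cb_inr H α) (by omega)
  have ef1 : ⁅e, f1⁆ = 0 := comm_nonneg H hlac he (by omega)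
  have ef2 : ⁅e, f2⁆ = 0 := comm_nonneg H hlac he (by omega)
  obtain ⟨ν, hν⟩ := root_one H α (cb_inr H α) ((cb H).ne_zero _) (lie_mem_of H (cb_inr H β1) (cb_inr H β2) (γ := α) (by rw [hb2r]; abel))
  rw [← hf1, ← hf2, ← hE] at hν
  have hν0 : ν ≠ 0 := by
    rintro rfl
    rw [zero_smul] at hν
    exact lie_ne_zero_of H (cb_inr H β1) (cb_inr H β2) ((cb H).ne_zero _) ((cb H).ne_zero _) (by omega) hν
  obtain ⟨κ, hκ⟩ := root_one H α (cb_inr H α) ((cb H).ne_zero _) he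
  have hsub := cent_e_le H s α he he0
  have hsp : Submodule.span F ((fun β : H.root => cb H (Sum.inr β)) '' {β | β.1 s = 0 ∧ 0 ≤ pz H β α}) ≤ Submodule.span F {E, f1, f2} := by
    apply Submodule.span_mono
    rintro _ ⟨β, ⟨h1, h2⟩, rfl⟩
    rcases hclass' β h1 h2 with rfl | rfl | rfl
    · exact Or.inl rfl
    · exact Or.inr (Or.inl rfl)
    · exact Or.inr (Or.inr rfl)
  have hsub' := hsub.trans (sup_le_sup_left hsp _)
  have hdim : finrank F (cent F (s : L) ⊓ cent F e : Submodule F L) ≤ r + 2 := by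
    refine (Submodule.finrank_mono hsub').trans ?_
    refine (Submodule.finrank_add_le_finrank_add_finrank _ _).trans ?_
    have h1 : finrank F (Submodule.span F ({E, f1, f2} : Set L)) ≤ 3 := by
      have := finrank_span_finset_le_card (R := F) ({E, f1, f2} : Finset L)
      have h2 := Finset.card_le_three (a := E) (b := f1) (c := f2)
      simp only [Finset.coe_insert, Finset.coe_singleton] at this
      exact this.trans h2
    have h2 : finrank F ((LinearMap.ker (rl H α)).map H.toSubmodule.subtype) = finrank F (LinearMap.ker (rl H α)) :=
      (LinearEquiv.finrank_eq (Submodule.equivMapOfInjective _ H.toSubmodule.injective_subtype _)).symm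
    have h3 := Module.Dual.finrank_ker_add_one_of_ne_zero (rl_ne_zero H α)
    omega
  have hdec : ∀ w, w ∈ cent F (s : L) → ⁅e, w⁆ = 0 → ∃ (w0 : H) (c a1 a2 : F), α.1 w0 = 0 ∧ w = w0 + c • E + a1 • f1 + a2 • f2 := by
    intro w h1 h2
    obtain ⟨_, ⟨w0, hw0, rfl⟩, v, hv, rfl⟩ := Submodule.mem_sup.mp (hsub' ⟨h1, mem_cent.mpr h2⟩)
    rw [Submodule.mem_span_triple] at hv
    obtain ⟨c, a1, a2, rfl⟩ := hv
    refine ⟨w0, c, a1, a2, ?_, ?_⟩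
    · rw [← rl_apply]; exact hw0
    · show (w0 : L) + _ = _
      abel
  have hx := R.cx
  have hlxy := R.lxy
  set y := s' + e' with hy
  have hyx : y ∈ cent F (s : L) ⊓ cent F e := by rw [← hx]; exact mem_cent.mpr hlxy
  have hrank : finrank F ((cent F (s : L) ⊓ cent F e : Submodule F L).map (ad F L y)) ≤ 1 := by
    have h1 := finrank_map_add (ad F L y) (cent F (s : L) ⊓ cent F e : Submodule F L)
    have h2 := R.hirr
    rw [hx, ← hy] at h2
    have h3 : (cent F (s : L) ⊓ cent F e ⊓ LinearMap.ker (ad F L y) : Submodule F L) = cent F (s : L) ⊓ cent F e ⊓ cent F y := rfl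
    rw [h3] at h1
    omega
  obtain ⟨y0, c, a1, a2, hy0, hyd⟩ := hdec y hyx.1 (mem_cent.mp hyx.2)
  have hcH : ∀ (w : H) (β : H.root), ⁅(w : L), cb H (Sum.inr β)⁆ = β.1 w • cb H (Sum.inr β) := fun w β => lie_root H (cb_inr H β) w.2
  have hcs : ∀ {β : H.root}, β.1 s = 0 → cb H (Sum.inr β) ∈ cent F (s : L) := fun h => by
    rw [mem_cent, hcH, h, zero_smul]
  have hb2v : ∀ w : H, β2.1 w = α.1 w - β1.1 w := fun w => by
    rw [← rl_apply, hb2r, LinearMap.sub_apply, rl_apply, rl_apply]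
  set t0 : H := (2 : F) • coroot β1.1 - coroot α.1 with ht0
  have t0α : α.1 t0 = 0 := by
    rw [← rl_apply, ht0, map_sub, map_smul, rl_coroot, rl_coroot, hb1', pz_self]; norm_num
  have t0β : β1.1 t0 = 3 := by
    rw [← rl_apply, ht0, map_sub, map_smul, rl_coroot, rl_coroot, hb1, pz_self]; norm_num
  have t0β2 : β2.1 t0 = -3 := by rw [hb2v, t0α, t0β, zero_sub]
  have t0x : (t0 : L) ∈ cent F (s : L) ⊓ cent F e := by
    refine ⟨mem_cent.mpr (cartan_comm H s.2 t0.2), mem_cent.mpr (comm_symm ?_)⟩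
    rw [lie_root H he t0.2, show α.1 ⟨(t0 : L), t0.2⟩ = α.1 t0 from rfl, t0α, zero_smul]
  have f1x : f1 ∈ cent F (s : L) ⊓ cent F e := ⟨hcs hb1s, mem_cent.mpr ef1⟩
  have f2x : f2 ∈ cent F (s : L) ⊓ cent F e := ⟨hcs hb2s, mem_cent.mpr ef2⟩
  have f21 : ⁅f2, f1⁆ = -(ν • E) := by rw [← lie_skew, hν]
  have Y1 : ⁅y, f1⁆ = β1.1 y0 • f1 - (a2 * ν) • E := by
    rw [hyd, add_lie, add_lie, add_lie, hcH, smul_lie, smul_lie, smul_lie, Ef1, lie_self, f21, ← hf1]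
    module
  have Y2 : ⁅y, f2⁆ = -(β1.1 y0) • f2 + (a1 * ν) • E := by
    rw [hyd, add_lie, add_lie, add_lie, hcH, smul_lie, smul_lie, smul_lie, Ef2, lie_self, hν, ← hf2, hb2v, hy0]
    module
  have Y3 : ⁅y, (t0 : L)⁆ = -(3 * a1) • f1 + (3 * a2) • f2 := by
    rw [← lie_skew, hyd, lie_add, lie_add, lie_add, lie_smul, lie_smul, lie_smul, hcH, hcH, hcH, t0α, t0β, t0β2,
      cartan_comm H t0.2 y0.2, ← hf1, ← hf2]
    module
  have m1 := Submodule.mem_map_of_mem (f := (ad F L y : L →ₗ[F] L)) f1x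
  have m2 := Submodule.mem_map_of_mem (f := (ad F L y : L →ₗ[F] L)) f2x
  have m3 := Submodule.mem_map_of_mem (f := (ad F L y : L →ₗ[F] L)) t0x
  rw [ad_apply, Y1] at m1
  rw [ad_apply, Y2] at m2
  rw [ad_apply, Y3] at m3
  have three : ∀ {x p q : F}, x • E + p • f1 + q • f2 = 0 → x = 0 ∧ p = 0 ∧ q = 0 := fun h =>
    cb_three H (one_ne hb1).1 (one_ne hb2).1 hne12 h
  have hμ : β1.1 y0 = 0 := by
    by_contra hμ
    obtain ⟨p, q, hpq, h⟩ := prop_of_finrank hrank m1 m2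
    obtain ⟨-, h1, h2⟩ := three (x := q * (a1 * ν) - p * (a2 * ν)) (p := p * β1.1 y0) (q := -(q * β1.1 y0)) (by rw [← h]; module)
    rw [neg_eq_zero] at h2
    rcases hpq with h3 | h3
    · exact (mul_ne_zero h3 hμ) h1
    · exact (mul_ne_zero h3 hμ) h2
  rw [hμ] at Y1 Y2 m1 m2
  have three0 : (3 : F) ≠ 0 := by norm_num
  have ha2 : a2 = 0 := by
    by_contra h0
    obtain ⟨p, q, hpq, h⟩ := prop_of_finrank hrank m1 m3
    obtain ⟨h1, -, h2⟩ := three (x := -(p * (a2 * ν))) (p := -(q * (3 * a1))) (q := q * (3 * a2)) (by rw [← h]; module)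
    rw [neg_eq_zero] at h1
    rcases hpq with h3 | h3
    · exact (mul_ne_zero h3 (mul_ne_zero h0 hν0)) h1
    · exact (mul_ne_zero h3 (mul_ne_zero three0 h0)) h2
  have ha1 : a1 = 0 := by
    by_contra h0
    obtain ⟨p, q, hpq, h⟩ := prop_of_finrank hrank m2 m3
    obtain ⟨h1, h2, -⟩ := three (x := (p * (a1 * ν))) (p := -(q * (3 * a1))) (q := q * (3 * a2)) (by rw [← h]; module)
    rw [neg_eq_zero] at h2
    rcases hpq with h3 | h3
    · exact (mul_ne_zero h3 (mul_ne_zero h0 hν0)) h1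
    · exact (mul_ne_zero h3 (mul_ne_zero three0 h0)) h2
  have hyc : ∀ w ∈ cent F ((s : L) + e), ⁅y, w⁆ = 0 := by
    intro w hw
    rw [hx] at hw
    obtain ⟨w0, c', b1, b2, hw0, rfl⟩ := hdec w hw.1 (mem_cent.mp hw.2)
    have hEw : ⁅(w0 : L), E⁆ = 0 := by rw [hcH, hw0, zero_smul]
    have hyw : ⁅y, (w0 : L)⁆ = 0 := by
      rw [hyd, ha1, ha2, zero_smul, zero_smul, add_zero, add_zero, add_lie, smul_lie, comm_symm hEw, cartan_comm H y0.2 w0.2]; simp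
    have hyE : ⁅y, E⁆ = 0 := by
      rw [hyd, ha1, ha2, zero_smul, zero_smul, add_zero, add_zero, add_lie, smul_lie, lie_self, hcH, hy0]; simp
    rw [lie_add, lie_add, lie_add, lie_smul, lie_smul, lie_smul, hyw, hyE, Y1, Y2, ha1, ha2]
    simp
  refine R.codim_two f1x.1 ef1 f2x.1 ef2 ?_
  intro p q hpq
  have t0x' : (t0 : L) ∈ cent F ((s : L) + e) := by rw [hx]; exact t0x
  obtain ⟨u, hu, hu'⟩ := R.r2 hpq (mem_cent.mp t0x') (hyc _ t0x')
  rw [← hy, hyc u hu, ← lie_skew, lie_add, lie_smul, lie_smul, hcH, hcH, t0β, t0β2, ← hf1, ← hf2] at hu'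
  obtain ⟨-, h1, h2⟩ := three (x := 0) (p := -(p * 3)) (q := q * 3) (by rw [← hu']; module)
  rw [neg_eq_zero] at h1
  exact ⟨(mul_eq_zero.mp h1).resolve_right three0, (mul_eq_zero.mp h2).resolve_right three0⟩

end
end Rdc
end CVA
end

section
set_option linter.all false
namespace CVA
open LieAlgebra Module LieAlgebra.IsKilling LieModule

section
variable {F L : Type*} [Field F] [CharZero F] [IsAlgClosed F] [LieRing L] [LieAlgebra F L] [FiniteDimensional F L]
  [IsKilling F L]
variable {s e s' e' : L} {B : Set ℕ} {r : ℕ} {T : Submodule F (L × L)}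

lemma Rdc.thmU (R : Rdc s e s' e' B r T) {l : ℕ} (h1 : 1 ≤ l) (h3 : l ≤ 3)
    (hlac : l ≤ 2 → ∀ (H : LieSubalgebra F L) [H.IsCartanSubalgebra], LacLE H l) :
    finrank F T + (5 - l) ≤ finrank F L + r := by
  by_cases he0 : e = 0
  · have := R.case_zero he0; omega
  have hc1 := R.case_one he0
  have hz := R.zen_lt.1
  have hbot := R.codim ⊥ bot_le (fun u hu _ => by simpa using hu)
  rw [finrank_bot] at hbot
  by_cases hd : finrank F (zen (cent F s)) + (5 - l) ≤ r
  · omega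
  have hl2 : l ≤ 2 := by omega
  have hlac := hlac hl2
  by_cases hd2 : finrank F (zen (cent F s)) + 2 = r
  · obtain ⟨a, ha, ha', b, hb, hb', hab⟩ := R.exists_kf (d := 2) (l := l) hlac (Or.inl ⟨rfl, hl2⟩) (by omega)
    by_cases hl1 : l = 1
    · subst hl1
      have key : finrank F T + 2 ≤ finrank F L + finrank F (zen (cent F s)) := by
        obtain ⟨H, hH, s0, α, rfl, hα, heα⟩ := single_root R.hs R.he R.hse he0 R.hr hd2 ha ha' hb hb' hab
        by_cases hP : ∃ β : H.root, β.1 s0 = 0 ∧ pz H β α = 0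
        · obtain ⟨β, hb1, hb2⟩ := hP
          exact case_b1 H (hlac H) R heα hb1 hb2
        · push Not at hP
          exact case_b2 H (hlac H) R heα he0 hα hd2 hP
      omega
    · have := R.case_a ha ha' hb hb' hab
      omega
  · have hl1 : l = 1 := by omega
    obtain ⟨a, ha, ha', b, hb, hb', hab⟩ := R.exists_kf (d := 3) (l := l) hlac (Or.inr ⟨rfl, by omega⟩) (by omega)
    have := R.case_a ha ha' hb hb' hab
    omega

lemma mem_cent_iff (H : LieSubalgebra F L) [H.IsCartanSubalgebra] (h : H) (w : L) :
    w ∈ cent F (h : L) ↔ ∀ i, (cb H).repr w i ≠ 0 → wt H i h = 0 := by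
  have := mem_eig_iff H (fun _ : Unit => h) (fun _ => (0 : F)) w
  simp only [zero_smul, forall_const] at this
  rw [mem_cent, this]

theorem thmU {x y : L} (hxy : ⁅x, y⁆ = 0) {r l : ℕ} (h1 : 1 ≤ l) (h3 : l ≤ 3)
    (hlac : l ≤ 2 → ∀ (H : LieSubalgebra F L) [H.IsCartanSubalgebra], LacLE H l)
    (hr : ∀ (H : LieSubalgebra F L) [H.IsCartanSubalgebra], finrank F H = r)
    (hirr : r < finrank F (cent F x ⊓ cent F y : Submodule F L)) (T : Submodule F (L × L))
    (hT : ∀ p ∈ T, ∃ δ : L →+ L, (∀ a b, δ ⁅a, b⁆ = ⁅δ a, b⁆ + ⁅a, δ b⁆) ∧ δ x = p.1 ∧ δ y = p.2) :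
    finrank F T + (5 - l) ≤ finrank F L + r := by
  obtain ⟨s, e, rfl, hs, he, hse, hc, -⟩ := jordan (F := F) x
  obtain ⟨s', e', rfl, hs', he', hse', hc', -⟩ := jordan (F := F) y
  have q1 := hc _ hxy
  have q2 : ⁅e, s' + e'⁆ = 0 := by rw [add_lie, q1, zero_add] at hxy; exact hxy
  have q3 := hc' _ (comm_symm q1)
  have q4 := hc' _ (comm_symm q2)
  have q5 : ⁅s, e'⁆ = 0 := by rw [lie_add, comm_symm q3, zero_add] at q1; exact q1
  have q6 : ⁅e, e'⁆ = 0 := by rw [lie_add, comm_symm q4, zero_add] at q2; exact q2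
  obtain ⟨H, hH, hHS⟩ := exists_cartan (F := F) ({s, s'} : Set L) (by
    rintro a (rfl | rfl)
    · exact hs
    · exact hs') (by
    rintro a (rfl | rfl) b (rfl | rfl)
    · exact lie_self _
    · exact comm_symm q3
    · exact q3
    · exact lie_self _)
  obtain ⟨s, rfl⟩ : ∃ s' : H, (s' : L) = s := ⟨⟨s, hHS s (by simp)⟩, rfl⟩
  obtain ⟨s', rfl⟩ : ∃ s'' : H, (s'' : L) = s' := ⟨⟨s', hHS s' (by simp)⟩, rfl⟩
  let bad : Set ℕ := ⋃ α : H.root, {b : ℕ | α.1 s + (b : F) * α.1 s' = 0 ∧ ¬ (α.1 s = 0 ∧ α.1 s' = 0)}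
  have hbad : bad.Finite := by
    apply Set.finite_iUnion
    intro α
    apply Set.Subsingleton.finite
    rintro b ⟨hb1, hb2⟩ b' ⟨hb1', -⟩
    have h0 : α.1 s' ≠ 0 := by
      intro h0
      rw [h0, mul_zero, add_zero] at hb1
      exact hb2 ⟨hb1, h0⟩
    have : (b : F) = b' := by
      apply mul_right_cancel₀ h0
      linear_combination hb1 - hb1'
    exact_mod_cast this
  have hgood : ∀ b ∉ bad, ∀ α : H.root, α.1 s + (b : F) * α.1 s' = 0 → α.1 s = 0 ∧ α.1 s' = 0 := by
    intro b hb α h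
    by_contra hcon
    exact hb (Set.mem_iUnion.mpr ⟨α, h, hcon⟩)
  have hcoe : ∀ b : ℕ, (s : L) + (b : F) • (s' : L) = ((s + (b : F) • s' : H) : L) := fun b => rfl
  have hcent : ∀ b ∉ bad, cent F ((s : L) + (b : F) • (s' : L)) = cent F (s : L) ⊓ cent F (s' : L) := by
    intro b hb
    ext w
    rw [hcoe, mem_cent_iff, Submodule.mem_inf, mem_cent_iff, mem_cent_iff]
    constructor
    · intro h
      have key : ∀ i, (cb H).repr w i ≠ 0 → wt H i s = 0 ∧ wt H i s' = 0 := by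
        intro i hi
        rcases i with i | α
        · exact ⟨rfl, rfl⟩
        · apply hgood b hb α
          have := h _ hi
          rw [← rl_apply, ← rl_apply, ← smul_eq_mul, ← map_smul, ← map_add, rl_apply]
          exact this
      exact ⟨fun i hi => (key i hi).1, fun i hi => (key i hi).2⟩
    · rintro ⟨ha, hb⟩ i hi
      have h1 := ha i hi
      have h2 := hb i hi
      rcases i with i | α
      · rfl
      · have h1 : α.1 s = 0 := h1
        have h2 : α.1 s' = 0 := h2
        show α.1 (s + (b : F) • s') = 0
        rw [← rl_apply, map_add, map_smul, rl_apply, rl_apply, h1, h2]; simp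
  obtain ⟨b0, hb0, hmin⟩ := WellFounded.has_min
    (measure (fun b : ℕ => finrank F (cent F ((s : L) + e + (b : F) • ((s' : L) + e'))))).wf badᶜ hbad.infinite_compl.nonempty
  let φ : (L × L) →ₗ[F] (L × L) := LinearMap.prod (LinearMap.fst F L L + (b0 : F) • LinearMap.snd F L L) (LinearMap.snd F L L)
  have hφ : Function.Injective φ := by
    rw [← LinearMap.ker_eq_bot, LinearMap.ker_eq_bot']
    rintro ⟨u, v⟩ h
    simp only [φ, LinearMap.prod_apply, Function.prod_apply, Prod.mk_eq_zero, LinearMap.add_apply, LinearMap.smul_apply, LinearMap.fst_apply, LinearMap.snd_apply] at h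
    obtain ⟨ha, hb⟩ := h
    subst hb
    simpa using ha
  have hfT : finrank F (T.map φ) = finrank F T :=
    (LinearEquiv.finrank_eq (Submodule.equivMapOfInjective _ hφ _)).symm
  have hre : ∀ b : ℕ, (s : L) + (b0 : F) • (s' : L) + (e + (b0 : F) • e') + (b : F) • ((s' : L) + e') =
      (s : L) + e + ((b0 + b : ℕ) : F) • ((s' : L) + e') := by
    intro b; push_cast; module
  have hre0 : (s : L) + (b0 : F) • (s' : L) + (e + (b0 : F) • e') = (s : L) + e + (b0 : F) • ((s' : L) + e') := by
    have := hre 0; simpa using this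
  have R : Rdc ((s : L) + (b0 : F) • (s' : L)) (e + (b0 : F) • e') (s' : L) e' ({0} ∪ (fun b => b0 + b) ⁻¹' bad)ᶜ r (T.map φ) := by
    refine ⟨?_, ?_, he', ?_, ?_, ?_, ?_, ?_, ?_, ?_, ?_, ?_, hr, ?_, ?_⟩
    · rw [hcoe]; exact cartan_ss H (Subtype.property _)
    · have h1 : IsNilpotent ((b0 : F) • ad F L e') := he'.smul (b0 : F)
      have h2 : Commute (ad F L e) ((b0 : F) • ad F L e') := (ad_commute q6).smul_right (b0 : F)
      have := h2.isNilpotent_add he h1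
      rwa [← map_smul, ← map_add] at this
    · simp [add_lie, lie_add, hse, q5, hse', q4]
    · simp [add_lie, q5, hse']
    · simp [add_lie, q6]
    · rw [hcent b0 hb0]
      refine mem_zen.mpr ⟨⟨mem_cent.mpr (comm_symm q3), mem_cent.mpr (lie_self _)⟩, fun a ha => comm_symm (mem_cent.mp ha.2)⟩
    · apply Set.Finite.infinite_compl
      exact (Set.finite_singleton _).union (hbad.preimage (add_right_injective b0).injOn)
    · simp
    · intro b hb
      have : (s : L) + (b0 : F) • (s' : L) + (b : F) • (s' : L) = ((s + (b0 : F) • s' + (b : F) • s' : H) : L) := rfl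
      rw [this]; exact cartan_ss H (Subtype.property _)
    · intro b hb
      have hb' : b0 + b ∉ bad := fun h => hb (Or.inr h)
      have := hcent _ hb'
      rw [hcent b0 hb0, ← this]
      congr 1; push_cast; module
    · intro b hb
      have hb' : b0 + b ∉ bad := fun h => hb (Or.inr h)
      rw [hre, hre0]
      exact not_lt.mp (hmin _ hb')
    · rintro _ ⟨⟨u, v⟩, hp, rfl⟩
      obtain ⟨δ, d1, d2, d3⟩ := hT _ hp
      refine ⟨δ, d1, ?_, d3⟩
      rw [hre0, Nat.cast_smul_eq_nsmul, map_add, map_nsmul, d2, d3]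
      show u + b0 • v = u + (b0 : F) • v
      rw [Nat.cast_smul_eq_nsmul]
    · refine lt_of_lt_of_le hirr (Submodule.finrank_mono ?_)
      rintro w ⟨hw1, hw2⟩
      refine ⟨?_, hw2⟩
      rw [hre0]
      show w ∈ cent F _
      rw [mem_cent, add_lie, smul_lie, mem_cent.mp hw1, mem_cent.mp hw2]; simp
  have := R.thmU h1 h3 hlac
  rwa [hfT] at this

end
end CVA
end

section
set_option linter.all false
namespace CVA
open LieAlgebra Module LieAlgebra.IsKilling LieModule

section
variable {K V σ : Type*} [Field K] [AddCommGroup V] [Module K V] [DecidableEq σ]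

lemma exps_gen [Algebra ℚ K] [Module ℚ V] [IsScalarTower ℚ K V] {f0 : (σ → K) → V} {a0 : σ → K} {f0' : σ → V}
    (hf : HasPD f0 a0 f0') (N : σ → Module.End K V) (hN : ∀ i, IsNilpotent (N i)) (li : List σ) (hnd : li.Nodup)
    (hz : ∀ i ∈ li, a0 i = 0) :
    ∃ f : (σ → K) → V, HasPD f a0 (fun j => f0' j + if j ∈ li then N j (f0 a0) else 0) ∧ f a0 = f0 a0 ∧
      ∀ S : Set V, (∀ i ∈ li, ∀ (c : K), ∀ v ∈ S, IsNilpotent.exp (c • N i) v ∈ S) → ∀ a, f0 a ∈ S → f a ∈ S := by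
  induction li with
  | nil => exact ⟨f0, by simpa using hf, rfl, fun S _ a h => h⟩
  | cons i li ih =>
    obtain ⟨f, h1, h2, h3⟩ := ih (List.nodup_cons.mp hnd).2 (fun j hj => hz j (List.mem_cons_of_mem _ hj))
    refine ⟨_, (h1.exp i (hz i (by simp)) (N i) (hN i)).congr (fun a => rfl) (fun j => ?_), ?_, ?_⟩
    · have hi := (List.nodup_cons.mp hnd).1
      by_cases hj : j = i
      · subst hj; simp [hi, h2]
      · simp [hj]
    · simp only [hz i (by simp), zero_smul, h2]
      simp
    · intro S hS a ha
      exact hS i (by simp) _ _ (h3 S (fun j hj => hS j (List.mem_cons_of_mem _ hj)) a ha)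
end

section
variable {F L : Type*} [Field F] [CharZero F] [LieRing L] [LieAlgebra F L]

lemma exps_one {σ : Type*} [Fintype σ] [DecidableEq σ] {f0 : (σ → F) → L} {a0 : σ → F} {f0' : σ → L}
    (hf : HasPD f0 a0 f0') (e : σ → L) (he : ∀ i, IsNil F (e i)) (I : Finset σ) (hz : ∀ i ∈ I, a0 i = 0) :
    ∃ f : (σ → F) → L, HasPD f a0 (fun j => f0' j + if j ∈ I then ⁅e j, f0 a0⁆ else 0) ∧
      ∀ S : Set L, (∀ A : L ≃ₗ⁅F⁆ L, ∀ v ∈ S, A v ∈ S) → ∀ a, f0 a ∈ S → f a ∈ S := by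
  letI : Module ℚ L := Module.compHom L (algebraMap ℚ F)
  haveI : IsScalarTower ℚ F L := ⟨fun q c v => by
    change (q • c) • v = (algebraMap ℚ F q) • (c • v)
    rw [Algebra.smul_def, mul_smul]⟩
  letI : LieAlgebra ℚ L := { lie_smul := fun q v w => lie_smul (algebraMap ℚ F q) v w }
  obtain ⟨f, h1, h2, h3⟩ := exps_gen hf (fun i => ad F L (e i)) he I.toList I.nodup_toList (by simpa using hz)
  refine ⟨f, h1.congr (fun _ => rfl) (fun j => by simp), fun S hS a ha => h3 S (fun i hi c v hv => ?_) a ha⟩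
  have hn : IsNilpotent (LieDerivation.ad F L (c • e i)).toLinearMap := by
    have : (LieDerivation.ad F L (c • e i)).toLinearMap = c • ad F L (e i) := by
      ext w; simp
    rw [this]
    exact (he i).smul c
  have := hS (LieDerivation.exp (LieDerivation.ad F L (c • e i)) hn) v hv
  rw [LieDerivation.exp_map_apply] at this
  convert this using 3
  ext w; simp

lemma exps_two {σ : Type*} [Fintype σ] [DecidableEq σ] {f0 : (σ → F) → L × L} {a0 : σ → F} {f0' : σ → L × L}
    (hf : HasPD f0 a0 f0') (e : σ → L) (he : ∀ i, IsNil F (e i)) (I : Finset σ) (hz : ∀ i ∈ I, a0 i = 0) :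
    ∃ f : (σ → F) → L × L, HasPD f a0 (fun j => f0' j + if j ∈ I then (⁅e j, (f0 a0).1⁆, ⁅e j, (f0 a0).2⁆) else 0) ∧
      ∀ S : Set (L × L), (∀ A : L ≃ₗ⁅F⁆ L, ∀ v ∈ S, (A v.1, A v.2) ∈ S) → ∀ a, f0 a ∈ S → f a ∈ S := by
  letI : Module ℚ L := Module.compHom L (algebraMap ℚ F)
  haveI : IsScalarTower ℚ F L := ⟨fun q c v => by
    change (q • c) • v = (algebraMap ℚ F q) • (c • v)
    rw [Algebra.smul_def, mul_smul]⟩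
  letI : LieAlgebra ℚ L := { lie_smul := fun q v w => lie_smul (algebraMap ℚ F q) v w }
  have hpow : ∀ (M : Module.End F L) (n : ℕ), (LinearMap.prodMap M M) ^ n = LinearMap.prodMap (M ^ n) (M ^ n) := by
    intro M n
    induction n with
    | zero => ext <;> simp
    | succ n ih => rw [pow_succ, ih, pow_succ]; ext <;> simp
  obtain ⟨f, h1, h2, h3⟩ := exps_gen hf (fun i => LinearMap.prodMap (ad F L (e i)) (ad F L (e i))) (fun i => by
    obtain ⟨n, hn⟩ := he i
    refine ⟨n, ?_⟩
    rw [hpow, hn]; ext <;> simp) I.toList I.nodup_toList (by simpa using hz)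
  refine ⟨f, h1.congr (fun _ => rfl) (fun j => by simp), fun S hS a ha => h3 S (fun i hi c v hv => ?_) a ha⟩
  have hn : IsNilpotent (LieDerivation.ad F L (c • e i)).toLinearMap := by
    have : (LieDerivation.ad F L (c • e i)).toLinearMap = c • ad F L (e i) := by
      ext w; simp
    rw [this]
    exact (he i).smul c
  have := hS (LieDerivation.exp (LieDerivation.ad F L (c • e i)) hn) v hv
  rw [LieDerivation.exp_map_apply, LieDerivation.exp_map_apply] at this
  convert this using 1
  obtain ⟨n, hn⟩ := hn
  have h5 : c • LinearMap.prodMap (ad F L (e i)) (ad F L (e i)) = LinearMap.prodMap (LieDerivation.ad F L (c • e i)).toLinearMap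
    (LieDerivation.ad F L (c • e i)).toLinearMap := by ext <;> simp
  rw [h5, IsNilpotent.exp_eq_sum (k := n) (by rw [hpow, hn]; ext <;> simp), IsNilpotent.exp_eq_sum hn]
  simp only [hpow, LinearMap.sum_apply, LinearMap.smul_apply, LinearMap.prodMap_apply]
  ext
  · simp [Prod.fst_sum]
  · simp [Prod.snd_sum]
end
end CVA
end

section
set_option linter.all false
namespace CVA
open LieAlgebra Module LieAlgebra.IsKilling LieModule

section
variable {F L : Type*} [Field F] [CharZero F] [IsAlgClosed F] [LieRing L] [LieAlgebra F L] [FiniteDimensional F L]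
  [IsKilling F L]
variable (H : LieSubalgebra F L) [H.IsCartanSubalgebra]

lemma nil_root {α : H.root} {e : L} (he : e ∈ rootSpace H α.1) : IsNil F e :=
  LieAlgebra.isNilpotent_ad_of_mem_rootSpace H (root_nz H α) he

lemma charpoly_H (h : H) : (ad F L (h : L)).charpoly = ∏ i, (Polynomial.X - Polynomial.C (wt H i h)) := by
  classical
  rw [← LinearMap.charpoly_toMatrix _ (cb H)]
  have : LinearMap.toMatrix (cb H) (cb H) (ad F L (h : L)) = Matrix.diagonal (fun i => wt H i h) := by
    ext i j
    rw [LinearMap.toMatrix_apply, ad_apply, lie_cb H j h.2, map_smul, Basis.repr_self, Matrix.diagonal_apply]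
    simp only [Finsupp.smul_apply, Finsupp.single_apply, smul_eq_mul]
    by_cases hij : i = j
    · subst hij; simp
    · simp [hij, Ne.symm hij]
  rw [this, Matrix.charpoly_diagonal]

lemma dense_H : ∃ b : Basis (Fin (finrank F H) ⊕ H.root) F L, ∀ S : Set L, (∀ A : L ≃ₗ⁅F⁆ L, ∀ v ∈ S, A v ∈ S) →
    (∀ h : H, (h : L) ∈ S) → ∀ G : MvPolynomial (Fin (finrank F H) ⊕ H.root) F,
    (∀ v ∈ S, MvPolynomial.eval (b.repr v) G = 0) → G = 0 := by
  classical
  obtain ⟨h0, hh, -⟩ := exists_gen H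
  let w : Fin (finrank F H) ⊕ H.root → F := Sum.elim (fun _ => 1) (fun α => - α.1 h0)
  have hw : ∀ i, IsUnit (w i) := by
    rintro (i | α)
    · simp [w]
    · simpa [w] using hh α
  let b := (cb H).isUnitSMul hw
  refine ⟨b, fun S hS hH G hG => ?_⟩
  let f0 : ((Fin (finrank F H) ⊕ H.root) → F) → L := fun a => (h0 : L) + ∑ i : Fin (finrank F H), a (Sum.inl i) • cb H (Sum.inl i)
  have hf0 : HasPD f0 0 (fun j => 0 + ∑ i : Fin (finrank F H), if j = Sum.inl i then cb H (Sum.inl i) else 0) :=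
    (HasPD.const _).add (HasPD.sum _ fun i _ => HasPD.coord _ _)
  obtain ⟨f, hf, hfS⟩ := exps_one hf0 (Sum.elim (fun _ => 0) (fun α => cb H (Sum.inr α))) (by
    rintro (i | α)
    · simp [IsNil]
    · exact nil_root H (cb_inr H α)) (Finset.univ.filter (fun i => i.isRight)) (fun _ _ => rfl)
  have hf' := hf.congr (fun a => rfl) (f₂' := b) (by
    rintro (i | α)
    · simp [b, w, Basis.isUnitSMul_apply]
    · simp [b, w, Basis.isUnitSMul_apply, f0]
      rw [← lie_skew, lie_root H (cb_inr H α) h0.2])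
  refine hf'.indep (fun s => b.coord s) (fun s t => by
    rw [Basis.coord_apply, Basis.repr_self, Finsupp.single_apply]; simp [eq_comm]) G (fun a => ?_)
  have := hG (f a) (hfS S hS a ?_)
  · rw [← MvPolynomial.coe_aeval_eq_eval] at this; exact this
  · exact hH ⟨f0 a, H.add_mem h0.2 (sum_mem fun i _ => H.smul_mem _ (cb_inl H i))⟩

lemma charpoly_aut (A : L ≃ₗ⁅F⁆ L) (v : L) : (ad F L (A v)).charpoly = (ad F L v).charpoly := by
  have := LinearEquiv.charpoly_conj A.toLinearEquiv (ad F L v)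
  rw [← this]
  congr 1
  ext w
  have h2 : w = A (A.symm w) := (A.apply_symm_apply w).symm
  change ⁅A v, w⁆ = A ⁅v, A.symm w⁆
  rw [LieEquiv.map_lie, ← h2]

/-- polynomial relations between coefficients of the characteristic polynomials -/
lemma rel_H (G : MvPolynomial ℕ F) (hG : ∀ h : H, MvPolynomial.eval (fun j => (ad F L (h : L)).charpoly.coeff j) G = 0)
    (p : L) : MvPolynomial.eval (fun j => (ad F L p).charpoly.coeff j) G = 0 := by
  classical
  obtain ⟨b, hb⟩ := dense_H H
  have key : ∀ v : L, MvPolynomial.eval (b.repr v) (MvPolynomial.bind₁ (fun j => ((ad F L : L →ₗ[F] End F L).polyCharpoly b).coeff j) G)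
      = MvPolynomial.eval (fun j => (ad F L v).charpoly.coeff j) G := by
    intro v
    rw [← MvPolynomial.coe_aeval_eq_eval, ← MvPolynomial.coe_aeval_eq_eval]
    change MvPolynomial.aeval _ _ = MvPolynomial.aeval _ _
    rw [MvPolynomial.aeval_bind₁]
    congr 2
    ext j
    exact LinearMap.polyCharpoly_coeff_eval (ad F L : L →ₗ[F] End F L) b v j
  have h0 := hb {v | MvPolynomial.eval (fun j => (ad F L v).charpoly.coeff j) G = 0} ?_ hG
    (MvPolynomial.bind₁ (fun j => ((ad F L : L →ₗ[F] End F L).polyCharpoly b).coeff j) G) ?_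
  · rw [← key, h0, map_zero]
  · intro A v hv
    change _ = _
    simp only [charpoly_aut]; exact hv
  · intro v hv
    rw [key]; exact hv

/-- every element has the same characteristic polynomial as an element of `H` -/
theorem lemmaE (p : L) : ∃ c : H, (ad F L p).charpoly = (ad F L (c : L)).charpoly := by
  classical
  let r := finrank F H
  let bH := finBasis F H
  let S := MvPolynomial (Fin r) F
  let lin : (H →ₗ[F] F) →ₗ[F] S := ∑ i, (LinearMap.toSpanSingleton F S (MvPolynomial.X i)).comp (Module.Dual.eval F H (bH i))
  have hlin : ∀ (l : H →ₗ[F] F) (y : Fin r → F), MvPolynomial.eval y (lin l) = l (∑ i, y i • bH i) := by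
    intro l y
    simp [lin, mul_comm]
    refine Finset.sum_congr rfl fun x _ => ?_
    have := MvPolynomial.smul_eval y (MvPolynomial.X x) (l (bH x))
    rw [MvPolynomial.eval_X, mul_comm] at this
    exact this
  have hlinX : ∀ i, lin (bH.coord i) = MvPolynomial.X i := by
    intro i
    simp [lin, Finsupp.single_apply]
  let wl : Fin r ⊕ H.root → (H →ₗ[F] F) := Sum.elim (fun _ => 0) (fun α => rl H α)
  let P : Polynomial S := ∏ i, (Polynomial.X - Polynomial.C (lin (wl i)))
  have hP : ∀ y : Fin r → F, P.map (MvPolynomial.eval y) = (ad F L ((∑ i, y i • bH i : H) : L)).charpoly := by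
    intro y
    rw [charpoly_H]
    simp only [P, Polynomial.map_prod]
    refine Finset.prod_congr rfl fun i _ => ?_
    rw [Polynomial.map_sub, Polynomial.map_X, Polynomial.map_C, hlin]
    rcases i with i | α
    · simp [wl, wt]
    · simp only [wl, Sum.elim_inr, rl_apply, wt]
  let R := MvPolynomial ℕ F
  let ψ : R →ₐ[F] S := MvPolynomial.aeval (fun j => P.coeff j)
  let φ : R →ₐ[F] F := MvPolynomial.aeval (fun j => (ad F L p).charpoly.coeff j)
  have hk : ∀ G : R, ψ G = 0 → φ G = 0 := by
    intro G hG
    refine rel_H H G (fun h => ?_) p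
    have h1 : MvPolynomial.aeval (fun i => bH.repr h i) (ψ G) = 0 := by rw [hG, map_zero]
    have h2 : (MvPolynomial.aeval (fun i => bH.repr h i)).comp ψ = MvPolynomial.aeval (fun j => (ad F L (h : L)).charpoly.coeff j) := by
      ext j
      simp only [ψ, AlgHom.comp_apply, MvPolynomial.aeval_X]
      have := hP (fun i => bH.repr h i)
      rw [bH.sum_repr] at this
      rw [← this, Polynomial.coeff_map, ← MvPolynomial.coe_aeval_eq_eval]
      rfl
    rw [← AlgHom.comp_apply, h2] at h1
    exact h1
  letI : Algebra R S := ψ.toRingHom.toAlgebra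
  have hintg : ∀ l, IsIntegral R (lin l) := by
    have hroot : ∀ α, IsIntegral R (lin (rl H α)) := by
      intro α
      have hmon : P.Monic := Polynomial.monic_prod_of_monic _ _ fun i _ => Polynomial.monic_X_sub_C _
      have hl : P ∈ Polynomial.lifts (algebraMap R S) := by
        rw [Polynomial.lifts_iff_coeff_lifts]
        intro j
        exact ⟨MvPolynomial.X j, MvPolynomial.aeval_X _ _⟩
      obtain ⟨Q, hQ, -, hQm⟩ := Polynomial.lifts_and_degree_eq_and_monic hl hmon
      refine ⟨Q, hQm, ?_⟩
      rw [← Polynomial.eval_map, hQ]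
      simp only [P]
      rw [Polynomial.eval_prod]
      refine Finset.prod_eq_zero (Finset.mem_univ (Sum.inr α)) ?_
      simp [wl]
    have hC : ∀ (c : F) (s : S), IsIntegral R s → IsIntegral R (c • s) := by
      intro c s hs
      rw [MvPolynomial.smul_eq_C_mul]
      refine IsIntegral.mul ?_ hs
      have : (MvPolynomial.C c : S) = algebraMap R S (MvPolynomial.C c) := (MvPolynomial.aeval_C _ c).symm
      rw [this]; exact isIntegral_algebraMap
    intro l
    have hl : l ∈ Submodule.span F (Set.range (rl H)) := by
      have h1 : Submodule.span F (Set.range (rootSystem H).root) = ⊤ := RootPairing.IsRootSystem.span_root_eq_top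
      have : Set.range (rl H) = Set.range (rootSystem H).root := rfl
      rw [this, h1]; trivial
    induction hl using Submodule.span_induction with
    | mem x hx => obtain ⟨α, rfl⟩ := hx; exact hroot α
    | zero => rw [map_zero]; exact isIntegral_zero
    | add x y _ _ h1 h2 => rw [map_add]; exact h1.add h2
    | smul c x _ h => rw [map_smul]; exact hC c _ h
  haveI : Algebra.IsIntegral R S := ⟨fun s => by
    induction s using MvPolynomial.induction_on with
    | C c =>
      have : (MvPolynomial.C c : S) = algebraMap R S (MvPolynomial.C c) := (MvPolynomial.aeval_C _ c).symm
      rw [this]; exact isIntegral_algebraMap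
    | add p q h1 h2 => exact h1.add h2
    | mul_X p i h => exact h.mul (by rw [← hlinX]; exact hintg _)⟩
  have hsurj : Function.Surjective φ := fun c => ⟨MvPolynomial.C c, by simp only [φ]; exact MvPolynomial.aeval_C _ c⟩
  have hmax : (RingHom.ker φ.toRingHom).IsMaximal := RingHom.ker_isMaximal_of_surjective φ.toRingHom hsurj
  haveI := hmax.isPrime
  obtain ⟨Q, -, hQp, hQ⟩ := Ideal.exists_ideal_over_prime_of_isIntegral (S := S) (RingHom.ker φ.toRingHom) ⊥ (by
    intro G hG
    exact hk G hG)
  have hQm : Q.IsMaximal := Ideal.isMaximal_of_isIntegral_of_isMaximal_comap Q (by rw [hQ]; exact hmax)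
  obtain ⟨y, hy⟩ := MvPolynomial.isMaximal_iff_eq_vanishingIdeal_singleton.mp hQm
  refine ⟨∑ i, y i • bH i, ?_⟩
  rw [← hP]
  ext j
  have h1 : (MvPolynomial.X j - MvPolynomial.C ((ad F L p).charpoly.coeff j) : R) ∈ RingHom.ker φ.toRingHom := by
    rw [RingHom.mem_ker]
    change φ _ = 0
    rw [map_sub]
    exact sub_eq_zero.mpr ((MvPolynomial.aeval_X _ j).trans (MvPolynomial.aeval_C (fun j => (ad F L p).charpoly.coeff j) ((ad F L p).charpoly.coeff j)).symm)
  rw [← hQ, Ideal.mem_comap] at h1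
  have h2 : algebraMap R S (MvPolynomial.X j - MvPolynomial.C ((ad F L p).charpoly.coeff j)) = P.coeff j - MvPolynomial.C ((ad F L p).charpoly.coeff j) := by
    change ψ _ = _
    rw [map_sub]
    exact congrArg₂ (· - ·) (MvPolynomial.aeval_X _ j) (MvPolynomial.aeval_C _ _)
  rw [h2, hy, MvPolynomial.mem_vanishingIdeal_singleton_iff] at h1
  rw [Polynomial.coeff_map]
  have h3 : MvPolynomial.aeval y (P.coeff j) - (ad F L p).charpoly.coeff j = 0 := by
    rw [← h1]; simp
  exact (sub_eq_zero.mp h3).symm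
end
end CVA
end

section
set_option linter.all false
namespace CVA
open LieAlgebra Module LieAlgebra.IsKilling LieModule
open scoped TensorProduct

section
variable {K Ω G : Type*} [Field K] [CharZero K] [IsAlgClosed K] [LieRing G] [LieAlgebra K G] [FiniteDimensional K G]
  [IsKilling K G] [Field Ω] [IsAlgClosed Ω] [Algebra K Ω]

lemma isKilling_bc : IsKilling Ω (Ω ⊗[K] G) := by
  classical
  constructor
  rw [eq_bot_iff]
  intro x hx
  rw [LieIdeal.mem_killingCompl] at hx
  have hnd := IsKilling.killingForm_nondegenerate K G
  let b := finBasis K G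
  let b' := LinearMap.BilinForm.dualBasis (killingForm K G) hnd b
  let B := Algebra.TensorProduct.basis Ω b
  have hB : ∀ i, B i = 1 ⊗ₜ b i := fun i => Algebra.TensorProduct.basis_apply _ _
  have key : ∀ i, B.repr x i = 0 := by
    intro j
    have h1 := hx (1 ⊗ₜ b' j) trivial
    rw [LieModule.traceForm_comm, LieModule.traceForm_baseChange] at h1
    rw [← B.sum_repr x] at h1
    simp only [map_sum, LinearMap.sum_apply, map_smul, LinearMap.smul_apply, hB] at h1
    rw [Finset.sum_eq_single j] at h1
    · rw [LinearMap.BilinForm.baseChange_tmul, LieModule.traceForm_comm] at h1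
      have := LinearMap.BilinForm.apply_dualBasis_left hnd b j j
      erw [this] at h1
      simpa using h1
    · intro i _ hij
      rw [LinearMap.BilinForm.baseChange_tmul, LieModule.traceForm_comm]
      have := LinearMap.BilinForm.apply_dualBasis_left hnd b j i
      erw [this]
      simp [hij]
    · simp
  rw [LieSubmodule.mem_bot]
  exact B.repr.injective (by ext i; simpa using key i)

lemma charpoly_bc (x : G) : (ad Ω (Ω ⊗[K] G) (1 ⊗ₜ x)).charpoly = (ad K G x).charpoly.map (algebraMap K Ω) := by
  have : ad Ω (Ω ⊗[K] G) (1 ⊗ₜ x) = (ad K G x).baseChange Ω := LieModule.toEnd_baseChange K Ω G G x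
  rw [this, LinearMap.charpoly_baseChange]

lemma coeff_zero {F L : Type*} [Field F] [CharZero F] [IsAlgClosed F] [LieRing L] [LieAlgebra F L] [FiniteDimensional F L]
    [IsKilling F L] (H : LieSubalgebra F L) [H.IsCartanSubalgebra] (h : H) :
    (ad F L (h : L)).charpoly = Polynomial.X ^ (finrank F H) * ∏ α : H.root, (Polynomial.X - Polynomial.C (α.1 h)) := by
  rw [charpoly_H, Fintype.prod_sum_type]
  simp [wt]


lemma bc_coeff (t : LieSubalgebra K G) [t.IsCartanSubalgebra] (v : Ω ⊗[K] G) (j : ℕ) (hj : j < finrank K t) : (ad Ω (Ω ⊗[K] G) v).charpoly.coeff j = 0 := by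
  classical
  obtain ⟨b, hb⟩ := dense_H t
  have h0 : ((ad K G : G →ₗ[K] End K G).polyCharpoly b).coeff j = 0 := by
    apply hb {v | (ad K G v).charpoly.coeff j = 0}
    · intro A v hv; change _ = _; rw [charpoly_aut]; exact hv
    · intro h; change _ = _
      rw [coeff_zero, Polynomial.coeff_X_pow_mul', if_neg (by omega)]
    · intro v hv
      exact (LinearMap.polyCharpoly_coeff_eval (ad K G : G →ₗ[K] End K G) b v j).trans hv
  have h1 := LinearMap.polyCharpoly_baseChange (ad K G : G →ₗ[K] End K G) b Ω
  have h3 := LinearMap.polyCharpoly_coeff_eval (LinearMap.tensorProduct K Ω G G ∘ₗ LinearMap.baseChange Ω (ad K G : G →ₗ[K] End K G))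
    (Algebra.TensorProduct.basis Ω b) v j
  rw [h1, Polynomial.coeff_map, h0, map_zero, map_zero] at h3
  have h4 : (LinearMap.tensorProduct K Ω G G ∘ₗ LinearMap.baseChange Ω (ad K G : G →ₗ[K] End K G)) v = ad Ω (Ω ⊗[K] G) v := by
    clear h3
    induction v using TensorProduct.induction_on with
    | zero => simp
    | add x y hx hy => rw [map_add, hx, hy, map_add]
    | tmul a x =>
      ext y
      simp
      change ((a • LinearMap.baseChangeHom K Ω G G) (ad K G x)) (1 ⊗ₜ[K] y) = _
      simp [TensorProduct.smul_tmul']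
  rw [h4] at h3
  exact h3.symm

lemma bc_rank (t : LieSubalgebra K G) [t.IsCartanSubalgebra] [CharZero Ω] [IsKilling Ω (Ω ⊗[K] G)] (H : LieSubalgebra Ω (Ω ⊗[K] G)) [H.IsCartanSubalgebra] :
    finrank Ω H = finrank K t := by
  apply le_antisymm
  · obtain ⟨τ, hτ, -⟩ := exists_gen t
    obtain ⟨c, hc⟩ := lemmaE H (1 ⊗ₜ (τ : G))
    rw [charpoly_bc, coeff_zero, coeff_zero] at hc
    by_contra hlt
    have h1 := congrArg (fun P => Polynomial.coeff P (finrank K t)) hc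
    simp only [Polynomial.map_mul, Polynomial.map_pow, Polynomial.map_X] at h1
    rw [Polynomial.coeff_X_pow_mul', Polynomial.coeff_X_pow_mul', if_pos le_rfl, if_neg (by omega), Nat.sub_self,
      Polynomial.coeff_map, Polynomial.coeff_zero_eq_eval_zero, Polynomial.eval_prod] at h1
    rw [map_eq_zero, Finset.prod_eq_zero_iff] at h1
    obtain ⟨α, -, hα⟩ := h1
    simp at hα
    exact hτ α hα
  · obtain ⟨h, hh, -⟩ := exists_gen H
    by_contra hlt
    have h1 := bc_coeff t (h : Ω ⊗[K] G) (finrank Ω H) (by omega)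
    rw [coeff_zero, Polynomial.coeff_X_pow_mul', if_pos le_rfl, Nat.sub_self,
      Polynomial.coeff_zero_eq_eval_zero, Polynomial.eval_prod, Finset.prod_eq_zero_iff] at h1
    obtain ⟨α, -, hα⟩ := h1
    simp at hα
    exact hh α hα

lemma bc_match (t : LieSubalgebra K G) [t.IsCartanSubalgebra] [CharZero Ω] [IsKilling Ω (Ω ⊗[K] G)] (H : LieSubalgebra Ω (Ω ⊗[K] G)) [H.IsCartanSubalgebra] (τ : t) :
    ∃ c : H, ∀ α : H.root, ∃ α' : t.root, α.1 c = algebraMap K Ω (α'.1 τ) := by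
  obtain ⟨c, hc⟩ := lemmaE H (1 ⊗ₜ (τ : G))
  refine ⟨c, fun α => ?_⟩
  rw [charpoly_bc, coeff_zero, coeff_zero, bc_rank t H, Polynomial.map_mul, Polynomial.map_pow, Polynomial.map_X] at hc
  have h1 := mul_left_cancel₀ (pow_ne_zero _ Polynomial.X_ne_zero) hc
  have h2 := congrArg (Polynomial.eval (α.1 c)) h1
  rw [Polynomial.eval_prod _ _ (α.1 c), Finset.prod_eq_zero (Finset.mem_univ α) (by simp), Polynomial.map_prod,
    Polynomial.eval_prod, Finset.prod_eq_zero_iff] at h2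
  obtain ⟨α', -, h⟩ := h2
  refine ⟨α', sub_eq_zero.mp (by simpa using h)⟩
end
end CVA
end

section
set_option linter.all false
namespace CVA
open LieAlgebra Module LieAlgebra.IsKilling LieModule
open scoped TensorProduct

section
variable {F L : Type*} [Field F] [CharZero F] [IsAlgClosed F] [LieRing L] [LieAlgebra F L] [FiniteDimensional F L]
  [IsKilling F L]
variable (H : LieSubalgebra F L) [H.IsCartanSubalgebra]

lemma root_refl (β α : H.root) : ∃ γ : H.root, rl H γ = rl H β - pz H β α • rl H α := by
  refine ⟨(rootSystem H).reflectionPerm α β, ?_⟩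
  have h1 := (rootSystem H).root_reflectionPerm α β
  rw [RootPairing.reflection_apply_root] at h1
  have h2 := (rootSystem H).algebraMap_pairingIn ℤ β α
  change (rootSystem H).root _ = _
  rw [h1, ← h2]
  ext x
  simp [pz, rl]

lemma prop_rl {α β : H.root} {c : F} (h : rl H β = c • rl H α) : rl H β = - rl H α ∨ β = α := by
  rcases prop_pm H α β c h with h | h
  · left; ext x; rw [LinearMap.neg_apply, rl_apply, rl_apply, h]
  · exact Or.inr h

lemma pz_le_three {α β : H.root} (h1 : α ≠ β) (h2 : rl H α ≠ - rl H β) : |pz H α β| ≤ 3 := by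
  have := (rootSystem H).pairingIn_pairingIn_mem_set_of_isCrystal_of_isRed' α β (fun h => h1 (rl_inj H h)) h2
  simp only [Set.mem_insert_iff, Set.mem_singleton_iff, Prod.mk.injEq] at this
  rw [abs_le]
  unfold pz
  omega

lemma lac_mem (n : ℕ) : (∃ α β : Weight F H L, α.IsNonZero ∧ β.IsNonZero ∧ (∀ c : F, (α : H → F) ≠ c • (β : H → F)) ∧
    (α (coroot β) = (n : F) ∨ α (coroot β) = -(n : F))) ↔
    ∃ α β : H.root, α ≠ β ∧ rl H α ≠ - rl H β ∧ |pz H α β| = n := by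
  constructor
  · rintro ⟨α, β, hα, hβ, hp, hn⟩
    let α' : H.root := ⟨α, by simpa using hα⟩
    let β' : H.root := ⟨β, by simpa using hβ⟩
    refine ⟨α', β', ?_, ?_, ?_⟩
    · intro h; apply hp 1; rw [one_smul]; exact congrArg (fun x : H.root => (x.1 : H → F)) h
    · intro h; apply hp (-1); funext x
      have := LinearMap.congr_fun h x
      rw [LinearMap.neg_apply, rl_apply, rl_apply] at this
      simpa using this
    · have h1 := pz_cast H α' β'
      rcases hn with hn | hn
      · have : (pz H α' β' : F) = ((n : ℤ) : F) := by rw [h1]; simpa using hn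
        have : pz H α' β' = n := by exact_mod_cast this
        rw [this]; simp
      · have : (pz H α' β' : F) = ((-n : ℤ) : F) := by rw [h1]; simpa using hn
        have : pz H α' β' = -n := by exact_mod_cast this
        rw [this]; simp
  · rintro ⟨α, β, h1, h2, h3⟩
    refine ⟨α.1, β.1, root_nz H α, root_nz H β, ?_, ?_⟩
    · intro c hc
      rcases prop_rl H (α := β) (β := α) (c := c) (by
        ext x; rw [LinearMap.smul_apply, rl_apply, rl_apply, hc]; rfl) with h | h
      · exact h2 h
      · exact h1 h
    · rw [← pz_cast]
      rcases abs_choice (pz H α β) with h | h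
      · left; rw [h] at h3; rw [h3]; simp
      · right
        have : pz H α β = -n := by omega
        rw [this]; simp

def lacSet : Set ℕ := {n : ℕ | ∃ α β : H.root, α ≠ β ∧ rl H α ≠ - rl H β ∧ |pz H α β| = n}

lemma lacety_eq (h : finrank F H ≠ 1) : lacety F L H = sSup (lacSet H) := by
  unfold lacety
  rw [if_neg h]
  congr 1
  ext n
  exact lac_mem H n

lemma lacSet_bdd : BddAbove (lacSet H) := ⟨3, by
  rintro n ⟨α, β, h1, h2, h3⟩
  have := pz_le_three H h1 h2
  omega⟩

lemma le_lacety (h : finrank F H ≠ 1) {α β : H.root} (h1 : α ≠ β) (h2 : rl H α ≠ - rl H β) : |pz H α β| ≤ lacety F L H := by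
  rw [lacety_eq H h]
  have : (pz H α β).natAbs ≤ sSup (lacSet H) := le_csSup (lacSet_bdd H) ⟨α, β, h1, h2, by simp⟩
  rw [← Int.natCast_natAbs]; exact_mod_cast this

lemma rank_pos [IsSimple F L] : 0 < finrank F H := by
  rw [Nat.pos_iff_ne_zero]
  intro h0
  have : Subsingleton H := finrank_zero_iff.mp h0
  have hr : IsEmpty H.root := ⟨fun α => root_nz H α (by
    funext x
    rw [Subsingleton.elim x 0]
    rw [← rl_apply, map_zero]; rfl)⟩
  have h1 := finrank_eq_card_basis (cb H)
  rw [Fintype.card_sum, Fintype.card_fin, h0, Fintype.card_eq_zero, finrank_zero_iff] at h1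
  apply IsSimple.non_abelian F (L := L)
  constructor
  intro x m
  exact Subsingleton.elim _ _

lemma exists_nonorth [IsSimple F L] (h : finrank F H ≠ 1) : ∃ α β : H.root, α ≠ β ∧ rl H α ≠ - rl H β ∧ pz H α β ≠ 0 := by
  by_contra hcon
  push Not at hcon
  have hpos := rank_pos H
  have hne : Nonempty H.root := by
    by_contra hem
    rw [not_nonempty_iff] at hem
    have h1 : Submodule.span F (Set.range (rootSystem H).root) = ⊤ := RootPairing.IsRootSystem.span_root_eq_top
    rw [Set.range_eq_empty, Submodule.span_empty] at h1
    have : finrank F (Dual F H) = 0 := by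
      rw [← finrank_top F (Dual F H), ← h1, finrank_bot]
    rw [Subspace.dual_finrank_eq] at this
    omega
  obtain ⟨β⟩ := hne
  have htop : Submodule.span F {rl H β} = ⊤ := by
    apply RootPairing.IsIrreducible.eq_top_of_invtSubmodule_reflection (P := rootSystem H)
    · intro α
      rw [Module.End.mem_invtSubmodule_iff_forall_mem_of_mem]
      intro v hv
      obtain ⟨c, rfl⟩ := Submodule.mem_span_singleton.mp hv
      rw [map_smul]
      apply Submodule.smul_mem
      change (rootSystem H).reflection α ((rootSystem H).root β) ∈ _
      rw [← RootPairing.root_reflectionPerm]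
      change rl H ((rootSystem H).reflectionPerm α β) ∈ _
      have hr : rl H ((rootSystem H).reflectionPerm α β) = rl H β - (rootSystem H).pairing β α • rl H α := by
        have h1 := (rootSystem H).root_reflectionPerm α β
        rw [RootPairing.reflection_apply_root] at h1
        exact h1
      have hmem := Submodule.mem_span_singleton_self (R := F) (rl H β)
      rw [hr]
      by_cases h1 : β = α
      · subst h1
        exact sub_mem hmem (Submodule.smul_mem _ _ hmem)
      by_cases h2 : rl H β = - rl H α
      · refine sub_mem hmem (Submodule.smul_mem _ _ ?_)
        have : rl H α = - rl H β := by rw [h2, neg_neg]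
        rw [this]; exact neg_mem hmem
      · have h3 := hcon β α h1 h2
        have : (rootSystem H).pairing β α = 0 := by
          rw [← (rootSystem H).algebraMap_pairingIn ℤ β α]
          change algebraMap ℤ F (pz H β α) = 0
          rw [h3]; simp
        rw [this, zero_smul, sub_zero]; exact hmem
    · rw [Ne, Submodule.span_singleton_eq_bot]; exact rl_ne_zero H β
  have h1 := finrank_span_singleton (K := F) (rl_ne_zero H β)
  rw [htop, finrank_top, Subspace.dual_finrank_eq] at h1
  exact h h1

lemma lacety_pos [IsSimple F L] : 1 ≤ lacety F L H := by
  by_cases h : finrank F H = 1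
  · unfold lacety; rw [if_pos h]
  · obtain ⟨α, β, h1, h2, h3⟩ := exists_nonorth H h
    have := le_lacety H h h1 h2
    have := abs_pos.mpr h3
    omega

/-- the maximum is attained (with negative sign) -/
lemma exists_lacety [IsSimple F L] (h : finrank F H ≠ 1) : ∃ α β : H.root, α ≠ β ∧ rl H α ≠ - rl H β ∧
    pz H α β = - lacety F L H := by
  have hne : (lacSet H).Nonempty := by
    obtain ⟨α, β, h1, h2, h3⟩ := exists_nonorth H h
    exact ⟨(pz H α β).natAbs, α, β, h1, h2, by simp⟩
  have hm := Nat.sSup_mem hne (lacSet_bdd H)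
  rw [← lacety_eq H h] at hm
  obtain ⟨α, β, h1, h2, h3⟩ := hm
  rcases abs_choice (pz H α β) with h4 | h4
  · obtain ⟨α', hα'⟩ := exists_neg' H α
    refine ⟨α', β, ?_, ?_, ?_⟩
    · rintro rfl; apply h2; rw [hα', neg_neg]
    · intro h; rw [hα', neg_inj] at h; exact h1 (rl_inj H h)
    · rw [pz_neg H hα']; omega
  · exact ⟨α, β, h1, h2, by omega⟩

lemma lacety_le [IsSimple F L] : lacety F L H ≤ 3 := by
  by_cases h : finrank F H = 1
  · unfold lacety; rw [if_pos h]; norm_num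
  · obtain ⟨α, β, h1, h2, h3⟩ := exists_lacety H h
    have := pz_le_three H h1 h2
    rw [h3, abs_neg] at this
    simpa using this
end

section
variable {K Ω G : Type*} [Field K] [CharZero K] [IsAlgClosed K] [LieRing G] [LieAlgebra K G] [FiniteDimensional K G]
  [IsKilling K G] [IsSimple K G] [Field Ω] [IsAlgClosed Ω] [Algebra K Ω]

lemma bc_lac (t : LieSubalgebra K G) [t.IsCartanSubalgebra] [CharZero Ω] [IsKilling Ω (Ω ⊗[K] G)]
    (H : LieSubalgebra Ω (Ω ⊗[K] G)) [H.IsCartanSubalgebra] : LacLE H (lacety K G t) := by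
  classical
  suffices key : ∀ α β : H.root, α ≠ β → rl H α ≠ - rl H β → |pz H α β| ≤ lacety K G t by
    intro α β h1 h2 n hn
    have := key α β h1 (fun h => h2 (by
      funext x
      have := LinearMap.congr_fun h x
      rw [LinearMap.neg_apply, rl_apply, rl_apply] at this
      exact this))
    rw [← pz_cast] at hn
    have h3 : pz H α β = n := by exact_mod_cast hn
    rwa [h3] at this
  suffices key : ∀ α β : H.root, α ≠ β → rl H α ≠ - rl H β → pz H α β < 0 → - pz H α β ≤ lacety K G t by
    intro α β h1 h2
    rcases lt_trichotomy (pz H α β) 0 with h | h | h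
    · rw [abs_of_neg h]; exact key α β h1 h2 h
    · rw [h]; simp
    · obtain ⟨α', hα'⟩ := exists_neg' H α
      have h5 := pz_neg H hα' (γ := β)
      have := key α' β (by rintro rfl; apply h2; rw [hα', neg_neg]) (by
        intro h; rw [hα', neg_inj] at h; exact h1 (rl_inj H h)) (by omega)
      rw [abs_of_pos h]; omega
  intro β α h1 h2 hneg
  by_cases hr1 : finrank K t = 1
  · exfalso
    have h3 : finrank Ω (Dual Ω H) = 1 := by rw [Subspace.dual_finrank_eq, bc_rank t H, hr1]
    obtain ⟨c, hc⟩ := (finrank_eq_one_iff_of_nonzero' (rl H α) (rl_ne_zero H α)).mp h3 (rl H β)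
    rcases prop_rl H hc.symm with h | h
    · exact h2 h
    · exact h1 h
  have h3 := pz_le_three H h1 h2
  obtain ⟨n, hn⟩ : ∃ n : ℕ, pz H β α = -n := ⟨(pz H β α).natAbs, by omega⟩
  have hn1 : 1 ≤ n := by omega
  have hn3 : n ≤ 3 := by rw [hn, abs_neg] at h3; simpa using h3
  obtain ⟨δ, hδ⟩ := root_add H hneg h2
  obtain ⟨γ, hγ⟩ := root_refl H β α
  rw [hn] at hγ
  -- generic element of t
  obtain ⟨τ, hτ⟩ := Module.Dual.exists_forall_ne_zero_of_forall_exists (K := K) (M := t)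
    (ι := {p : (t.root × t.root × t.root) × Fin 4 // rl t p.1.1 + (p.2 : ℕ) • rl t p.1.2.1 - rl t p.1.2.2 ≠ 0})
    (fun p => rl t p.1.1.1 + (p.1.2 : ℕ) • rl t p.1.1.2.1 - rl t p.1.1.2.2) (by
      rintro ⟨p, hp⟩
      by_contra hcon
      push Not at hcon
      exact hp (LinearMap.ext hcon))
  obtain ⟨c, hc⟩ := bc_match t H τ
  choose φ hφ using hc
  have rel : ∀ (a b d : H.root) (j : ℕ), j ≤ 3 → rl H d = rl H a + j • rl H b → rl t (φ d) = rl t (φ a) + j • rl t (φ b) := by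
    intro a b d j hj h
    by_contra hne
    have h4 := hτ ⟨((φ a, φ b, φ d), ⟨j, by omega⟩), fun h0 => hne (sub_eq_zero.mp h0).symm⟩
    apply h4
    have h5 := LinearMap.congr_fun h c
    simp only [LinearMap.add_apply, LinearMap.smul_apply, rl_apply, hφ, nsmul_eq_mul] at h5
    apply (algebraMap K Ω).injective
    simp only [LinearMap.sub_apply, LinearMap.add_apply, LinearMap.smul_apply, rl_apply, nsmul_eq_mul, map_sub, map_add, map_mul,
      map_natCast, map_zero]
    rw [← h5, sub_self]
  have r1 := rel β α δ 1 (by norm_num) (by simpa using hδ)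
  have r2 := rel β α γ n hn3 (by rw [hγ]; simp)
  rw [one_smul] at r1
  have np : ∀ c : K, rl t (φ β) ≠ c • rl t (φ α) := by
    intro c hc
    rcases prop_rl t hc with h | h
    · rw [h, neg_add_cancel] at r1; exact rl_ne_zero t _ r1
    · rw [h] at r1
      have h6 : rl t (φ δ) = (2 : K) • rl t (φ α) := by rw [r1, two_smul]
      rcases prop_rl t h6 with h | h
      · rw [h, neg_eq_iff_add_eq_zero] at h6
        have : (3 : K) • rl t (φ α) = 0 := by rw [← h6]; module
        simp [rl_ne_zero] at this
      · rw [h] at h6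
        have : (1 : K) • rl t (φ α) = 0 := by
          have h7 : (1 : K) • rl t (φ α) = (2 : K) • rl t (φ α) - rl t (φ α) := by module
          rw [h7, ← h6, sub_self]
        simp [rl_ne_zero] at this
  have np2 : ∀ c : K, rl t (φ γ) ≠ c • rl t (φ α) := by
    intro c hc
    apply np (c - n)
    have h8 : rl t (φ β) = c • rl t (φ α) - (n:K) • rl t (φ α) := by
      rw [← hc, r2, Nat.cast_smul_eq_nsmul, add_sub_cancel_right]
    exact h8.trans (sub_smul (c:K) (n:K) (rl t (φ α))).symm
  have e1 : pz t (φ γ) (φ α) = pz t (φ β) (φ α) + n * 2 := by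
    apply pz_eq
    rw [r2, LinearMap.add_apply, LinearMap.smul_apply, rl_coroot, rl_coroot, pz_self]
    simp
  have b1 := le_lacety t hr1 (α := φ β) (β := φ α) (fun h => np 1 (by rw [h, one_smul])) (fun h => np (-1) (by rw [h]; module))
  have b2 := le_lacety t hr1 (α := φ γ) (β := φ α) (fun h => np2 1 (by rw [h, one_smul])) (fun h => np2 (-1) (by rw [h]; module))
  rw [abs_le] at b1 b2
  rw [hn]
  omega
end
end CVA
end

section
set_option linter.all false
namespace CVA
open LieAlgebra Module LieAlgebra.IsKilling LieModule

section
variable {F L : Type*} [Field F] [CharZero F] [IsAlgClosed F] [LieRing L] [LieAlgebra F L] [FiniteDimensional F L]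
  [IsKilling F L]
variable (H : LieSubalgebra F L) [H.IsCartanSubalgebra]

lemma nil_aut (A : L ≃ₗ⁅F⁆ L) {v : L} (h : IsNil F v) : IsNil F (A v) := by
  obtain ⟨n, hn⟩ := h
  refine ⟨n, ?_⟩
  have key : ∀ (n : ℕ) (w : L), ((ad F L (A v)) ^ n) (A w) = A (((ad F L v) ^ n) w) := by
    intro n
    induction n with
    | zero => intro w; simp
    | succ n ih => intro w; rw [pow_succ, pow_succ]; change ((ad F L (A v)) ^ n) ⁅A v, A w⁆ = A (((ad F L v) ^ n) ⁅v, w⁆); rw [← LieEquiv.map_lie, ih]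
  ext w
  obtain ⟨w, rfl⟩ : ∃ w', A w' = w := A.surjective w
  rw [key, hn]; simp

lemma nil_sl2 {e f h : L} (he : IsNil F e) (hf : IsNil F f) (hef : ⁅e, f⁆ = h) (hh : ⁅h, e⁆ = 2 • e) :
    IsNil F (f + h - e) := by
  letI : Module ℚ L := Module.compHom L (algebraMap ℚ F)
  haveI : IsScalarTower ℚ F L := ⟨fun q c v => by
    change (q • c) • v = (algebraMap ℚ F q) • (c • v)
    rw [Algebra.smul_def, mul_smul]⟩
  letI : LieAlgebra ℚ L := { lie_smul := fun q v w => lie_smul (algebraMap ℚ F q) v w }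
  have hd : (LieDerivation.ad F L e).toLinearMap = ad F L e := by ext w; simp
  have hn : IsNilpotent (LieDerivation.ad F L e).toLinearMap := by rw [hd]; exact he
  have h1 := nil_aut (LieDerivation.exp (LieDerivation.ad F L e) hn) hf
  rw [LieDerivation.exp_map_apply, hd] at h1
  have h2 : ⁅e, h⁆ = - (2 • e) := by rw [← hh, lie_skew]
  have h3 : ((ad F L e) ^ 3) • f = 0 := by
    change ((ad F L e) ^ 3) f = 0
    rw [pow_succ, pow_succ, pow_one]
    simp [hef, h2]
  have h4 := IsNilpotent.exp_smul_eq_sum (a := ad F L e) h3 he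
  change IsNilpotent.exp (ad F L e) f = _ at h4
  rw [h4] at h1
  convert h1 using 1
  simp only [Finset.sum_range_succ, Finset.sum_range_zero, pow_zero, pow_one, Module.End.smul_def, ad_apply, hef, Module.End.one_apply, pow_two,
    Module.End.mul_apply, h2]
  have : ((Nat.factorial 2 : ℚ))⁻¹ • (2 • e) = e := by
    rw [← Nat.cast_smul_eq_nsmul ℚ, smul_smul]; norm_num
  rw [smul_neg, this]
  simp; abel

lemma nil_span (H : LieSubalgebra F L) [H.IsCartanSubalgebra] : Submodule.span F {e : L | IsNil F e} = ⊤ := by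
  rw [eq_top_iff]
  set U := Submodule.span F {e : L | IsNil F e}
  have hH : ∀ h : H, (h : L) ∈ U := by
    have h1 : (⊤ : Submodule F H) ≤ U.comap H.toSubmodule.subtype := by
      rw [← RootPairing.IsRootSystem.span_coroot_eq_top (P := rootSystem H), Submodule.span_le]
      rintro _ ⟨α, rfl⟩
      obtain ⟨h, e, f, ht, he, hf⟩ := exists_isSl2Triple_of_weight_isNonZero (root_nz H α)
      have hc := ht.h_eq_coroot (root_nz H α) he hf
      have hfn : IsNil F f := by
        refine LieAlgebra.isNilpotent_ad_of_mem_rootSpace H (χ := (-α.1 : H → F)) ?_ hf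
        intro h0
        exact root_nz H α (by simpa using h0)
      have hen := nil_root H he
      have := nil_sl2 hen hfn ht.lie_e_f ht.lie_h_e_nsmul
      change ((coroot α.1 : H) : L) ∈ U
      rw [← hc]
      have h5 : h = (f + h - e) - f + e := by abel
      rw [h5]
      exact U.add_mem (U.sub_mem (Submodule.subset_span this) (Submodule.subset_span hfn)) (Submodule.subset_span hen)
    intro h
    exact h1 (Submodule.mem_top (x := h))
  rw [← (cb H).span_eq, Submodule.span_le]
  rintro _ ⟨i | α, rfl⟩
  · exact hH ⟨_, cb_inl H i⟩
  · exact Submodule.subset_span (nil_root H (cb_inr H α))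

lemma Cirr_aut (A : L ≃ₗ⁅F⁆ L) (v : L × L) (hv : v ∈ Cirr F L H) : (A v.1, A v.2) ∈ Cirr F L H := by
  obtain ⟨h1, h2⟩ := hv
  refine ⟨?_, lt_of_lt_of_eq h2 ?_⟩
  · change ⁅A v.1, A v.2⁆ = 0
    change ⁅v.1, v.2⁆ = 0 at h1
    rw [← LieEquiv.map_lie, h1, map_zero]
  · have : (cent F (A v.1) ⊓ cent F (A v.2)) = (cent F v.1 ⊓ cent F v.2).map (A.toLinearEquiv : L →ₗ[F] L) := by
      ext w
      obtain ⟨w, rfl⟩ : ∃ w', A w' = w := A.surjective w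
      have h0 : ∀ u : L, ⁅A u, A w⁆ = 0 ↔ ⁅u, w⁆ = 0 := fun u => by
        rw [← LieEquiv.map_lie]
        exact ⟨fun h => A.injective (h.trans (map_zero A).symm), fun h => by rw [h, map_zero]⟩
      simp only [Submodule.mem_inf, mem_cent, Submodule.mem_map, h0]
      constructor
      · intro h; exact ⟨w, h, rfl⟩
      · rintro ⟨w', h, h'⟩
        have := A.injective h'
        rwa [← this]
    rw [this]
    exact (LinearEquiv.finrank_map_eq A.toLinearEquiv _).symm

theorem LBfam (x0 : L) (Z Y : Submodule F L) (hc : ∀ z ∈ Z, ∀ y ∈ Y, (x0 + z, y) ∈ Cirr F L H)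
    (hZ : ∀ z ∈ Z, ∀ w : L, ⁅w, x0⁆ = z → z = 0) (N : ℕ) (hN : N + finrank F (cent F x0) ≤ finrank F L + finrank F Z + finrank F Y) :
    (N : WithBot ℕ∞) ≤ CV.dimSet F (L × L) (Cirr F L H) := by
  classical
  set s : Set L := (fun e => ⁅e, x0⁆) '' {e : L | IsNil F e} with hs
  have hrange : Submodule.span F s = LinearMap.range (ad F L x0) := by
    have h1 : s = (-ad F L x0) '' {e : L | IsNil F e} := by
      rw [hs]; congr 1; ext e; simp
    rw [h1, Submodule.span_image, nil_span H, ← LinearMap.range_eq_map]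
    ext w; simp only [LinearMap.mem_range]
    constructor
    · rintro ⟨y, rfl⟩; exact ⟨-y, by simp⟩
    · rintro ⟨y, rfl⟩; exact ⟨-y, by simp⟩
  obtain ⟨d, hdd, fe, h1, h2, h3⟩ : ∃ d : ℕ, d = finrank F (Submodule.span F s) ∧ ∃ fe : Fin d → L, (∀ i, fe i ∈ s) ∧
      Submodule.span F (Set.range fe) = Submodule.span F s ∧ LinearIndependent F fe :=
    ⟨_, rfl, Submodule.exists_fun_fin_finrank_span_eq F s⟩
  have hd : d + finrank F (cent F x0) = finrank F L := by
    have := LinearMap.finrank_range_add_finrank_ker (ad F L x0)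
    rw [← hrange, ← hdd] at this
    exact this
  choose e he hfe using h1
  let bz := finBasis F Z
  let by' := finBasis F Y
  let σ := Fin d ⊕ (Fin (finrank F Z) ⊕ Fin (finrank F Y))
  let v : σ → L × L := Sum.elim 0 (Sum.elim (fun i => ((bz i : L), 0)) (fun j => (0, (by' j : L))))
  have hf0 : HasPD (fun a : σ → F => ((x0, 0) : L × L) + ∑ s : σ, a s • v s) 0 v := by
    refine (HasPD.add (HasPD.const (K := F) (a0 := (0 : σ → F)) ((x0, 0) : L × L)) (HasPD.sum Finset.univ (fun i _ => HasPD.coord i (v i)))).congr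
      (fun a => rfl) (fun j => ?_)
    change 0 + ∑ i, (if j = i then v i else 0) = v j
    rw [zero_add, Finset.sum_ite_eq, if_pos (Finset.mem_univ _)]
  let e' : σ → L := Sum.elim e 0
  have hnil : ∀ i, IsNil F (e' i) := by
    rintro (i | i)
    · exact he i
    · change IsNilpotent (ad F L 0); simp
  obtain ⟨f, hf, hS⟩ := exps_two hf0 e' hnil Finset.univ (fun i _ => rfl)
  have hmem : ∀ a, f a ∈ Cirr F L H := by
    intro a
    apply hS _ (Cirr_aut H)
    have : ((x0, 0) : L × L) + ∑ s : σ, a s • v s =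
        (x0 + ((∑ i, a (Sum.inr (Sum.inl i)) • bz i : Z) : L), ((∑ i, a (Sum.inr (Sum.inr i)) • by' i : Y) : L)) := by
      simp only [σ, Fintype.sum_sum_type, v]
      ext <;> simp [Prod.fst_sum, Prod.snd_sum]
    rw [this]
    exact hc _ (Submodule.coe_mem _) _ (Submodule.coe_mem _)
  have := le_dimSet (Cirr F L H) hf hmem ?_
  · refine le_trans ?_ this
    have : N ≤ Fintype.card σ := by simp [σ]; omega
    exact_mod_cast this
  · have heq : (fun j => v j + if j ∈ Finset.univ then (⁅e' j, (((x0, 0) : L × L) + ∑ s : σ, (0 : σ → F) s • v s).1⁆, ⁅e' j, (((x0, 0) : L × L) + ∑ s : σ, (0 : σ → F) s • v s).2⁆) else 0) =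
      Sum.elim (fun i => LinearMap.inl F L L (fe i)) (Sum.elim (fun i => LinearMap.inl F L L (bz i)) (fun j => LinearMap.inr F L L (by' j))) := by
      funext j
      rcases j with i | i | i
      · simp [v, e', ← hfe]
      · simp [v, e']
      · simp [v, e']
    rw [heq]
    have li1 : LinearIndependent F (fun i => LinearMap.inl F L L (fe i)) := h3.map' _ (LinearMap.ker_eq_bot.mpr LinearMap.inl_injective)
    have li2 : LinearIndependent F (fun i => LinearMap.inl F L L (bz i)) :=
      (bz.linearIndependent.map' Z.subtype (Submodule.ker_subtype _)).map' _ (LinearMap.ker_eq_bot.mpr LinearMap.inl_injective)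
    have li3 : LinearIndependent F (fun i => LinearMap.inr F L L (by' i)) :=
      (by'.linearIndependent.map' Y.subtype (Submodule.ker_subtype _)).map' _ (LinearMap.ker_eq_bot.mpr LinearMap.inr_injective)
    have s1 : Submodule.span F (Set.range (fun i => LinearMap.inl F L L (fe i))) ≤ (LinearMap.range (ad F L x0)).prod ⊥ := by
      rw [Submodule.span_le]; rintro _ ⟨i, rfl⟩
      refine ⟨?_, by simp⟩
      rw [← hrange, ← h2]
      exact Submodule.subset_span ⟨i, rfl⟩
    have s2 : Submodule.span F (Set.range (fun i => LinearMap.inl F L L (bz i))) ≤ Z.prod ⊥ := by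
      rw [Submodule.span_le]; rintro _ ⟨i, rfl⟩
      exact ⟨by simp, by simp⟩
    have s3 : Submodule.span F (Set.range (fun i => LinearMap.inr F L L (by' i))) ≤ (⊥ : Submodule F L).prod Y := by
      rw [Submodule.span_le]; rintro _ ⟨i, rfl⟩
      exact ⟨by simp, by simp⟩
    refine li1.sum_type (li2.sum_type li3 ?_) ?_
    · rw [Submodule.disjoint_def]
      intro w h1 h2
      have h1 := s2 h1
      have h2 := s3 h2
      rw [Submodule.mem_prod] at h1 h2
      exact Prod.ext (by simpa using h2.1) (by simpa using h1.2)
    · have s4 : Submodule.span F (Set.range (Sum.elim (fun i => LinearMap.inl F L L (bz i)) (fun j => LinearMap.inr F L L (by' j)))) ≤ Z.prod ⊤ := by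
        rw [Submodule.span_le]; rintro _ ⟨i | i, rfl⟩
        · exact ⟨by simp, by simp⟩
        · exact ⟨by simp, by simp⟩
      rw [Submodule.disjoint_def]
      intro w h1 h2
      have h1 := s1 h1
      have h2 := s4 h2
      rw [Submodule.mem_prod] at h1 h2
      refine Prod.ext ?_ (by simpa using h1.2)
      obtain ⟨u, hu⟩ := h1.1
      exact hZ _ h2.1 (-u) (by rw [← hu]; simp)
end
end CVA
end

section
set_option linter.all false
namespace CVA
open LieAlgebra Module LieAlgebra.IsKilling LieModule

section
variable {F L : Type*} [Field F] [CharZero F] [IsAlgClosed F] [LieRing L] [LieAlgebra F L] [FiniteDimensional F L]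
  [IsKilling F L]
variable (H : LieSubalgebra F L) [H.IsCartanSubalgebra]

lemma kf_H {h : L} (hh : h ∈ H) (h0 : ∀ h' : H, killingForm F L h h' = 0) : h = 0 := by
  obtain ⟨s, hs, _⟩ := exists_gen H
  apply kf_nondeg (F := F)
  have : killingForm F L h = 0 := by
    apply (cb H).ext
    rintro (i | α)
    · simpa using h0 ⟨_, cb_inl H i⟩
    · have h1 : cb H (Sum.inr α) = (α.1 s)⁻¹ • ⁅(s : L), cb H (Sum.inr α)⁆ := by
        rw [lie_root H (cb_inr H α) s.2, smul_smul, inv_mul_cancel₀ (hs α), one_smul]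
      rw [h1, map_smul, ← kf_inv, cartan_comm H hh s.2]
      simp
  intro v; rw [this]; rfl

lemma sl2_of (α : H.root) : ∃ (β : H.root) (e f : L), rl H β = - rl H α ∧ e ∈ rootSpace H α.1 ∧ f ∈ rootSpace H β.1 ∧
    e ≠ 0 ∧ ⁅e, f⁆ = ((coroot α.1 : H) : L) := by
  obtain ⟨h, e, f, ht, he, hf⟩ := exists_isSl2Triple_of_weight_isNonZero (root_nz H α)
  obtain ⟨β, hβ⟩ := exists_neg' H α
  refine ⟨β, e, f, hβ, he, ?_, ht.e_ne_zero, ?_⟩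
  · convert hf using 2
    funext x
    have := LinearMap.congr_fun hβ x
    rw [LinearMap.neg_apply, rl_apply, rl_apply] at this
    rw [this]; simp
  · rw [ht.lie_e_f, ht.h_eq_coroot (root_nz H α) he hf]

lemma HZ (α : H.root) (x0 : L) (hx0 : ∀ h : H, α.1 h = 0 → ⁅x0, (h : L)⁆ = 0) {z : L} (hz : z ∈ H) (hαz : α.1 ⟨z, hz⟩ = 0)
    (w : L) (hw : ⁅w, x0⁆ = z) : z = 0 := by
  apply kf_H H hz
  have k1 : ∀ h : H, α.1 h = 0 → killingForm F L z h = 0 := by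
    intro h hh
    rw [← hw, kf_inv, hx0 h hh]; simp
  have k2 : killingForm F L z (coroot α.1 : H) = 0 := by
    obtain ⟨β, e, f, hβ, he, hf, he0, hef⟩ := sl2_of H α
    rw [← hef, ← kf_inv, lie_root H he hz, hαz, zero_smul]; simp
  intro h
  have h2 : α.1 (coroot α.1) = 2 := root_apply_coroot (root_nz H α)
  have h3 := k1 (h - (α.1 h / 2) • coroot α.1) (by
    have := map_sub (rl H α) h ((α.1 h / 2) • coroot α.1)
    rw [map_smul, rl_apply, rl_apply, rl_apply, h2] at this
    rw [this, smul_eq_mul]; ring)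
  change killingForm F L z ((h : L) - (α.1 h / 2) • ((coroot α.1 : H) : L)) = 0 at h3
  rw [map_sub, map_smul, k2, smul_zero, sub_zero] at h3
  exact h3

lemma gen_in (W : Submodule F H) : ∃ z ∈ W, ∀ β : H.root, β.1 z = 0 → ∀ w ∈ W, β.1 w = 0 := by
  obtain ⟨z, hz, h⟩ := Module.Dual.exists_forall_mem_ne_zero_of_forall_exists W
    (fun β : {β : H.root // ∃ w ∈ W, β.1 w ≠ 0} => rl H β.1) (by
      rintro ⟨β, w, hw, h⟩
      exact ⟨w, hw, by rwa [rl_apply]⟩)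
  refine ⟨z, hz, fun β hβ w hw => ?_⟩
  by_contra hne
  have := h ⟨β, w, hw, hne⟩
  rw [rl_apply] at this
  exact this hβ

lemma sup_finrank {ι : Type*} [Fintype ι] (g : ι → H.root) (hg : Function.Injective g) (Z : Submodule F L) (hZ : ∀ z ∈ Z, z ∈ H) :
    finrank F Z + Fintype.card ι ≤ finrank F (Z ⊔ Submodule.span F (Set.range fun i => cb H (Sum.inr (g i))) : Submodule F L) := by
  classical
  set W := Submodule.span F (Set.range fun i => cb H (Sum.inr (g i)))
  have h1 : finrank F W = Fintype.card ι :=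
    finrank_span_eq_card ((cb H).linearIndependent.comp (fun i => Sum.inr (g i)) (Sum.inr_injective.comp hg))
  have h2 : Z ⊓ W = ⊥ := by
    rw [eq_bot_iff]
    intro w hw
    obtain ⟨hz, hw⟩ := hw
    obtain ⟨s, hs, _⟩ := exists_gen H
    have h3 := (mem_cent_iff H s w).mp (le_cent H s.2 (hZ _ hz))
    have h4 : ∀ i, (cb H).repr w (Sum.inl i) = 0 := by
      intro i
      have : W ≤ LinearMap.ker ((cb H).coord (Sum.inl i)) := by
        rw [Submodule.span_le]
        rintro _ ⟨j, rfl⟩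
        simp
      simpa using this hw
    rw [Submodule.mem_bot]
    apply (cb H).repr.injective
    ext i
    rcases i with i | α
    · simp [h4]
    · by_contra hne
      have := h3 (Sum.inr α) (by simpa using hne)
      exact hs α this
  have := Submodule.finrank_sup_add_finrank_inf_eq Z W
  rw [h2, finrank_bot] at this
  omega

lemma emb_finrank (W : Submodule F H) : finrank F (W.map H.toSubmodule.subtype) = finrank F W :=
    (Submodule.equivMapOfInjective H.toSubmodule.subtype (Submodule.injective_subtype _) W).finrank_eq.symm

open scoped Classical in
lemma cent_count (s : H) : finrank F (cent F (s : L)) = (Finset.univ.filter fun α : H.root => α.1 s = 0).card + finrank F H := by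
  have := finrank_eig H (fun _ : Unit => s) (fun _ => (0 : F)) (cent F (s : L)) (by
    intro w
    rw [mem_cent]; simp)
  rw [this, if_pos (fun _ => rfl)]
  congr 2
  ext α; simp

lemma card_two (S : Finset H.root) (α : H.root) (h : ∀ β ∈ S, ∃ c : F, rl H β = c • rl H α) : S.card ≤ 2 := by
  classical
  obtain ⟨α', hα'⟩ := exists_neg' H α
  have : S ⊆ {α, α'} := by
    intro β hβ
    obtain ⟨c, hc⟩ := h β hβ
    rw [Finset.mem_insert, Finset.mem_singleton]
    rcases prop_rl H hc with h | h
    · right; exact rl_inj H (by rw [h, hα'])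
    · exact Or.inl h
  exact (Finset.card_le_card this).trans Finset.card_le_two

theorem F4 (α : H.root) (N : ℕ) (hN : N + 4 ≤ finrank F L + finrank F H) : (N : WithBot ℕ∞) ≤ CV.dimSet F (L × L) (Cirr F L H) := by
  classical
  set W : Submodule F H := LinearMap.ker (rl H α) with hW
  have hWr : finrank F W + 1 = finrank F H := Module.Dual.finrank_ker_add_one_of_ne_zero (rl_ne_zero H α)
  obtain ⟨x0, hx0, hgen⟩ := gen_in H W
  set Z := W.map H.toSubmodule.subtype with hZd
  have hZr : finrank F Z = finrank F W := emb_finrank H W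
  have hZm : ∀ z ∈ Z, ∃ h : z ∈ H, α.1 ⟨z, h⟩ = 0 := by
    rintro _ ⟨w, hw, rfl⟩
    have hw : rl H α w = 0 := hw
    exact ⟨w.2, by rwa [rl_apply] at hw⟩
  have hx0' : α.1 x0 = 0 := by
    have : rl H α x0 = 0 := hx0
    rwa [rl_apply] at this
  have hcent : finrank F (cent F (x0 : L)) ≤ finrank F H + 2 := by
    rw [cent_count]
    have := card_two H (Finset.univ.filter fun β : H.root => β.1 x0 = 0) α (by
      intro β hβ
      have hβ := (Finset.mem_filter.mp hβ).2
      have h1 := mem_span_of_iInf_ker_le_ker (L := fun _ : Unit => rl H α) (K := rl H β) (by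
        intro w hw
        have hw : w ∈ W := by simpa [hW] using hw
        rw [LinearMap.mem_ker, rl_apply]
        exact hgen β hβ w hw)
      rw [Set.range_const, Submodule.mem_span_singleton] at h1
      obtain ⟨c, hc⟩ := h1
      exact ⟨c, hc.symm⟩)
    omega
  refine LBfam H x0 Z Z ?_ ?_ N (by omega)
  · intro z hz y hy
    obtain ⟨hzH, hz⟩ := hZm z hz
    obtain ⟨hyH, hy⟩ := hZm y hy
    refine ⟨cartan_comm H (H.add_mem x0.2 hzH) hyH, ?_⟩
    have h1 := sup_finrank H (fun _ : Unit => α) (fun _ _ _ => rfl) H.toSubmodule (fun z hz => hz)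
    have h2 : finrank F H.toSubmodule = finrank F H := rfl
    rw [h2, Fintype.card_unit] at h1
    refine lt_of_lt_of_le (Nat.lt_of_succ_le h1) (Submodule.finrank_mono ?_)
    refine sup_le ?_ ?_
    · intro w hw
      exact ⟨le_cent H (H.add_mem x0.2 hzH) hw, le_cent H hyH hw⟩
    · rw [Submodule.span_le]
      rintro _ ⟨_, rfl⟩
      refine ⟨mem_cent.mpr ?_, mem_cent.mpr ?_⟩
      · change ⁅(x0 : L) + z, _⁆ = _
        rw [add_lie, lie_root H (cb_inr H α) x0.2, lie_root H (cb_inr H α) hzH, hz, hx0']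
        simp
      · change ⁅y, _⁆ = _
        rw [lie_root H (cb_inr H α) hyH, hy, zero_smul]
  · intro z hz w hw
    obtain ⟨hzH, hz⟩ := hZm z hz
    exact HZ H α x0 (fun h _ => cartan_comm H x0.2 h.2) hzH hz w hw
end
end CVA
end

section
set_option linter.all false
namespace CVA
open LieAlgebra Module LieAlgebra.IsKilling LieModule

section
variable {F L : Type*} [Field F] [CharZero F] [IsAlgClosed F] [LieRing L] [LieAlgebra F L] [FiniteDimensional F L]
  [IsKilling F L]
variable (H : LieSubalgebra F L) [H.IsCartanSubalgebra]

lemma pz_zero {α β : H.root} (h : pz H α β = 0) : pz H β α = 0 := by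
  exact ((rootSystem H).pairingIn_eq_zero_iff (S := ℤ)).mp h

structure B2dat (a β γ δ : H.root) : Prop where
  hγ : rl H β = rl H γ - rl H a
  hδ : rl H δ = rl H γ + rl H a
  h1 : pz H γ a = 0
  h2 : pz H a γ = 0
  bd : ∀ u v : H.root, u ≠ v → rl H u ≠ - rl H v → |pz H u v| ≤ 2

variable {H} {a β γ δ : H.root}

lemma pz_lin {c d : F} {ψ u v w : H.root} (h : rl H ψ = c • rl H u + d • rl H v) : (pz H ψ w : F) = c * pz H u w + d * pz H v w := by
  rw [← rl_coroot, h, LinearMap.add_apply, LinearMap.smul_apply, LinearMap.smul_apply, rl_coroot, rl_coroot]; rfl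

lemma B2dat.ne (D : B2dat H a β γ δ) : β ≠ γ ∧ β ≠ δ ∧ γ ≠ δ := by
  have e1 := pz_sub H (γ := a) D.hγ
  have e2 := pz_add H (γ := a) D.hδ
  rw [pz_self, D.h1] at e1 e2
  have := D.h1
  refine ⟨?_, ?_, ?_⟩ <;> rintro rfl <;> omega

lemma B2dat.no2 (D : B2dat H a β γ δ) (ψ : H.root) (c : F) (h : rl H ψ = c • rl H a + (2 : F) • rl H γ) : False := by
  have e1 := pz_lin (w := γ) h
  rw [D.h2, pz_self] at e1
  have e2 : pz H ψ γ = 4 := by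
    have : (pz H ψ γ : F) = ((4 : ℤ) : F) := by rw [e1]; push_cast; ring
    exact_mod_cast this
  have := D.bd ψ γ (by rintro rfl; rw [pz_self] at e2; omega) (by
    intro h; have := pz_neg H (γ := γ) h; rw [pz_self] at this; omega)
  rw [e2] at this; norm_num at this

lemma B2dat.no_half (D : B2dat H a β γ δ) (ψ : H.root) (c d : F) (h : rl H ψ = c • rl H a + d • rl H γ) : pz H ψ γ ≠ 1 := by
  intro h1
  have e1 := pz_lin (w := γ) h
  rw [D.h2, pz_self, h1] at e1
  have hd : 2 * d = 1 := by push_cast at e1; rw [e1]; ring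
  have e2 := pz_lin (w := a) h
  rw [D.h1, pz_self] at e2
  have e3 := pz_lin (w := ψ) h
  rw [pz_self] at e3
  have e4 : (4 : ℤ) = pz H ψ a * pz H a ψ + pz H γ ψ := by
    have : ((4 : ℤ) : F) = ((pz H ψ a * pz H a ψ + pz H γ ψ : ℤ) : F) := by
      push_cast at *
      linear_combination 2 * e3 - (pz H a ψ : F) * e2 + (pz H γ ψ : F) * hd
    exact_mod_cast this
  have q0 : 0 < pz H γ ψ := (pz_pos H ψ γ).mp (by omega)
  have f1 := pz_sub H (γ := γ) D.hγ
  have f2 := pz_add H (γ := γ) D.hδ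
  rw [pz_self, D.h2] at f1 f2
  have ne : ∀ u : H.root, pz H u γ ≠ 1 → pz H u γ ≠ -1 → u ≠ ψ ∧ rl H u ≠ - rl H ψ := by
    intro u h3 h4
    constructor
    · rintro rfl; exact h3 h1
    · intro h5; have := pz_neg H (γ := γ) h5; omega
  have n1 := ne β (by omega) (by omega)
  have n2 := ne δ (by omega) (by omega)
  have n3 := ne a (by rw [D.h2]; omega) (by rw [D.h2]; omega)
  have b1 := D.bd β ψ n1.1 n1.2
  have b2 := D.bd δ ψ n2.1 n2.2
  have b3 := D.bd ψ a n3.1.symm (by intro h; exact n3.2 (by rw [h, neg_neg]))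
  rw [pz_sub H D.hγ, abs_le] at b1
  rw [pz_add H D.hδ, abs_le] at b2
  rw [abs_le] at b3
  obtain ⟨b3, b4⟩ := b3
  generalize pz H ψ a = m at *
  generalize pz H a ψ = p at *
  generalize pz H γ ψ = q at *
  have hm : m = -2 ∨ m = -1 ∨ m = 0 ∨ m = 1 ∨ m = 2 := by omega
  rcases hm with rfl | rfl | rfl | rfl | rfl <;> omega

lemma inj3 {A : Type*} {x y z : A} (h1 : x ≠ y) (h2 : x ≠ z) (h3 : y ≠ z) {i j : Fin 3} (h : (![x, y, z] : Fin 3 → A) i = ![x, y, z] j) : i = j := by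
  fin_cases i <;> fin_cases j <;> simp_all

set_option maxHeartbeats 1000000 in
theorem F3 (D : B2dat H a β γ δ) (N : ℕ) (hN : N + 3 ≤ finrank F L + finrank F H) :
    (N : WithBot ℕ∞) ≤ CV.dimSet F (L × L) (Cirr F L H) := by
  classical
  set W : Submodule F H := LinearMap.ker (rl H a) ⊓ LinearMap.ker (rl H γ) with hW
  have hWr : finrank F H ≤ finrank F W + 2 := by
    have h1 := LinearMap.finrank_range_add_finrank_ker ((rl H a).prod (rl H γ))
    rw [LinearMap.ker_prod] at h1
    have h3 := Submodule.finrank_le (LinearMap.range ((rl H a).prod (rl H γ)))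
    rw [finrank_prod, finrank_self] at h3
    have h4 : finrank F W = finrank F ↥(LinearMap.ker (rl H a) ⊓ LinearMap.ker (rl H γ)) := rfl
    rw [← h4] at h1
    omega
  obtain ⟨z0, hz0, hgen⟩ := gen_in H W
  have hWm : ∀ w ∈ W, a.1 w = 0 ∧ γ.1 w = 0 := by
    rintro w ⟨h1, h2⟩
    have h1 : rl H a w = 0 := h1
    have h2 : rl H γ w = 0 := h2
    rw [rl_apply] at h1 h2
    exact ⟨h1, h2⟩
  set Z := W.map H.toSubmodule.subtype with hZd
  have hZr : finrank F Z = finrank F W := emb_finrank H W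
  have hZm : ∀ z ∈ Z, ∃ h : z ∈ H, a.1 ⟨z, h⟩ = 0 ∧ γ.1 ⟨z, h⟩ = 0 := by
    rintro _ ⟨w, hw, rfl⟩
    exact ⟨w.2, hWm w hw⟩
  let g : Fin 3 → H.root := ![β, γ, δ]
  obtain ⟨n1, n2, n3⟩ := D.ne
  have hg : Function.Injective g := by
    intro i j hij
    exact inj3 n1 n2 n3 hij
  have hgl : ∀ i, ∃ c : F, rl H (g i) = c • rl H a + rl H γ := by
    intro i
    fin_cases i
    · refine ⟨-1, ?_⟩
      change rl H β = _
      rw [D.hγ]; ext x; simp [sub_eq_add_neg, add_comm]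
    · exact ⟨0, by simp [g]⟩
    · refine ⟨1, ?_⟩
      change rl H δ = _
      rw [D.hδ, one_smul]; abel
  set E := Submodule.span F (Set.range fun i => cb H (Sum.inr (g i))) with hE
  have hY := sup_finrank H g hg Z (fun z hz => (hZm z hz).1)
  rw [Fintype.card_fin] at hY
  set Y := Z ⊔ E with hYd
  have gz : ∀ i, ∀ z, ∀ (h : z ∈ Z), ⁅z, cb H (Sum.inr (g i))⁆ = 0 := by
    intro i z hz
    obtain ⟨hzH, h1, h2⟩ := hZm z hz
    rw [lie_root H (cb_inr H (g i)) hzH]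
    obtain ⟨c, hc⟩ := hgl i
    have : (g i).1 ⟨z, hzH⟩ = 0 := by
      rw [← rl_apply, hc, LinearMap.add_apply, LinearMap.smul_apply, rl_apply, rl_apply, h1, h2]; simp
    rw [this, zero_smul]
  have gg : ∀ i j, ⁅cb H (Sum.inr (g i)), cb H (Sum.inr (g j))⁆ = 0 := by
    intro i j
    obtain ⟨c, hc⟩ := hgl i
    obtain ⟨d, hd⟩ := hgl j
    have hs : rl H (g i) + rl H (g j) = (c + d) • rl H a + (2 : F) • rl H γ := by
      rw [hc, hd]; module
    refine lie_eq_zero_of H (cb_inr H _) (cb_inr H _) ?_ ?_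
    · intro h0
      rw [hs] at h0
      have := LinearMap.congr_fun h0 (coroot γ.1)
      rw [LinearMap.add_apply, LinearMap.smul_apply, LinearMap.smul_apply, rl_coroot, rl_coroot, D.h2, pz_self] at this
      norm_num at this
    · intro ψ hψ
      rw [hs] at hψ
      exact D.no2 ψ _ hψ
  have ZE : ∀ z ∈ Z, ∀ u ∈ E, ⁅z, u⁆ = 0 := by
    intro z hz u hu
    have : E ≤ cent F z := by
      rw [hE, Submodule.span_le]; rintro _ ⟨i, rfl⟩
      exact mem_cent.mpr (gz i z hz)
    exact mem_cent.mp (this hu)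
  have EE : ∀ z ∈ E, ∀ u ∈ E, ⁅z, u⁆ = 0 := by
    intro z hz u hu
    have h1 : ∀ i, E ≤ cent F (cb H (Sum.inr (g i))) := by
      intro i
      rw [hE, Submodule.span_le]; rintro _ ⟨j, rfl⟩
      exact mem_cent.mpr (gg i j)
    have : E ≤ cent F u := by
      rw [hE, Submodule.span_le]; rintro _ ⟨i, rfl⟩
      refine mem_cent.mpr ?_
      exact comm_symm (mem_cent.mp (h1 i hu))
    exact comm_symm (mem_cent.mp (this hz))
  have ZZ : ∀ z ∈ Z, ∀ u ∈ Z, ⁅z, u⁆ = 0 := fun z hz u hu => cartan_comm H (hZm z hz).1 (hZm u hu).1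
  have YY : ∀ y ∈ Y, ∀ u ∈ Y, ⁅y, u⁆ = 0 := by
    intro y hy u hu
    obtain ⟨z, hz, e, he, rfl⟩ := Submodule.mem_sup.mp hy
    obtain ⟨z', hz', e', he', rfl⟩ := Submodule.mem_sup.mp hu
    rw [lie_add, add_lie, add_lie, ZZ z hz z' hz', ZE z hz e' he', EE e he e' he', comm_symm (ZE z' hz' e he)]
    simp
  set e := cb H (Sum.inr γ) with hed
  have he : e ∈ rootSpace H γ.1 := cb_inr H γ
  have he0 : e ≠ 0 := (cb H).ne_zero _
  have hz0Z : (z0 : L) ∈ Z := ⟨z0, hz0, rfl⟩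
  have heE : e ∈ E := Submodule.subset_span ⟨1, rfl⟩
  have hze : ⁅(z0 : L), e⁆ = 0 := ZE _ hz0Z _ heE
  have hcent : finrank F (cent F ((z0 : L) + e)) ≤ finrank F H + 2 := by
    rw [cent_add (cartan_ss H z0.2) (nil_root H he) hze]
    refine (cent_le_pos H z0 (coroot γ.1) hze ?_ ?_).trans ?_
    · rw [lie_root H he (coroot γ.1).2]
      congr 1
      exact root_apply_coroot (root_nz H γ)
    · intro w hw0 hew c hw
      exact nn_root H γ he hw0 he0 hew hw
    · have hlin : ∀ ψ : H.root, ψ.1 z0 = 0 → ∃ c d : F, rl H ψ = c • rl H a + d • rl H γ := by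
        intro ψ hψ
        have h1 := mem_span_of_iInf_ker_le_ker (L := ![rl H a, rl H γ]) (K := rl H ψ) (by
          intro w hw
          have hw : w ∈ W := by
            rw [Submodule.mem_iInf] at hw
            exact ⟨hw 0, hw 1⟩
          rw [LinearMap.mem_ker, rl_apply]
          exact hgen ψ hψ w hw)
        rw [Matrix.range_cons, Matrix.range_cons, Matrix.range_empty, Set.union_empty, Set.singleton_union,
          Submodule.mem_span_pair] at h1
        obtain ⟨c, d, h⟩ := h1
        exact ⟨c, d, h.symm⟩
      rw [ei_finrank, ei_finrank, if_pos rfl, if_neg one_ne_zero]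
      have c0 := card_two H (Finset.univ.filter fun ψ : H.root => ψ.1 z0 = 0 ∧ ψ.1 (coroot γ.1) = 0) a (by
        intro ψ hψ
        obtain ⟨h1, h2⟩ := (Finset.mem_filter.mp hψ).2
        obtain ⟨c, d, h3⟩ := hlin ψ h1
        refine ⟨c, ?_⟩
        have h4 := pz_lin (w := γ) h3
        rw [pz_cast, h2, D.h2, pz_self] at h4
        have : d = 0 := by
          push_cast at h4
          have : d * 2 = 0 := by rw [h4]; ring
          simpa using this
        rw [h3, this, zero_smul, add_zero])
      have c1 : (Finset.univ.filter fun ψ : H.root => ψ.1 z0 = 0 ∧ ψ.1 (coroot γ.1) = 1).card = 0 := by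
        rw [Finset.card_eq_zero, Finset.filter_eq_empty_iff]
        rintro ψ - ⟨h1, h2⟩
        obtain ⟨c, d, h3⟩ := hlin ψ h1
        apply D.no_half ψ c d h3
        rw [← pz_cast] at h2
        exact_mod_cast h2
      convert (show _ ≤ _ from (by
        rw [c1]; omega : (Finset.univ.filter fun ψ : H.root => ψ.1 z0 = 0 ∧ ψ.1 (coroot γ.1) = 0).card + finrank F H +
          ((Finset.univ.filter fun ψ : H.root => ψ.1 z0 = 0 ∧ ψ.1 (coroot γ.1) = 1).card + 0) ≤ finrank F H + 2)) using 4
  refine LBfam H ((z0 : L) + e) Z Y ?_ ?_ N (by omega)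
  · intro z hz y hy
    have hxY : (z0 : L) + e + z ∈ Y := Y.add_mem (Y.add_mem ((le_sup_left : Z ≤ Y) hz0Z) ((le_sup_right : E ≤ Y) heE)) ((le_sup_left : Z ≤ Y) hz)
    refine ⟨YY _ hxY _ hy, ?_⟩
    refine lt_of_lt_of_le (show finrank F H < finrank F Y by omega) (Submodule.finrank_mono ?_)
    intro u hu
    exact ⟨mem_cent.mpr (YY _ hxY _ hu), mem_cent.mpr (YY _ hy _ hu)⟩
  · intro z hz w hw
    obtain ⟨hzH, _, hz⟩ := hZm z hz
    refine HZ H γ ((z0 : L) + e) (fun h hh => ?_) hzH hz w hw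
    rw [add_lie, cartan_comm H z0.2 h.2, zero_add]
    apply comm_symm
    rw [lie_root H he h.2]
    change γ.1 h • e = 0
    rw [hh, zero_smul]

theorem F3' (H : LieSubalgebra F L) [H.IsCartanSubalgebra] [IsSimple F L] (hl : lacety F L H = 2) (N : ℕ) (hN : N + 3 ≤ finrank F L + finrank F H) :
    (N : WithBot ℕ∞) ≤ CV.dimSet F (L × L) (Cirr F L H) := by
  have hr : finrank F H ≠ 1 := by
    intro h; unfold lacety at hl; rw [if_pos h] at hl; omega
  obtain ⟨β, a, h1, h2, h3⟩ := exists_lacety H hr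
  rw [hl] at h3
  obtain ⟨γ, hγ⟩ := root_add H (α := β) (β := a) (by omega) h2
  obtain ⟨δ, hδ⟩ := root_refl H β a
  have e1 : pz H γ a = 0 := by
    rw [pz_add H hγ, pz_self, h3]; norm_num
  refine F3 (a := a) (β := β) (γ := γ) (δ := δ) ⟨by rw [hγ]; abel, ?_, e1, pz_zero H e1, ?_⟩ N hN
  · rw [hδ, h3, hγ]
    push_cast
    rw [neg_smul, sub_neg_eq_add, two_smul]; abel
  · intro u v h4 h5
    have := le_lacety H hr h4 h5
    rw [hl] at this
    exact_mod_cast this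
end
end CVA
end

section
set_option linter.all false
namespace CVA
open LieAlgebra Module LieAlgebra.IsKilling LieModule

section
variable {F L : Type*} [Field F] [CharZero F] [IsAlgClosed F] [LieRing L] [LieAlgebra F L] [FiniteDimensional F L]
  [IsKilling F L]
variable (H : LieSubalgebra F L) [H.IsCartanSubalgebra]

/-- integral combinations of two roots -/
def zc (a b : H.root) (m n : ℤ) : Dual F H := (m : F) • rl H a + (n : F) • rl H b

lemma zc_apply (a b : H.root) (m n : ℤ) (x : H) : zc H a b m n x = m * a.1 x + n * b.1 x := by
  rw [zc, LinearMap.add_apply, LinearMap.smul_apply, LinearMap.smul_apply, rl_apply, rl_apply]; rfl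

lemma zc_add (a b : H.root) (m n m' n' : ℤ) : zc H a b m n + zc H a b m' n' = zc H a b (m + m') (n + n') := by
  ext x
  rw [LinearMap.add_apply, zc_apply, zc_apply, zc_apply]; push_cast; ring

lemma zc_neg (a b : H.root) (m n : ℤ) : - zc H a b m n = zc H a b (-m) (-n) := by
  ext x
  rw [LinearMap.neg_apply, zc_apply, zc_apply]; push_cast; ring

/-- coefficients of the twelve roots in type G2 -/
def gco : List (ℤ × ℤ) := [(0, 1), (0, -1), (1, 0), (-1, 0), (1, 1), (-1, -1),
    (2, 1), (-2, -1), (3, 1), (-3, -1), (3, 2), (-3, -2)]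

structure G2dat (a b c1 c2 c3 θ : H.root) : Prop where
  e1 : rl H c1 = zc H a b 1 1
  e2 : rl H c2 = zc H a b 2 1
  e3 : rl H c3 = zc H a b 3 1
  e4 : rl H θ = zc H a b 3 2
  li : ∀ m n : ℤ, zc H a b m n = 0 → m = 0 ∧ n = 0
  cl : ∀ β : H.root, ∃ m n : ℤ, rl H β = zc H a b m n ∧ (m, n) ∈ gco
  p1 : pz H a b = -1
  p2 : pz H a c3 = 1
  p3 : pz H b c3 = -1
  hr : finrank F H = 2

lemma exists_G2 [IsSimple F L] {a b : H.root} (h : pz H b a = -3) : ∃ c1 c2 c3 θ, G2dat H a b c1 c2 c3 θ := by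
  letI I : (rootSystem H).EmbeddedG2 := { long := b, short := a, pairingIn_long_short := h }
  have hs : RootPairing.EmbeddedG2.short (rootSystem H) = a := rfl
  have hl : RootPairing.EmbeddedG2.long (rootSystem H) = b := rfl
  refine ⟨RootPairing.EmbeddedG2.shortAddLong (rootSystem H), RootPairing.EmbeddedG2.twoShortAddLong (rootSystem H),
    RootPairing.EmbeddedG2.threeShortAddLong (rootSystem H), RootPairing.EmbeddedG2.threeShortAddTwoLong (rootSystem H), ?_⟩
  have q1 : rl H (RootPairing.EmbeddedG2.shortAddLong (rootSystem H)) = zc H a b 1 1 := by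
    have := RootPairing.EmbeddedG2.shortAddLongRoot_eq (rootSystem H)
    ext x
    rw [zc_apply, ← rl_apply, ← rl_apply]
    have := LinearMap.congr_fun this x
    refine this.trans ?_
    change rl H a x + rl H b x = _
    push_cast; ring
  have q2 : rl H (RootPairing.EmbeddedG2.twoShortAddLong (rootSystem H)) = zc H a b 2 1 := by
    have := RootPairing.EmbeddedG2.twoShortAddLongRoot_eq (rootSystem H)
    ext x
    rw [zc_apply, ← rl_apply, ← rl_apply]
    have := LinearMap.congr_fun this x
    refine this.trans ?_
    change 2 * rl H a x + rl H b x = _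
    push_cast; ring
  have q3 : rl H (RootPairing.EmbeddedG2.threeShortAddLong (rootSystem H)) = zc H a b 3 1 := by
    have := RootPairing.EmbeddedG2.threeShortAddLongRoot_eq (rootSystem H)
    ext x
    rw [zc_apply, ← rl_apply, ← rl_apply]
    have := LinearMap.congr_fun this x
    refine this.trans ?_
    change 3 * rl H a x + rl H b x = _
    push_cast; ring
  have q4 : rl H (RootPairing.EmbeddedG2.threeShortAddTwoLong (rootSystem H)) = zc H a b 3 2 := by
    have := RootPairing.EmbeddedG2.threeShortAddTwoLongRoot_eq (rootSystem H)
    ext x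
    rw [zc_apply, ← rl_apply, ← rl_apply]
    have := LinearMap.congr_fun this x
    refine this.trans ?_
    change 3 * rl H a x + 2 * rl H b x = _
    push_cast; ring
  have hli := RootPairing.EmbeddedG2.linearIndependent_short_long (rootSystem H)
  refine ⟨q1, q2, q3, q4, ?_, ?_, ?_, ?_, ?_, ?_⟩
  · intro m n hmn
    have := LinearIndependent.pair_iff.mp hli (m : F) (n : F) hmn
    exact_mod_cast this
  · intro β
    have hb : rl H b = zc H a b 0 1 := by
      ext x; rw [zc_apply, rl_apply]; push_cast; ring
    have ha : rl H a = zc H a b 1 0 := by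
      ext x; rw [zc_apply, rl_apply]; push_cast; ring
    have h1 := RootPairing.EmbeddedG2.mem_allRoots (rootSystem H) β
    simp only [RootPairing.EmbeddedG2.allRoots, List.mem_cons, List.not_mem_nil, or_false] at h1
    rcases h1 with h1 | h1 | h1 | h1 | h1 | h1 | h1 | h1 | h1 | h1 | h1 | h1
    · exact ⟨0, 1, Eq.trans h1 hb, by decide⟩
    · exact ⟨0, -1, Eq.trans h1 ((congrArg Neg.neg hb).trans (zc_neg H a b _ _)), by decide⟩
    · exact ⟨1, 0, Eq.trans h1 ha, by decide⟩
    · exact ⟨-1, 0, Eq.trans h1 ((congrArg Neg.neg ha).trans (zc_neg H a b _ _)), by decide⟩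
    · exact ⟨1, 1, Eq.trans h1 q1, by decide⟩
    · exact ⟨-1, -1, Eq.trans h1 ((congrArg Neg.neg q1).trans (zc_neg H a b _ _)), by decide⟩
    · exact ⟨2, 1, Eq.trans h1 q2, by decide⟩
    · exact ⟨-2, -1, Eq.trans h1 ((congrArg Neg.neg q2).trans (zc_neg H a b _ _)), by decide⟩
    · exact ⟨3, 1, Eq.trans h1 q3, by decide⟩
    · exact ⟨-3, -1, Eq.trans h1 ((congrArg Neg.neg q3).trans (zc_neg H a b _ _)), by decide⟩
    · exact ⟨3, 2, Eq.trans h1 q4, by decide⟩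
    · exact ⟨-3, -2, Eq.trans h1 ((congrArg Neg.neg q4).trans (zc_neg H a b _ _)), by decide⟩
  · exact RootPairing.EmbeddedG2.pairingIn_short_long (rootSystem H)
  · have h1 := RootPairing.EmbeddedG2.pairingIn_threeShortAddLong_right (rootSystem H) a
    have h2 := RootPairing.EmbeddedG2.pairingIn_short_long (rootSystem H)
    have h3 : (rootSystem H).pairingIn ℤ a a = 2 := pz_self H a
    rw [hs, hl] at *
    rw [pz, h1, h2, h3]; norm_num
  · have h1 := RootPairing.EmbeddedG2.pairingIn_threeShortAddLong_right (rootSystem H) b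
    have h3 : (rootSystem H).pairingIn ℤ b b = 2 := pz_self H b
    rw [pz] at h ⊢
    rw [hs, hl] at h1
    rw [h1, h, h3]; norm_num
  · have h1 := finrank_eq_card_basis (RootPairing.EmbeddedG2.basis (rootSystem H))
    rw [Fintype.card_fin] at h1
    rw [← h1]
    exact (Subspace.dual_finrank_eq (K := F) (V := H)).symm

variable {H} {a b c1 c2 c3 θ : H.root}

lemma G2dat.no (D : G2dat H a b c1 c2 c3 θ) {m n : ℤ} (h : (m, n) ∉ gco) (γ : H.root) : rl H γ ≠ zc H a b m n := by
  intro h1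
  obtain ⟨m', n', h2, h3⟩ := D.cl γ
  have h4 : zc H a b m n + zc H a b (-m') (-n') = 0 := by
    rw [← zc_neg, ← h2, h1, add_neg_cancel]
  rw [zc_add] at h4
  obtain ⟨h5, h6⟩ := D.li _ _ h4
  have : m = m' := by omega
  have : n = n' := by omega
  subst m n
  exact h h3

lemma G2dat.zero (D : G2dat H a b c1 c2 c3 θ) {m n m' n' : ℤ} {α β : H.root} {x y : L} (hα : rl H α = zc H a b m n)
    (hβ : rl H β = zc H a b m' n') (hx : x ∈ rootSpace H α.1) (hy : y ∈ rootSpace H β.1) (h : (m + m', n + n') ∉ gco)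
    (h0 : ¬ (m + m' = 0 ∧ n + n' = 0)) : ⁅x, y⁆ = 0 := by
  refine lie_eq_zero_of H hx hy ?_ ?_
  · rw [hα, hβ, zc_add]; intro h1; exact h0 (D.li _ _ h1)
  · intro γ; rw [hα, hβ, zc_add]; exact D.no h γ

lemma G2dat.neq (D : G2dat H a b c1 c2 c3 θ) {m n m' n' : ℤ} {α β : H.root} (hα : rl H α = zc H a b m n)
    (hβ : rl H β = zc H a b m' n') (h0 : ¬ (m = m' ∧ n = n')) : α ≠ β := by
  rintro rfl
  have h4 : zc H a b m n + zc H a b (-m') (-n') = 0 := by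
    rw [← zc_neg, ← hα, ← hβ, add_neg_cancel]
  rw [zc_add] at h4
  have := D.li _ _ h4
  omega

end
end CVA
end

section
set_option linter.all false
namespace CVA
open LieAlgebra Module LieAlgebra.IsKilling LieModule

section
variable {F L : Type*} [Field F] [CharZero F] [IsAlgClosed F] [LieRing L] [LieAlgebra F L] [FiniteDimensional F L]
  [IsKilling F L]
variable {H : LieSubalgebra F L} [H.IsCartanSubalgebra]
variable {a b c1 c2 c3 θ : H.root}

set_option maxHeartbeats 1000000 in
theorem F2 (D : G2dat H a b c1 c2 c3 θ) (N : ℕ) (hN : N + 2 ≤ finrank F L + finrank F H) :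
    (N : WithBot ℕ∞) ≤ CV.dimSet F (L × L) (Cirr F L H) := by
  classical
  have e0 : rl H b = zc H a b 0 1 := by
    ext x; rw [zc_apply, rl_apply]; push_cast; ring
  obtain ⟨b', eb, fb, hb', heb, hfb, heb0, hefb⟩ := sl2_of H b
  obtain ⟨c', ec, fc, hc', hec, hfc, hec0, hefc⟩ := sl2_of H c3
  have e0' : rl H b' = zc H a b 0 (-1) := by rw [hb', e0, zc_neg]; rfl
  have e3' : rl H c' = zc H a b (-3) (-1) := by rw [hc', D.e3, zc_neg]
  set h : H := (2 : F) • coroot b.1 + (2 : F) • coroot c3.1 with hh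
  have hah : a.1 h = 0 := by
    rw [← rl_apply, hh, map_add, map_smul, map_smul, rl_coroot, rl_coroot, D.p1, D.p2]
    simp
  have hbh : b.1 h = 2 := by
    rw [← rl_apply, hh, map_add, map_smul, map_smul, rl_coroot, rl_coroot, D.p3, pz_self]
    simp only [smul_eq_mul]; push_cast; norm_num
  have hzh : ∀ {α : H.root} {m n : ℤ}, rl H α = zc H a b m n → α.1 h = 2 * n := by
    intro α m n hα
    rw [← rl_apply, hα, zc_apply, hah, hbh]; ring
  have hHh : (h : L) ∈ H := h.2
  have lh : ∀ {α : H.root} {m n : ℤ} {x : L}, rl H α = zc H a b m n → x ∈ rootSpace H α.1 → ⁅(h : L), x⁆ = ((2 * n : F)) • x := by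
    intro α m n x hα hx
    rw [lie_root H hx hHh]
    congr 1
    exact hzh hα
  set e := eb + ec with hed
  have hhe : ⁅(h : L), e⁆ = (2 : F) • e := by
    rw [hed, lie_add, lh e0 heb, lh D.e3 hec]; simp
  have hcr1 : ⁅eb, fc⁆ = 0 := D.zero e0 e3' heb hfc (by decide) (by decide)
  have hcr2 : ⁅ec, fb⁆ = 0 := D.zero D.e3 e0' hec hfb (by decide) (by decide)
  set f := (2 : F) • fb + (2 : F) • fc with hfd
  have hef : ⁅e, f⁆ = (h : L) := by
    rw [hed, hfd, add_lie, lie_add, lie_add, lie_smul, lie_smul, lie_smul, lie_smul, hcr1, hcr2, hefb, hefc]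
    rw [hh]; simp
  have hhf : ⁅(h : L), f⁆ = -((2 : F) • f) := by
    rw [hfd, lie_add, lie_smul, lie_smul, lh e0' hfb, lh e3' hfc]
    push_cast; module
  have he0 : e ≠ 0 := by
    intro h0
    have h1 : (h : L) = 0 := by rw [← hef, h0, zero_lie]
    have h2 : h = 0 := Subtype.ext h1
    rw [h2] at hbh
    rw [← rl_apply, map_zero] at hbh
    norm_num at hbh
  have hh0 : (h : L) ≠ 0 := by
    intro h1
    have h2 : h = 0 := Subtype.ext h1
    rw [h2, ← rl_apply, map_zero] at hbh
    norm_num at hbh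
  have hT : IsSl2Triple (h : L) e f := by
    refine ⟨hh0, hef, ?_, ?_⟩
    · rw [hhe, ← Nat.cast_smul_eq_nsmul F]; norm_num
    · rw [hhf, ← Nat.cast_smul_eq_nsmul F]; norm_num
  have hcent : finrank F (cent F e) ≤ 4 := by
    have h1 := cent_le_pos H 0 h (e := e) (by simp) hhe (by
      intro w hw0 hew c hw
      have P : hT.HasPrimitiveVectorWith w c := ⟨hw0, hw, hew⟩
      exact P.exists_nat)
    have h2 : cent F e ≤ cent F (((0 : H) : L)) ⊓ cent F e := by
      intro w hw
      exact ⟨mem_cent.mpr (by simp), hw⟩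
    refine (Submodule.finrank_mono h2).trans (h1.trans ?_)
    rw [ei_finrank, ei_finrank, if_pos rfl, if_neg one_ne_zero]
    have c0 := card_two H (Finset.univ.filter fun ψ : H.root => ψ.1 (0 : H) = 0 ∧ ψ.1 h = 0) a (by
      intro ψ hψ
      obtain ⟨-, h2⟩ := (Finset.mem_filter.mp hψ).2
      obtain ⟨m, n, h3, -⟩ := D.cl ψ
      refine ⟨m, ?_⟩
      rw [hzh h3] at h2
      have : (n : F) = 0 := by simpa using h2
      rw [h3, zc, this, zero_smul, add_zero])
    have c1 : (Finset.univ.filter fun ψ : H.root => ψ.1 (0 : H) = 0 ∧ ψ.1 h = 1).card = 0 := by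
      rw [Finset.card_eq_zero, Finset.filter_eq_empty_iff]
      rintro ψ - ⟨-, h2⟩
      obtain ⟨m, n, h3, -⟩ := D.cl ψ
      rw [hzh h3] at h2
      have : (2 * n : ℤ) = 1 := by exact_mod_cast h2
      omega
    have hr := D.hr
    convert (show _ ≤ _ from (by
      rw [c1]; omega : (Finset.univ.filter fun ψ : H.root => ψ.1 (0 : H) = 0 ∧ ψ.1 h = 0).card + finrank F H +
        ((Finset.univ.filter fun ψ : H.root => ψ.1 (0 : H) = 0 ∧ ψ.1 h = 1).card + 0) ≤ 4)) using 4
  -- the abelian-by-central space A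
  let g : Fin 3 → H.root := ![θ, c1, c2]
  have hg : Function.Injective g := by
    intro i j hij
    exact inj3 (D.neq D.e4 D.e1 (by decide)) (D.neq D.e4 D.e2 (by decide)) (D.neq D.e1 D.e2 (by decide)) hij
  set xθ := cb H (Sum.inr θ) with hxθ
  set x1 := cb H (Sum.inr c1) with hx1
  set x2 := cb H (Sum.inr c2) with hx2
  have mθ : xθ ∈ rootSpace H θ.1 := cb_inr H θ
  have m1 : x1 ∈ rootSpace H c1.1 := cb_inr H c1
  have m2 : x2 ∈ rootSpace H c2.1 := cb_inr H c2
  have hθ0 : xθ ≠ 0 := (cb H).ne_zero _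
  set E := Submodule.span F (Set.range fun i => cb H (Sum.inr (g i))) with hE
  have hEr := sup_finrank H g hg ⊥ (by intro z hz; rw [Submodule.mem_bot] at hz; rw [hz]; exact H.zero_mem)
  rw [Fintype.card_fin, bot_sup_eq, finrank_bot, ← hE] at hEr
  have heE : e ∉ E := by
    intro he
    obtain ⟨u, hu⟩ := root_one H b (cb_inr H b) ((cb H).ne_zero _) heb
    obtain ⟨v, hv⟩ := root_one H c3 (cb_inr H c3) ((cb H).ne_zero _) hec
    have hu0 : u ≠ 0 := by
      rintro rfl; rw [zero_smul] at hu; exact heb0 hu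
    have hle : E ≤ LinearMap.ker ((cb H).coord (Sum.inr b)) := by
      rw [hE, Submodule.span_le]
      rintro _ ⟨i, rfl⟩
      have : g i ≠ b := by
        fin_cases i
        · exact D.neq D.e4 e0 (by decide)
        · exact D.neq D.e1 e0 (by decide)
        · exact D.neq D.e2 e0 (by decide)
      simp [Basis.coord_apply, Finsupp.single_apply, this]
    have h1 := hle he
    have h2 : c3 ≠ b := D.neq D.e3 e0 (by decide)
    rw [LinearMap.mem_ker, hed, hu, hv] at h1
    simp [Basis.coord_apply, Finsupp.single_apply, h2] at h1
    exact hu0 h1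
  set A := Submodule.span F {e} ⊔ E with hA
  have heA : e ∈ A := (le_sup_left : _ ≤ A) (Submodule.mem_span_singleton_self e)
  have hAr : 4 ≤ finrank F A := by
    have : E < A := by
      refine lt_of_le_of_ne le_sup_right ?_
      intro h1
      rw [h1] at heE
      exact heE heA
    have := Submodule.finrank_lt_finrank_of_lt this
    omega
  have hgen : ∀ S : Submodule F L, e ∈ S → xθ ∈ S → x1 ∈ S → x2 ∈ S → A ≤ S := by
    intro S h0 h1 h2 h3
    refine sup_le ?_ ?_
    · rw [Submodule.span_singleton_le_iff_mem]; exact h0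
    · rw [hE, Submodule.span_le]
      rintro _ ⟨i, rfl⟩
      fin_cases i
      · exact h1
      · exact h2
      · exact h3
  have r1 : ⁅e, xθ⁆ = 0 := by
    rw [hed, add_lie, D.zero e0 D.e4 heb mθ (by decide) (by decide), D.zero D.e3 D.e4 hec mθ (by decide) (by decide), add_zero]
  have r2 : ⁅e, x1⁆ = 0 := by
    rw [hed, add_lie, D.zero e0 D.e1 heb m1 (by decide) (by decide), D.zero D.e3 D.e1 hec m1 (by decide) (by decide), add_zero]
  have r3 : ⁅e, x2⁆ = 0 := by
    rw [hed, add_lie, D.zero e0 D.e2 heb m2 (by decide) (by decide), D.zero D.e3 D.e2 hec m2 (by decide) (by decide), add_zero]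
  have r4 : ⁅xθ, x1⁆ = 0 := D.zero D.e4 D.e1 mθ m1 (by decide) (by decide)
  have r5 : ⁅xθ, x2⁆ = 0 := D.zero D.e4 D.e2 mθ m2 (by decide) (by decide)
  have r6 : ⁅x1, x2⁆ ∈ Submodule.span F {xθ} := by
    have h1 : ⁅x1, x2⁆ ∈ rootSpace H θ.1 := lie_mem_of H m1 m2 (by rw [D.e1, D.e2, D.e4, zc_add]; rfl)
    obtain ⟨c, hc⟩ := root_one H θ mθ hθ0 h1
    exact Submodule.mem_span_singleton.mpr ⟨c, hc.symm⟩
  have hAe : A ≤ cent F e := hgen _ (mem_cent.mpr (lie_self e)) (mem_cent.mpr r1) (mem_cent.mpr r2) (mem_cent.mpr r3)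
  set Θ := Submodule.span F {xθ} with hΘ
  have z0 : ∀ {u : L}, u = 0 → u ∈ Θ := by rintro u rfl; exact Θ.zero_mem
  have k1 : ∀ u : L, ⁅u, e⁆ ∈ Θ → ⁅u, xθ⁆ ∈ Θ → ⁅u, x1⁆ ∈ Θ → ⁅u, x2⁆ ∈ Θ → A ≤ Θ.comap (ad F L u) := by
    intro u h1 h2 h3 h4
    exact hgen _ h1 h2 h3 h4
  have kθ := k1 xθ (z0 (comm_symm r1)) (z0 (lie_self _)) (z0 r4) (z0 r5)
  have kx1 := k1 x1 (z0 (comm_symm r2)) (z0 (comm_symm r4)) (z0 (lie_self _)) r6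
  have kx2 := k1 x2 (z0 (comm_symm r3)) (z0 (comm_symm r5)) (by rw [← lie_skew]; exact Θ.neg_mem r6) (z0 (lie_self _))
  have ksym : ∀ {u w : L}, ⁅u, w⁆ ∈ Θ → ⁅w, u⁆ ∈ Θ := by
    intro u w h1; rw [← lie_skew]; exact Θ.neg_mem h1
  have kA : ∀ y ∈ A, A ≤ Θ.comap (ad F L y) := by
    intro y hy
    exact k1 y (ksym (z0 (mem_cent.mp (hAe hy)))) (ksym (kθ hy)) (ksym (kx1 hy)) (ksym (kx2 hy))
  refine LBfam H e ⊥ A ?_ ?_ N ?_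
  · intro z hz y hy
    rw [Submodule.mem_bot] at hz
    subst z
    rw [add_zero]
    refine ⟨mem_cent.mp (hAe hy), ?_⟩
    have h1 := finrank_map_add (ad F L y) A
    have h2 : finrank F (A.map (ad F L y)) ≤ 1 := by
      refine (Submodule.finrank_mono (Submodule.map_le_iff_le_comap.mpr (kA y hy))).trans ?_
      rw [hΘ]
      exact (finrank_span_singleton hθ0).le
    have h3 : A ⊓ LinearMap.ker (ad F L y) ≤ cent F e ⊓ cent F y := inf_le_inf hAe le_rfl
    have h4 := Submodule.finrank_mono h3
    have hr := D.hr
    change finrank F H < finrank F ↥(cent F e ⊓ cent F y)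
    omega
  · intro z hz w hw
    exact (Submodule.mem_bot F).mp hz
  · rw [finrank_bot]
    have hr := D.hr
    omega

theorem F2' (H : LieSubalgebra F L) [H.IsCartanSubalgebra] [IsSimple F L] (hl : lacety F L H = 3) (N : ℕ)
    (hN : N + 2 ≤ finrank F L + finrank F H) : (N : WithBot ℕ∞) ≤ CV.dimSet F (L × L) (Cirr F L H) := by
  have hr : finrank F H ≠ 1 := by
    intro h; unfold lacety at hl; rw [if_pos h] at hl; omega
  obtain ⟨b, a, h1, h2, h3⟩ := exists_lacety H hr
  rw [hl] at h3
  obtain ⟨c1, c2, c3, θ, D⟩ := exists_G2 H h3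
  exact F2 D N hN
end
end CVA
end

section
set_option linter.all false
namespace CVA
open LieAlgebra Module LieAlgebra.IsKilling LieModule
open scoped TensorProduct

section
variable {F L : Type*} [Field F] [CharZero F] [IsAlgClosed F] [LieRing L] [LieAlgebra F L] [FiniteDimensional F L]
  [IsKilling F L]
variable (H : LieSubalgebra F L) [H.IsCartanSubalgebra]

lemma root_nonempty [IsSimple F L] : Nonempty H.root := by
  have hpos := rank_pos H
  by_contra hem
  rw [not_nonempty_iff] at hem
  have h1 : Submodule.span F (Set.range (rootSystem H).root) = ⊤ := RootPairing.IsRootSystem.span_root_eq_top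
  rw [Set.range_eq_empty, Submodule.span_empty] at h1
  have : finrank F (Dual F H) = 0 := by
    rw [← finrank_top F (Dual F H), ← h1, finrank_bot]
  rw [Subspace.dual_finrank_eq] at this
  omega

lemma dim_ge [IsSimple F L] : 4 ≤ finrank F L + finrank F H := by
  classical
  have hpos := rank_pos H
  obtain ⟨α⟩ := root_nonempty H
  obtain ⟨β, hβ⟩ := exists_neg' H α
  have hne : α ≠ β := by
    rintro rfl
    have h1 := rl_coroot H α α
    rw [hβ, LinearMap.neg_apply, rl_coroot, pz_self] at h1
    norm_num at h1
  have h1 := finrank_eq_card_basis (cb H)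
  rw [Fintype.card_sum, Fintype.card_fin] at h1
  have h2 : 1 < Fintype.card H.root := Fintype.one_lt_card_iff.mpr ⟨α, β, hne⟩
  omega

theorem lower [IsSimple F L] (N : ℕ) (hN : N + (5 - lacety F L H) = finrank F L + finrank F H) :
    (N : WithBot ℕ∞) ≤ CV.dimSet F (L × L) (Cirr F L H) := by
  have h1 := lacety_pos H
  have h2 := lacety_le H
  have h3 : lacety F L H = 1 ∨ lacety F L H = 2 ∨ lacety F L H = 3 := by omega
  rcases h3 with h | h | h
  · obtain ⟨α⟩ := root_nonempty H
    exact F4 H α N (by omega)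
  · exact F3' H h N (by omega)
  · exact F2' H h N (by omega)

theorem upper [IsSimple F L] (N : ℕ) (hN : N + (5 - lacety F L H) = finrank F L + finrank F H) :
    CV.dimSet F (L × L) (Cirr F L H) ≤ (N : WithBot ℕ∞) := by
  by_contra hcon
  obtain ⟨Ω, i1, i2, i3, x, y, hxy, hirr, T, hT, hd⟩ := exists_generic (Cirr F L H) (finrank F H) (by
    intro z hz; exact ⟨hz.1, hz.2⟩) N hcon
  haveI : CharZero Ω := charZero_of_injective_algebraMap (algebraMap F Ω).injective
  haveI : IsKilling Ω (Ω ⊗[F] L) := isKilling_bc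
  have := thmU hxy (lacety_pos H) (lacety_le H) (fun _ H' _ => bc_lac H H') (fun H' _ => bc_rank H H') hirr T hd
  rw [Module.finrank_baseChange] at this
  omega

theorem main_eq [IsSimple F L] :
    CV.dimSet F (L × L) (Cirr F L H) + ((5 - lacety F L H : ℕ) : ℕ∞)
      = (((Module.finrank F L + Module.finrank F ↥H : ℕ) : ℕ∞) : WithBot ℕ∞) := by
  have h1 := lacety_pos H
  have h4 := dim_ge H
  obtain ⟨N, hN⟩ : ∃ N, N + (5 - lacety F L H) = finrank F L + finrank F H :=
    ⟨finrank F L + finrank F H - (5 - lacety F L H), by omega⟩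
  have h2 : CV.dimSet F (L × L) (Cirr F L H) = (N : WithBot ℕ∞) := le_antisymm (upper H N hN) (lower H N hN)
  rw [h2, ← hN]
  push_cast
  rfl
end
end CVA
end

/-- For a simple Lie algebra `g`, the codimension in the commuting variety
`C` of the irregular locus `C^irr` equals `5 - l`, where `l` is the lacing number of `g`:
`dim C^irr + (5 - l) = dim C = dim g + rk g`. -/
theorem irregular_codim_eq_five_sub_lacety
    [LieAlgebra.IsSimple k g] [LieAlgebra.IsKilling k g]
    (t : LieSubalgebra k g) [t.IsCartanSubalgebra] :
    CV.dimSet k (g × g) (Cirr k g t) + ((5 - lacety k g t : ℕ) : ℕ∞)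
      = (((Module.finrank k g + Module.finrank k ↥t : ℕ) : ℕ∞) : WithBot ℕ∞) := by
  exact CVA.main_eq t
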